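/- Suppose Ω satisfies the non-degeneracy assumption. Then there exists κ₀ > 0 such that for every κ > κ₀ all four critical fields coincide: H^{loc}(κ) = H̄^{loc}(κ) = H_{C3}(κ) = H̄_{C3}(κ). -/

import Mathlib

open MeasureTheory Filter Set Topology

noncomputable section

namespace SC

/-- The plane `ℝ²`. -/
abbrev Plane := ℝ × ℝ

/-- Squared Euclidean norm on the plane. -/
def esq (v : Plane) : ℝ := v.1 ^ 2 + v.2 ^ 2

/-- Euclidean dot product on the plane. -/
def dot2 (v w : Plane) : ℝ := v.1 * w.1 + v.2 * w.2

/-- The reference vector potential `F₀(x) = (-x₂/2, x₁/2)`, with `curl F₀ = 1`. -/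
def F0 : Plane → Plane := fun x => (-x.2 / 2, x.1 / 2)

/-- `u` is of class `Cⁿ` on a neighborhood of the closure of `Ω`. -/
def CNearCl {E : Type*} [NormedAddCommGroup E] [NormedSpace ℝ E]
    (n : ℕ) (Ω : Set Plane) (u : Plane → E) : Prop :=
  ∃ U : Set Plane, IsOpen U ∧ closure Ω ⊆ U ∧ ContDiffOn ℝ n u U

/-- The pointwise squared magnetic gradient `|(-i∇ - B·A)u|²`. -/
def magSq (B : ℝ) (A : Plane → Plane) (u : Plane → ℂ) (x : Plane) : ℝ :=
  ‖(-Complex.I) * fderiv ℝ u x ((1 : ℝ), (0 : ℝ)) - ((B * (A x).1 : ℝ) : ℂ) * u x‖ ^ 2 +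
  ‖(-Complex.I) * fderiv ℝ u x ((0 : ℝ), (1 : ℝ)) - ((B * (A x).2 : ℝ) : ℂ) * u x‖ ^ 2

/-- `curl A = ∂₁A₂ - ∂₂A₁`. -/
def curl2 (A : Plane → Plane) (x : Plane) : ℝ :=
  fderiv ℝ (fun y => (A y).2) x ((1 : ℝ), (0 : ℝ)) -
    fderiv ℝ (fun y => (A y).1) x ((0 : ℝ), (1 : ℝ))

/-- The variational ground state energy `λ₁(B·A)` of the magnetic Neumann Laplacian. -/
def lam1A (Ω : Set Plane) (B : ℝ) (A : Plane → Plane) : ℝ :=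
  sInf { r : ℝ | ∃ u : Plane → ℂ, CNearCl 1 Ω u ∧ (∫ x in Ω, ‖u x‖ ^ 2) ≠ 0 ∧
    r = (∫ x in Ω, magSq B A u x) / (∫ x in Ω, ‖u x‖ ^ 2) }

/-- `λ₁(B) = λ₁(B·F₀)`. -/
def lam1 (Ω : Set Plane) (B : ℝ) : ℝ := lam1A Ω B F0

/-- The Ginzburg–Landau energy functional. -/
def GLenergy (Ω : Set Plane) (κ H : ℝ) (ψ : Plane → ℂ) (A : Plane → Plane) : ℝ :=
  ∫ x in Ω, (magSq (κ * H) A ψ x - κ ^ 2 * ‖ψ x‖ ^ 2 + κ ^ 2 / 2 * ‖ψ x‖ ^ 4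
    + κ ^ 2 * H ^ 2 * (curl2 A x - 1) ^ 2)

/-- Admissible Ginzburg–Landau configurations. -/
def GLadm (Ω : Set Plane) (ψ : Plane → ℂ) (A : Plane → Plane) : Prop :=
  CNearCl 1 Ω ψ ∧ CNearCl 1 Ω A

/-- The normal state is a minimizer at `(κ, H)`. -/
def NormalMin (Ω : Set Plane) (κ H : ℝ) : Prop :=
  ∀ ψ A, GLadm Ω ψ A → 0 ≤ GLenergy Ω κ H ψ A

/-- The normal state is the unique minimizer at `(κ, H)`. -/
def NormalUnique (Ω : Set Plane) (κ H : ℝ) : Prop :=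
  NormalMin Ω κ H ∧
  ∀ ψ A, GLadm Ω ψ A → (∫ x in Ω, ‖ψ x‖ ^ 2) ≠ 0 → 0 < GLenergy Ω κ H ψ A

/-- `(ψ, A)` is a minimizer of the Ginzburg–Landau energy at `(κ, H)`. -/
def IsGLMin (Ω : Set Plane) (κ H : ℝ) (ψ : Plane → ℂ) (A : Plane → Plane) : Prop :=
  GLadm Ω ψ A ∧ ∀ ψ' A', GLadm Ω ψ' A' → GLenergy Ω κ H ψ A ≤ GLenergy Ω κ H ψ' A'

/-- Lower global critical field. -/
def HC3low (Ω : Set Plane) (κ : ℝ) : ℝ := sInf {H : ℝ | 0 < H ∧ NormalMin Ω κ H}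

/-- Upper global critical field. -/
def HC3up (Ω : Set Plane) (κ : ℝ) : ℝ :=
  sInf {H : ℝ | 0 < H ∧ ∀ H', H < H' → NormalUnique Ω κ H'}

/-- Lower local critical field. -/
def HlocLow (Ω : Set Plane) (κ : ℝ) : ℝ :=
  sInf {H : ℝ | 0 < H ∧ κ ^ 2 ≤ lam1 Ω (κ * H)}

/-- Upper local critical field. -/
def HlocUp (Ω : Set Plane) (κ : ℝ) : ℝ :=
  sInf {H : ℝ | 0 < H ∧ ∀ H', H < H' → κ ^ 2 ≤ lam1 Ω (κ * H')}

/-- The inward unit normal `ν(s) = (-γ₂'(s), γ₁'(s))`. -/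
def nuVec (γ : ℝ → Plane) (s : ℝ) : Plane := (-(deriv γ s).2, (deriv γ s).1)

/-- The curvature `k(s) = ⟨γ''(s), ν(s)⟩`. -/
def curvOf (γ : ℝ → Plane) (s : ℝ) : ℝ := dot2 (deriv (deriv γ) s) (nuVec γ s)

/-- The maximal curvature. -/
def kmaxOf (γ : ℝ → Plane) : ℝ := sSup (Set.range (curvOf γ))

/-- A smooth counterclockwise arclength parametrization of the boundary of `Ω`. -/
structure BoundaryParam (Ω : Set Plane) where
  γ : ℝ → Plane
  L : ℝ
  L_pos : 0 < L
  smooth : ContDiff ℝ (⊤ : ℕ∞) γ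
  periodic : Function.Periodic γ L
  unit_speed : ∀ s, esq (deriv γ s) = 1
  injOn : Set.InjOn γ (Set.Ico 0 L)
  range_eq : Set.range γ = frontier Ω
  inward : ∀ s, ∃ ε > 0, ∀ t ∈ Set.Ioo (0 : ℝ) ε, γ s + t • nuVec γ s ∈ Ω

/-- The non-degeneracy assumption: finitely many points of maximal curvature,
all of them non-degenerate maxima. -/
def NonDegen {Ω : Set Plane} (P : BoundaryParam Ω) : Prop :=
  ∃ (N : ℕ) (s : Fin N → ℝ), 0 < N ∧ (∀ j, s j ∈ Set.Ico 0 P.L) ∧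
    (∀ j, curvOf P.γ (s j) = kmaxOf P.γ) ∧
    (∀ t ∈ Set.Ico 0 P.L, (∀ j, t ≠ s j) → curvOf P.γ t < kmaxOf P.γ) ∧
    (∀ j, deriv (deriv (curvOf P.γ)) (s j) < 0)

/-- The ground state energy `μ(ζ)` of the de Gennes half-line model operator. -/
def muGen (ζ : ℝ) : ℝ :=
  sInf { r : ℝ | ∃ φ : ℝ → ℝ, ContDiff ℝ 1 φ ∧ HasCompactSupport φ ∧
    (∃ τ, 0 < τ ∧ φ τ ≠ 0) ∧
    r = (∫ τ in Set.Ioi (0 : ℝ), ((deriv φ τ) ^ 2 + (τ + ζ) ^ 2 * (φ τ) ^ 2)) /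
        (∫ τ in Set.Ioi (0 : ℝ), (φ τ) ^ 2) }

/-- The de Gennes constant `Θ₀`. -/
def Theta0 : ℝ := sInf (Set.range muGen)

/-- Standard facts about the de Gennes constant, taken as hypotheses. -/
structure DeGennes where
  ξ₀ : ℝ
  u₀ : ℝ → ℝ
  theta_lb : 1 / 2 < Theta0
  theta_ub : Theta0 < 1
  ξ₀_mem : ξ₀ ∈ Set.Ioo (-1 : ℝ) 0
  ξ₀_min : muGen ξ₀ = Theta0
  ξ₀_uniq : ∀ ζ, muGen ζ = Theta0 → ζ = ξ₀
  ξ₀_sq : ξ₀ ^ 2 = Theta0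
  u₀_pos : ∀ τ, 0 ≤ τ → 0 < u₀ τ
  u₀_smooth : ContDiffOn ℝ 2 u₀ (Set.Ici 0)
  u₀_sq_int : IntegrableOn (fun τ => (u₀ τ) ^ 2) (Set.Ioi 0)
  u₀_normalized : (∫ τ in Set.Ioi (0 : ℝ), (u₀ τ) ^ 2) = 1
  u₀_neumann : derivWithin u₀ (Set.Ici 0) 0 = 0
  u₀_ode : ∀ τ ∈ Set.Ioi (0 : ℝ),
    -(deriv (deriv u₀) τ) + (τ + ξ₀) ^ 2 * u₀ τ = Theta0 * u₀ τ

/-- The universal constant `C₁ = u₀(0)²/3`. -/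
def DeGennes.C1 (D : DeGennes) : ℝ := (D.u₀ 0) ^ 2 / 3

/-- Condition (★) on a vector field `A` at field strength `B` with constant `C₀`. -/
def StarCond (Ω : Set Plane) (C₀ B : ℝ) (A : Plane → Plane) : Prop :=
  CNearCl 2 Ω A ∧
  (∀ x ∈ closure Ω, ‖A x‖ ≤ C₀) ∧
  (∀ x ∈ closure Ω, ‖fderiv ℝ A x‖ ≤ C₀) ∧
  (∀ x ∈ closure Ω, ‖fderiv ℝ (fderiv ℝ A) x‖ ≤ C₀) ∧
  (∀ x ∈ closure Ω, |curl2 A x - 1| ≤ C₀ * B ^ (-(1 : ℝ) / 4)) ∧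
  (∀ x ∈ closure Ω, ‖fderiv ℝ (curl2 A) x‖ ≤ C₀ * B ^ (-(1 : ℝ) / 4)) ∧
  (∀ x ∈ frontier Ω, curl2 A x = 1)

/-- The open unit disc. -/
def unitDisc : Set Plane := {x : Plane | x.1 ^ 2 + x.2 ^ 2 < 1}

/-- `Δ_B`: distance from `B/2 + ξ₀√B + δ₀` to the nearest integer. -/
def DeltaB (ξ₀ δ₀ B : ℝ) : ℝ :=
  sInf (Set.range (fun m : ℤ => |(m : ℝ) - B / 2 - ξ₀ * Real.sqrt B - δ₀|))

/-- Euclidean distance to the boundary of `Ω`. -/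
def distBdry (Ω : Set Plane) (x : Plane) : ℝ :=
  sInf ((fun y => Real.sqrt (esq (x - y))) '' frontier Ω)

end SC

namespace SC

/-! ### Functions of class `Cⁿ` near the closure -/

section NearCl

set_option linter.unusedSectionVars false

variable {E F : Type*} [NormedAddCommGroup E] [NormedSpace ℝ E]
  [NormedAddCommGroup F] [NormedSpace ℝ F] {Ω : Set Plane} {n : ℕ}

lemma CNearCl.contDiffAt {u : Plane → E} (h : CNearCl n Ω u) {x : Plane} (hx : x ∈ closure Ω) :
    ContDiffAt ℝ n u x := by
  obtain ⟨U, hU, hs, hu⟩ := h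
  exact hu.contDiffAt (hU.mem_nhds (hs hx))

lemma CNearCl.differentiableAt {u : Plane → E} (h : CNearCl 1 Ω u) {x : Plane}
    (hx : x ∈ closure Ω) : DifferentiableAt ℝ u x :=
  (h.contDiffAt hx).differentiableAt (by norm_num)

lemma CNearCl.continuousOn {u : Plane → E} (h : CNearCl n Ω u) : ContinuousOn u (closure Ω) :=
  fun _ hx => (h.contDiffAt hx).continuousAt.continuousWithinAt

lemma CNearCl.continuousOn_fderiv {u : Plane → E} (h : CNearCl 1 Ω u) :
    ContinuousOn (fderiv ℝ u) (closure Ω) := by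
  obtain ⟨U, hU, hs, hu⟩ := h
  exact (hu.continuousOn_fderiv_of_isOpen hU (by norm_num)).mono hs

lemma CNearCl.continuousOn_fderiv_apply {u : Plane → E} (h : CNearCl 1 Ω u) (v : Plane) :
    ContinuousOn (fun x => fderiv ℝ u x v) (closure Ω) :=
  h.continuousOn_fderiv.clm_apply continuousOn_const

lemma CNearCl.map {u : Plane → E} (h : CNearCl n Ω u) {g : E → F} (hg : ContDiff ℝ n g) :
    CNearCl n Ω (fun x => g (u x)) := by
  obtain ⟨U, hU, hs, hu⟩ := h
  exact ⟨U, hU, hs, hg.comp_contDiffOn hu⟩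

lemma CNearCl.prodMk {u : Plane → E} {v : Plane → F} (h : CNearCl n Ω u) (h' : CNearCl n Ω v) :
    CNearCl n Ω (fun x => (u x, v x)) := by
  obtain ⟨U, hU, hs, hu⟩ := h
  obtain ⟨V, hV, hs', hv⟩ := h'
  exact ⟨U ∩ V, hU.inter hV, subset_inter hs hs',
    (hu.mono inter_subset_left).prodMk (hv.mono inter_subset_right)⟩

lemma CNearCl.add {u v : Plane → E} (h : CNearCl n Ω u) (h' : CNearCl n Ω v) :
    CNearCl n Ω (fun x => u x + v x) := (h.prodMk h').map (g := fun p => p.1 + p.2) (by fun_prop)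

lemma CNearCl.mul {u v : Plane → ℂ} (h : CNearCl n Ω u) (h' : CNearCl n Ω v) :
    CNearCl n Ω (fun x => u x * v x) := (h.prodMk h').map (g := fun p => p.1 * p.2) (by fun_prop)

lemma CNearCl.const_smul {u : Plane → E} (h : CNearCl n Ω u) (c : ℝ) :
    CNearCl n Ω (fun x => c • u x) := h.map (g := fun p => c • p) (by fun_prop)

lemma CNearCl.ofReal {u : Plane → ℝ} (h : CNearCl n Ω u) :
    CNearCl n Ω (fun x => (u x : ℂ)) := h.map (g := fun p : ℝ => (p : ℂ)) Complex.ofRealCLM.contDiff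

lemma CNearCl.ofReal_mul {f : Plane → ℝ} {u : Plane → ℂ} (h : CNearCl n Ω f)
    (h' : CNearCl n Ω u) : CNearCl n Ω (fun x => (f x : ℂ) * u x) := h.ofReal.mul h'

lemma CNearCl.of_contDiff {u : Plane → E} (h : ContDiff ℝ n u) : CNearCl n Ω u :=
  ⟨univ, isOpen_univ, subset_univ _, h.contDiffOn⟩

lemma CNearCl.fst {u : Plane → Plane} (h : CNearCl n Ω u) : CNearCl n Ω (fun x => (u x).1) :=
  h.map contDiff_fst

lemma CNearCl.snd {u : Plane → Plane} (h : CNearCl n Ω u) : CNearCl n Ω (fun x => (u x).2) :=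
  h.map contDiff_snd

lemma isCompact_closure_of_bdd (hb : Bornology.IsBounded Ω) : IsCompact (closure Ω) :=
  Metric.isCompact_of_isClosed_isBounded isClosed_closure hb.closure

lemma integrableOn_of_continuousOn_closure (hb : Bornology.IsBounded Ω) {f : Plane → E}
    (hf : ContinuousOn f (closure Ω)) : IntegrableOn f Ω :=
  (hf.integrableOn_compact (isCompact_closure_of_bdd hb)).mono_set subset_closure

lemma exists_bound_of_continuousOn_closure (hb : Bornology.IsBounded Ω) {f : Plane → E}
    (hf : ContinuousOn f (closure Ω)) : ∃ C > 0, ∀ x ∈ closure Ω, ‖f x‖ ≤ C := by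
  obtain ⟨C, hC⟩ := (isCompact_closure_of_bdd hb).exists_bound_of_continuousOn hf
  exact ⟨max C 1, by positivity, fun x hx => (hC x hx).trans (le_max_left _ _)⟩

end NearCl

/-! ### Magnetic derivatives -/

/-- First component of the magnetic gradient `(-i∇ - a)u`. -/
def Dx (a : Plane → Plane) (u : Plane → ℂ) (x : Plane) : ℂ :=
  (-Complex.I) * fderiv ℝ u x ((1 : ℝ), (0 : ℝ)) - ((a x).1 : ℂ) * u x

/-- Second component of the magnetic gradient `(-i∇ - a)u`. -/
def Dy (a : Plane → Plane) (u : Plane → ℂ) (x : Plane) : ℂ :=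
  (-Complex.I) * fderiv ℝ u x ((0 : ℝ), (1 : ℝ)) - ((a x).2 : ℂ) * u x

/-- Magnetic energy density. -/
def en (a : Plane → Plane) (u : Plane → ℂ) (x : Plane) : ℝ :=
  ‖Dx a u x‖ ^ 2 + ‖Dy a u x‖ ^ 2

/-- The current `Re (conj u · (-i∇ - a)u)`. -/
def cur (a : Plane → Plane) (u : Plane → ℂ) (x : Plane) : Plane :=
  ((starRingEnd ℂ (u x) * Dx a u x).re, (starRingEnd ℂ (u x) * Dy a u x).re)

/-- The squared Euclidean length of the gradient of a real function. -/
def gsq (f : Plane → ℝ) (x : Plane) : ℝ :=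
  fderiv ℝ f x ((1 : ℝ), (0 : ℝ)) ^ 2 + fderiv ℝ f x ((0 : ℝ), (1 : ℝ)) ^ 2

lemma magSq_eq (B : ℝ) (A : Plane → Plane) (u : Plane → ℂ) (x : Plane) :
    magSq B A u x = en (fun y => B • A y) u x := by
  simp [magSq, en, Dx, Dy]

lemma en_nonneg (a : Plane → Plane) (u : Plane → ℂ) (x : Plane) : 0 ≤ en a u x := by
  unfold en; positivity

lemma esq_nonneg (v : Plane) : 0 ≤ esq v := by unfold esq; positivity

lemma gsq_nonneg (f : Plane → ℝ) (x : Plane) : 0 ≤ gsq f x := by unfold gsq; positivity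

lemma nsq (z : ℂ) : ‖z‖ ^ 2 = z.re ^ 2 + z.im ^ 2 := by
  rw [← Complex.normSq_eq_norm_sq, Complex.normSq_apply]; ring

lemma fderiv_mul_c {f u : Plane → ℂ} {x : Plane} (hf : DifferentiableAt ℝ f x)
    (hu : DifferentiableAt ℝ u x) (v : Plane) :
    fderiv ℝ (fun y => f y * u y) x v = f x * fderiv ℝ u x v + u x * fderiv ℝ f x v := by
  rw [fderiv_fun_mul hf hu]; simp

lemma fderiv_ofReal_c {f : Plane → ℝ} {x : Plane} (hf : DifferentiableAt ℝ f x) (v : Plane) :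
    fderiv ℝ (fun y => (f y : ℂ)) x v = (fderiv ℝ f x v : ℂ) := by
  have := (Complex.ofRealCLM.hasFDerivAt.comp x hf.hasFDerivAt).fderiv
  have h2 : fderiv ℝ (fun y => (f y : ℂ)) x = Complex.ofRealCLM.comp (fderiv ℝ f x) := this
  rw [h2]; simp

lemma differentiableAt_ofReal {f : Plane → ℝ} {x : Plane} (hf : DifferentiableAt ℝ f x) :
    DifferentiableAt ℝ (fun y => (f y : ℂ)) x :=
  Complex.ofRealCLM.differentiableAt.comp x hf

lemma Dx_mul (a : Plane → Plane) {f : Plane → ℝ} {u : Plane → ℂ} {x : Plane}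
    (hf : DifferentiableAt ℝ f x) (hu : DifferentiableAt ℝ u x) :
    Dx a (fun y => (f y : ℂ) * u y) x =
      f x * Dx a u x - Complex.I * (fderiv ℝ f x ((1 : ℝ), (0 : ℝ)) : ℝ) * u x := by
  unfold Dx
  rw [fderiv_mul_c (differentiableAt_ofReal hf) hu, fderiv_ofReal_c hf]; ring

lemma Dy_mul (a : Plane → Plane) {f : Plane → ℝ} {u : Plane → ℂ} {x : Plane}
    (hf : DifferentiableAt ℝ f x) (hu : DifferentiableAt ℝ u x) :
    Dy a (fun y => (f y : ℂ) * u y) x =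
      f x * Dy a u x - Complex.I * (fderiv ℝ f x ((0 : ℝ), (1 : ℝ)) : ℝ) * u x := by
  unfold Dy
  rw [fderiv_mul_c (differentiableAt_ofReal hf) hu, fderiv_ofReal_c hf]; ring

lemma norm_sub_I_sq (f d : ℝ) (D z : ℂ) : ‖(f : ℂ) * D - Complex.I * d * z‖ ^ 2 =
    f ^ 2 * ‖D‖ ^ 2 + d ^ 2 * ‖z‖ ^ 2 + 2 * (f * d) * (D.re * z.im - D.im * z.re) := by
  simp only [nsq]; simp; ring

/-- Pointwise product formula for the energy density. -/
lemma en_mul (a : Plane → Plane) {f : Plane → ℝ} {u : Plane → ℂ} {x : Plane}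
    (hf : DifferentiableAt ℝ f x) (hu : DifferentiableAt ℝ u x) :
    en a (fun y => (f y : ℂ) * u y) x = f x ^ 2 * en a u x + gsq f x * ‖u x‖ ^ 2 +
      2 * (f x * fderiv ℝ f x ((1 : ℝ), (0 : ℝ))) *
        ((Dx a u x).re * (u x).im - (Dx a u x).im * (u x).re) +
      2 * (f x * fderiv ℝ f x ((0 : ℝ), (1 : ℝ))) *
        ((Dy a u x).re * (u x).im - (Dy a u x).im * (u x).re) := by
  unfold en gsq
  rw [Dx_mul a hf hu, Dy_mul a hf hu, norm_sub_I_sq, norm_sub_I_sq]; ring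

/-- The pointwise IMS localization formula. -/
lemma en_ims (a : Plane → Plane) {f g : Plane → ℝ} {u : Plane → ℂ} {x : Plane} {M : ℝ}
    (hf : DifferentiableAt ℝ f x) (hg : DifferentiableAt ℝ g x) (hu : DifferentiableAt ℝ u x)
    (h : ∀ᶠ y in 𝓝 x, f y ^ 2 + g y ^ 2 = M) :
    en a (fun y => (f y : ℂ) * u y) x + en a (fun y => (g y : ℂ) * u y) x =
      M * en a u x + (gsq f x + gsq g x) * ‖u x‖ ^ 2 := by
  have hM := h.self_of_nhds
  have key : ∀ v, f x * fderiv ℝ f x v + g x * fderiv ℝ g x v = 0 := by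
    intro v
    have h1 : HasFDerivAt (fun y => f y ^ 2 + g y ^ 2) (0 : Plane →L[ℝ] ℝ) x :=
      (hasFDerivAt_const M x).congr_of_eventuallyEq h
    have h2 := ((hf.hasFDerivAt.pow 2).add (hg.hasFDerivAt.pow 2)).unique h1
    have h3 := congrArg (fun l : Plane →L[ℝ] ℝ => l v) h2
    simp at h3
    linarith
  rw [en_mul a hf hu, en_mul a hg hu, ← hM]
  linear_combination
    2 * ((Dx a u x).re * (u x).im - (Dx a u x).im * (u x).re) * key ((1 : ℝ), (0 : ℝ)) +
    2 * ((Dy a u x).re * (u x).im - (Dy a u x).im * (u x).re) * key ((0 : ℝ), (1 : ℝ))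

/-- Shifting the potential. -/
lemma en_shift (a c : Plane → Plane) (u : Plane → ℂ) (x : Plane) :
    en (fun y => a y + c y) u x =
      en a u x - 2 * dot2 (c x) (cur a u x) + esq (c x) * ‖u x‖ ^ 2 := by
  have aux : ∀ (d a c : ℝ) (D z : ℂ), ‖D - ((a + c : ℝ) : ℂ) * z‖ ^ 2 = ‖D - (a : ℂ) * z‖ ^ 2 -
      2 * (c * (starRingEnd ℂ z * (D - (a : ℂ) * z)).re) + c ^ 2 * ‖z‖ ^ 2 := by
    intro d a c D z
    simp only [nsq]; simp; ring
  simp only [en, Dx, Dy, cur, dot2, esq]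
  rw [show (a x + c x).1 = (a x).1 + (c x).1 from rfl,
    show (a x + c x).2 = (a x).2 + (c x).2 from rfl, aux 0, aux 0]
  ring

lemma cur_mul (a : Plane → Plane) {f : Plane → ℝ} {u : Plane → ℂ} {x : Plane}
    (hf : DifferentiableAt ℝ f x) (hu : DifferentiableAt ℝ u x) :
    cur a (fun y => (f y : ℂ) * u y) x = f x ^ 2 • cur a u x := by
  unfold cur
  rw [Dx_mul a hf hu, Dy_mul a hf hu]
  ext <;> simp <;> ring

lemma cur_bound (a c : Plane → Plane) (u : Plane → ℂ) (x : Plane) (δ : ℝ) (hδ : 0 < δ) :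
    2 * |dot2 (c x) (cur a u x)| ≤ δ * (esq (c x) * ‖u x‖ ^ 2) + δ⁻¹ * en a u x := by
  have h1 : ∀ c : Plane → Plane, 2 * dot2 (c x) (cur a u x) ≤
      δ * (esq (c x) * ‖u x‖ ^ 2) + δ⁻¹ * en a u x := by
    intro c
    have h := en_shift a (fun y => δ • c y) u x
    have h0 := en_nonneg (fun y => a y + δ • c y) u x
    rw [h] at h0
    have e1 : dot2 (δ • c x) (cur a u x) = δ * dot2 (c x) (cur a u x) := by
      simp [dot2]; ring
    have e2 : esq (δ • c x) = δ ^ 2 * esq (c x) := by simp [esq]; ring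
    rw [e1, e2] at h0
    have h3 : δ * (2 * dot2 (c x) (cur a u x)) ≤
        δ * (δ * (esq (c x) * ‖u x‖ ^ 2) + δ⁻¹ * en a u x) := by
      have : δ * (δ⁻¹ * en a u x) = en a u x := by field_simp
      nlinarith
    exact le_of_mul_le_mul_left h3 hδ
  rcases abs_cases (dot2 (c x) (cur a u x)) with h | h
  · rw [h.1]; exact h1 c
  · rw [h.1]
    have := h1 (fun y => - c y)
    have e1 : dot2 (- c x) (cur a u x) = - dot2 (c x) (cur a u x) := by simp [dot2]; ring
    have e2 : esq (- c x) = esq (c x) := by simp [esq]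
    rwa [e1, e2] at this

/-- Multiplication by a phase shifts the potential. -/
lemma en_phase (a θ : Plane → Plane) {f : Plane → ℝ} {w u : Plane → ℂ} {x : Plane} {p : ℂ}
    (hf : DifferentiableAt ℝ f x) (hu : DifferentiableAt ℝ u x) (hw : DifferentiableAt ℝ w x)
    (hp : ‖p‖ = 1) (hwx : w x = f x * p)
    (hdw : ∀ v, fderiv ℝ w x v = ((fderiv ℝ f x v : ℝ) + Complex.I * f x * dot2 (θ x) v) * p) :
    en a (fun y => w y * u y) x = en (fun y => a y - θ y) (fun y => (f y : ℂ) * u y) x := by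
  have h1 : Dx a (fun y => w y * u y) x =
      p * Dx (fun y => a y - θ y) (fun y => (f y : ℂ) * u y) x := by
    unfold Dx
    rw [fderiv_mul_c hw hu, fderiv_mul_c (differentiableAt_ofReal hf) hu, fderiv_ofReal_c hf,
      hdw, hwx]
    simp [dot2]
    linear_combination (-(u x * f x * (θ x).1 * p)) * Complex.I_sq -
      (u x * (a x).1) * hwx
  have h2 : Dy a (fun y => w y * u y) x =
      p * Dy (fun y => a y - θ y) (fun y => (f y : ℂ) * u y) x := by
    unfold Dy
    rw [fderiv_mul_c hw hu, fderiv_mul_c (differentiableAt_ofReal hf) hu, fderiv_ofReal_c hf,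
      hdw, hwx]
    simp [dot2]
    linear_combination (-(u x * f x * (θ x).2 * p)) * Complex.I_sq -
      (u x * (a x).2) * hwx
  simp only [en, h1, h2, norm_mul, hp, one_mul]

/-- Gauge transformation by a real phase function. -/
lemma en_gauge (a : Plane → Plane) {φ : Plane → ℝ} {u : Plane → ℂ} {x : Plane}
    (hφ : DifferentiableAt ℝ φ x) (hu : DifferentiableAt ℝ u x) (θ : Plane)
    (hθ : ∀ v, fderiv ℝ φ x v = dot2 θ v) :
    en a (fun y => Complex.exp (Complex.I * φ y) * u y) x = en (fun y => a y - θ) u x := by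
  have hd : HasFDerivAt (fun y => Complex.exp (Complex.I * φ y))
      (Complex.exp (Complex.I * φ x) • (Complex.I • Complex.ofRealCLM.comp (fderiv ℝ φ x))) x :=
    ((Complex.ofRealCLM.hasFDerivAt.comp x hφ.hasFDerivAt).const_mul Complex.I).cexp
  have := en_phase a (fun _ => θ) (f := fun _ => 1)
    (p := Complex.exp (Complex.I * φ x)) (differentiableAt_const _) hu hd.differentiableAt
    (by rw [mul_comm]; exact Complex.norm_exp_ofReal_mul_I _) (by simp)
    (by intro v; rw [hd.fderiv]; simp [hθ]; ring)
  rw [this]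
  simp

end SC

namespace SC

variable {Ω : Set Plane}

lemma continuousOn_en {a : Plane → Plane} {u : Plane → ℂ} (ha : ContinuousOn a (closure Ω))
    (hu : CNearCl 1 Ω u) : ContinuousOn (en a u) (closure Ω) := by
  unfold en Dx Dy
  have h1 := hu.continuousOn_fderiv_apply ((1 : ℝ), (0 : ℝ))
  have h2 := hu.continuousOn_fderiv_apply ((0 : ℝ), (1 : ℝ))
  have h3 := hu.continuousOn
  fun_prop

lemma continuousOn_cur {a : Plane → Plane} {u : Plane → ℂ} (ha : ContinuousOn a (closure Ω))
    (hu : CNearCl 1 Ω u) : ContinuousOn (cur a u) (closure Ω) := by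
  unfold cur Dx Dy
  have h1 := hu.continuousOn_fderiv_apply ((1 : ℝ), (0 : ℝ))
  have h2 := hu.continuousOn_fderiv_apply ((0 : ℝ), (1 : ℝ))
  have h3 := hu.continuousOn
  refine ContinuousOn.prodMk ?_ ?_
  · refine Complex.continuous_re.comp_continuousOn ?_
    exact (Complex.continuous_conj.comp_continuousOn h3).mul (by fun_prop)
  · refine Complex.continuous_re.comp_continuousOn ?_
    exact (Complex.continuous_conj.comp_continuousOn h3).mul (by fun_prop)

lemma continuousOn_gsq {f : Plane → ℝ} (hf : CNearCl 1 Ω f) :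
    ContinuousOn (gsq f) (closure Ω) := by
  unfold gsq
  have h1 := hf.continuousOn_fderiv_apply ((1 : ℝ), (0 : ℝ))
  have h2 := hf.continuousOn_fderiv_apply ((0 : ℝ), (1 : ℝ))
  fun_prop

lemma continuous_F0 : Continuous F0 := by unfold F0; fun_prop

lemma continuous_smul_F0 (B : ℝ) : Continuous (fun y => B • F0 y) := by unfold F0; fun_prop

lemma integrableOn_en (hb : Bornology.IsBounded Ω) {a : Plane → Plane} {u : Plane → ℂ}
    (ha : ContinuousOn a (closure Ω)) (hu : CNearCl 1 Ω u) : IntegrableOn (en a u) Ω :=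
  integrableOn_of_continuousOn_closure hb (continuousOn_en ha hu)

lemma integrableOn_nsq (hb : Bornology.IsBounded Ω) {u : Plane → ℂ}
    (hu : CNearCl 1 Ω u) : IntegrableOn (fun x => ‖u x‖ ^ 2) Ω :=
  integrableOn_of_continuousOn_closure hb (hu.continuousOn.norm.pow 2)

lemma volume_lt_top_of_bdd (hb : Bornology.IsBounded Ω) : volume Ω < ⊤ := hb.measure_lt_top

lemma lam1_set_bddBelow (B : ℝ) : BddBelow { r : ℝ | ∃ u : Plane → ℂ, CNearCl 1 Ω u ∧
    (∫ x in Ω, ‖u x‖ ^ 2) ≠ 0 ∧ r = (∫ x in Ω, magSq B F0 u x) / (∫ x in Ω, ‖u x‖ ^ 2) } := by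
  refine ⟨0, ?_⟩
  rintro r ⟨u, -, -, rfl⟩
  exact div_nonneg (integral_nonneg fun x => by rw [magSq_eq]; exact en_nonneg _ _ _)
    (integral_nonneg fun x => by positivity)

lemma lam1_mul_le (B : ℝ) {u : Plane → ℂ} (hu : CNearCl 1 Ω u) :
    lam1 Ω B * ∫ x in Ω, ‖u x‖ ^ 2 ≤ ∫ x in Ω, en (fun y => B • F0 y) u x := by
  have h0 : 0 ≤ ∫ x in Ω, en (fun y => B • F0 y) u x := integral_nonneg fun x => en_nonneg _ _ _
  by_cases h : (∫ x in Ω, ‖u x‖ ^ 2) = 0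
  · rw [h, mul_zero]; exact h0
  have hpos : 0 < ∫ x in Ω, ‖u x‖ ^ 2 :=
    lt_of_le_of_ne (integral_nonneg fun x => by positivity) (Ne.symm h)
  rw [← le_div_iff₀ hpos]
  refine csInf_le (lam1_set_bddBelow B) ⟨u, hu, h, ?_⟩
  simp only [magSq_eq]

lemma volume_pos_of_nonempty (ho : IsOpen Ω) (hne : Ω.Nonempty) (hb : Bornology.IsBounded Ω) :
    0 < volume.real Ω :=
  ENNReal.toReal_pos (ho.measure_pos volume hne).ne' (volume_lt_top_of_bdd hb).ne

lemma integral_one_sq : (∫ x in Ω, ‖(fun _ : Plane => (1 : ℂ)) x‖ ^ 2) = volume.real Ω := by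
  simp

lemma exists_near_min (ho : IsOpen Ω) (hne : Ω.Nonempty) (hb : Bornology.IsBounded Ω) (B : ℝ)
    {ε : ℝ} (hε : 0 < ε) : ∃ u : Plane → ℂ, CNearCl 1 Ω u ∧ (∫ x in Ω, ‖u x‖ ^ 2) = 1 ∧
      (∫ x in Ω, en (fun y => B • F0 y) u x) ≤ lam1 Ω B + ε := by
  have hn : { r : ℝ | ∃ u : Plane → ℂ, CNearCl 1 Ω u ∧
    (∫ x in Ω, ‖u x‖ ^ 2) ≠ 0 ∧
    r = (∫ x in Ω, magSq B F0 u x) / (∫ x in Ω, ‖u x‖ ^ 2) }.Nonempty := by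
    refine ⟨_, fun _ => 1, .of_contDiff contDiff_const, ?_, rfl⟩
    rw [integral_one_sq]
    exact (volume_pos_of_nonempty ho hne hb).ne'
  obtain ⟨r, ⟨u, hu, h0, rfl⟩, hr⟩ := exists_lt_of_csInf_lt hn
    (show sInf _ < lam1 Ω B + ε by unfold lam1 lam1A; linarith)
  have hpos : 0 < ∫ x in Ω, ‖u x‖ ^ 2 :=
    lt_of_le_of_ne (integral_nonneg fun x => by positivity) (Ne.symm h0)
  set m := ∫ x in Ω, ‖u x‖ ^ 2
  set c : ℝ := (Real.sqrt m)⁻¹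
  have hc : c ^ 2 = m⁻¹ := by simp only [c]; rw [inv_pow, Real.sq_sqrt hpos.le]
  refine ⟨fun x => ((c : ℝ) : ℂ) * u x, CNearCl.ofReal_mul (f := fun _ => c)
    (.of_contDiff contDiff_const) hu, ?_, ?_⟩
  · simp only [norm_mul, mul_pow]
    rw [integral_const_mul]
    simp only [Complex.norm_real, Real.norm_eq_abs, sq_abs, hc]
    exact inv_mul_cancel₀ hpos.ne'
  · have : (∫ x in Ω, en (fun y => B • F0 y) (fun x => ((c : ℝ) : ℂ) * u x) x) =
        ∫ x in Ω, c ^ 2 * en (fun y => B • F0 y) u x := by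
      refine setIntegral_congr_fun ho.measurableSet fun x hx => ?_
      rw [en_mul _ (f := fun _ => c) (differentiableAt_const _)
        (hu.differentiableAt (subset_closure hx))]
      simp [gsq]
    rw [this, integral_const_mul, hc]
    simp only [magSq_eq] at hr
    rw [inv_mul_eq_div]
    exact hr.le

lemma lam1_nonneg (B : ℝ) : 0 ≤ lam1 Ω B := by
  refine Real.sInf_nonneg ?_
  rintro r ⟨u, -, -, rfl⟩
  exact div_nonneg (integral_nonneg fun x => by rw [magSq_eq]; exact en_nonneg _ _ _)
    (integral_nonneg fun x => by positivity)

/-- Crude quadratic upper bound from the constant trial state. -/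
lemma lam1_le_sq (ho : IsOpen Ω) (hne : Ω.Nonempty) (hb : Bornology.IsBounded Ω) :
    ∃ C > 0, ∀ B, lam1 Ω B ≤ C * B ^ 2 := by
  have hv := volume_pos_of_nonempty ho hne hb
  set I := ∫ x in Ω, esq (F0 x)
  have hI : 0 ≤ I := integral_nonneg fun x => esq_nonneg _
  refine ⟨I / volume.real Ω + 1, by positivity, fun B => ?_⟩
  have h := lam1_mul_le (Ω := Ω) B (u := fun _ => 1) (.of_contDiff contDiff_const)
  rw [integral_one_sq] at h
  have h2 : (∫ x in Ω, en (fun y => B • F0 y) (fun _ => 1) x) = B ^ 2 * I := by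
    rw [← integral_const_mul]
    congr 1; ext x
    simp [en, Dx, Dy, esq, mul_pow]; ring
  rw [h2, ← le_div_iff₀ hv] at h
  refine h.trans ?_
  have : B ^ 2 * I / volume.real Ω = (I / volume.real Ω) * B ^ 2 := by ring
  rw [this]
  nlinarith [sq_nonneg B]

lemma curl2_F0 (x : Plane) : curl2 F0 x = 1 := by
  unfold curl2 F0
  have h1 : HasFDerivAt (fun y : Plane => y.1 / 2)
      ((2 : ℝ)⁻¹ • ContinuousLinearMap.fst ℝ ℝ ℝ) x := by
    simpa [div_eq_inv_mul] using (hasFDerivAt_fst (p := x) (𝕜 := ℝ)).const_mul (2 : ℝ)⁻¹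
  have h2 : HasFDerivAt (fun y : Plane => -y.2 / 2)
      (-((2 : ℝ)⁻¹ • ContinuousLinearMap.snd ℝ ℝ ℝ)) x := by
    have := ((hasFDerivAt_snd (p := x) (𝕜 := ℝ)).const_mul (2 : ℝ)⁻¹).neg
    refine this.congr_of_eventuallyEq (Eventually.of_forall fun y => ?_)
    simp; ring
  simp only [h1.fderiv, h2.fderiv]
  simp; norm_num

/-- If the normal state minimizes, then the linear stability condition holds. -/
lemma le_lam1_of_normalMin (ho : IsOpen Ω) (hne : Ω.Nonempty) (hb : Bornology.IsBounded Ω)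
    {κ H : ℝ} (h : NormalMin Ω κ H) : κ ^ 2 ≤ lam1 Ω (κ * H) := by
  by_contra hlt
  push Not at hlt
  obtain ⟨u, hu, hu1, hu2⟩ := exists_near_min ho hne hb (κ * H)
    (ε := (κ ^ 2 - lam1 Ω (κ * H)) / 2) (by linarith)
  set Q := ∫ x in Ω, en (fun y => (κ * H) • F0 y) u x
  set X4 := ∫ x in Ω, ‖u x‖ ^ 4
  have hX4i : IntegrableOn (fun x => ‖u x‖ ^ 4) Ω :=
    integrableOn_of_continuousOn_closure hb (hu.continuousOn.norm.pow 4)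
  have hX2i := integrableOn_nsq hb hu
  have hQi := integrableOn_en hb (a := fun y => (κ * H) • F0 y)
    (continuous_smul_F0 _).continuousOn hu
  have hX4 : 0 ≤ X4 := integral_nonneg fun x => by positivity
  have key : ∀ t : ℝ, 0 ≤ t ^ 2 * (Q - κ ^ 2) + t ^ 4 * (κ ^ 2 / 2 * X4) := by
    intro t
    have hadm : GLadm Ω (fun x => ((t : ℝ) : ℂ) * u x) F0 :=
      ⟨CNearCl.ofReal_mul (f := fun _ => t) (.of_contDiff contDiff_const) hu,
        .of_contDiff (by unfold F0; fun_prop)⟩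
    have h0 := h _ _ hadm
    have e : GLenergy Ω κ H (fun x => ((t : ℝ) : ℂ) * u x) F0 =
        ∫ x in Ω, (t ^ 2 * en (fun y => (κ * H) • F0 y) u x - t ^ 2 * κ ^ 2 * ‖u x‖ ^ 2
          + t ^ 4 * (κ ^ 2 / 2) * ‖u x‖ ^ 4) := by
      unfold GLenergy
      refine setIntegral_congr_fun ho.measurableSet fun x hx => ?_
      dsimp only
      rw [magSq_eq, en_mul _ (f := fun _ => t) (differentiableAt_const _)
        (hu.differentiableAt (subset_closure hx)), curl2_F0]
      simp [gsq, mul_pow]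
      have : |t| ^ 4 = t ^ 4 := by rw [show (4 : ℕ) = 2 * 2 by rfl, pow_mul, sq_abs, pow_mul]
      rw [this]; ring
    rw [e, integral_add, integral_sub, integral_const_mul, integral_const_mul,
      integral_const_mul, hu1] at h0
    · linarith
    · exact hQi.const_mul _
    · exact hX2i.const_mul _
    · exact (hQi.const_mul _).sub (hX2i.const_mul _)
    · exact hX4i.const_mul _
  have hneg : Q - κ ^ 2 < 0 := by linarith
  set d := κ ^ 2 - Q
  set K := κ ^ 2 / 2 * X4
  have hK : 0 ≤ K := by positivity
  have hd : 0 < d := by simp only [d]; linarith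
  have h1 := key (Real.sqrt (d / (2 * (K + 1))))
  have h2 : Real.sqrt (d / (2 * (K + 1))) ^ 2 = d / (2 * (K + 1)) :=
    Real.sq_sqrt (by positivity)
  have h4 : Real.sqrt (d / (2 * (K + 1))) ^ 4 = (d / (2 * (K + 1))) ^ 2 := by
    rw [show (4 : ℕ) = 2 * 2 by rfl, pow_mul, h2]
  rw [h2, h4] at h1
  set s := d / (2 * (K + 1))
  have hs : 0 < s := by positivity
  have hsK : s * K < d := by
    have : s * (2 * (K + 1)) = d := by simp only [s]; field_simp
    nlinarith
  have : Q - κ ^ 2 = -d := by simp only [d]; ring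
  rw [this] at h1
  nlinarith

/-- Reduction of the equality of all critical fields to monotonicity of the ground state energy
and to the nonlinear stability criterion. -/
lemma critical_fields_coincide (ho : IsOpen Ω) (hne : Ω.Nonempty) (hb : Bornology.IsBounded Ω)
    (hmono : ∃ B₀ > 0, ∀ B B', B₀ ≤ B → B ≤ B' → lam1 Ω B ≤ lam1 Ω B')
    (hnl : ∃ κ₀ > 0, ∀ κ > κ₀, ∀ H > 0, κ ^ 2 ≤ lam1 Ω (κ * H) → NormalUnique Ω κ H) :
    ∃ κ₀ > 0, ∀ κ > κ₀,
      HlocLow Ω κ = HlocUp Ω κ ∧ HlocUp Ω κ = HC3low Ω κ ∧ HC3low Ω κ = HC3up Ω κ := by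
  obtain ⟨B₀, hB₀, hmono⟩ := hmono
  obtain ⟨κ₁, hκ₁, hnl⟩ := hnl
  obtain ⟨C, hC, hsq⟩ := lam1_le_sq ho hne hb
  refine ⟨max κ₁ (Real.sqrt C * B₀), lt_max_of_lt_left hκ₁, fun κ hκ => ?_⟩
  have hk1 : κ₁ < κ := (le_max_left _ _).trans_lt hκ
  have hk2 : Real.sqrt C * B₀ < κ := (le_max_right _ _).trans_lt hκ
  have hk0 : 0 < κ := hκ₁.trans hk1
  have hlarge : ∀ H > 0, κ ^ 2 ≤ lam1 Ω (κ * H) → B₀ ≤ κ * H := by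
    intro H hH h
    have h1 := h.trans (hsq (κ * H))
    by_contra hlt
    push Not at hlt
    have hs : Real.sqrt C ^ 2 = C := Real.sq_sqrt hC.le
    have h2 : (κ * H) ^ 2 < B₀ ^ 2 := by
      apply pow_lt_pow_left₀ hlt (by positivity) (by norm_num)
    have h3 : (Real.sqrt C * B₀) ^ 2 < κ ^ 2 := pow_lt_pow_left₀ hk2 (by positivity) (by norm_num)
    rw [mul_pow, hs] at h3
    nlinarith
  have hup : ∀ H > 0, κ ^ 2 ≤ lam1 Ω (κ * H) → ∀ H', H ≤ H' → κ ^ 2 ≤ lam1 Ω (κ * H') := by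
    intro H hH h H' hH'
    exact h.trans (hmono _ _ (hlarge H hH h) (by gcongr))
  have hSU : {H : ℝ | 0 < H ∧ κ ^ 2 ≤ lam1 Ω (κ * H)} = {H : ℝ | 0 < H ∧ NormalMin Ω κ H} := by
    ext H
    exact ⟨fun h => ⟨h.1, (hnl κ hk1 H h.1 h.2).1⟩,
      fun h => ⟨h.1, le_lam1_of_normalMin ho hne hb h.2⟩⟩
  have hVU : {H : ℝ | 0 < H ∧ ∀ H', H < H' → κ ^ 2 ≤ lam1 Ω (κ * H')} =
      {H : ℝ | 0 < H ∧ ∀ H', H < H' → NormalUnique Ω κ H'} := by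
    ext H
    exact ⟨fun h => ⟨h.1, fun H' hH' => hnl κ hk1 H' (h.1.trans hH') (h.2 H' hH')⟩,
      fun h => ⟨h.1, fun H' hH' => le_lam1_of_normalMin ho hne hb (h.2 H' hH').1⟩⟩
  have hLoc : HlocLow Ω κ = HlocUp Ω κ := by
    unfold HlocLow HlocUp
    set S := {H : ℝ | 0 < H ∧ κ ^ 2 ≤ lam1 Ω (κ * H)}
    set U := {H : ℝ | 0 < H ∧ ∀ H', H < H' → κ ^ 2 ≤ lam1 Ω (κ * H')}
    have hsub : S ⊆ U := fun H h => ⟨h.1, fun H' hH' => hup H h.1 h.2 H' hH'.le⟩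
    have hbS : BddBelow S := ⟨0, fun H h => h.1.le⟩
    have hbU : BddBelow U := ⟨0, fun H h => h.1.le⟩
    rcases U.eq_empty_or_nonempty with hU | ⟨H₀, hH₀⟩
    · have : S = ∅ := subset_eq_empty hsub hU
      rw [hU, this]
    have hin : ∀ H ∈ U, ∀ H', H < H' → H' ∈ S := fun H h H' hH' => ⟨h.1.trans hH', h.2 H' hH'⟩
    refine le_antisymm ?_ (csInf_le_csInf hbU ⟨H₀ + 1, hin H₀ hH₀ _ (by linarith)⟩ hsub)
    refine le_csInf ⟨H₀, hH₀⟩ fun H hH => ?_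
    refine le_of_forall_gt_imp_ge_of_dense fun H' hH' => ?_
    exact csInf_le hbS (hin H hH H' hH')
  have h2 : HC3low Ω κ = HlocLow Ω κ := by unfold HC3low HlocLow; rw [hSU]
  have h3 : HC3up Ω κ = HlocUp Ω κ := by unfold HC3up HlocUp; rw [hVU]
  exact ⟨hLoc, by rw [h2, hLoc], by rw [h2, h3, hLoc]⟩

end SC

namespace SC

/-! ### The half-line model -/

/-- `φ` is a `C¹` trial function for the half-line model, vanishing beyond `R`. -/
structure Trial (φ : ℝ → ℝ) (R : ℝ) : Prop where
  pos : 0 < R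
  smooth : ContDiff ℝ 1 φ
  zero : ∀ t, R ≤ t → φ t = 0

/-- Quadratic form of the half-line model with shift `a`. -/
def halfForm (a : ℝ) (φ : ℝ → ℝ) (R : ℝ) : ℝ :=
  ∫ t in (0 : ℝ)..R, ((deriv φ t) ^ 2 + (t - a) ^ 2 * φ t ^ 2)

/-- Rayleigh quotients of the half-line models. -/
def thSet : Set ℝ := { r | ∃ (φ : ℝ → ℝ) (R a : ℝ), Trial φ R ∧
  0 < (∫ t in (0 : ℝ)..R, φ t ^ 2) ∧ r = halfForm a φ R / ∫ t in (0 : ℝ)..R, φ t ^ 2 }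

/-- The half-line constant. -/
def Th : ℝ := sInf thSet

lemma Trial.cont {φ : ℝ → ℝ} {R : ℝ} (h : Trial φ R) : Continuous φ := h.smooth.continuous

lemma Trial.cont_deriv {φ : ℝ → ℝ} {R : ℝ} (h : Trial φ R) : Continuous (deriv φ) :=
  h.smooth.continuous_deriv (by norm_num)

lemma Trial.hasDerivAt {φ : ℝ → ℝ} {R : ℝ} (h : Trial φ R) (t : ℝ) :
    HasDerivAt φ (deriv φ t) t :=
  (h.smooth.differentiable (by norm_num) t).hasDerivAt

lemma halfForm_nonneg {a R : ℝ} (φ : ℝ → ℝ) (hR : 0 ≤ R) : 0 ≤ halfForm a φ R :=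
  intervalIntegral.integral_nonneg hR fun t _ => by positivity

lemma thSet_bddBelow : BddBelow thSet := by
  refine ⟨0, ?_⟩
  rintro r ⟨φ, R, a, h, h0, rfl⟩
  exact div_nonneg (halfForm_nonneg φ h.pos.le) h0.le

lemma Th_mul_le {φ : ℝ → ℝ} {R : ℝ} (h : Trial φ R) (a : ℝ) :
    Th * (∫ t in (0 : ℝ)..R, φ t ^ 2) ≤ halfForm a φ R := by
  have h0 : 0 ≤ ∫ t in (0 : ℝ)..R, φ t ^ 2 :=
    intervalIntegral.integral_nonneg h.pos.le fun t _ => by positivity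
  rcases h0.eq_or_lt with h0 | h0
  · rw [← h0, mul_zero]; exact halfForm_nonneg φ h.pos.le
  · rw [← le_div_iff₀ h0]
    exact csInf_le thSet_bddBelow ⟨φ, R, a, h, h0, rfl⟩

/-- Scaled half-line inequality. -/
lemma Th_scaled {φ : ℝ → ℝ} {R : ℝ} (h : Trial φ R) (a : ℝ) {B : ℝ} (hB : 0 < B) :
    Th * B * (∫ t in (0 : ℝ)..R, φ t ^ 2) ≤
      ∫ t in (0 : ℝ)..R, ((deriv φ t) ^ 2 + (B * t - a) ^ 2 * φ t ^ 2) := by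
  set r := Real.sqrt B
  have hr : 0 < r := Real.sqrt_pos.2 hB
  have hrr : r ^ 2 = B := Real.sq_sqrt hB.le
  have hrinv : r⁻¹ * r = 1 := inv_mul_cancel₀ hr.ne'
  have hT : Trial (fun t => φ (r⁻¹ * t)) (r * R) := by
    refine ⟨mul_pos hr h.pos, h.smooth.comp (by fun_prop), fun t ht => h.zero _ ?_⟩
    rw [inv_mul_eq_div, le_div_iff₀ hr]; linarith
  have hd : ∀ t, deriv (fun t => φ (r⁻¹ * t)) t = r⁻¹ * deriv φ (r⁻¹ * t) := by
    intro t
    rw [deriv_comp_mul_left]; simp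
  have h1 := Th_mul_le hT (a / r)
  unfold halfForm at h1
  simp only [hd] at h1
  have s1 := intervalIntegral.smul_integral_comp_mul_left (a := 0) (b := r * R)
    (fun t => φ t ^ 2) r⁻¹
  have s2 := intervalIntegral.smul_integral_comp_mul_left (a := 0) (b := r * R)
    (fun t => (r⁻¹ * deriv φ t) ^ 2 + (r * t - a / r) ^ 2 * φ t ^ 2) r⁻¹
  have e1 : r⁻¹ * (r * R) = R := by rw [← mul_assoc, hrinv, one_mul]
  rw [mul_zero, e1, smul_eq_mul] at s1 s2
  have e2 : ∀ t : ℝ, r * (r⁻¹ * t) = t := fun t => by rw [← mul_assoc, mul_inv_cancel₀ hr.ne',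
    one_mul]
  simp only [e2] at s2
  have h2 : Th * (∫ t in (0 : ℝ)..R, φ t ^ 2) ≤
      ∫ t in (0 : ℝ)..R, ((r⁻¹ * deriv φ t) ^ 2 + (r * t - a / r) ^ 2 * φ t ^ 2) := by
    rw [← s1, ← s2]
    have := mul_le_mul_of_nonneg_left h1 (inv_pos.2 hr).le
    linarith
  have h3 : ∫ t in (0 : ℝ)..R, ((deriv φ t) ^ 2 + (B * t - a) ^ 2 * φ t ^ 2) =
      B * ∫ t in (0 : ℝ)..R, ((r⁻¹ * deriv φ t) ^ 2 + (r * t - a / r) ^ 2 * φ t ^ 2) := by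
    rw [← intervalIntegral.integral_const_mul]
    congr 1; ext t
    rw [← hrr]; field_simp
  rw [h3]
  nlinarith

/-! ### A Riccati subsolution -/

/-- The cubic middle part of the Riccati subsolution. -/
def ricMid (x : ℝ) : ℝ := -(12 / 125) * x - 12 / 5 * x ^ 2 + 192 / 125 * x ^ 3

/-- A nonpositive subsolution of `p' + p² ≤ τ² - μ` with `μ > 1/2`. -/
def ric (τ : ℝ) : ℝ :=
  if τ ≤ -(71 / 100) then 0 else if τ ≤ 5 / 4 then ricMid ((τ + 71 / 100) * (25 / 49))
  else -(24 / 25)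

/-- Right derivative of `ric`. -/
def ricD (τ : ℝ) : ℝ :=
  if τ < -(71 / 100) then 0 else if τ < 5 / 4 then
    (-(12 / 125) - 24 / 5 * ((τ + 71 / 100) * (25 / 49)) +
      576 / 125 * ((τ + 71 / 100) * (25 / 49)) ^ 2) * (25 / 49)
  else 0

lemma continuous_ric : Continuous ric := by
  unfold ric ricMid
  refine Continuous.if_le continuous_const ?_ continuous_id continuous_const ?_
  · refine Continuous.if_le (by fun_prop) continuous_const continuous_id continuous_const ?_
    intro x hx
    rw [hx]; norm_num
  · intro x hx
    rw [hx]; norm_num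

lemma ric_hasDerivWithinAt (τ : ℝ) : HasDerivWithinAt ric (ricD τ) (Ioi τ) τ := by
  have hmid : HasDerivAt (fun τ : ℝ => ricMid ((τ + 71 / 100) * (25 / 49)))
      ((-(12 / 125) - 24 / 5 * ((τ + 71 / 100) * (25 / 49)) +
      576 / 125 * ((τ + 71 / 100) * (25 / 49)) ^ 2) * (25 / 49)) τ := by
    have hi : HasDerivAt (fun τ : ℝ => (τ + 71 / 100) * (25 / 49)) (25 / 49) τ := by
      simpa using ((hasDerivAt_id τ).add_const (71 / 100 : ℝ)).mul_const (25 / 49 : ℝ)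
    unfold ricMid
    have := ((hi.const_mul (-(12 / 125) : ℝ)).sub ((hi.pow 2).const_mul (12 / 5))).add
      ((hi.pow 3).const_mul (192 / 125))
    refine this.congr_deriv ?_
    norm_num; ring
  unfold ricD
  split_ifs with h1 h2
  · refine (hasDerivWithinAt_const τ _ (0 : ℝ)).congr_of_eventuallyEq ?_ ?_
    · filter_upwards [mem_nhdsWithin_of_mem_nhds (Iio_mem_nhds h1)] with y hy
      simp only [mem_Iio] at hy
      simp [ric, hy.le]
    · simp [ric, h1.le]
  · push Not at h1
    refine hmid.hasDerivWithinAt.congr_of_eventuallyEq ?_ ?_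
    · filter_upwards [self_mem_nhdsWithin, mem_nhdsWithin_of_mem_nhds (Iio_mem_nhds h2)]
        with y hy hy2
      simp only [mem_Iio, mem_Ioi] at hy hy2
      simp only [ric]
      rw [if_neg (by linarith), if_pos hy2.le]
    · simp only [ric]
      split_ifs with h3 h4
      · have : τ = -(71 / 100) := le_antisymm h3 h1
        rw [this]; norm_num [ricMid]
      · rfl
      · exact absurd h2.le h4
  · push Not at h1 h2
    refine (hasDerivWithinAt_const τ _ (-(24 / 25) : ℝ)).congr_of_eventuallyEq ?_ ?_
    · filter_upwards [self_mem_nhdsWithin] with y hy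
      simp only [mem_Ioi] at hy
      simp only [ric]
      rw [if_neg (by linarith), if_neg (by linarith)]
    · simp only [ric]
      rw [if_neg (by linarith)]
      split_ifs with h3
      · have : τ = 5 / 4 := le_antisymm h3 h2
        rw [this]; norm_num [ricMid]
      · rfl

lemma ric_nonpos (τ : ℝ) : ric τ ≤ 0 := by
  unfold ric
  split_ifs with h1 h2
  · exact le_rfl
  · push Not at h1
    have hx0 : 0 ≤ (τ + 71 / 100) * (25 / 49) := by
      apply mul_nonneg <;> linarith
    have hx1 : (τ + 71 / 100) * (25 / 49) ≤ 1 := by linarith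
    generalize (τ + 71 / 100) * (25 / 49) = x at *
    unfold ricMid
    nlinarith [mul_nonneg (mul_nonneg hx0 hx0) (sub_nonneg.2 hx1), mul_nonneg hx0 hx0]
  · norm_num

lemma ric_le (τ : ℝ) : ricD τ + ric τ ^ 2 ≤ τ ^ 2 - 501 / 1000 := by
  unfold ricD ric
  rcases lt_or_ge τ (-(71 / 100)) with h1 | h1
  · rw [if_pos h1, if_pos h1.le]; nlinarith
  rw [if_neg h1.not_gt]
  rcases h1.eq_or_lt with h1 | h1
  · rw [← h1]; norm_num
  rw [if_neg h1.not_ge]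
  rcases lt_or_ge τ (5 / 4) with h2 | h2
  · rw [if_pos h2, if_pos h2.le]
    have hx0 : 0 ≤ (τ + 71 / 100) * (25 / 49) := by
      apply mul_nonneg <;> linarith
    have hx1 : (τ + 71 / 100) * (25 / 49) ≤ 1 := by linarith
    have ht : τ = (τ + 71 / 100) * (25 / 49) * (49 / 25) - 71 / 100 := by ring
    generalize (τ + 71 / 100) * (25 / 49) = x at *
    rw [ht, ← sub_nonneg]
    unfold ricMid
    rcases le_total x (1 / 2) with hx | hx
    · have hy : 0 ≤ 2 * x := by linarith
      have hz : 0 ≤ 1 - 2 * x := by linarith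
      refine le_of_le_of_eq (b := 25519/490000 * ((2 * x) ^ 0 * (1 - 2 * x) ^ 6) +
        7123/49000 * ((2 * x) ^ 1 * (1 - 2 * x) ^ 5) +
        3870801/12250000 * ((2 * x) ^ 2 * (1 - 2 * x) ^ 4) +
        2432401/3062500 * ((2 * x) ^ 3 * (1 - 2 * x) ^ 3) +
        10017673/12250000 * ((2 * x) ^ 4 * (1 - 2 * x) ^ 2) +
        2038119/6125000 * ((2 * x) ^ 5 * (1 - 2 * x) ^ 1) +
        86937/1750000 * ((2 * x) ^ 6 * (1 - 2 * x) ^ 0)) ?_ (by ring)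
      positivity
    · have hy : 0 ≤ 2 * x - 1 := by linarith
      have hz : 0 ≤ 2 - 2 * x := by linarith
      refine le_of_le_of_eq (b := 86937/1750000 * ((2 * x - 1) ^ 0 * (2 - 2 * x) ^ 6) +
        322647/1225000 * ((2 * x - 1) ^ 1 * (2 - 2 * x) ^ 5) +
        824119/1750000 * ((2 * x - 1) ^ 2 * (2 - 2 * x) ^ 4) +
        47317/122500 * ((2 * x - 1) ^ 3 * (2 - 2 * x) ^ 3) +
        5872449/12250000 * ((2 * x - 1) ^ 4 * (2 - 2 * x) ^ 2) +
        825703/1225000 * ((2 * x - 1) ^ 5 * (2 - 2 * x) ^ 1) +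
        140551/490000 * ((2 * x - 1) ^ 6 * (2 - 2 * x) ^ 0)) ?_ (by ring)
      positivity
  · rw [if_neg h2.not_gt]
    rcases h2.eq_or_lt with h2 | h2
    · rw [← h2]; norm_num [ricMid]
    · rw [if_neg h2.not_ge]; nlinarith

/-- The half-line models are bounded below by a number larger than `1/2`. -/
lemma half_lower {φ : ℝ → ℝ} {R : ℝ} (h : Trial φ R) (a : ℝ) :
    501 / 1000 * (∫ t in (0 : ℝ)..R, φ t ^ 2) ≤ halfForm a φ R := by
  have hc := h.cont
  have hc' := h.cont_deriv
  have key := intervalIntegral.sub_le_integral_of_hasDeriv_right_of_le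
    (g := fun t => ric (t - a) * φ t ^ 2)
    (g' := fun t => ricD (t - a) * φ t ^ 2 + ric (t - a) * (2 * φ t * deriv φ t))
    (φ := fun t => (deriv φ t) ^ 2 + (t - a) ^ 2 * φ t ^ 2 - 501 / 1000 * φ t ^ 2)
    h.pos.le
    ((continuous_ric.comp (continuous_id.sub continuous_const)).mul (hc.pow 2)).continuousOn
    (fun t _ => by
      have h1 : HasDerivWithinAt (fun t => ric (t - a)) (ricD (t - a)) (Ioi t) t := by
        have := (ric_hasDerivWithinAt (t - a)).scomp (h := fun t => t - a) (h' := 1)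
          (s := Ioi t) t
          ((hasDerivAt_id t).sub_const a).hasDerivWithinAt
          (fun y hy => by simp only [mem_Ioi] at hy ⊢; linarith)
        rw [one_smul] at this
        exact this
      have h2 := ((h.hasDerivAt t).pow 2).hasDerivWithinAt (s := Ioi t)
      refine (h1.mul h2).congr_deriv ?_
      simp)
    (by
      apply Continuous.integrableOn_Icc
      fun_prop)
    (fun t _ => by
      have h1 := ric_le (t - a)
      nlinarith [sq_nonneg (deriv φ t - ric (t - a) * φ t), sq_nonneg (φ t),
        mul_le_mul_of_nonneg_right h1 (sq_nonneg (φ t))])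
  rw [h.zero R le_rfl] at key
  have h0 := mul_nonneg (neg_nonneg.2 (ric_nonpos (0 - a))) (sq_nonneg (φ 0))
  rw [intervalIntegral.integral_sub, intervalIntegral.integral_const_mul] at key
  · unfold halfForm
    nlinarith
  · apply Continuous.intervalIntegrable; fun_prop
  · apply Continuous.intervalIntegrable; fun_prop

/-! ### Upper bound through an explicit trial function -/

lemma hasDerivAt_posPart_sq (x : ℝ) :
    HasDerivAt (fun y : ℝ => (max y 0) ^ 2) (2 * max x 0) x := by
  rcases lt_trichotomy x 0 with hx | hx | hx
  · rw [max_eq_right hx.le, mul_zero]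
    refine (hasDerivAt_const x (0 : ℝ)).congr_of_eventuallyEq ?_
    filter_upwards [Iio_mem_nhds hx] with y hy
    simp only [mem_Iio] at hy
    simp [hy.le]
  · subst hx
    rw [hasDerivAt_iff_isLittleO_nhds_zero]
    simp only [zero_add, max_self, mul_zero, smul_zero, sub_zero, ne_eq, OfNat.ofNat_ne_zero,
      not_false_eq_true, zero_pow]
    refine Asymptotics.IsBigO.trans_isLittleO (g := fun h : ℝ => h ^ 2) ?_ ?_
    · refine Asymptotics.IsBigO.of_bound 1 (Eventually.of_forall fun y => ?_)
      rw [one_mul, Real.norm_of_nonneg (by positivity), Real.norm_of_nonneg (by positivity)]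
      rcases le_total y 0 with h | h
      · rw [max_eq_right h]; nlinarith [sq_nonneg y]
      · rw [max_eq_left h]
    · exact Asymptotics.isLittleO_pow_id (by norm_num)
  · rw [max_eq_left hx.le]
    have : HasDerivAt (fun y : ℝ => y ^ 2) (2 * x) x := by simpa using hasDerivAt_pow 2 x
    refine this.congr_of_eventuallyEq ?_
    filter_upwards [Ioi_mem_nhds hx] with y hy
    simp only [mem_Ioi] at hy
    simp [hy.le]

lemma deriv_posPart_sq : deriv (fun y : ℝ => (max y 0) ^ 2) = fun x => 2 * max x 0 :=
  funext fun x => (hasDerivAt_posPart_sq x).deriv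

lemma contDiff_posPart_sq : ContDiff ℝ 1 (fun y : ℝ => (max y 0) ^ 2) := by
  rw [contDiff_one_iff_deriv]
  refine ⟨fun x => (hasDerivAt_posPart_sq x).differentiableAt, ?_⟩
  rw [deriv_posPart_sq]
  fun_prop

lemma thSet_small : ∃ r ∈ thSet, r < 1 := by
  set φ : ℝ → ℝ := fun t => (max (4 - t) 0) ^ 2
  have hd : ∀ t, deriv φ t = -(2 * max (4 - t) 0) := by
    intro t
    have h1 := (hasDerivAt_posPart_sq (4 - t)).comp t ((hasDerivAt_id t).const_sub 4)
    refine h1.deriv.trans ?_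
    ring
  have hT : Trial φ 4 := by
    refine ⟨by norm_num, contDiff_posPart_sq.comp (by fun_prop), fun t ht => ?_⟩
    simp [φ, ht]
  have hφ : ∀ t ∈ uIcc (0 : ℝ) 4, φ t ^ 2 = (4 - t) ^ 4 := by
    intro t ht
    rw [uIcc_of_le (by norm_num)] at ht
    simp only [φ]
    rw [max_eq_left (by linarith [ht.2])]; ring
  have i1 : (∫ t in (0 : ℝ)..4, φ t ^ 2) = 1024 / 5 := by
    rw [intervalIntegral.integral_congr hφ, intervalIntegral.integral_comp_sub_left
      (fun t => t ^ 4)]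
    norm_num
  refine ⟨_, ⟨φ, 4, 2 / 3, hT, by rw [i1]; norm_num, rfl⟩, ?_⟩
  rw [i1, div_lt_one (by norm_num)]
  have i2 : halfForm (2 / 3) φ 4 =
      ∫ t in (0 : ℝ)..4, (4 * t ^ 2 + (100 / 9 * t ^ 4 - 20 / 3 * t ^ 5 + t ^ 6)) := by
    have := intervalIntegral.integral_comp_sub_left (a := 0) (b := 4)
      (fun t : ℝ => 4 * t ^ 2 + (100 / 9 * t ^ 4 - 20 / 3 * t ^ 5 + t ^ 6)) 4
    norm_num at this
    rw [← this]
    refine intervalIntegral.integral_congr fun t ht => ?_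
    rw [hφ t ht, hd]
    rw [uIcc_of_le (by norm_num)] at ht
    rw [max_eq_left (by linarith [ht.2])]
    ring
  rw [i2, intervalIntegral.integral_add, intervalIntegral.integral_add,
    intervalIntegral.integral_sub, intervalIntegral.integral_const_mul,
    intervalIntegral.integral_const_mul, intervalIntegral.integral_const_mul]
  · norm_num
  all_goals (apply Continuous.intervalIntegrable; fun_prop)

lemma Th_lt_one : Th < 1 := by
  obtain ⟨r, hr, h1⟩ := thSet_small
  exact (csInf_le thSet_bddBelow hr).trans_lt h1

lemma half_lt_Th : 1 / 2 < Th := by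
  have : 501 / 1000 ≤ Th := by
    obtain ⟨r₀, hr₀, -⟩ := thSet_small
    refine le_csInf ⟨r₀, hr₀⟩ ?_
    rintro r ⟨φ, R, a, h, h0, rfl⟩
    rw [le_div_iff₀ h0]
    exact half_lower h a
  linarith

lemma exists_near_Th {δ : ℝ} (hδ : 0 < δ) : ∃ (φ : ℝ → ℝ) (R a : ℝ), Trial φ R ∧
    0 < (∫ t in (0 : ℝ)..R, φ t ^ 2) ∧
    halfForm a φ R ≤ (Th + δ) * ∫ t in (0 : ℝ)..R, φ t ^ 2 := by
  obtain ⟨r₀, hr₀, -⟩ := thSet_small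
  obtain ⟨r, ⟨φ, R, a, h, h0, rfl⟩, hr⟩ := exists_lt_of_csInf_lt ⟨r₀, hr₀⟩
    (show sInf thSet < Th + δ by unfold Th; linarith)
  exact ⟨φ, R, a, h, h0, ((div_lt_iff₀ h0).1 hr).le⟩

end SC

namespace SC

/-! ### The flat strip -/

lemma hasDerivAt_param_integral {E : Type*} [NormedAddCommGroup E] [NormedSpace ℝ E]
    {F F' : ℝ → ℝ → E} (hF : Continuous (Function.uncurry F))
    (hF' : Continuous (Function.uncurry F')) (h : ∀ t s, HasDerivAt (fun t => F t s) (F' t s) t)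
    (a b t : ℝ) : HasDerivAt (fun t => ∫ s in a..b, F t s) (∫ s in a..b, F' t s) t := by
  obtain ⟨C, hC⟩ := ((isCompact_Icc (a := t - 1) (b := t + 1)).prod
    (isCompact_uIcc (a := a) (b := b))).exists_bound_of_continuousOn hF'.continuousOn
  have hs : ∀ t, Continuous (F t) := fun t => hF.comp (by fun_prop : Continuous fun s => (t, s))
  have hs' : ∀ t, Continuous (F' t) := fun t => hF'.comp (by fun_prop : Continuous fun s => (t, s))
  refine (intervalIntegral.hasDerivAt_integral_of_dominated_loc_of_deriv_le
    (s := Icc (t - 1) (t + 1)) (bound := fun _ => C)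
    (Icc_mem_nhds (by linarith) (by linarith))
    (Eventually.of_forall fun x => (hs x).aestronglyMeasurable)
    ((hs t).intervalIntegrable _ _) (hs' t).aestronglyMeasurable ?_
    intervalIntegrable_const ?_).2
  · exact Eventually.of_forall fun s hsm x hx => hC (x, s) ⟨hx, uIoc_subset_uIcc hsm⟩
  · exact Eventually.of_forall fun s _ x _ => h x s

/-- Two-dimensional flat data on a periodic strip: a `C¹` function with its partial derivatives. -/
structure Strip (L R : ℝ) (U Us Ut : ℝ → ℝ → ℂ) : Prop where
  cU : Continuous (Function.uncurry U)
  cs : Continuous (Function.uncurry Us)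
  ct : Continuous (Function.uncurry Ut)
  ds : ∀ t s, HasDerivAt (fun s => U t s) (Us t s) s
  dt : ∀ t s, HasDerivAt (fun t => U t s) (Ut t s) t
  per : ∀ t, U t L = U t 0
  zero : ∀ t s, R ≤ t → U t s = 0

section

variable {L R : ℝ} {U Us Ut : ℝ → ℝ → ℂ}

lemma memLp_of_continuous {f : ℝ → ℂ} (hf : Continuous f) (a b : ℝ) :
    MemLp f 2 (volume.restrict (Ioc a b)) := by
  obtain ⟨C, hC⟩ := isCompact_Icc.exists_bound_of_continuousOn (s := Icc a b) hf.continuousOn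
  refine MemLp.of_bound hf.aestronglyMeasurable C ?_
  exact (ae_restrict_iff' measurableSet_Ioc).2 (Eventually.of_forall fun x hx =>
    hC x (Ioc_subset_Icc_self hx))

lemma fourierCoeffOn_lin (hL : 0 < L) {f g : ℝ → ℂ} (hf : Continuous f) (hg : Continuous g)
    (c d : ℂ) (m : ℤ) : fourierCoeffOn hL (fun s => c * f s + d * g s) m =
      c * fourierCoeffOn hL f m + d * fourierCoeffOn hL g m := by
  simp only [fourierCoeffOn_eq_integral]
  have hc : Continuous fun s : ℝ => (fourier (-m) (s : AddCircle (L - 0)) : ℂ) :=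
    (map_continuous _).comp (AddCircle.continuous_mk' _)
  have : ∀ s : ℝ, (fourier (-m) (s : AddCircle (L - 0)) : ℂ) • (c * f s + d * g s) =
      c * ((fourier (-m) (s : AddCircle (L - 0)) : ℂ) • f s) +
      d * ((fourier (-m) (s : AddCircle (L - 0)) : ℂ) • g s) := by
    intro s; simp only [smul_eq_mul]; ring
  simp only [this]
  rw [intervalIntegral.integral_add, intervalIntegral.integral_const_mul,
    intervalIntegral.integral_const_mul]
  · simp only [Complex.real_smul]; ring
  · exact ((hc.smul hf).const_mul c).intervalIntegrable _ _
  · exact ((hc.smul hg).const_mul d).intervalIntegrable _ _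

lemma fourierCoeffOn_deriv (hL : 0 < L) {f f' : ℝ → ℂ} (hf : ∀ s, HasDerivAt f (f' s) s)
    (hf' : Continuous f') (hp : f L = f 0) (m : ℤ) :
    fourierCoeffOn hL f' m = (2 * Real.pi * m / L : ℝ) * Complex.I * fourierCoeffOn hL f m := by
  have hL' : (L : ℂ) ≠ 0 := by exact_mod_cast hL.ne'
  by_cases hm : m = 0
  · subst hm
    rw [fourierCoeffOn_eq_integral]
    simp
    right
    rw [intervalIntegral.integral_eq_sub_of_hasDerivAt (fun x _ => hf x)
      (hf'.intervalIntegrable _ _), hp, sub_self]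
  · rw [fourierCoeffOn_of_hasDerivAt hL hm (fun x _ => hf x) (hf'.intervalIntegrable _ _), hp]
    have hm' : (m : ℂ) ≠ 0 := by exact_mod_cast hm
    have hpi : (Real.pi : ℂ) ≠ 0 := by exact_mod_cast Real.pi_ne_zero
    push_cast
    field_simp
    simp

lemma Strip.cont_slice (h : Strip L R U Us Ut) (t : ℝ) : Continuous (U t) :=
  h.cU.comp (by fun_prop : Continuous fun s => (t, s))

lemma Strip.cont_slice_s (h : Strip L R U Us Ut) (t : ℝ) : Continuous (Us t) :=
  h.cs.comp (by fun_prop : Continuous fun s => (t, s))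

lemma Strip.cont_slice_t (h : Strip L R U Us Ut) (t : ℝ) : Continuous (Ut t) :=
  h.ct.comp (by fun_prop : Continuous fun s => (t, s))

lemma continuous_fourierCoeffOn (hL : 0 < L) {G : ℝ → ℝ → ℂ}
    (hG : Continuous (Function.uncurry G)) (m : ℤ) :
    Continuous fun t => fourierCoeffOn hL (G t) m := by
  simp only [fourierCoeffOn_eq_integral]
  refine Continuous.const_smul ?_ _
  refine intervalIntegral.continuous_parametric_intervalIntegral_of_continuous' ?_ _ _
  have hc : Continuous fun s : ℝ => (fourier (-m) (s : AddCircle (L - 0)) : ℂ) :=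
    (map_continuous _).comp (AddCircle.continuous_mk' _)
  exact (hc.comp continuous_snd).smul hG

lemma Strip.hasDerivAt_coeff (h : Strip L R U Us Ut) (hL : 0 < L) (m : ℤ) (t : ℝ) :
    HasDerivAt (fun t => fourierCoeffOn hL (U t) m) (fourierCoeffOn hL (Ut t) m) t := by
  simp only [fourierCoeffOn_eq_integral]
  have hc : Continuous fun s : ℝ => (fourier (-m) (s : AddCircle (L - 0)) : ℂ) :=
    (map_continuous _).comp (AddCircle.continuous_mk' _)
  have h1 := hasDerivAt_param_integral
    (F := fun t s => (fourier (-m) (s : AddCircle (L - 0)) : ℂ) • U t s)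
    (F' := fun t s => (fourier (-m) (s : AddCircle (L - 0)) : ℂ) • Ut t s)
    ((hc.comp continuous_snd).smul h.cU) ((hc.comp continuous_snd).smul h.ct)
    (fun t s => (h.dt t s).const_mul (fourier (-m) (s : AddCircle (L - 0)) : ℂ)) 0 L t
  exact h1.const_smul (1 / (L - 0) : ℝ)

/-- The half-line inequality for complex valued functions. -/
lemma Th_scaled_complex {c c' : ℝ → ℂ} (hR : 0 < R) (hc : ∀ t, HasDerivAt c (c' t) t)
    (hc' : Continuous c') (hz : ∀ t, R ≤ t → c t = 0) (a : ℝ) {B : ℝ} (hB : 0 < B) :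
    Th * B * (∫ t in (0 : ℝ)..R, ‖c t‖ ^ 2) ≤
      ∫ t in (0 : ℝ)..R, (‖c' t‖ ^ 2 + (B * t - a) ^ 2 * ‖c t‖ ^ 2) := by
  have hcc : Continuous c := continuous_iff_continuousAt.2 fun t => (hc t).continuousAt
  have dre : ∀ t, HasDerivAt (fun t => (c t).re) (c' t).re t := fun t =>
    Complex.reCLM.hasFDerivAt.comp_hasDerivAt t (hc t)
  have dim : ∀ t, HasDerivAt (fun t => (c t).im) (c' t).im t := fun t =>
    Complex.imCLM.hasFDerivAt.comp_hasDerivAt t (hc t)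
  have ere : deriv (fun t => (c t).re) = fun t => (c' t).re := funext fun t => (dre t).deriv
  have eim : deriv (fun t => (c t).im) = fun t => (c' t).im := funext fun t => (dim t).deriv
  have tre : Trial (fun t => (c t).re) R := by
    refine ⟨hR, contDiff_one_iff_deriv.2 ⟨fun t => (dre t).differentiableAt, ?_⟩,
      fun t ht => by simp [hz t ht]⟩
    rw [ere]; exact Complex.continuous_re.comp hc'
  have tim : Trial (fun t => (c t).im) R := by
    refine ⟨hR, contDiff_one_iff_deriv.2 ⟨fun t => (dim t).differentiableAt, ?_⟩,
      fun t ht => by simp [hz t ht]⟩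
    rw [eim]; exact Complex.continuous_im.comp hc'
  have h1 := Th_scaled tre a hB
  have h2 := Th_scaled tim a hB
  rw [ere] at h1
  rw [eim] at h2
  have := add_le_add h1 h2
  rw [← mul_add, ← intervalIntegral.integral_add, ← intervalIntegral.integral_add] at this
  · have e1 : ∀ t, ‖c t‖ ^ 2 = (c t).re ^ 2 + (c t).im ^ 2 := fun t => nsq _
    have e2 : ∀ t, ‖c' t‖ ^ 2 + (B * t - a) ^ 2 * ‖c t‖ ^ 2 =
        (c' t).re ^ 2 + (B * t - a) ^ 2 * (c t).re ^ 2 +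
        ((c' t).im ^ 2 + (B * t - a) ^ 2 * (c t).im ^ 2) := fun t => by rw [nsq, nsq]; ring
    simp only [e2]
    simp only [e1]
    exact this
  all_goals (apply Continuous.intervalIntegrable; fun_prop)

lemma strip_lower (h : Strip L R U Us Ut) (hL : 0 < L) (hR : 0 < R) {B : ℝ} (hB : 0 < B) (b : ℝ) :
    Th * B * (∫ t in (0 : ℝ)..R, ∫ s in (0 : ℝ)..L, ‖U t s‖ ^ 2) ≤
      ∫ t in (0 : ℝ)..R, ∫ s in (0 : ℝ)..L,
        (‖Ut t s‖ ^ 2 + ‖-Complex.I * Us t s - ((b - B * t : ℝ) : ℂ) * U t s‖ ^ 2) := by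
  set V : ℝ → ℝ → ℂ := fun t s => -Complex.I * Us t s - ((b - B * t : ℝ) : ℂ) * U t s
  have cV : Continuous (Function.uncurry V) :=
    (h.cs.const_mul _).sub ((Complex.continuous_ofReal.comp (by fun_prop)).mul h.cU)
  have cVs : ∀ t, Continuous (V t) := fun t => cV.comp (by fun_prop : Continuous fun s => (t, s))
  set c : ℤ → ℝ → ℂ := fun m t => fourierCoeffOn hL (U t) m
  set c' : ℤ → ℝ → ℂ := fun m t => fourierCoeffOn hL (Ut t) m
  have cc : ∀ m, Continuous (c m) := fun m => continuous_fourierCoeffOn hL h.cU m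
  have cc' : ∀ m, Continuous (c' m) := fun m => continuous_fourierCoeffOn hL h.ct m
  have hV : ∀ m t, fourierCoeffOn hL (V t) m =
      ((B * t - (b - 2 * Real.pi * m / L) : ℝ) : ℂ) * c m t := by
    intro m t
    have h1 := fourierCoeffOn_lin hL (h.cont_slice_s t) (h.cont_slice t) (-Complex.I)
      (-((b - B * t : ℝ) : ℂ)) m
    rw [fourierCoeffOn_deriv hL (h.ds t) (h.cont_slice_s t) (h.per t)] at h1
    have e : V t = fun s => -Complex.I * Us t s + -((b - B * t : ℝ) : ℂ) * U t s := by
      ext s; simp only [V]; ring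
    rw [e, h1]
    simp only [c]
    push_cast
    linear_combination (-(2 * Real.pi * m / L * fourierCoeffOn hL (U t) m)) * Complex.I_sq
  have hpars : ∀ (f : ℝ → ℂ), Continuous f →
      HasSum (fun m => ‖fourierCoeffOn hL f m‖ ^ 2) (L⁻¹ * ∫ s in (0 : ℝ)..L, ‖f s‖ ^ 2) := by
    intro f hf
    simpa using hasSum_sq_fourierCoeffOn hL (memLp_of_continuous hf 0 L)
  have hlow : ∀ m, Th * B * (∫ t in (0 : ℝ)..R, ‖c m t‖ ^ 2) ≤
      ∫ t in (0 : ℝ)..R, (‖c' m t‖ ^ 2 + ‖fourierCoeffOn hL (V t) m‖ ^ 2) := by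
    intro m
    have := Th_scaled_complex hR (c := c m) (c' := c' m) (fun t => h.hasDerivAt_coeff hL m t)
      (cc' m) (fun t ht => by
        have : U t = fun _ => 0 := funext fun s => h.zero t s ht
        simp [c, this, fourierCoeffOn_eq_integral]) (b - 2 * Real.pi * m / L) hB
    refine this.trans_eq ?_
    congr 1; ext t
    rw [hV, norm_mul, mul_pow, Complex.norm_real, Real.norm_eq_abs, sq_abs]
  have cI : ∀ {G : ℝ → ℝ → ℂ}, Continuous (Function.uncurry G) →
      Continuous fun t => L⁻¹ * ∫ s in (0 : ℝ)..L, ‖G t s‖ ^ 2 := by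
    intro G hG
    refine continuous_const.mul
      (intervalIntegral.continuous_parametric_intervalIntegral_of_continuous' ?_ _ _)
    exact hG.norm.pow 2
  have hcV : ∀ m, Continuous fun t => fourierCoeffOn hL (V t) m := fun m =>
    continuous_fourierCoeffOn hL cV m
  have hfin : ∀ F : Finset ℤ, Th * B * (∑ m ∈ F, ∫ t in (0 : ℝ)..R, ‖c m t‖ ^ 2) ≤
      ∫ t in (0 : ℝ)..R, ((L⁻¹ * ∫ s in (0 : ℝ)..L, ‖Ut t s‖ ^ 2) +
        L⁻¹ * ∫ s in (0 : ℝ)..L, ‖V t s‖ ^ 2) := by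
    intro F
    rw [Finset.mul_sum]
    refine (Finset.sum_le_sum fun m _ => hlow m).trans ?_
    rw [← intervalIntegral.integral_finsetSum]
    · refine intervalIntegral.integral_mono_on hR.le ?_ ?_ ?_
      · refine Continuous.intervalIntegrable ?_ _ _
        exact continuous_finsetSum _ fun m _ => ((cc' m).norm.pow 2).add ((hcV m).norm.pow 2)
      · exact ((cI h.ct).add (cI cV)).intervalIntegrable _ _
      · intro t _
        rw [Finset.sum_add_distrib]
        exact add_le_add
          (sum_le_hasSum F (fun m _ => by positivity) (hpars _ (h.cont_slice_t t)))
          (sum_le_hasSum F (fun m _ => by positivity) (hpars _ (cVs t)))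
    · intro m _
      exact (((cc' m).norm.pow 2).add ((hcV m).norm.pow 2)).intervalIntegrable _ _
  have hsum : HasSum (fun m => ∫ t in (0 : ℝ)..R, ‖c m t‖ ^ 2)
      (∫ t in (0 : ℝ)..R, L⁻¹ * ∫ s in (0 : ℝ)..L, ‖U t s‖ ^ 2) := by
    refine intervalIntegral.hasSum_integral_of_dominated_convergence
      (fun m t => ‖c m t‖ ^ 2) ?_ ?_ ?_ ?_ ?_
    · intro m; exact ((cc m).norm.pow 2).aestronglyMeasurable
    · intro m; refine Eventually.of_forall fun t _ => ?_
      rw [Real.norm_of_nonneg (by positivity)]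
    · exact Eventually.of_forall fun t _ => (hpars _ (h.cont_slice t)).summable
    · have : (fun t => ∑' m, ‖c m t‖ ^ 2) = fun t => L⁻¹ * ∫ s in (0 : ℝ)..L, ‖U t s‖ ^ 2 :=
        funext fun t => (hpars _ (h.cont_slice t)).tsum_eq
      rw [this]
      exact (cI h.cU).intervalIntegrable _ _
    · exact Eventually.of_forall fun t _ => hpars _ (h.cont_slice t)
  have hlim := le_of_tendsto (hsum.mul_left (Th * B)) (Eventually.of_forall fun F => by
    rw [← Finset.mul_sum]; exact hfin F)
  have e2 : (∫ t in (0 : ℝ)..R, ((L⁻¹ * ∫ s in (0 : ℝ)..L, ‖Ut t s‖ ^ 2) +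
        L⁻¹ * ∫ s in (0 : ℝ)..L, ‖V t s‖ ^ 2)) =
      L⁻¹ * ∫ t in (0 : ℝ)..R, ∫ s in (0 : ℝ)..L, (‖Ut t s‖ ^ 2 + ‖V t s‖ ^ 2) := by
    rw [← intervalIntegral.integral_const_mul]
    congr 1; ext t
    rw [intervalIntegral.integral_add, mul_add]
    · exact ((h.cont_slice_t t).norm.pow 2).intervalIntegrable _ _
    · exact ((cVs t).norm.pow 2).intervalIntegrable _ _
  rw [e2, intervalIntegral.integral_const_mul] at hlim
  have hLi : 0 < L⁻¹ := inv_pos.2 hL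
  rw [show Th * B * (L⁻¹ * ∫ t in (0 : ℝ)..R, ∫ s in (0 : ℝ)..L, ‖U t s‖ ^ 2) =
    L⁻¹ * (Th * B * ∫ t in (0 : ℝ)..R, ∫ s in (0 : ℝ)..L, ‖U t s‖ ^ 2) by ring] at hlim
  exact le_of_mul_le_mul_left hlim hLi

end

end SC

namespace SC

/-! ### The isoperimetric bound -/

lemma wirtinger {L : ℝ} (hL : 0 < L) {f f' : ℝ → ℂ} (hf : ∀ s, HasDerivAt f (f' s) s)
    (hf' : Continuous f') (hp : f L = f 0) (h0 : (∫ s in (0 : ℝ)..L, f s) = 0) :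
    (2 * Real.pi / L) ^ 2 * (∫ s in (0 : ℝ)..L, ‖f s‖ ^ 2) ≤ ∫ s in (0 : ℝ)..L, ‖f' s‖ ^ 2 := by
  have hc : Continuous f := continuous_iff_continuousAt.2 fun s => (hf s).continuousAt
  have h1 := hasSum_sq_fourierCoeffOn hL (memLp_of_continuous hc 0 L)
  have h2 := hasSum_sq_fourierCoeffOn hL (memLp_of_continuous hf' 0 L)
  have h3 := hasSum_le (fun m => ?_) (h1.mul_left ((2 * Real.pi / L) ^ 2)) h2
  · simp only [sub_zero, smul_eq_mul] at h3
    have hLi : 0 < L⁻¹ := inv_pos.2 hL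
    refine le_of_mul_le_mul_left ?_ hLi
    linarith
  · rw [fourierCoeffOn_deriv hL hf hf' hp]
    by_cases hm : m = 0
    · subst hm
      have : fourierCoeffOn hL f 0 = 0 := by
        rw [fourierCoeffOn_eq_integral]; simp [h0]
      simp [this]
    · rw [norm_mul, norm_mul, Complex.norm_I, mul_one, mul_pow, Complex.norm_real,
        Real.norm_eq_abs, sq_abs]
      have hm1 : (1 : ℝ) ≤ (m : ℝ) ^ 2 := by
        have : (1 : ℤ) ≤ m ^ 2 := by
          have := sq_nonneg m
          have h2 : m ^ 2 ≠ 0 := pow_ne_zero 2 hm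
          omega
        exact_mod_cast this
      refine mul_le_mul_of_nonneg_right ?_ (by positivity)
      rw [show (2 * Real.pi * m / L) ^ 2 = (m : ℝ) ^ 2 * (2 * Real.pi / L) ^ 2 by ring]
      nlinarith [sq_nonneg (2 * Real.pi / L)]

namespace BoundaryParam

variable {Ω : Set Plane} (P : BoundaryParam Ω)

lemma hasDerivAt_γ (s : ℝ) : HasDerivAt P.γ (deriv P.γ s) s :=
  ((P.smooth.differentiable (by norm_num)) s).hasDerivAt

lemma contDiff_deriv : ContDiff ℝ (⊤ : ℕ∞) (deriv P.γ) :=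
  (contDiff_infty_iff_deriv.1 P.smooth).2

lemma continuous_deriv : Continuous (deriv P.γ) := P.contDiff_deriv.continuous

/-- The enclosed area `½ ∮ γ ∧ γ'`. -/
def area : ℝ := (1 / 2) * ∫ s in (0 : ℝ)..P.L,
  ((P.γ s).1 * (deriv P.γ s).2 - (P.γ s).2 * (deriv P.γ s).1)

lemma abs_area_le : |P.area| ≤ P.L ^ 2 / (4 * Real.pi) := by
  set L := P.L
  have hL : 0 < L := P.L_pos
  have hpi := Real.pi_pos
  have cγ : Continuous P.γ := P.smooth.continuous
  have cγ' := P.continuous_deriv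
  set z : ℝ → ℂ := fun s => ((P.γ s).1 : ℂ) + (P.γ s).2 * Complex.I
  set z' : ℝ → ℂ := fun s => ((deriv P.γ s).1 : ℂ) + (deriv P.γ s).2 * Complex.I
  have cz : Continuous z := by fun_prop
  have cz' : Continuous z' := by fun_prop
  have hz : ∀ s, HasDerivAt z (z' s) s := fun s => by
    have h := P.hasDerivAt_γ s
    have h1 : HasDerivAt (fun s => (P.γ s).1) (deriv P.γ s).1 s :=
      (hasFDerivAt_fst (𝕜 := ℝ) (p := P.γ s)).comp_hasDerivAt s h
    have h2 : HasDerivAt (fun s => (P.γ s).2) (deriv P.γ s).2 s :=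
      (hasFDerivAt_snd (𝕜 := ℝ) (p := P.γ s)).comp_hasDerivAt s h
    exact h1.ofReal_comp.add (h2.ofReal_comp.mul_const Complex.I)
  have hper : P.γ L = P.γ 0 := by simpa using P.periodic 0
  have zper : z L = z 0 := by simp only [z, hper]
  set c : ℂ := (L : ℂ)⁻¹ * ∫ s in (0 : ℝ)..L, z s
  have hLc : (L : ℂ) ≠ 0 := by exact_mod_cast hL.ne'
  have hw := wirtinger hL (f := fun s => z s - c) (f' := z') (fun s => (hz s).sub_const c) cz'
    (by rw [zper]) (by
      rw [intervalIntegral.integral_sub (cz.intervalIntegrable _ _) (by simp)]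
      simp only [intervalIntegral.integral_const, sub_zero, Complex.real_smul, c]
      field_simp
      simp)
  have hz'1 : ∀ s, ‖z' s‖ ^ 2 = 1 := fun s => by
    rw [nsq, ← P.unit_speed s]; simp [z', esq]
  have hI1 : (∫ s in (0 : ℝ)..L, ‖z' s‖ ^ 2) = L := by simp [hz'1]
  rw [hI1] at hw
  have hintg : (∫ s in (0 : ℝ)..L, z' s) = 0 := by
    rw [intervalIntegral.integral_eq_sub_of_hasDerivAt (fun s _ => hz s)
      (cz'.intervalIntegrable _ _), zper, sub_self]
  have hdet : ∀ s, ((P.γ s).1 * (deriv P.γ s).2 - (P.γ s).2 * (deriv P.γ s).1) =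
      (starRingEnd ℂ (z s - c) * z' s).im + (starRingEnd ℂ c * z' s).im := fun s => by
    simp [z, z']; ring
  have hzero : (∫ s in (0 : ℝ)..L, (starRingEnd ℂ c * z' s).im) = 0 := by
    have := Complex.imCLM.intervalIntegral_comp_comm
      ((cz'.const_mul (starRingEnd ℂ c)).intervalIntegrable (μ := volume) 0 L)
    simp only [Complex.imCLM_apply] at this
    rw [this, intervalIntegral.integral_const_mul, hintg]; simp
  have harea : P.area = (1 / 2) * ∫ s in (0 : ℝ)..L, (starRingEnd ℂ (z s - c) * z' s).im := by
    unfold area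
    simp only [hdet]
    rw [intervalIntegral.integral_add, hzero, add_zero]
    · exact (Complex.continuous_im.comp ((Complex.continuous_conj.comp
        (cz.sub continuous_const)).mul cz')).intervalIntegrable _ _
    · exact (Complex.continuous_im.comp (continuous_const.mul cz')).intervalIntegrable _ _
  have hb : |∫ s in (0 : ℝ)..L, (starRingEnd ℂ (z s - c) * z' s).im| ≤
      ∫ s in (0 : ℝ)..L, (Real.pi / L * ‖z s - c‖ ^ 2 + L / (4 * Real.pi)) := by
    refine (intervalIntegral.abs_integral_le_integral_abs hL.le).trans ?_
    refine intervalIntegral.integral_mono_on hL.le ?_ ?_ fun s _ => ?_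
    · exact (Complex.continuous_im.comp ((Complex.continuous_conj.comp
        (cz.sub continuous_const)).mul cz')).abs.intervalIntegrable _ _
    · exact (((cz.sub continuous_const).norm.pow 2).const_mul _ |>.add
        continuous_const).intervalIntegrable _ _
    · have h1 : |(starRingEnd ℂ (z s - c) * z' s).im| ≤ ‖z s - c‖ := by
        refine (Complex.abs_im_le_norm _).trans_eq ?_
        have : ‖z' s‖ = 1 := by
          have h2 := hz'1 s
          nlinarith [norm_nonneg (z' s)]
        rw [norm_mul, this, RCLike.norm_conj, mul_one]
      refine h1.trans ?_
      have : Real.pi / L * ‖z s - c‖ ^ 2 + L / (4 * Real.pi) - ‖z s - c‖ =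
        Real.pi / L * (‖z s - c‖ - L / (2 * Real.pi)) ^ 2 := by
        field_simp; ring
      have h2 : 0 ≤ Real.pi / L * (‖z s - c‖ - L / (2 * Real.pi)) ^ 2 := by positivity
      linarith
  rw [intervalIntegral.integral_add, intervalIntegral.integral_const_mul,
    intervalIntegral.integral_const, sub_zero, smul_eq_mul] at hb
  · rw [harea, abs_mul, abs_of_nonneg (by norm_num : (0 : ℝ) ≤ 1 / 2)]
    have h3 : Real.pi / L * (∫ s in (0 : ℝ)..L, ‖z s - c‖ ^ 2) ≤ L ^ 2 / (4 * Real.pi) := by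
      have := mul_le_mul_of_nonneg_left hw (by positivity : 0 ≤ L / (4 * Real.pi))
      refine le_trans (le_of_eq ?_) (this.trans_eq (by ring))
      field_simp
      ring
    have h4 : L * (L / (4 * Real.pi)) = L ^ 2 / (4 * Real.pi) := by ring
    linarith
  · exact ((cz.sub continuous_const).norm.pow 2).const_mul _ |>.intervalIntegrable _ _
  · exact intervalIntegrable_const

end BoundaryParam

end SC

namespace SC

/-! ### Tubular coordinates near the boundary -/

namespace BoundaryParam

variable {Ω : Set Plane} (P : BoundaryParam Ω)

/-- Unit tangent. -/
abbrev tau (s : ℝ) : Plane := deriv P.γ s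

/-- Inward normal. -/
abbrev nu (s : ℝ) : Plane := nuVec P.γ s

/-- Curvature. -/
abbrev kap (s : ℝ) : ℝ := curvOf P.γ s

lemma contDiff_tau : ContDiff ℝ (⊤ : ℕ∞) P.tau := P.contDiff_deriv

lemma contDiff_nu : ContDiff ℝ (⊤ : ℕ∞) P.nu := by
  have := P.contDiff_tau
  unfold nu nuVec
  exact (contDiff_snd.comp this).neg.prodMk (contDiff_fst.comp this)

lemma contDiff_tau' : ContDiff ℝ (⊤ : ℕ∞) (deriv P.tau) :=
  (contDiff_infty_iff_deriv.1 P.contDiff_tau).2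

lemma contDiff_kap : ContDiff ℝ (⊤ : ℕ∞) P.kap := by
  have h1 := P.contDiff_tau'
  have h2 := P.contDiff_nu
  unfold kap curvOf dot2
  exact ((contDiff_fst.comp h1).mul (contDiff_fst.comp h2)).add
    ((contDiff_snd.comp h1).mul (contDiff_snd.comp h2))

lemma hasDerivAt_tau_aux (s : ℝ) : HasDerivAt P.tau (deriv P.tau s) s :=
  ((P.contDiff_tau.differentiable (by norm_num)) s).hasDerivAt

lemma tau_sq (s : ℝ) : (P.tau s).1 ^ 2 + (P.tau s).2 ^ 2 = 1 := P.unit_speed s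

lemma tau_deriv (s : ℝ) : deriv P.tau s = P.kap s • P.nu s := by
  have h := P.hasDerivAt_tau_aux s
  have h1 : HasDerivAt (fun s => (P.tau s).1) (deriv P.tau s).1 s :=
    (hasFDerivAt_fst (𝕜 := ℝ) (p := P.tau s)).comp_hasDerivAt s h
  have h2 : HasDerivAt (fun s => (P.tau s).2) (deriv P.tau s).2 s :=
    (hasFDerivAt_snd (𝕜 := ℝ) (p := P.tau s)).comp_hasDerivAt s h
  have h3 := (h1.pow 2).add (h2.pow 2)
  have h4 : ((fun s => (P.tau s).1) ^ 2 + (fun s => (P.tau s).2) ^ 2) = fun _ => (1 : ℝ) :=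
    funext fun s => P.tau_sq s
  rw [h4] at h3
  have h5 := h3.unique (hasDerivAt_const s 1)
  have h6 := P.tau_sq s
  simp only [Nat.cast_ofNat, Nat.add_one_sub_one, pow_one] at h5
  have e : P.kap s = (deriv P.tau s).1 * (-(P.tau s).2) + (deriv P.tau s).2 * (P.tau s).1 := rfl
  ext
  · change _ = P.kap s * (-(P.tau s).2)
    rw [e]; linear_combination (-(deriv P.tau s).1) * h6 + (P.tau s).1 / 2 * h5
  · change _ = P.kap s * (P.tau s).1
    rw [e]; linear_combination (-(deriv P.tau s).2) * h6 + (P.tau s).2 / 2 * h5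

lemma hasDerivAt_tau (s : ℝ) : HasDerivAt P.tau (P.kap s • P.nu s) s := by
  rw [← tau_deriv]; exact P.hasDerivAt_tau_aux s

lemma hasDerivAt_nu (s : ℝ) : HasDerivAt P.nu (-(P.kap s) • P.tau s) s := by
  have h := P.hasDerivAt_tau s
  have h1 : HasDerivAt (fun s => (P.tau s).1) (P.kap s • P.nu s).1 s :=
    (hasFDerivAt_fst (𝕜 := ℝ) (p := P.tau s)).comp_hasDerivAt s h
  have h2 : HasDerivAt (fun s => (P.tau s).2) (P.kap s • P.nu s).2 s :=
    (hasFDerivAt_snd (𝕜 := ℝ) (p := P.tau s)).comp_hasDerivAt s h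
  refine (h2.neg.prodMk h1).congr_deriv ?_
  refine Prod.ext ?_ ?_ <;> simp [nuVec, tau]

lemma tau_per : Function.Periodic P.tau P.L := fun s => by
  have : P.γ = fun s => P.γ (s + P.L) := funext fun s => (P.periodic s).symm
  unfold tau
  conv_rhs => rw [this]
  rw [deriv_comp_add_const]

lemma nu_per : Function.Periodic P.nu P.L := fun s => by
  have := P.tau_per s
  unfold tau at this
  simp [nu, nuVec, this]

lemma kap_per : Function.Periodic P.kap P.L := fun s => by
  have h : P.tau = fun s => P.tau (s + P.L) := funext fun s => (P.tau_per s).symm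
  have h2 : deriv P.tau (s + P.L) = deriv P.tau s := by
    conv_rhs => rw [h]
    rw [deriv_comp_add_const]
  have h3 := P.nu_per s
  unfold nu at h3
  simp only [kap, curvOf]
  rw [h3, show deriv (deriv P.γ) = deriv P.tau from rfl, h2]

/-- Tubular coordinates `(s,t) ↦ γ(s) + t ν(s)`. -/
def Psi (p : ℝ × ℝ) : Plane := P.γ p.1 + p.2 • P.nu p.1

lemma Psi_zero (s : ℝ) : P.Psi (s, 0) = P.γ s := by simp [Psi]

lemma contDiff_Psi : ContDiff ℝ (⊤ : ℕ∞) P.Psi := by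
  unfold Psi
  exact (P.smooth.comp contDiff_fst).add (contDiff_snd.smul (P.contDiff_nu.comp contDiff_fst))

lemma continuous_Psi : Continuous P.Psi := P.contDiff_Psi.continuous

lemma Psi_per (s t : ℝ) (n : ℤ) : P.Psi (s + n * P.L, t) = P.Psi (s, t) := by
  have h1 : P.γ (s + n * P.L) = P.γ s := by simpa using (P.periodic.int_mul n) s
  have h2 : P.nu (s + n * P.L) = P.nu s := by simpa using (P.nu_per.int_mul n) s
  simp [Psi, h1, h2]

/-- The derivative of the tubular coordinates. -/
def DPsi (p : ℝ × ℝ) : ℝ × ℝ →L[ℝ] Plane :=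
  ((ContinuousLinearMap.fst ℝ ℝ ℝ).smulRight ((1 - p.2 * P.kap p.1) • P.tau p.1)) +
    (ContinuousLinearMap.snd ℝ ℝ ℝ).smulRight (P.nu p.1)

lemma DPsi_apply (p v : ℝ × ℝ) :
    P.DPsi p v = v.1 • ((1 - p.2 * P.kap p.1) • P.tau p.1) + v.2 • P.nu p.1 := rfl

lemma hasFDerivAt_Psi (p : ℝ × ℝ) : HasFDerivAt P.Psi (P.DPsi p) p := by
  have h1 : HasFDerivAt (fun p : ℝ × ℝ => P.γ p.1) _ p :=
    (P.hasDerivAt_γ p.1).hasFDerivAt.comp p (hasFDerivAt_fst (𝕜 := ℝ) (p := p))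
  have h2 : HasFDerivAt (fun p : ℝ × ℝ => P.nu p.1) _ p :=
    (P.hasDerivAt_nu p.1).hasFDerivAt.comp p (hasFDerivAt_fst (𝕜 := ℝ) (p := p))
  have h3 := h1.add ((hasFDerivAt_snd (𝕜 := ℝ) (p := p)).smul h2)
  refine h3.congr_fderiv ?_
  ext <;> simp [DPsi, tau] <;> ring

lemma hasStrictFDerivAt_Psi (p : ℝ × ℝ) : HasStrictFDerivAt P.Psi (P.DPsi p) p := by
  have := P.contDiff_Psi.contDiffAt (x := p)
  exact this.hasStrictFDerivAt' (P.hasFDerivAt_Psi p) (by norm_num)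

lemma det_DPsi (p : ℝ × ℝ) : (P.DPsi p).det = 1 - p.2 * P.kap p.1 := by
  rw [ContinuousLinearMap.det, ← LinearMap.det_toMatrix (Module.Basis.finTwoProd ℝ),
    Matrix.det_fin_two]
  simp [LinearMap.toMatrix_apply, Module.Basis.finTwoProd_zero, Module.Basis.finTwoProd_one, DPsi_apply, nu, nuVec]
  have := P.tau_sq p.1
  unfold tau at this
  linear_combination (1 - p.2 * P.kap p.1) * this

/-- The derivative of the tubular coordinates as an equivalence. -/
def DPsiEquiv (p : ℝ × ℝ) (hp : 1 - p.2 * P.kap p.1 ≠ 0) : (ℝ × ℝ) ≃L[ℝ] Plane :=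
  (P.DPsi p).toContinuousLinearEquivOfDetNeZero (by rwa [det_DPsi])

lemma DPsiEquiv_coe (p : ℝ × ℝ) (hp : 1 - p.2 * P.kap p.1 ≠ 0) :
    (P.DPsiEquiv p hp : ℝ × ℝ →L[ℝ] Plane) = P.DPsi p := by
  ext <;> simp [DPsiEquiv]

lemma hasStrictFDerivAt_Psi' (p : ℝ × ℝ) (hp : 1 - p.2 * P.kap p.1 ≠ 0) :
    HasStrictFDerivAt P.Psi (P.DPsiEquiv p hp : ℝ × ℝ →L[ℝ] Plane) p := by
  rw [DPsiEquiv_coe]; exact P.hasStrictFDerivAt_Psi p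

lemma map_nhds_Psi (p : ℝ × ℝ) (hp : 1 - p.2 * P.kap p.1 ≠ 0) :
    map P.Psi (𝓝 p) = 𝓝 (P.Psi p) :=
  (P.hasStrictFDerivAt_Psi' p hp).map_nhds_eq_of_equiv

/-- Smooth local inverse of the tubular coordinates. -/
lemma exists_local_inverse (p : ℝ × ℝ) (hp : 1 - p.2 * P.kap p.1 ≠ 0) :
    ∃ g : Plane → ℝ × ℝ, ContDiffAt ℝ (⊤ : ℕ∞) g (P.Psi p) ∧ g (P.Psi p) = p ∧
      (∀ᶠ x in 𝓝 (P.Psi p), P.Psi (g x) = x) ∧ ∀ᶠ q in 𝓝 p, g (P.Psi q) = q := by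
  have hs := P.hasStrictFDerivAt_Psi' p hp
  refine ⟨hs.localInverse P.Psi _ _, ?_, hs.localInverse_apply_image, hs.eventually_right_inverse,
    hs.eventually_left_inverse⟩
  exact (P.contDiff_Psi.contDiffAt (x := p)).to_localInverse
    (P.hasStrictFDerivAt_Psi' p hp).hasFDerivAt (by norm_num)

lemma exists_kap_bound : ∃ K > 0, ∀ s, |P.kap s| ≤ K := by
  obtain ⟨C, hC⟩ := (P.kap_per.isBounded_of_continuous P.L_pos.ne'
    P.contDiff_kap.continuous).exists_norm_le
  refine ⟨max C 1, by positivity, fun s => ?_⟩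
  exact (hC _ (mem_range_self s)).trans (le_max_left _ _)

end BoundaryParam

end SC

namespace SC

lemma inter_frontier_nonempty_of_isPreconnected {Ω T : Set Plane} (ho : IsOpen Ω)
    (hT : IsPreconnected T) (h1 : (T ∩ Ω).Nonempty) (h2 : (T ∩ Ωᶜ).Nonempty) :
    (T ∩ frontier Ω).Nonempty := by
  by_contra hc
  rw [not_nonempty_iff_eq_empty] at hc
  have hsub : T ∩ Ωᶜ ⊆ (closure Ω)ᶜ := by
    rintro x ⟨hx, hxo⟩ hcl
    have : x ∈ T ∩ frontier Ω := ⟨hx, by rw [ho.frontier_eq]; exact ⟨hcl, hxo⟩⟩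
    rw [hc] at this; exact this
  obtain ⟨x, -, hx1, hx2⟩ := hT Ω (closure Ω)ᶜ ho isClosed_closure.isOpen_compl
    (fun x hx => by
      by_cases h : x ∈ Ω
      · exact Or.inl h
      · exact Or.inr (hsub ⟨hx, h⟩)) h1
    (h2.mono fun x hx => ⟨hx.1, hsub hx⟩)
  exact hx2 (subset_closure hx1)

namespace BoundaryParam

variable {Ω : Set Plane} (P : BoundaryParam Ω)

/-- `t₀` is an admissible width for the tubular neighbourhood of the boundary. -/
structure Collar (t₀ : ℝ) : Prop where
  pos : 0 < t₀
  curv : ∀ s, |P.kap s| * t₀ ≤ 1 / 2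
  inj : ∀ s t s' t', |t| < t₀ → |t'| < t₀ → P.Psi (s, t) = P.Psi (s', t') →
    t = t' ∧ ∃ n : ℤ, s' = s + n * P.L
  inside : ∀ s t, 0 < t → t < t₀ → P.Psi (s, t) ∈ Ω
  outside : ∀ s t, -t₀ < t → t ≤ 0 → P.Psi (s, t) ∉ Ω

lemma gamma_eq {s s' : ℝ} (h : P.γ s = P.γ s') : ∃ n : ℤ, s' = s + n * P.L := by
  have hm : ∀ s, P.γ (toIcoMod P.L_pos 0 s) = P.γ s := fun s => by
    rw [← self_sub_toIcoDiv_zsmul, P.periodic.sub_zsmul_eq]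
  have h1 := P.injOn (toIcoMod_mem_Ico' P.L_pos s) (toIcoMod_mem_Ico' P.L_pos s')
    (by rw [hm, hm, h])
  rw [← self_sub_toIcoDiv_zsmul, ← self_sub_toIcoDiv_zsmul] at h1
  refine ⟨toIcoDiv P.L_pos 0 s' - toIcoDiv P.L_pos 0 s, ?_⟩
  simp only [zsmul_eq_mul] at h1
  push_cast
  linarith

lemma exists_inj : ∃ t₀ > 0, ∀ s t s' t', |t| < t₀ → |t'| < t₀ → P.Psi (s, t) = P.Psi (s', t') →
    t = t' ∧ ∃ n : ℤ, s' = s + n * P.L := by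
  have hL := P.L_pos
  have hK : IsCompact (Icc (0 : ℝ) P.L ×ˢ Icc (-(P.L / 2)) (P.L / 2)) :=
    isCompact_Icc.prod isCompact_Icc
  have key : ∀ x ∈ Icc (0 : ℝ) P.L ×ˢ Icc (-(P.L / 2)) (P.L / 2),
      ∀ᶠ z : (ℝ × ℝ) × (ℝ × ℝ) in 𝓝 ((0 : ℝ × ℝ), x),
        P.Psi (z.2.1, z.1.1) = P.Psi (z.2.1 + z.2.2, z.1.2) → z.1.1 = z.1.2 ∧ z.2.2 = 0 := by
    rintro ⟨s, d⟩ ⟨-, hd⟩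
    have c1 : Continuous fun z : (ℝ × ℝ) × (ℝ × ℝ) => (z.2.1, z.1.1) := by fun_prop
    have c2 : Continuous fun z : (ℝ × ℝ) × (ℝ × ℝ) => (z.2.1 + z.2.2, z.1.2) := by fun_prop
    by_cases h0 : d = 0
    · subst h0
      obtain ⟨g, -, -, -, hg⟩ := P.exists_local_inverse (s, 0) (by simp)
      have e1 := c1.tendsto ((0 : ℝ × ℝ), (s, (0 : ℝ)))
      have e2 := c2.tendsto ((0 : ℝ × ℝ), (s, (0 : ℝ)))
      simp only [Prod.fst_zero, Prod.snd_zero, add_zero] at e1 e2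
      filter_upwards [e1.eventually hg, e2.eventually hg] with z h1 h2 h
      rw [h, h2] at h1
      simp only [Prod.mk.injEq, add_eq_left] at h1
      exact ⟨h1.2.symm, h1.1⟩
    · have hne : P.Psi (s, 0) ≠ P.Psi (s + d, 0) := by
        rw [Psi_zero, Psi_zero]
        intro h
        obtain ⟨n, hn⟩ := P.gamma_eq h
        have hdn : d = n * P.L := by linarith
        rw [hdn] at hd h0
        have h1 : (n : ℝ) < 1 := by
          by_contra hc; push Not at hc; nlinarith [hd.2]
        have h2 : (-1 : ℝ) < n := by
          by_contra hc; push Not at hc; nlinarith [hd.1]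
        have h3 : n < 1 := by exact_mod_cast h1
        have h4 : -1 < n := by exact_mod_cast h2
        have : n = 0 := by omega
        simp [this] at h0
      have e1 : ContinuousAt (fun z : (ℝ × ℝ) × (ℝ × ℝ) => P.Psi (z.2.1, z.1.1))
        ((0 : ℝ × ℝ), (s, d)) := (P.continuous_Psi.comp c1).continuousAt
      have e2 : ContinuousAt (fun z : (ℝ × ℝ) × (ℝ × ℝ) => P.Psi (z.2.1 + z.2.2, z.1.2))
        ((0 : ℝ × ℝ), (s, d)) := (P.continuous_Psi.comp c2).continuousAt
      filter_upwards [(e1.ne_iff_eventually_ne e2).1 (by simpa using hne)] with z hz h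
      exact absurd h hz
  have := hK.eventually_forall_of_forall_eventually (P := fun (z x : ℝ × ℝ) =>
    P.Psi (x.1, z.1) = P.Psi (x.1 + x.2, z.2) → z.1 = z.2 ∧ x.2 = 0) key
  rw [Metric.eventually_nhds_iff] at this
  obtain ⟨r, hr, H⟩ := this
  refine ⟨r, hr, ?_⟩
  intro s t s' t' ht ht' h
  obtain ⟨m, hm⟩ : ∃ m : ℤ, s - m * P.L ∈ Icc 0 P.L := by
    refine ⟨⌊s / P.L⌋, ?_, ?_⟩
    · have := Int.floor_le (s / P.L); rw [le_div_iff₀ hL] at this; linarith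
    · have := Int.lt_floor_add_one (s / P.L); rw [div_lt_iff₀ hL] at this; linarith
  obtain ⟨n, hn⟩ : ∃ n : ℤ, s' - s - n * P.L ∈ Icc (-(P.L / 2)) (P.L / 2) := by
    refine ⟨⌊(s' - s) / P.L + 1 / 2⌋, ?_, ?_⟩
    · have := Int.floor_le ((s' - s) / P.L + 1 / 2)
      rw [← sub_le_iff_le_add, le_div_iff₀ hL] at this; linarith
    · have := Int.lt_floor_add_one ((s' - s) / P.L + 1 / 2)
      rw [← lt_sub_iff_add_lt, div_lt_iff₀ hL] at this; linarith
  have h2 := H (y := (t, t')) (by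
    rw [dist_zero_right, Prod.norm_def]; exact max_lt ht ht') (s - m * P.L, s' - s - n * P.L)
    ⟨hm, hn⟩ (by
      have e1 := P.Psi_per s t (-m)
      have e2 := P.Psi_per s' t' (-m - n)
      push_cast at e1 e2
      rw [show s - m * P.L = s + -(m : ℝ) * P.L by ring, e1,
        show s + -(m : ℝ) * P.L + (s' - s - n * P.L) = s' + (-(m : ℝ) - n) * P.L by ring, e2, h])
  exact ⟨h2.1, n, by linarith [h2.2]⟩

lemma bdry_not_mem (ho : IsOpen Ω) (s : ℝ) : P.γ s ∉ Ω := by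
  have h : P.γ s ∈ frontier Ω := by rw [← P.range_eq]; exact mem_range_self s
  rw [ho.frontier_eq] at h
  exact h.2

theorem exists_collar (ho : IsOpen Ω) (hb : Bornology.IsBounded Ω) : ∃ t₀, P.Collar t₀ := by
  obtain ⟨K, hK, hKb⟩ := P.exists_kap_bound
  obtain ⟨t₁, ht₁, hinj⟩ := P.exists_inj
  set t₀ := min t₁ (1 / (2 * K))
  have ht₀ : 0 < t₀ := lt_min ht₁ (by positivity)
  have hle : t₀ ≤ t₁ := min_le_left _ _
  have hcurv : ∀ s, |P.kap s| * t₀ ≤ 1 / 2 := fun s => by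
    calc |P.kap s| * t₀ ≤ K * (1 / (2 * K)) :=
          mul_le_mul (hKb s) (min_le_right _ _) ht₀.le hK.le
      _ = 1 / 2 := by field_simp
  have hjac : ∀ s t, |t| < t₀ → 1 - t * P.kap s ≠ 0 := fun s t ht => by
    have h1 : |t * P.kap s| ≤ 1 / 2 := by
      rw [abs_mul, mul_comm]
      exact (mul_le_mul_of_nonneg_left ht.le (abs_nonneg _)).trans (hcurv s)
    have := (abs_le.1 h1).2
    intro h; linarith
  have hdis : ∀ s t, |t| < t₀ → t ≠ 0 → P.Psi (s, t) ∉ frontier Ω := by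
    intro s t ht h0 h
    rw [← P.range_eq] at h
    obtain ⟨s', hs'⟩ := h
    rw [← Psi_zero] at hs'
    exact h0 (hinj s' 0 s t (by simpa using ht₁) (ht.trans_le hle) hs').1.symm
  have hne : Ω.Nonempty := by
    obtain ⟨ε, hε, h⟩ := P.inward 0
    exact ⟨_, h (ε / 2) ⟨by linarith, by linarith⟩⟩
  have hpc : ∀ a b : ℝ, IsPreconnected (P.Psi '' (univ ×ˢ Ioo a b)) := fun a b =>
    (isPreconnected_univ.prod isPreconnected_Ioo).image _ P.continuous_Psi.continuousOn
  have hin : ∀ s t, 0 < t → t < t₀ → P.Psi (s, t) ∈ Ω := by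
    intro s t h0 h1
    by_contra hc
    obtain ⟨ε, hε, h⟩ := P.inward 0
    have hmin : 0 < min (ε / 2) (t₀ / 2) := lt_min (by linarith) (by linarith)
    have hfr := (inter_frontier_nonempty_of_isPreconnected ho (hpc 0 t₀))
      ⟨P.Psi (0, min (ε / 2) (t₀ / 2)), ⟨_, ⟨mem_univ _, hmin,
          (min_le_right _ _).trans_lt (by linarith)⟩, rfl⟩,
        h _ ⟨hmin, (min_le_left _ _).trans_lt (by linarith)⟩⟩
      ⟨P.Psi (s, t), ⟨_, ⟨mem_univ _, h0, h1⟩, rfl⟩, hc⟩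
    obtain ⟨_, ⟨⟨s', t'⟩, hy, rfl⟩, hx⟩ := hfr
    exact hdis s' t' (by rw [abs_of_pos hy.2.1]; exact hy.2.2) hy.2.1.ne' hx
  have hW : ∀ s t, |t| < t₀ → (∀ s t, |t| < t₀ → P.Psi (s, t) ∈ closure Ω) →
      closure Ω ∈ 𝓝 (P.Psi (s, t)) := by
    intro s t ht hall
    rw [← P.map_nhds_Psi (s, t) (hjac s t ht)]
    refine mem_of_superset (image_mem_map ((isOpen_univ.prod (isOpen_lt
      (continuous_abs) continuous_const)).mem_nhds (⟨mem_univ s, ht⟩ :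
        (s, t) ∈ (univ : Set ℝ) ×ˢ {t : ℝ | |t| < t₀}))) ?_
    rintro _ ⟨⟨s', t'⟩, h', rfl⟩
    exact hall s' t' h'.2
  have hout : ∀ s t, -t₀ < t → t ≤ 0 → P.Psi (s, t) ∉ Ω := by
    intro s t h0 h1 hc
    rcases h1.eq_or_lt with rfl | h1
    · rw [Psi_zero] at hc; exact P.bdry_not_mem ho s hc
    have hall : ∀ s t, -t₀ < t → t < 0 → P.Psi (s, t) ∈ Ω := by
      intro s₁ t₁ h2 h3
      by_contra hc'
      obtain ⟨_, ⟨⟨s', t'⟩, hy, rfl⟩, hx⟩ := inter_frontier_nonempty_of_isPreconnected ho (hpc (-t₀) 0)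
        ⟨_, ⟨(s, t), ⟨mem_univ _, h0, h1⟩, rfl⟩, hc⟩
        ⟨_, ⟨(s₁, t₁), ⟨mem_univ _, h2, h3⟩, rfl⟩, hc'⟩
      exact hdis s' t' (by rw [abs_of_neg hy.2.2]; linarith [hy.2.1]) hy.2.2.ne hx
    have hall' : ∀ s t, |t| < t₀ → P.Psi (s, t) ∈ closure Ω := by
      intro s t ht
      rcases lt_trichotomy t 0 with h | rfl | h
      · exact subset_closure (hall s t (abs_lt.1 ht).1 h)
      · rw [Psi_zero]
        have : P.γ s ∈ frontier Ω := by rw [← P.range_eq]; exact mem_range_self s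
        exact frontier_subset_closure this
      · exact subset_closure (hin s t h (abs_lt.1 ht).2)
    have hop : IsOpen (closure Ω) := by
      rw [isOpen_iff_mem_nhds]
      intro x hx
      by_cases hxo : x ∈ Ω
      · exact mem_of_superset (ho.mem_nhds hxo) subset_closure
      · have : x ∈ frontier Ω := by rw [ho.frontier_eq]; exact ⟨hx, hxo⟩
        rw [← P.range_eq] at this
        obtain ⟨s', rfl⟩ := this
        rw [← Psi_zero]
        exact hW s' 0 (by simpa using ht₀) hall'
    have huniv : closure Ω = univ := IsClopen.eq_univ ⟨isClosed_closure, hop⟩ hne.closure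
    have := hb.closure
    rw [huniv] at this
    exact NormedSpace.unbounded_univ ℝ Plane this
  exact ⟨t₀, ht₀, hcurv, fun s t s' t' h h' => hinj s t s' t' (h.trans_le hle) (h'.trans_le hle),
    hin, hout⟩

end BoundaryParam

end SC

namespace SC

namespace BoundaryParam

variable {Ω : Set Plane} (P : BoundaryParam Ω) {E : Type*} [NormedAddCommGroup E] [NormedSpace ℝ E]

/-- Periodicity in the tangential variable. -/
def PerS (F : ℝ × ℝ → E) : Prop := ∀ s t, F (s + P.L, t) = F (s, t)

variable {P}

lemma PerS.int {F : ℝ × ℝ → E} (h : P.PerS F) (s t : ℝ) (n : ℤ) :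
    F (s + n * P.L, t) = F (s, t) := by
  have : Function.Periodic (fun s => F (s, t)) P.L := fun s => h s t
  simpa using (this.int_mul n) s

variable (P)

/-- The open two-sided collar. -/
def strip (t₀ : ℝ) : Set (ℝ × ℝ) := {p | |p.2| < t₀}

lemma isOpen_strip (t₀ : ℝ) : IsOpen (strip t₀) :=
  isOpen_lt (continuous_abs.comp continuous_snd) continuous_const

open Classical in
/-- Transport of a function of the tubular coordinates to the plane, extended by zero. -/
def ext (t₀ : ℝ) (F : ℝ × ℝ → E) (x : Plane) : E :=
  if h : ∃ p ∈ strip t₀, P.Psi p = x then F h.choose else 0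

/-- The natural neighbourhood of the closure. -/
def nbhd (t₀ : ℝ) : Set Plane := Ω ∪ P.Psi '' strip t₀

variable {P} {t₀ : ℝ}

lemma ext_of_not {F : ℝ × ℝ → E} {x : Plane} (h : x ∉ P.Psi '' strip t₀) : P.ext t₀ F x = 0 := by
  rw [ext, dif_neg]
  rintro ⟨p, hp, rfl⟩
  exact h ⟨p, hp, rfl⟩

namespace Collar

variable (hc : P.Collar t₀) {F : ℝ × ℝ → E}

include hc

lemma ext_Psi (hF : P.PerS F) {p : ℝ × ℝ} (hp : p ∈ strip t₀) :
    P.ext t₀ F (P.Psi p) = F p := by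
  have h : ∃ q ∈ strip t₀, P.Psi q = P.Psi p := ⟨p, hp, rfl⟩
  rw [ext, dif_pos h]
  obtain ⟨h1, h2⟩ := h.choose_spec
  obtain ⟨e1, n, e2⟩ := hc.inj p.1 p.2 h.choose.1 h.choose.2 hp h1 h2.symm
  rw [← Prod.mk.eta (p := h.choose), e2, ← e1, hF.int]

lemma jac_pos {p : ℝ × ℝ} (hp : p ∈ strip t₀) : 1 / 2 ≤ 1 - p.2 * P.kap p.1 := by
  have h1 : |p.2 * P.kap p.1| ≤ 1 / 2 := by
    rw [abs_mul, mul_comm]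
    exact (mul_le_mul_of_nonneg_left (le_of_lt hp) (abs_nonneg _)).trans (hc.curv p.1)
  linarith [(abs_le.1 h1).2]

lemma jac_ne {p : ℝ × ℝ} (hp : p ∈ strip t₀) : 1 - p.2 * P.kap p.1 ≠ 0 := by
  linarith [hc.jac_pos hp]

lemma isOpen_image {S : Set (ℝ × ℝ)} (hS : IsOpen S) (hs : S ⊆ strip t₀) :
    IsOpen (P.Psi '' S) := by
  rw [isOpen_iff_mem_nhds]
  rintro _ ⟨p, hp, rfl⟩
  rw [← P.map_nhds_Psi p (hc.jac_ne (hs hp))]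
  exact image_mem_map (hS.mem_nhds hp)

lemma isOpen_nbhd (ho : IsOpen Ω) : IsOpen (P.nbhd t₀) :=
  ho.union (hc.isOpen_image (isOpen_strip t₀) le_rfl)

omit hc in
lemma mem_closure_iff (P : BoundaryParam Ω) (ho : IsOpen Ω) {x : Plane} :
    x ∈ closure Ω ↔ x ∈ Ω ∨ ∃ s, P.γ s = x := by
  have : closure Ω = Ω ∪ frontier Ω := closure_eq_self_union_frontier Ω
  rw [this, ← P.range_eq]; rfl

lemma closure_subset_nbhd (ho : IsOpen Ω) : closure Ω ⊆ P.nbhd t₀ := by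
  intro x hx
  rcases (mem_closure_iff P ho).1 hx with h | ⟨s, rfl⟩
  · exact Or.inl h
  · refine Or.inr ⟨(s, 0), ?_, P.Psi_zero s⟩
    simpa [strip] using hc.pos

lemma Psi_mem_iff {p : ℝ × ℝ} (hp : p ∈ strip t₀) : P.Psi p ∈ Ω ↔ 0 < p.2 := by
  constructor
  · intro h
    by_contra h0
    exact hc.outside p.1 p.2 (abs_lt.1 hp).1 (not_lt.1 h0) h
  · intro h; exact hc.inside p.1 p.2 h (abs_lt.1 hp).2

lemma Psi_mem_closure (ho : IsOpen Ω) {p : ℝ × ℝ} (hp : p ∈ strip t₀) (h0 : 0 ≤ p.2) :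
    P.Psi p ∈ closure Ω := by
  rcases h0.eq_or_lt with h | h
  · refine (mem_closure_iff P ho).2 (Or.inr ⟨p.1, ?_⟩)
    rw [← P.Psi_zero, h]
  · exact subset_closure ((hc.Psi_mem_iff hp).2 h)

/-- Points of the closure outside a thinner closed collar have a neighbourhood (in the natural
neighbourhood of the closure) avoiding that collar. -/
lemma eventually_avoid (ho : IsOpen Ω) {c : ℝ} (hct : c < t₀) {x : Plane} (hx : x ∈ Ω)
    (hx' : ∀ s t, |t| < t₀ → t ≤ c → P.Psi (s, t) ≠ x) :
    ∀ᶠ y in 𝓝 x, ∀ s t, |t| < t₀ → t ≤ c → P.Psi (s, t) ≠ y := by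
  have hK : IsCompact (P.Psi '' (Icc 0 P.L ×ˢ Icc 0 c)) :=
    (isCompact_Icc.prod isCompact_Icc).image P.continuous_Psi
  have hL := P.L_pos
  have hnx : x ∈ (P.Psi '' (Icc 0 P.L ×ˢ Icc 0 c))ᶜ := by
    rintro ⟨⟨s, t⟩, ⟨-, h1, h2⟩, h3⟩
    exact hx' s t (by rw [abs_of_nonneg h1]; exact h2.trans_lt hct) h2 h3
  filter_upwards [hK.isClosed.isOpen_compl.mem_nhds hnx, ho.mem_nhds hx] with y hy hyo s t h1 h2 h3
  rw [← h3] at hyo hy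
  have h4 := (hc.Psi_mem_iff (p := (s, t)) h1).1 hyo
  refine hy ⟨(s - ⌊s / P.L⌋ * P.L, t), ⟨⟨?_, ?_⟩, h4.le, h2⟩, ?_⟩
  · have := Int.floor_le (s / P.L); rw [le_div_iff₀ hL] at this; simpa using by linarith
  · have := Int.lt_floor_add_one (s / P.L); rw [div_lt_iff₀ hL] at this
    simp only; linarith
  · have := P.Psi_per s t (-⌊s / P.L⌋)
    push_cast at this
    rw [← this]; congr 2; ring

lemma ext_eventually_zero (ho : IsOpen Ω) (hF : P.PerS F) {c : ℝ} (hct : c < t₀)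
    (hz : ∀ s t, c ≤ t → F (s, t) = 0) {x : Plane} (hx : x ∈ Ω)
    (hx' : ∀ s t, |t| < t₀ → t ≤ c → P.Psi (s, t) ≠ x) :
    P.ext t₀ F =ᶠ[𝓝 x] fun _ => 0 := by
  filter_upwards [hc.eventually_avoid ho hct hx hx'] with y hy
  by_cases h : y ∈ P.Psi '' strip t₀
  · obtain ⟨⟨s, t⟩, hp, rfl⟩ := h
    rw [hc.ext_Psi hF hp]
    refine hz s t ?_
    by_contra hlt
    exact hy s t hp (le_of_lt (not_le.1 hlt)) rfl
  · exact ext_of_not h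

lemma ext_comp_eventuallyEq (hF : P.PerS F) {p : ℝ × ℝ} (hp : p ∈ strip t₀) :
    (fun q => P.ext t₀ F (P.Psi q)) =ᶠ[𝓝 p] F := by
  filter_upwards [(isOpen_strip t₀).mem_nhds hp] with q hq
  exact hc.ext_Psi hF hq

lemma contDiffAt_ext_Psi {n : ℕ∞} (hF : P.PerS F) {p : ℝ × ℝ} (hs : ContDiffAt ℝ n F p)
    (hp : p ∈ strip t₀) : ContDiffAt ℝ n (P.ext t₀ F) (P.Psi p) := by
  obtain ⟨g, hg, hgp, h1, -⟩ := P.exists_local_inverse p (hc.jac_ne hp)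
  have hcomp : ContDiffAt ℝ n (fun x => F (g x)) (P.Psi p) :=
    ContDiffAt.comp _ (by rwa [hgp]) (hg.of_le (by exact_mod_cast le_top))
  refine hcomp.congr_of_eventuallyEq ?_
  have h2 : ∀ᶠ x in 𝓝 (P.Psi p), g x ∈ strip t₀ :=
    hg.continuousAt.eventually ((isOpen_strip t₀).mem_nhds (by rwa [hgp]))
  filter_upwards [h1, h2] with x hx hx2
  conv_lhs => rw [← hx]
  exact hc.ext_Psi hF hx2

lemma contDiffOn_ext (ho : IsOpen Ω) {n : ℕ∞} (hF : P.PerS F)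
    (hs : ∀ p ∈ strip t₀, ContDiffAt ℝ n F p) {c : ℝ}
    (hct : c < t₀) (hz : ∀ s t, c ≤ t → F (s, t) = 0) :
    ContDiffOn ℝ n (P.ext t₀ F) (P.nbhd t₀) := by
  intro x hx
  refine ContDiffAt.contDiffWithinAt ?_
  by_cases h : x ∈ P.Psi '' strip t₀
  · obtain ⟨p, hp, rfl⟩ := h
    exact hc.contDiffAt_ext_Psi hF (hs p hp) hp
  · have hxo : x ∈ Ω := hx.resolve_right h
    refine contDiffAt_const.congr_of_eventuallyEq (hc.ext_eventually_zero ho hF hct hz hxo ?_)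
    intro s t h1 _ h3
    exact h ⟨(s, t), h1, h3⟩

lemma cNearCl_ext' (ho : IsOpen Ω) {n : ℕ} (hF : P.PerS F)
    (hs : ∀ p ∈ strip t₀, ContDiffAt ℝ n F p) {c : ℝ}
    (hct : c < t₀) (hz : ∀ s t, c ≤ t → F (s, t) = 0) : CNearCl n Ω (P.ext t₀ F) :=
  ⟨_, hc.isOpen_nbhd ho, hc.closure_subset_nbhd ho,
    hc.contDiffOn_ext ho (n := (n : ℕ∞)) hF (by exact_mod_cast hs) hct hz⟩

lemma cNearCl_ext (ho : IsOpen Ω) {n : ℕ} (hF : P.PerS F) (hs : ContDiff ℝ n F) {c : ℝ}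
    (hct : c < t₀) (hz : ∀ s t, c ≤ t → F (s, t) = 0) : CNearCl n Ω (P.ext t₀ F) :=
  hc.cNearCl_ext' ho hF (fun _ _ => hs.contDiffAt) hct hz

lemma fderiv_ext (hF : P.PerS F) (hs : ContDiff ℝ 1 F) {p : ℝ × ℝ} (hp : p ∈ strip t₀)
    (v : ℝ × ℝ) : fderiv ℝ (P.ext t₀ F) (P.Psi p) (P.DPsi p v) = fderiv ℝ F p v := by
  have hd : DifferentiableAt ℝ (P.ext t₀ F) (P.Psi p) :=
    (hc.contDiffAt_ext_Psi (n := 1) hF (by exact_mod_cast hs.contDiffAt) hp).differentiableAt (by norm_num)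
  have h1 := (hd.hasFDerivAt.comp p (P.hasFDerivAt_Psi p)).congr_of_eventuallyEq
    (hc.ext_comp_eventuallyEq hF hp).symm
  rw [h1.fderiv]; rfl

omit hc in
/-- The fundamental cell of the inner collar of width `c`. -/
lemma measurableSet_cell (c : ℝ) :
    MeasurableSet (Ico 0 P.L ×ˢ Ioo (0 : ℝ) c : Set (ℝ × ℝ)) :=
  measurableSet_Ico.prod measurableSet_Ioo

lemma cell_image {c : ℝ} : P.Psi '' (Ico 0 P.L ×ˢ Ioo (0 : ℝ) c) =
    P.Psi '' (univ ×ˢ Ioo (0 : ℝ) c) := by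
  have hL := P.L_pos
  refine Subset.antisymm (image_mono (prod_mono_left (subset_univ _))) ?_
  rintro _ ⟨⟨s, t⟩, ⟨-, ht⟩, rfl⟩
  refine ⟨(s - ⌊s / P.L⌋ * P.L, t), ⟨⟨?_, ?_⟩, ht⟩, ?_⟩
  · have := Int.floor_le (s / P.L); rw [le_div_iff₀ hL] at this; simpa using by linarith
  · have := Int.lt_floor_add_one (s / P.L); rw [div_lt_iff₀ hL] at this
    simp only; linarith
  · have := P.Psi_per s t (-⌊s / P.L⌋)
    push_cast at this
    rw [← this]; congr 2; ring

omit hc in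
lemma cell_subset_strip {c : ℝ} (hct : c ≤ t₀) {p : ℝ × ℝ} (hp : p.2 ∈ Ioo (0 : ℝ) c) :
    p ∈ strip t₀ := by
  change |p.2| < t₀
  rw [abs_of_pos hp.1]; exact hp.2.trans_le hct

lemma injOn_cell {c : ℝ} (hct : c ≤ t₀) : InjOn P.Psi (Ico 0 P.L ×ˢ Ioo (0 : ℝ) c) := by
  rintro ⟨s, t⟩ ⟨⟨h1, h2⟩, h3⟩ ⟨s', t'⟩ ⟨⟨h1', h2'⟩, h3'⟩ h
  obtain ⟨rfl, n, hn⟩ := hc.inj s t s' t' (cell_subset_strip hct (p := (s, t)) h3)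
    (cell_subset_strip hct (p := (s', t')) h3') h
  have hL := P.L_pos
  simp only at h1 h2 h1' h2'
  have a1 : (n : ℝ) < 1 := by by_contra hh; push Not at hh; nlinarith
  have a2 : (-1 : ℝ) < n := by by_contra hh; push Not at hh; nlinarith
  have a3 : n < 1 := by exact_mod_cast a1
  have a4 : -1 < n := by exact_mod_cast a2
  have : n = 0 := by omega
  subst this
  simp [hn]

/-- The inner collar of width `c`. -/
lemma isOpen_inner {c : ℝ} (hct : c ≤ t₀) : IsOpen (P.Psi '' (univ ×ˢ Ioo (0 : ℝ) c)) :=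
  hc.isOpen_image (isOpen_univ.prod isOpen_Ioo) fun _ hp => cell_subset_strip hct hp.2

lemma inner_subset {c : ℝ} (hct : c ≤ t₀) : P.Psi '' (univ ×ˢ Ioo (0 : ℝ) c) ⊆ Ω := by
  rintro _ ⟨p, hp, rfl⟩
  exact hc.inside p.1 p.2 hp.2.1 (hp.2.2.trans_le hct)

lemma integral_inner {c : ℝ} (hct : c ≤ t₀) (f : Plane → E) :
    (∫ x in P.Psi '' (univ ×ˢ Ioo (0 : ℝ) c), f x) =
      ∫ p in Ico 0 P.L ×ˢ Ioo (0 : ℝ) c, (1 - p.2 * P.kap p.1) • f (P.Psi p) := by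
  rw [← hc.cell_image, integral_image_eq_integral_abs_det_fderiv_smul volume (measurableSet_cell c)
    (fun p _ => (P.hasFDerivAt_Psi p).hasFDerivWithinAt) (hc.injOn_cell hct)]
  refine setIntegral_congr_fun (measurableSet_cell c) fun p hp => ?_
  rw [det_DPsi, abs_of_pos (by linarith [hc.jac_pos (cell_subset_strip hct hp.2)])]

lemma integrableOn_inner {c : ℝ} (hct : c ≤ t₀) {f : Plane → E} :
    IntegrableOn f (P.Psi '' (univ ×ˢ Ioo (0 : ℝ) c)) ↔
      IntegrableOn (fun p => (1 - p.2 * P.kap p.1) • f (P.Psi p)) (Ico 0 P.L ×ˢ Ioo (0 : ℝ) c) := by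
  rw [← hc.cell_image, integrableOn_image_iff_integrableOn_abs_det_fderiv_smul volume
    (measurableSet_cell c)
    (fun p _ => (P.hasFDerivAt_Psi p).hasFDerivWithinAt) (hc.injOn_cell hct)]
  refine integrableOn_congr_fun (fun p hp => ?_) (measurableSet_cell c)
  rw [det_DPsi, abs_of_pos (by linarith [hc.jac_pos (cell_subset_strip hct hp.2)])]

end Collar

end BoundaryParam

end SC

namespace SC

lemma exists_step_deriv_bound : ∃ C > 0, ∀ y, |deriv Real.smoothTransition y| ≤ C := by
  have hc : Continuous (deriv Real.smoothTransition) :=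
    (Real.smoothTransition.contDiff (n := 1)).continuous_deriv (by norm_num)
  obtain ⟨C, hC⟩ := isCompact_Icc.exists_bound_of_continuousOn (s := Icc (0 : ℝ) 1) hc.continuousOn
  refine ⟨max C 1, by positivity, fun y => ?_⟩
  by_cases h : y ∈ Icc (0 : ℝ) 1
  · exact (hC y h).trans (le_max_left _ _)
  · have : deriv Real.smoothTransition y = 0 := by
      rcases lt_or_ge y 0 with h0 | h0
      · have : Real.smoothTransition =ᶠ[𝓝 y] fun _ => 0 := by
          filter_upwards [Iio_mem_nhds h0] with z hz
          exact Real.smoothTransition.zero_of_nonpos (le_of_lt hz)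
        rw [this.deriv_eq]; simp
      · have h1 : 1 < y := by by_contra h1; exact h ⟨h0, not_lt.1 h1⟩
        have : Real.smoothTransition =ᶠ[𝓝 y] fun _ => 1 := by
          filter_upwards [Ioi_mem_nhds h1] with z hz
          exact Real.smoothTransition.one_of_one_le (le_of_lt hz)
        rw [this.deriv_eq]; simp
    rw [this]; simp

/-- Transition angle, from `0` for `y ≤ c / 2` to `π / 2` for `c ≤ y`. -/
def ang (c y : ℝ) : ℝ := Real.pi / 2 * Real.smoothTransition (2 * y / c - 1)

/-- Cutoff equal to one for `y ≤ c / 2` and to zero for `c ≤ y`. -/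
def xi (c y : ℝ) : ℝ := Real.cos (ang c y)

/-- Complementary cutoff. -/
def eta (c y : ℝ) : ℝ := Real.sin (ang c y)

lemma contDiff_ang (c : ℝ) {n : ℕ∞} : ContDiff ℝ n (ang c) := by
  unfold ang
  exact contDiff_const.mul (Real.smoothTransition.contDiff.comp (by fun_prop))

lemma contDiff_xi (c : ℝ) {n : ℕ∞} : ContDiff ℝ n (xi c) := (contDiff_ang c).cos

lemma contDiff_eta (c : ℝ) {n : ℕ∞} : ContDiff ℝ n (eta c) := (contDiff_ang c).sin

lemma xi_sq_add (c y : ℝ) : xi c y ^ 2 + eta c y ^ 2 = 1 := Real.cos_sq_add_sin_sq _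

lemma ang_low {c y : ℝ} (hc : 0 < c) (h : y ≤ c / 2) : ang c y = 0 := by
  rw [ang, Real.smoothTransition.zero_of_nonpos, mul_zero]
  rw [sub_nonpos, div_le_one hc]; linarith

lemma ang_high {c y : ℝ} (hc : 0 < c) (h : c ≤ y) : ang c y = Real.pi / 2 := by
  rw [ang, Real.smoothTransition.one_of_one_le, mul_one]
  rw [le_sub_iff_add_le, le_div_iff₀ hc]; linarith

lemma xi_one {c y : ℝ} (hc : 0 < c) (h : y ≤ c / 2) : xi c y = 1 := by simp [xi, ang_low hc h]

lemma eta_zero {c y : ℝ} (hc : 0 < c) (h : y ≤ c / 2) : eta c y = 0 := by simp [eta, ang_low hc h]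

lemma xi_zero {c y : ℝ} (hc : 0 < c) (h : c ≤ y) : xi c y = 0 := by simp [xi, ang_high hc h]

lemma xi_sq_le (c y : ℝ) : xi c y ^ 2 ≤ 1 := by nlinarith [xi_sq_add c y, sq_nonneg (eta c y)]

lemma eta_sq_le (c y : ℝ) : eta c y ^ 2 ≤ 1 := by nlinarith [xi_sq_add c y, sq_nonneg (xi c y)]

lemma exists_cut_deriv_bound : ∃ C > 0, ∀ c > 0, ∀ y,
    deriv (xi c) y ^ 2 + deriv (eta c) y ^ 2 ≤ C / c ^ 2 := by
  obtain ⟨C, hC, h⟩ := exists_step_deriv_bound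
  refine ⟨(Real.pi * C) ^ 2, by positivity, fun c hc y => ?_⟩
  have hd : HasDerivAt (ang c) (Real.pi / 2 *
      (deriv Real.smoothTransition (2 * y / c - 1) * (2 / c))) y := by
    have h1 : HasDerivAt (fun y : ℝ => 2 * y / c - 1) (2 / c) y := by
      simpa using (((hasDerivAt_id y).const_mul 2).div_const c).sub_const 1
    exact ((((Real.smoothTransition.contDiff (n := 1)).differentiable (by norm_num)
      (2 * y / c - 1)).hasDerivAt.comp y h1).const_mul _)
  have e1 : deriv (xi c) y = _ := hd.cos.deriv
  have e2 : deriv (eta c) y = _ := hd.sin.deriv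
  rw [e1, e2]
  set d := deriv Real.smoothTransition (2 * y / c - 1)
  have hd2 : d ^ 2 ≤ C ^ 2 := by rw [← sq_abs d]; gcongr; exact h _
  calc _ = (Real.cos (ang c y) ^ 2 + Real.sin (ang c y) ^ 2) * (Real.pi ^ 2 * d ^ 2 / c ^ 2) := by
        ring
    _ = Real.pi ^ 2 * d ^ 2 / c ^ 2 := by rw [Real.cos_sq_add_sin_sq, one_mul]
    _ ≤ _ := by rw [mul_pow]; gcongr

lemma gsq_comp {g : ℝ → ℝ} {f : Plane → ℝ} {x : Plane} (hg : DifferentiableAt ℝ g (f x))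
    (hf : DifferentiableAt ℝ f x) : gsq (fun y => g (f y)) x = deriv g (f x) ^ 2 * gsq f x := by
  have h := (hg.hasDerivAt.comp_hasFDerivAt x hf.hasFDerivAt).fderiv
  have h' : fderiv ℝ (fun y => g (f y)) x = _ := h
  simp only [gsq, h']
  simp; ring

/-- Profile of the regularised distance. -/
def prof (t₀ t : ℝ) : ℝ :=
  t * (1 - Real.smoothTransition (4 * t / t₀ - 2)) + t₀ * Real.smoothTransition (4 * t / t₀ - 2)

lemma contDiff_prof (t₀ : ℝ) {n : ℕ∞} : ContDiff ℝ n (prof t₀) := by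
  unfold prof
  have : ContDiff ℝ n fun t : ℝ => Real.smoothTransition (4 * t / t₀ - 2) :=
    Real.smoothTransition.contDiff.comp (by fun_prop)
  exact (contDiff_id.mul (contDiff_const.sub this)).add (contDiff_const.mul this)

lemma prof_low {t₀ t : ℝ} (h0 : 0 < t₀) (h : t ≤ t₀ / 2) : prof t₀ t = t := by
  rw [prof, Real.smoothTransition.zero_of_nonpos]; · ring
  rw [sub_nonpos, div_le_iff₀ h0]; linarith

lemma prof_high {t₀ t : ℝ} (h0 : 0 < t₀) (h : 3 * t₀ / 4 ≤ t) : prof t₀ t = t₀ := by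
  rw [prof, Real.smoothTransition.one_of_one_le]; · ring
  rw [le_sub_iff_add_le, le_div_iff₀ h0]; linarith

lemma prof_le {t₀ t : ℝ} (h : t ≤ t₀) : prof t₀ t ≤ t₀ := by
  unfold prof
  have := Real.smoothTransition.le_one (4 * t / t₀ - 2)
  nlinarith

lemma le_prof {t₀ t : ℝ} (h : t ≤ t₀) : t ≤ prof t₀ t := by
  unfold prof
  have := Real.smoothTransition.nonneg (4 * t / t₀ - 2)
  nlinarith

namespace BoundaryParam

variable {Ω : Set Plane} (P : BoundaryParam Ω) {t₀ : ℝ}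

/-- Regularised distance to the boundary. -/
def dst (t₀ : ℝ) (x : Plane) : ℝ := t₀ + P.ext t₀ (fun p => prof t₀ p.2 - t₀) x

variable {P}

namespace Collar

variable (hc : P.Collar t₀)

include hc

lemma cNearCl_dst (ho : IsOpen Ω) (n : ℕ) : CNearCl n Ω (P.dst t₀) := by
  have h0 := hc.pos
  refine CNearCl.add (CNearCl.of_contDiff contDiff_const) (hc.cNearCl_ext ho (fun s t => rfl) ?_
    (c := 3 * t₀ / 4) (by linarith) ?_)
  · exact ((contDiff_prof t₀ (n := n)).comp contDiff_snd).sub contDiff_const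
  · intro s t h; simp [prof_high h0 h]

lemma dst_Psi {p : ℝ × ℝ} (hp : p ∈ strip t₀) : P.dst t₀ (P.Psi p) = prof t₀ p.2 := by
  rw [dst, hc.ext_Psi (fun s t => rfl) hp]; ring

lemma dst_Psi_low {p : ℝ × ℝ} (hp : p ∈ strip t₀) (h : p.2 ≤ t₀ / 2) :
    P.dst t₀ (P.Psi p) = p.2 := by rw [hc.dst_Psi hp, prof_low hc.pos h]

lemma dst_le (x : Plane) : P.dst t₀ x ≤ t₀ := by
  by_cases h : x ∈ P.Psi '' strip t₀
  · obtain ⟨p, hp, rfl⟩ := h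
    rw [hc.dst_Psi hp]; exact prof_le (abs_lt.1 hp).2.le
  · rw [dst, ext_of_not h, add_zero]

lemma dst_pos {x : Plane} (hx : x ∈ Ω) : 0 < P.dst t₀ x := by
  by_cases h : x ∈ P.Psi '' strip t₀
  · obtain ⟨p, hp, rfl⟩ := h
    rw [hc.dst_Psi hp]
    exact ((hc.Psi_mem_iff hp).1 hx).trans_le (le_prof (abs_lt.1 hp).2.le)
  · rw [dst, ext_of_not h, add_zero]; exact hc.pos

lemma mem_inner_of_dst_lt {x : Plane} (hx : x ∈ Ω) {c : ℝ} (hct : c ≤ t₀) (h : P.dst t₀ x < c) :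
    x ∈ P.Psi '' (univ ×ˢ Ioo (0 : ℝ) c) := by
  by_cases h' : x ∈ P.Psi '' strip t₀
  · obtain ⟨p, hp, rfl⟩ := h'
    rw [hc.dst_Psi hp] at h
    exact ⟨p, ⟨mem_univ _, (hc.Psi_mem_iff hp).1 hx,
      (le_prof (abs_lt.1 hp).2.le).trans_lt h⟩, rfl⟩
  · rw [dst, ext_of_not h', add_zero] at h; linarith

lemma exists_gsq_bound (ho : IsOpen Ω) (hb : Bornology.IsBounded Ω) :
    ∃ C > 0, ∀ x ∈ closure Ω, gsq (P.dst t₀) x ≤ C := by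
  obtain ⟨C, hC⟩ := exists_bound_of_continuousOn_closure hb (continuousOn_gsq (hc.cNearCl_dst ho 1))
  refine ⟨max C 1, by positivity, fun x hx => ?_⟩
  exact (le_abs_self _).trans (((Real.norm_eq_abs _).ge.trans (hC.2 x hx)).trans (le_max_left _ _))

/-- Cutoffs built from the regularised distance. -/
lemma cNearCl_comp_dst (ho : IsOpen Ω) {n : ℕ} {g : ℝ → ℝ} (hg : ContDiff ℝ n g) :
    CNearCl n Ω (fun x => g (P.dst t₀ x)) := (hc.cNearCl_dst ho n).map hg

lemma exists_cut_gsq_bound (ho : IsOpen Ω) (hb : Bornology.IsBounded Ω) :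
    ∃ C > 0, ∀ c > 0, ∀ x ∈ closure Ω, gsq (fun y => xi c (P.dst t₀ y)) x +
      gsq (fun y => eta c (P.dst t₀ y)) x ≤ C / c ^ 2 := by
  obtain ⟨C, hC, h⟩ := hc.exists_gsq_bound ho hb
  obtain ⟨D, hD, h'⟩ := exists_cut_deriv_bound
  refine ⟨D * C, by positivity, fun c hc0 x hx => ?_⟩
  have hd := (hc.cNearCl_dst ho 1).differentiableAt hx
  rw [gsq_comp ((contDiff_xi c (n := 1)).differentiable (by norm_num) _) hd,
    gsq_comp ((contDiff_eta c (n := 1)).differentiable (by norm_num) _) hd, ← add_mul,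
    mul_div_right_comm]
  have := h' c hc0 (P.dst t₀ x)
  gcongr
  · exact gsq_nonneg _ _
  · exact h x hx

end Collar

end BoundaryParam

end SC

namespace SC

namespace BoundaryParam

variable {Ω : Set Plane} (P : BoundaryParam Ω) {t₀ : ℝ}

lemma dot2_tau_nu (s : ℝ) : dot2 (P.tau s) (P.nu s) = 0 := by
  simp [dot2, nu, nuVec]; ring

lemma esq_frame (V : Plane) (s : ℝ) :
    esq V = dot2 V (P.tau s) ^ 2 + dot2 V (P.nu s) ^ 2 := by
  have h := P.tau_sq s
  simp only [esq, dot2, nu, nuVec]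
  simp only [tau] at h ⊢
  linear_combination (-(V.1 ^ 2 + V.2 ^ 2)) * h

/-- The energy density in tubular coordinates. -/
lemma en_coord (a : Plane → Plane) (u : Plane → ℂ) (p : ℝ × ℝ) (hp : 1 - p.2 * P.kap p.1 ≠ 0) :
    en a u (P.Psi p) =
      ‖(-Complex.I) * fderiv ℝ u (P.Psi p) (P.DPsi p (0, 1)) -
        (dot2 (a (P.Psi p)) (P.DPsi p (0, 1)) : ℂ) * u (P.Psi p)‖ ^ 2 +
      ((1 - p.2 * P.kap p.1) ^ 2)⁻¹ * ‖(-Complex.I) * fderiv ℝ u (P.Psi p) (P.DPsi p (1, 0)) -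
        (dot2 (a (P.Psi p)) (P.DPsi p (1, 0)) : ℂ) * u (P.Psi p)‖ ^ 2 := by
  set x := P.Psi p
  set J := 1 - p.2 * P.kap p.1
  have hdec : ∀ v : Plane, fderiv ℝ u x v =
      v.1 * fderiv ℝ u x ((1 : ℝ), (0 : ℝ)) + v.2 * fderiv ℝ u x ((0 : ℝ), (1 : ℝ)) := by
    intro v
    have : v = v.1 • ((1 : ℝ), (0 : ℝ)) + v.2 • ((0 : ℝ), (1 : ℝ)) := by
      ext <;> simp
    conv_lhs => rw [this]
    rw [map_add, map_smul, map_smul]; simp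
  have hD : ∀ v : Plane, (-Complex.I) * fderiv ℝ u x v - (dot2 (a x) v : ℂ) * u x =
      v.1 * Dx a u x + v.2 * Dy a u x := by
    intro v
    rw [hdec v]; simp only [Dx, Dy, dot2]; push_cast; ring
  have h1 : P.DPsi p (1, 0) = J • P.tau p.1 := by simp [DPsi_apply, J]
  have h2 : P.DPsi p (0, 1) = P.nu p.1 := by simp [DPsi_apply]
  rw [hD, hD, h1, h2]
  have h := P.tau_sq p.1
  simp only [nu, nuVec]
  have h3 : ((J • P.tau p.1).1 : ℂ) * Dx a u x + ((J • P.tau p.1).2 : ℂ) * Dy a u x =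
      J * ((P.tau p.1).1 * Dx a u x + (P.tau p.1).2 * Dy a u x) := by
    simp; ring
  rw [h3, norm_mul, mul_pow, Complex.norm_real, Real.norm_eq_abs, sq_abs, ← mul_assoc,
    inv_mul_cancel₀ (pow_ne_zero 2 hp), one_mul, en]
  simp only [tau] at h ⊢
  simp only [nsq]
  simp
  linear_combination (-((Dx a u x).re ^ 2 + (Dx a u x).im ^ 2 + (Dy a u x).re ^ 2 +
    (Dy a u x).im ^ 2)) * h

/-- The wedge product of plane vectors. -/
def wdg (v w : Plane) : ℝ := v.1 * w.2 - v.2 * w.1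

/-- Tangential part of the gauge function. -/
def gs (s : ℝ) : ℝ := 1 / 2 * (∫ r in (0 : ℝ)..s, wdg (P.γ r) (P.tau r)) - P.area * s / P.L

/-- The gauge function in tubular coordinates. -/
def gf (p : ℝ × ℝ) : ℝ := 1 / 2 * p.2 * wdg (P.γ p.1) (P.nu p.1) + P.gs p.1

lemma contDiff_wdg {n : ℕ∞} {f g : ℝ → Plane} (hf : ContDiff ℝ n f) (hg : ContDiff ℝ n g) :
    ContDiff ℝ n fun s => wdg (f s) (g s) := by
  unfold wdg; fun_prop

lemma hasDerivAt_gs (s : ℝ) :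
    HasDerivAt P.gs (1 / 2 * wdg (P.γ s) (P.tau s) - P.area / P.L) s := by
  have hc : Continuous fun r => wdg (P.γ r) (P.tau r) :=
    (contDiff_wdg P.smooth P.contDiff_tau).continuous
  have h1 := (intervalIntegral.integral_hasDerivAt_right (hc.intervalIntegrable 0 s)
    (hc.stronglyMeasurableAtFilter _ _) hc.continuousAt).const_mul (1 / 2)
  have h2 : HasDerivAt (fun s => P.area * s / P.L) (P.area / P.L) s := by
    simpa using ((hasDerivAt_id s).const_mul P.area).div_const P.L
  exact h1.sub h2

lemma contDiff_gs : ContDiff ℝ (⊤ : ℕ∞) P.gs := by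
  refine contDiff_infty_iff_deriv.2 ⟨fun s => (P.hasDerivAt_gs s).differentiableAt, ?_⟩
  have : deriv P.gs = fun s => 1 / 2 * wdg (P.γ s) (P.tau s) - P.area / P.L :=
    funext fun s => (P.hasDerivAt_gs s).deriv
  rw [this]
  exact (contDiff_const.mul (contDiff_wdg P.smooth P.contDiff_tau)).sub contDiff_const

lemma gs_per : Function.Periodic P.gs P.L := by
  intro s
  have hper : Function.Periodic (fun r => wdg (P.γ r) (P.tau r)) P.L := fun r => by
    simp only [P.periodic r, P.tau_per r]
  have hc : Continuous fun r => wdg (P.γ r) (P.tau r) :=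
    (contDiff_wdg P.smooth P.contDiff_tau).continuous
  have h1 := intervalIntegral.integral_add_adjacent_intervals
    (hc.intervalIntegrable (μ := volume) 0 s) (hc.intervalIntegrable s (s + P.L))
  have h2 := hper.intervalIntegral_add_eq s 0
  have h3 : P.area = 1 / 2 * ∫ r in (0 : ℝ)..P.L, wdg (P.γ r) (P.tau r) := rfl
  rw [zero_add] at h2
  rw [gs, gs, ← h1, h2, mul_add, mul_add, ← h3]
  field_simp [P.L_pos.ne']
  ring

lemma contDiff_gf : ContDiff ℝ (⊤ : ℕ∞) P.gf := by
  have h1 : ContDiff ℝ (⊤ : ℕ∞) fun s => wdg (P.γ s) (P.nu s) := contDiff_wdg P.smooth P.contDiff_nu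
  unfold gf
  exact ((contDiff_const.mul contDiff_snd).mul (h1.comp contDiff_fst)).add
    (P.contDiff_gs.comp contDiff_fst)

lemma gf_per : P.PerS P.gf := fun s t => by
  simp only [gf, P.periodic s, P.nu_per s, P.gs_per s]

lemma fderiv_gf (p v : ℝ × ℝ) : fderiv ℝ P.gf p v =
    dot2 (F0 (P.Psi p)) (P.DPsi p v) -
      (P.area / P.L - p.2 + P.kap p.1 * p.2 ^ 2 / 2) * v.1 := by
  have hw : HasDerivAt (fun s => wdg (P.γ s) (P.nu s))
      (wdg (P.tau p.1) (P.nu p.1) - P.kap p.1 * wdg (P.γ p.1) (P.tau p.1)) p.1 := by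
    have a := P.hasDerivAt_γ p.1
    have b := P.hasDerivAt_nu p.1
    have a1 : HasDerivAt (fun s => (P.γ s).1) (P.tau p.1).1 p.1 :=
      (hasFDerivAt_fst (𝕜 := ℝ) (p := P.γ p.1)).comp_hasDerivAt _ a
    have a2 : HasDerivAt (fun s => (P.γ s).2) (P.tau p.1).2 p.1 :=
      (hasFDerivAt_snd (𝕜 := ℝ) (p := P.γ p.1)).comp_hasDerivAt _ a
    have b1 : HasDerivAt (fun s => (P.nu s).1) (-(P.kap p.1) • P.tau p.1).1 p.1 :=
      (hasFDerivAt_fst (𝕜 := ℝ) (p := P.nu p.1)).comp_hasDerivAt _ b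
    have b2 : HasDerivAt (fun s => (P.nu s).2) (-(P.kap p.1) • P.tau p.1).2 p.1 :=
      (hasFDerivAt_snd (𝕜 := ℝ) (p := P.nu p.1)).comp_hasDerivAt _ b
    refine ((a1.mul b2).sub (a2.mul b1)).congr_deriv ?_
    simp [wdg]; ring
  have h1 := (((hasFDerivAt_snd (𝕜 := ℝ) (p := p)).const_mul (1 / 2 : ℝ)).mul
    (hw.comp_hasFDerivAt p (hasFDerivAt_fst (𝕜 := ℝ) (p := p)))).add
    ((P.hasDerivAt_gs p.1).comp_hasFDerivAt p (hasFDerivAt_fst (𝕜 := ℝ) (p := p)))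
  have h2 : HasFDerivAt P.gf _ p := h1
  rw [h2.fderiv]
  have ht := P.tau_sq p.1
  simp [DPsi_apply, dot2, F0, Psi, wdg, nu, nuVec]
  simp only [tau] at ht ⊢
  linear_combination (v.1 * p.2 - v.1 * p.2 ^ 2 * P.kap p.1 / 2) * ht

/-- The global gauge function. -/
def gau (t₀ : ℝ) : Plane → ℝ := P.ext t₀ fun p => xi (3 * t₀ / 4) p.2 * P.gf p

/-- The potential of unit field adapted to the boundary. -/
def G (t₀ : ℝ) (x : Plane) : Plane :=
  F0 x - (fderiv ℝ (P.gau t₀) x ((1 : ℝ), (0 : ℝ)), fderiv ℝ (P.gau t₀) x ((0 : ℝ), (1 : ℝ)))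

/-- The normalised circulation field. -/
def om (t₀ : ℝ) : Plane → Plane := P.ext t₀ fun p =>
  (xi (3 * t₀ / 4) p.2 / (P.L * (1 - p.2 * P.kap p.1))) • P.tau p.1

/-- The winding phase, cut off away from the boundary. -/
def wnd (t₀ : ℝ) (n : ℤ) : Plane → ℂ := P.ext t₀ fun p =>
  (xi (t₀ / 4) p.2 : ℂ) * Complex.exp (Complex.I * ((2 * Real.pi * n / P.L * p.1 : ℝ) : ℂ))

lemma dot_fderiv {f : Plane → ℝ} {x : Plane} (v : Plane) : fderiv ℝ f x v =
    dot2 (fderiv ℝ f x ((1 : ℝ), (0 : ℝ)), fderiv ℝ f x ((0 : ℝ), (1 : ℝ))) v := by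
  have : v = v.1 • ((1 : ℝ), (0 : ℝ)) + v.2 • ((0 : ℝ), (1 : ℝ)) := by ext <;> simp
  conv_lhs => rw [this]
  rw [map_add, map_smul, map_smul]; simp [dot2]; ring

variable {P}

namespace Collar

variable (hc : P.Collar t₀)

include hc

lemma gau_per : P.PerS fun p => xi (3 * t₀ / 4) p.2 * P.gf p := fun s t => by
  simp only [P.gf_per s t]

lemma contDiff_gau_coord {n : ℕ} : ContDiff ℝ n fun p : ℝ × ℝ => xi (3 * t₀ / 4) p.2 * P.gf p :=
  ((contDiff_xi _ (n := n)).comp contDiff_snd).mul (P.contDiff_gf.of_le (by exact_mod_cast le_top))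

lemma cNearCl_gau (ho : IsOpen Ω) (n : ℕ) : CNearCl n Ω (P.gau t₀) := by
  have h0 := hc.pos
  refine hc.cNearCl_ext ho hc.gau_per hc.contDiff_gau_coord (c := 3 * t₀ / 4) (by linarith) ?_
  intro s t h; simp [xi_zero (by positivity : 0 < 3 * t₀ / 4) h]

lemma continuousOn_G (ho : IsOpen Ω) : ContinuousOn (P.G t₀) (closure Ω) := by
  have h := hc.cNearCl_gau ho 1
  exact continuous_F0.continuousOn.sub
    ((h.continuousOn_fderiv_apply _).prodMk (h.continuousOn_fderiv_apply _))

lemma G_coord {p : ℝ × ℝ} (hp : p ∈ strip t₀) (h : p.2 < 3 * t₀ / 8) (v : ℝ × ℝ) :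
    dot2 (P.G t₀ (P.Psi p)) (P.DPsi p v) =
      (P.area / P.L - p.2 + P.kap p.1 * p.2 ^ 2 / 2) * v.1 := by
  have h0 := hc.pos
  have h1 := hc.fderiv_ext hc.gau_per (hc.contDiff_gau_coord (n := 1)) hp v
  have h2 : (fun p : ℝ × ℝ => xi (3 * t₀ / 4) p.2 * P.gf p) =ᶠ[𝓝 p] P.gf := by
    filter_upwards [(isOpen_Iio.preimage continuous_snd).mem_nhds h] with q hq
    have : q.2 < 3 * t₀ / 8 := hq
    rw [xi_one (by positivity) (by linarith), one_mul]
  rw [h2.fderiv_eq, fderiv_gf, dot_fderiv] at h1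
  have h3 : dot2 (P.G t₀ (P.Psi p)) (P.DPsi p v) = dot2 (F0 (P.Psi p)) (P.DPsi p v) -
    dot2 (fderiv ℝ (P.gau t₀) (P.Psi p) ((1 : ℝ), (0 : ℝ)),
      fderiv ℝ (P.gau t₀) (P.Psi p) ((0 : ℝ), (1 : ℝ))) (P.DPsi p v) := by
    simp [dot2, G]; ring
  rw [h3]
  have h1' : dot2 (fderiv ℝ (P.gau t₀) (P.Psi p) ((1 : ℝ), (0 : ℝ)),
      fderiv ℝ (P.gau t₀) (P.Psi p) ((0 : ℝ), (1 : ℝ))) (P.DPsi p v) = _ := h1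
  rw [h1']; ring

lemma om_per : P.PerS fun p : ℝ × ℝ =>
    (xi (3 * t₀ / 4) p.2 / (P.L * (1 - p.2 * P.kap p.1))) • P.tau p.1 := fun s t => by
  simp only [P.kap_per s, P.tau_per s]

lemma continuousOn_om (ho : IsOpen Ω) : ContinuousOn (P.om t₀) (closure Ω) := by
  have h0 := hc.pos
  refine (hc.cNearCl_ext' (n := 0) ho hc.om_per (fun p hp => ?_) (c := 3 * t₀ / 4)
    (by linarith) ?_).continuousOn
  · have h1 : ContDiff ℝ (0 : ℕ) fun p : ℝ × ℝ => xi (3 * t₀ / 4) p.2 :=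
      (contDiff_xi _ (n := 0)).comp contDiff_snd
    have h2 : ContDiff ℝ (0 : ℕ) fun p : ℝ × ℝ => P.kap p.1 :=
      (P.contDiff_kap.of_le (by exact_mod_cast le_top)).comp contDiff_fst
    have h3 : ContDiff ℝ (0 : ℕ) fun p : ℝ × ℝ => P.tau p.1 :=
      (P.contDiff_tau.of_le (by exact_mod_cast le_top)).comp contDiff_fst
    have h4 : ContDiff ℝ (0 : ℕ) fun p : ℝ × ℝ => P.L * (1 - p.2 * P.kap p.1) :=
      contDiff_const.mul (contDiff_const.sub (contDiff_snd.mul h2))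
    exact (h1.contDiffAt.div h4.contDiffAt
      (mul_ne_zero P.L_pos.ne' (hc.jac_ne hp))).smul h3.contDiffAt
  · intro s t h; simp [xi_zero (by positivity : 0 < 3 * t₀ / 4) h]

lemma om_coord {p : ℝ × ℝ} (hp : p ∈ strip t₀) (h : p.2 < 3 * t₀ / 8) (v : ℝ × ℝ) :
    dot2 (P.om t₀ (P.Psi p)) (P.DPsi p v) = v.1 / P.L := by
  have h0 := hc.pos
  rw [om, hc.ext_Psi hc.om_per hp, xi_one (by positivity) (by linarith), DPsi_apply]
  have h1 := P.dot2_tau_nu p.1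
  have h2 := P.tau_sq p.1
  have h3 := hc.jac_ne hp
  have h4 := P.L_pos.ne'
  have : dot2 ((1 / (P.L * (1 - p.2 * P.kap p.1))) • P.tau p.1)
      (v.1 • ((1 - p.2 * P.kap p.1) • P.tau p.1) + v.2 • P.nu p.1) =
      (1 / (P.L * (1 - p.2 * P.kap p.1))) * (v.1 * (1 - p.2 * P.kap p.1) *
        ((P.tau p.1).1 ^ 2 + (P.tau p.1).2 ^ 2) + v.2 * dot2 (P.tau p.1) (P.nu p.1)) := by
    simp [dot2]; ring
  rw [this, h1, h2]
  field_simp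
  ring

lemma esq_coord {p : ℝ × ℝ} (hp : p ∈ strip t₀) (V : Plane) :
    esq V = (dot2 V (P.DPsi p (1, 0)) / (1 - p.2 * P.kap p.1)) ^ 2 +
      dot2 V (P.DPsi p (0, 1)) ^ 2 := by
  rw [P.esq_frame V p.1]
  have h3 := hc.jac_ne hp
  have h1 : dot2 V (P.DPsi p (1, 0)) = (1 - p.2 * P.kap p.1) * dot2 V (P.tau p.1) := by
    simp [DPsi_apply, dot2]; ring
  have h2 : dot2 V (P.DPsi p (0, 1)) = dot2 V (P.nu p.1) := by simp [DPsi_apply]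
  rw [h1, h2, mul_div_cancel_left₀ _ h3]

lemma esq_G_sub_le {x : Plane} (hx : x ∈ Ω) (h : P.dst t₀ x < 3 * t₀ / 8) :
    esq (P.G t₀ x - P.area • P.om t₀ x) ≤ 9 * P.dst t₀ x ^ 2 := by
  have h0 := hc.pos
  obtain ⟨p, ⟨-, h1, h2⟩, rfl⟩ := hc.mem_inner_of_dst_lt hx (by linarith) h
  have hp : p ∈ strip t₀ := cell_subset_strip (c := 3 * t₀ / 8) (by linarith) ⟨h1, h2⟩
  rw [hc.dst_Psi_low hp (by linarith)]
  have e : ∀ v, dot2 (P.G t₀ (P.Psi p) - P.area • P.om t₀ (P.Psi p)) (P.DPsi p v) =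
      (- p.2 + P.kap p.1 * p.2 ^ 2 / 2) * v.1 := by
    intro v
    have e1 := hc.G_coord hp h2 v
    have e2 := hc.om_coord hp h2 v
    have : dot2 (P.G t₀ (P.Psi p) - P.area • P.om t₀ (P.Psi p)) (P.DPsi p v) =
      dot2 (P.G t₀ (P.Psi p)) (P.DPsi p v) - P.area * dot2 (P.om t₀ (P.Psi p)) (P.DPsi p v) := by
      simp [dot2]; ring
    rw [this, e1, e2]; ring
  rw [hc.esq_coord hp, e, e]
  have hj := hc.jac_pos hp
  have hj' : |p.2 * P.kap p.1| ≤ 1 / 2 := by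
    rw [abs_mul, mul_comm]
    exact (mul_le_mul_of_nonneg_left (le_of_lt hp) (abs_nonneg _)).trans (hc.curv p.1)
  have hj2 := abs_le.1 hj'
  simp only [mul_zero, mul_one, ne_eq, OfNat.ofNat_ne_zero, not_false_eq_true, zero_pow, add_zero]
  rw [div_pow, div_le_iff₀ (by positivity)]
  have e3 : (-p.2 + P.kap p.1 * p.2 ^ 2 / 2) ^ 2 = p.2 ^ 2 * (1 - p.2 * P.kap p.1 / 2) ^ 2 := by
    ring
  rw [e3, mul_comm 9, mul_assoc]
  refine mul_le_mul_of_nonneg_left ?_ (sq_nonneg _)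
  nlinarith

lemma esq_om_le {K : ℝ} (hK : ∀ s, |P.kap s| ≤ K) {x : Plane} (hx : x ∈ Ω)
    (h : P.dst t₀ x < 3 * t₀ / 8) :
    esq (P.om t₀ x) ≤ (1 + 6 * K * P.dst t₀ x) / P.L ^ 2 := by
  have h0 := hc.pos
  obtain ⟨p, ⟨-, h1, h2⟩, rfl⟩ := hc.mem_inner_of_dst_lt hx (by linarith) h
  have hp : p ∈ strip t₀ := cell_subset_strip (c := 3 * t₀ / 8) (by linarith) ⟨h1, h2⟩
  rw [hc.dst_Psi_low hp (by linarith), hc.esq_coord hp, hc.om_coord hp h2, hc.om_coord hp h2]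
  have hj := hc.jac_pos hp
  have hj' : |p.2 * P.kap p.1| ≤ 1 / 2 := by
    rw [abs_mul, mul_comm]
    exact (mul_le_mul_of_nonneg_left (le_of_lt hp) (abs_nonneg _)).trans (hc.curv p.1)
  have hL := P.L_pos
  have hy : p.2 * P.kap p.1 ≤ K * p.2 := by
    rw [mul_comm]; exact mul_le_mul_of_nonneg_right ((le_abs_self _).trans (hK _)) h1.le
  have hK0 : 0 ≤ K * p.2 := mul_nonneg ((abs_nonneg _).trans (hK 0)) h1.le
  have hle : ((1 - p.2 * P.kap p.1) ^ 2)⁻¹ ≤ 1 + 6 * K * p.2 := by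
    rw [inv_le_iff_one_le_mul₀ (by positivity)]
    have := abs_le.1 hj'
    set y := p.2 * P.kap p.1
    rcases le_or_gt 0 y with hy0 | hy0
    · nlinarith [mul_nonneg hy0 (by linarith : (0 : ℝ) ≤ 1 / 2 - y),
        mul_nonneg (mul_nonneg hy0 hy0) (by linarith : (0 : ℝ) ≤ 1 / 2 - y), sq_nonneg (1 - y)]
    · nlinarith [sq_nonneg (1 - y)]
  simp only [zero_div, ne_eq, OfNat.ofNat_ne_zero, not_false_eq_true, zero_pow, add_zero]
  rw [div_pow, div_pow, one_pow, div_div, ← div_div, div_div, mul_comm (P.L ^ 2), ← div_div,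
    one_div]
  gcongr

end Collar

end BoundaryParam

end SC

namespace SC

namespace BoundaryParam

variable {Ω : Set Plane} {P : BoundaryParam Ω} {t₀ : ℝ}

namespace Collar

variable (hc : P.Collar t₀)

include hc

omit hc in
lemma wnd_per (P : BoundaryParam Ω) (t₀ : ℝ) (n : ℤ) : P.PerS fun p : ℝ × ℝ =>
    (xi (t₀ / 4) p.2 : ℂ) *
      Complex.exp (Complex.I * ((2 * Real.pi * n / P.L * p.1 : ℝ) : ℂ)) := fun s t => by
  simp only
  congr 1
  have h : Complex.I * ((2 * Real.pi * n / P.L * (s + P.L) : ℝ) : ℂ) =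
      Complex.I * ((2 * Real.pi * n / P.L * s : ℝ) : ℂ) + n * (2 * Real.pi * Complex.I) := by
    have : (P.L : ℂ) ≠ 0 := by exact_mod_cast P.L_pos.ne'
    push_cast; field_simp
  rw [h, Complex.exp_add, Complex.exp_int_mul_two_pi_mul_I, mul_one]

omit hc in
lemma contDiff_wnd_coord (t₀ r : ℝ) {n : ℕ} : ContDiff ℝ n fun p : ℝ × ℝ =>
    (xi (t₀ / 4) p.2 : ℂ) * Complex.exp (Complex.I * ((r * p.1 : ℝ) : ℂ)) := by
  have h1 : ContDiff ℝ n fun p : ℝ × ℝ => (xi (t₀ / 4) p.2 : ℂ) :=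
    Complex.ofRealCLM.contDiff.comp ((contDiff_xi _ (n := n)).comp contDiff_snd)
  have h2 : ContDiff ℝ n fun p : ℝ × ℝ => ((r * p.1 : ℝ) : ℂ) :=
    Complex.ofRealCLM.contDiff.comp (contDiff_const.mul contDiff_fst)
  exact h1.mul (contDiff_const.mul h2).cexp

lemma cNearCl_wnd (ho : IsOpen Ω) (n : ℤ) (m : ℕ) : CNearCl m Ω (P.wnd t₀ n) := by
  have h0 := hc.pos
  refine hc.cNearCl_ext ho (wnd_per P t₀ n) (contDiff_wnd_coord t₀ _) (c := t₀ / 4)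
    (by linarith) ?_
  intro s t h; simp [xi_zero (by positivity : 0 < t₀ / 4) h]

lemma wnd_eq_zero {x : Plane} (n : ℤ) (h : t₀ / 4 < P.dst t₀ x) : P.wnd t₀ n x = 0 := by
  have h0 := hc.pos
  by_cases h' : x ∈ P.Psi '' strip t₀
  · obtain ⟨p, hp, rfl⟩ := h'
    rw [wnd, hc.ext_Psi (wnd_per P t₀ n) hp]
    have : t₀ / 4 ≤ p.2 := by
      by_contra hlt
      rw [hc.dst_Psi_low hp (by linarith)] at h
      linarith
    simp [xi_zero (by positivity : 0 < t₀ / 4) this]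
  · exact ext_of_not h'

lemma norm_wnd {x : Plane} (hx : x ∈ Ω) (n : ℤ) :
    ‖P.wnd t₀ n x‖ ^ 2 = xi (t₀ / 4) (P.dst t₀ x) ^ 2 := by
  have h0 := hc.pos
  rcases lt_or_ge (t₀ / 4) (P.dst t₀ x) with h | h
  · rw [hc.wnd_eq_zero n h, xi_zero (by positivity) h.le]; simp
  · obtain ⟨p, ⟨-, h1, h2⟩, rfl⟩ := hc.mem_inner_of_dst_lt (c := 3 * t₀ / 8) hx (by linarith)
      (by linarith)
    have hp : p ∈ strip t₀ := cell_subset_strip (c := 3 * t₀ / 8) (by linarith) ⟨h1, h2⟩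
    rw [wnd, hc.ext_Psi (wnd_per P t₀ n) hp, hc.dst_Psi_low hp (by linarith), norm_mul,
      mul_comm Complex.I, Complex.norm_exp_ofReal_mul_I, mul_one, Complex.norm_real]
    simp

/-- Multiplication by the winding phase subtracts a multiple of the circulation field. -/
lemma en_wnd (ho : IsOpen Ω) (a : Plane → Plane) (n : ℤ) {u : Plane → ℂ} {x : Plane} (hx : x ∈ Ω)
    (hu : DifferentiableAt ℝ u x) :
    en a (fun y => P.wnd t₀ n y * u y) x =
      en (fun y => a y - (2 * Real.pi * n) • P.om t₀ y)
        (fun y => (xi (t₀ / 4) (P.dst t₀ y) : ℂ) * u y) x := by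
  have h0 := hc.pos
  have hxc := subset_closure hx
  have hdst := (hc.cNearCl_dst ho 1).differentiableAt hxc
  rcases lt_or_ge (P.dst t₀ x) (3 * t₀ / 8) with h | h
  · obtain ⟨p, ⟨-, h1, h2⟩, rfl⟩ := hc.mem_inner_of_dst_lt hx (by linarith) h
    have hp : p ∈ strip t₀ := cell_subset_strip (c := 3 * t₀ / 8) (by linarith) ⟨h1, h2⟩
    have hd1 := hc.dst_Psi_low hp (by linarith)
    have hxi : DifferentiableAt ℝ (fun y => xi (t₀ / 4) (P.dst t₀ y)) (P.Psi p) :=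
      (hc.cNearCl_comp_dst ho (n := 1) (contDiff_xi _ (n := 1))).differentiableAt hxc
    set r := 2 * Real.pi * n / P.L with hr
    refine en_phase a (fun y => (2 * Real.pi * n) • P.om t₀ y)
      (p := Complex.exp (Complex.I * ((r * p.1 : ℝ) : ℂ))) hxi hu
      ((hc.cNearCl_wnd ho n 1).differentiableAt hxc) ?_ ?_ ?_
    · rw [mul_comm Complex.I, Complex.norm_exp_ofReal_mul_I]
    · rw [wnd, hc.ext_Psi (wnd_per P t₀ n) hp, hd1]
    · -- reduce to tangent vectors of the tubular coordinates
      have key : ∀ v : ℝ × ℝ, fderiv ℝ (P.wnd t₀ n) (P.Psi p) (P.DPsi p v) =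
          ((fderiv ℝ (fun y => xi (t₀ / 4) (P.dst t₀ y)) (P.Psi p) (P.DPsi p v) : ℝ) +
            Complex.I * (xi (t₀ / 4) (P.dst t₀ (P.Psi p)) : ℝ) *
              dot2 ((2 * Real.pi * n) • P.om t₀ (P.Psi p)) (P.DPsi p v)) *
            Complex.exp (Complex.I * ((r * p.1 : ℝ) : ℂ)) := by
        intro v
        have e1 := hc.fderiv_ext (wnd_per P t₀ n) (contDiff_wnd_coord t₀ _ (n := 1)) hp v
        have e2 : dot2 ((2 * Real.pi * n) • P.om t₀ (P.Psi p)) (P.DPsi p v) = r * v.1 := by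
          have := hc.om_coord hp h2 v
          have e : dot2 ((2 * Real.pi * n) • P.om t₀ (P.Psi p)) (P.DPsi p v) =
            (2 * Real.pi * n) * dot2 (P.om t₀ (P.Psi p)) (P.DPsi p v) := by
            simp [dot2]; ring
          rw [e, this, hr]; ring
        have hxid : HasFDerivAt (fun q : ℝ × ℝ => xi (t₀ / 4) q.2)
            (deriv (xi (t₀ / 4)) p.2 • ContinuousLinearMap.snd ℝ ℝ ℝ) p :=
          ((contDiff_xi (t₀ / 4) (n := 1)).differentiable (by norm_num)
            p.2).hasDerivAt.comp_hasFDerivAt p (hasFDerivAt_snd (𝕜 := ℝ) (p := p))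
        have e3 : fderiv ℝ (fun y => xi (t₀ / 4) (P.dst t₀ y)) (P.Psi p) (P.DPsi p v) =
            deriv (xi (t₀ / 4)) p.2 * v.2 := by
          have a1 := hxi.hasFDerivAt.comp p (P.hasFDerivAt_Psi p)
          have a2 : (fun q => xi (t₀ / 4) (P.dst t₀ (P.Psi q))) =ᶠ[𝓝 p]
              fun q => xi (t₀ / 4) q.2 := by
            filter_upwards [(isOpen_strip t₀).mem_nhds hp,
              (isOpen_Iio.preimage continuous_snd).mem_nhds h2] with q hq hq2
            have hq2 : q.2 < 3 * t₀ / 8 := hq2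
            rw [hc.dst_Psi_low hq (by linarith)]
          have a3 := (a1.congr_of_eventuallyEq a2.symm).unique hxid
          have := congrArg (fun f : ℝ × ℝ →L[ℝ] ℝ => f v) a3
          simpa using this
        have hexp : HasFDerivAt (fun q : ℝ × ℝ => Complex.exp (Complex.I * ((r * q.1 : ℝ) : ℂ)))
            (Complex.exp (Complex.I * ((r * p.1 : ℝ) : ℂ)) • (Complex.I • Complex.ofRealCLM.comp
              (r • ContinuousLinearMap.fst ℝ ℝ ℝ))) p :=
          ((Complex.ofRealCLM.hasFDerivAt.comp p
            ((hasFDerivAt_fst (𝕜 := ℝ) (p := p)).const_mul r)).const_mul Complex.I).cexp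
        have e4 := ((Complex.ofRealCLM.hasFDerivAt.comp p hxid).mul hexp).fderiv
        have e5 : fderiv ℝ (fun p : ℝ × ℝ => (xi (t₀ / 4) p.2 : ℂ) *
            Complex.exp (Complex.I * ((r * p.1 : ℝ) : ℂ))) p = _ := e4
        rw [e2, e3, hd1]
        refine e1.trans ?_
        rw [e5]
        simp
        ring
      intro v
      obtain ⟨w, rfl⟩ : ∃ w, P.DPsi p w = v := by
        refine ⟨(P.DPsiEquiv p (hc.jac_ne hp)).symm v, ?_⟩
        rw [← P.DPsiEquiv_coe p (hc.jac_ne hp)]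
        simp
      exact key w
  · have hev : ∀ᶠ y in 𝓝 x, t₀ / 4 < P.dst t₀ y :=
      hdst.continuousAt.eventually (lt_mem_nhds (by linarith))
    have z1 : (fun y => P.wnd t₀ n y * u y) =ᶠ[𝓝 x] fun _ => 0 := by
      filter_upwards [hev] with y hy
      rw [hc.wnd_eq_zero n hy, zero_mul]
    have z2 : (fun y => (xi (t₀ / 4) (P.dst t₀ y) : ℂ) * u y) =ᶠ[𝓝 x] fun _ => 0 := by
      filter_upwards [hev] with y hy
      rw [xi_zero (by positivity) hy.le]; simp
    simp [en, Dx, Dy, z1.fderiv_eq, z2.fderiv_eq, z1.self_of_nhds, z2.self_of_nhds]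

/-- Transfer to the adapted gauge. -/
lemma en_gau (ho : IsOpen Ω) (B : ℝ) {u : Plane → ℂ} {x : Plane} (hx : x ∈ Ω)
    (hu : DifferentiableAt ℝ u x) :
    en (fun y => B • F0 y) (fun y => Complex.exp (Complex.I * ((B * P.gau t₀ y : ℝ) : ℂ)) * u y) x =
      en (fun y => B • P.G t₀ y) u x := by
  have hg := (hc.cNearCl_gau ho 1).differentiableAt (subset_closure hx)
  have := en_gauge (fun y => B • F0 y) (φ := fun y => B * P.gau t₀ y) (hg.const_mul B) hu
    (B • (fderiv ℝ (P.gau t₀) x ((1 : ℝ), (0 : ℝ)), fderiv ℝ (P.gau t₀) x ((0 : ℝ), (1 : ℝ))))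
    (by
      intro v
      rw [fderiv_const_mul hg]
      have := dot_fderiv (f := P.gau t₀) (x := x) v
      simp only [FunLike.coe_smul, Pi.smul_apply, this]
      simp [dot2]; ring)
  rw [this]
  have e : (B • F0 x - B • (fderiv ℝ (P.gau t₀) x ((1 : ℝ), (0 : ℝ)),
    fderiv ℝ (P.gau t₀) x ((0 : ℝ), (1 : ℝ)))) = B • P.G t₀ x := by
    rw [G, smul_sub]
  simp only [en, Dx, Dy, e]

lemma cNearCl_gau_mul (ho : IsOpen Ω) (B : ℝ) {u : Plane → ℂ} (hu : CNearCl 1 Ω u) :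
    CNearCl 1 Ω (fun y => Complex.exp (Complex.I * ((B * P.gau t₀ y : ℝ) : ℂ)) * u y) := by
  have h1 : ContDiff ℝ (1 : ℕ) fun r : ℝ => Complex.exp (Complex.I * ((B * r : ℝ) : ℂ)) :=
    (contDiff_const.mul (Complex.ofRealCLM.contDiff.comp (contDiff_const.mul contDiff_id))).cexp
  exact CNearCl.mul ((hc.cNearCl_gau ho 1).map h1) hu

omit hc in
lemma norm_gau_mul (B : ℝ) (u : Plane → ℂ) (y : Plane) :
    ‖Complex.exp (Complex.I * ((B * P.gau t₀ y : ℝ) : ℂ)) * u y‖ = ‖u y‖ := by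
  rw [norm_mul, mul_comm Complex.I, Complex.norm_exp_ofReal_mul_I, one_mul]

lemma lam_le_G (ho : IsOpen Ω) (B : ℝ) {u : Plane → ℂ} (hu : CNearCl 1 Ω u) :
    lam1 Ω B * ∫ x in Ω, ‖u x‖ ^ 2 ≤ ∫ x in Ω, en (fun y => B • P.G t₀ y) u x := by
  have h := lam1_mul_le B (hc.cNearCl_gau_mul ho B hu)
  simp only [norm_gau_mul] at h
  refine h.trans_eq (setIntegral_congr_fun ho.measurableSet fun x hx => ?_)
  exact hc.en_gau ho B hx (hu.differentiableAt (subset_closure hx))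

lemma exists_near_min_G (ho : IsOpen Ω) (hne : Ω.Nonempty) (hb : Bornology.IsBounded Ω) (B : ℝ)
    {ε : ℝ} (hε : 0 < ε) : ∃ u, CNearCl 1 Ω u ∧ (∫ x in Ω, ‖u x‖ ^ 2) = 1 ∧
      (∫ x in Ω, en (fun y => B • P.G t₀ y) u x) ≤ lam1 Ω B + ε := by
  obtain ⟨u, hu, h1, h2⟩ := exists_near_min ho hne hb B hε
  refine ⟨_, hc.cNearCl_gau_mul ho (-B) hu, by simpa only [norm_gau_mul] using h1, ?_⟩
  refine le_trans (le_of_eq (setIntegral_congr_fun ho.measurableSet fun x hx => ?_)) h2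
  have hx' := subset_closure hx
  have h3 := hc.en_gau ho B hx ((hc.cNearCl_gau_mul ho (-B) hu).differentiableAt hx')
  rw [← h3]
  congr 1
  funext y
  rw [← mul_assoc, ← Complex.exp_add]
  have : Complex.I * ((B * P.gau t₀ y : ℝ) : ℂ) + Complex.I * ((-B * P.gau t₀ y : ℝ) : ℂ) = 0 := by
    push_cast; ring
  rw [this, Complex.exp_zero, one_mul]

end Collar

end BoundaryParam

end SC

namespace SC

/-- Convergence of difference quotients tested against a continuous function. -/
lemma tendsto_integral_diffQuot {w g : Plane → ℝ} (hw : Continuous w) (hg : ContDiff ℝ 1 g)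
    (hgc : HasCompactSupport g) (e : Plane) :
    Tendsto (fun n : ℕ => ∫ x, w x * (((n : ℝ) + 1) * (g (x + ((n : ℝ) + 1)⁻¹ • e) - g x))) atTop
      (𝓝 (∫ x, w x * fderiv ℝ g x e)) := by
  obtain ⟨C, hC⟩ := hg.lipschitzWith_of_hasCompactSupport hgc (by norm_num)
  obtain ⟨R, hR⟩ := hgc.isCompact.isBounded.subset_closedBall (0 : Plane)
  have hzero : ∀ x, x ∉ Metric.closedBall (0 : Plane) R → g x = 0 := fun x hx =>
    image_eq_zero_of_notMem_tsupport fun h => hx (hR h)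
  set S := Metric.closedBall (0 : Plane) (R + ‖e‖)
  have hS : IsCompact S := isCompact_closedBall _ _
  obtain ⟨D, hD⟩ := hS.exists_bound_of_continuousOn hw.continuousOn
  have hn : ∀ n : ℕ, (0 : ℝ) < (n : ℝ) + 1 := fun n => by positivity
  refine tendsto_integral_of_dominated_convergence (S.indicator fun _ => D * (C * ‖e‖)) ?_ ?_ ?_ ?_
  · intro n
    have := hg.continuous
    exact (by fun_prop : Continuous fun x => w x * (((n : ℝ) + 1) *
      (g (x + ((n : ℝ) + 1)⁻¹ • e) - g x))).aestronglyMeasurable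
  · rw [integrable_indicator_iff hS.measurableSet]
    exact integrableOn_const hS.measure_lt_top.ne
  · intro n
    refine ae_of_all _ fun x => ?_
    have hn1 : ((n : ℝ) + 1)⁻¹ ≤ 1 := inv_le_one_of_one_le₀ (by linarith [n.cast_nonneg (α := ℝ)])
    have hsm : ‖((n : ℝ) + 1)⁻¹ • e‖ ≤ ‖e‖ := by
      rw [norm_smul, norm_inv, Real.norm_of_nonneg (hn n).le]
      exact mul_le_of_le_one_left (norm_nonneg _) hn1
    by_cases hx : x ∈ S
    · rw [indicator_of_mem hx, norm_mul]
      have h0 : 0 ≤ D := (norm_nonneg _).trans (hD x hx)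
      refine mul_le_mul (hD x hx) ?_ (norm_nonneg _) h0
      have h1 := hC.dist_le_mul (x + ((n : ℝ) + 1)⁻¹ • e) x
      rw [dist_eq_norm, dist_eq_norm, add_sub_cancel_left, norm_smul, norm_inv,
        Real.norm_of_nonneg (hn n).le] at h1
      rw [norm_mul, Real.norm_of_nonneg (hn n).le]
      calc ((n : ℝ) + 1) * ‖g (x + ((n : ℝ) + 1)⁻¹ • e) - g x‖
          ≤ ((n : ℝ) + 1) * (C * (((n : ℝ) + 1)⁻¹ * ‖e‖)) :=
            mul_le_mul_of_nonneg_left h1 (hn n).le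
        _ = C * ‖e‖ := by field_simp [(hn n).ne']
    · rw [indicator_of_notMem hx]
      have hx1 : R + ‖e‖ < ‖x‖ := by simpa [S] using hx
      have h1 : g x = 0 := hzero x (by simp; linarith [norm_nonneg e])
      have h2 : g (x + ((n : ℝ) + 1)⁻¹ • e) = 0 := by
        refine hzero _ ?_
        have := norm_sub_norm_le x (-(((n : ℝ) + 1)⁻¹ • e))
        rw [norm_neg, sub_neg_eq_add] at this
        simp only [Metric.mem_closedBall, dist_zero_right, not_le]
        linarith
      rw [h1, h2]; simp
  · refine ae_of_all _ fun x => Tendsto.const_mul _ ?_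
    have hd := (hg.differentiable (by norm_num) x).hasFDerivAt
    have h1 : Tendsto (fun n : ℕ => ((n : ℝ) + 1)) atTop atTop :=
      tendsto_atTop_add_const_right _ _ tendsto_natCast_atTop_atTop
    refine ((hd.lim_real e).comp h1).congr fun n => ?_
    simp

lemma integral_fderiv_eq_zero {g : Plane → ℝ} (hg : ContDiff ℝ 1 g) (hgc : HasCompactSupport g)
    (e : Plane) : ∫ x, fderiv ℝ g x e = 0 := by
  have h := tendsto_integral_diffQuot (w := fun _ => 1) continuous_const hg hgc e
  simp only [one_mul] at h
  refine tendsto_nhds_unique h ?_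
  refine tendsto_const_nhds.congr fun n => ?_
  have hi : Integrable g := hg.continuous.integrable_of_hasCompactSupport hgc
  rw [integral_const_mul, integral_sub (hi.comp_add_right _) hi, integral_add_right_eq_self, sub_self,
    mul_zero]

lemma integral_det_eq_zero {p q : Plane → ℝ} (hp : ContDiff ℝ 1 p) (hpc : HasCompactSupport p)
    (hq : ContDiff ℝ 1 q) (hqc : HasCompactSupport q) (e f : Plane) :
    ∫ x, fderiv ℝ p x e * fderiv ℝ q x f = ∫ x, fderiv ℝ q x e * fderiv ℝ p x f := by
  have hcp : ∀ v, Continuous fun x => fderiv ℝ p x v := fun v =>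
    (hp.continuous_fderiv (by norm_num)).clm_apply continuous_const
  have hcq : ∀ v, Continuous fun x => fderiv ℝ q x v := fun v =>
    (hq.continuous_fderiv (by norm_num)).clm_apply continuous_const
  have h1 := tendsto_integral_diffQuot (hcp e) hq hqc f
  have h2 := (tendsto_integral_diffQuot (hcq e) hp hpc (-f)).neg
  have h3 : ∫ x, fderiv ℝ p x e * fderiv ℝ q x f = -∫ x, fderiv ℝ q x e * fderiv ℝ p x (-f) := by
    refine tendsto_nhds_unique h1 (h2.congr fun n => ?_)
    set r := ((n : ℝ) + 1)
    set k := r⁻¹ • f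
    have hqk : ContDiff ℝ 1 fun x => q (x + k) := hq.comp (contDiff_id.add contDiff_const)
    have hqkc : HasCompactSupport fun x => q (x + k) :=
      hqc.comp_homeomorph (Homeomorph.addRight k)
    have hdd : ContDiff ℝ 1 fun x => r * (q (x + k) - q x) := contDiff_const.mul (hqk.sub hq)
    have hddc : HasCompactSupport fun x => r * (q (x + k) - q x) := (hqkc.sub hqc).mul_left
    have hfd : ∀ x, fderiv ℝ (fun x => r * (q (x + k) - q x)) x e =
        r * (fderiv ℝ q (x + k) e - fderiv ℝ q x e) := by
      intro x
      have a1 : HasFDerivAt (fun x => q (x + k)) (fderiv ℝ q (x + k)) x := by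
        exact ((hq.differentiable (by norm_num) (x + k)).hasFDerivAt.comp x
          ((hasFDerivAt_id x).add_const k)).congr_fderiv (ContinuousLinearMap.comp_id _)
      have a2 := ((a1.sub (hq.differentiable (by norm_num) x).hasFDerivAt).const_mul r).fderiv
      have a3 : fderiv ℝ (fun x => r * (q (x + k) - q x)) x = _ := a2
      rw [a3]; simp
    have hcd : Continuous fun x => fderiv ℝ (fun x => r * (q (x + k) - q x)) x e :=
      (hdd.continuous_fderiv (by norm_num)).clm_apply continuous_const
    have ibp := integral_mul_fderiv_eq_neg_fderiv_mul_of_integrable (μ := volume) (v := e)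
      (f := fun x => r * (q (x + k) - q x)) (g := p)
      ((hcd.mul hp.continuous).integrable_of_hasCompactSupport hpc.mul_left)
      ((hdd.continuous.mul (hcp e)).integrable_of_hasCompactSupport hddc.mul_right)
      ((hdd.continuous.mul hp.continuous).integrable_of_hasCompactSupport hddc.mul_right)
      (fun x _ => hdd.differentiable (by norm_num) x) (fun x _ => hp.differentiable (by norm_num) x)
    have e1 : ∫ x, fderiv ℝ p x e * (r * (q (x + k) - q x)) =
        -∫ x, r * (fderiv ℝ q (x + k) e - fderiv ℝ q x e) * p x := by
      rw [← funext fun x => mul_comm _ (fderiv ℝ p x e)]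
      rw [ibp]; simp only [hfd]
    rw [e1]
    have hi1 : Integrable fun x => fderiv ℝ q x e * p (x + r⁻¹ • -f) := by
      have : Continuous fun x => fderiv ℝ q x e * p (x + r⁻¹ • -f) :=
        (hcq e).mul (hp.continuous.comp (continuous_id.add continuous_const))
      exact this.integrable_of_hasCompactSupport
        (hpc.comp_homeomorph (Homeomorph.addRight (r⁻¹ • -f))).mul_left
    have hi2 : Integrable fun x => fderiv ℝ q x e * p x :=
      ((hcq e).mul hp.continuous).integrable_of_hasCompactSupport hpc.mul_left
    have hi3 : Integrable fun x => fderiv ℝ q (x + k) e * p x :=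
      (((hcq e).comp (continuous_id.add continuous_const)).mul
        hp.continuous).integrable_of_hasCompactSupport hpc.mul_left
    have e2 : ∫ x, fderiv ℝ q (x + k) e * p x = ∫ x, fderiv ℝ q x e * p (x + r⁻¹ • -f) := by
      rw [← integral_add_right_eq_self (fun x => fderiv ℝ q x e * p (x + r⁻¹ • -f)) k]
      congr 1; funext x
      rw [smul_neg, add_assoc, add_neg_cancel, add_zero]
    have e3 : ∫ x, fderiv ℝ q x e * (r * (p (x + r⁻¹ • -f) - p x)) =
        r * ((∫ x, fderiv ℝ q x e * p (x + r⁻¹ • -f)) - ∫ x, fderiv ℝ q x e * p x) := by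
      rw [← integral_sub hi1 hi2, ← integral_const_mul]
      congr 1; funext x; ring
    have e4 : ∫ x, r * (fderiv ℝ q (x + k) e - fderiv ℝ q x e) * p x =
        r * ((∫ x, fderiv ℝ q (x + k) e * p x) - ∫ x, fderiv ℝ q x e * p x) := by
      rw [← integral_sub hi3 hi2, ← integral_const_mul]
      congr 1; funext x; ring
    rw [e3, e4, e2]
  rw [h3, ← integral_neg]; congr 1; funext x; simp

variable {Ω : Set Plane}

/-- A function vanishing near the boundary extends by zero. -/
lemma contDiff_indicator (ho : IsOpen Ω) {E : Type*} [NormedAddCommGroup E] [NormedSpace ℝ E]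
    {f : Plane → E} (hf : CNearCl 1 Ω f) (hz : ∀ x ∈ frontier Ω, ∀ᶠ y in 𝓝 x, f y = 0) :
    ContDiff ℝ 1 (Ω.indicator f) := by
  rw [contDiff_iff_contDiffAt]
  intro x
  by_cases hx : x ∈ Ω
  · refine (hf.contDiffAt (subset_closure hx)).congr_of_eventuallyEq ?_
    filter_upwards [ho.mem_nhds hx] with y hy using indicator_of_mem hy f
  · refine (contDiffAt_const (c := (0 : E))).congr_of_eventuallyEq ?_
    by_cases hx' : x ∈ closure Ω
    · have : x ∈ frontier Ω := by rw [frontier, ho.interior_eq]; exact ⟨hx', hx⟩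
      filter_upwards [hz x this] with y hy
      by_cases h : y ∈ Ω
      · rw [indicator_of_mem h, hy]
      · rw [indicator_of_notMem h]
    · filter_upwards [isClosed_closure.isOpen_compl.mem_nhds hx'] with y hy
      exact indicator_of_notMem (fun h => hy (subset_closure h)) f

lemma hasCompactSupport_indicator (hb : Bornology.IsBounded Ω) {E : Type*} [NormedAddCommGroup E]
    (f : Plane → E) : HasCompactSupport (Ω.indicator f) := by
  refine HasCompactSupport.of_support_subset_isCompact (isCompact_closure_of_bdd hb) ?_
  exact (support_indicator_subset).trans subset_closure

lemma fderiv_indicator (ho : IsOpen Ω) {E : Type*} [NormedAddCommGroup E] [NormedSpace ℝ E]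
    (f : Plane → E) {x : Plane} (hx : x ∈ Ω) : fderiv ℝ (Ω.indicator f) x = fderiv ℝ f x := by
  refine Filter.EventuallyEq.fderiv_eq ?_
  filter_upwards [ho.mem_nhds hx] with y hy using indicator_of_mem hy f

lemma fderiv_indicator_of_not (ho : IsOpen Ω) {E : Type*} [NormedAddCommGroup E] [NormedSpace ℝ E]
    {f : Plane → E} (hz : ∀ x ∈ frontier Ω, ∀ᶠ y in 𝓝 x, f y = 0) {x : Plane} (hx : x ∉ Ω) :
    fderiv ℝ (Ω.indicator f) x = 0 := by
  have : Ω.indicator f =ᶠ[𝓝 x] fun _ => 0 := by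
    by_cases hx' : x ∈ closure Ω
    · have : x ∈ frontier Ω := by rw [frontier, ho.interior_eq]; exact ⟨hx', hx⟩
      filter_upwards [hz x this] with y hy
      by_cases h : y ∈ Ω
      · rw [indicator_of_mem h, hy]
      · rw [indicator_of_notMem h]
    · filter_upwards [isClosed_closure.isOpen_compl.mem_nhds hx'] with y hy
      exact indicator_of_notMem (fun h => hy (subset_closure h)) f
  rw [this.fderiv_eq]; simp

lemma setIntegral_fderiv_eq_zero (ho : IsOpen Ω) (hb : Bornology.IsBounded Ω) {f : Plane → ℝ}
    (hf : CNearCl 1 Ω f) (hz : ∀ x ∈ frontier Ω, ∀ᶠ y in 𝓝 x, f y = 0) (e : Plane) :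
    ∫ x in Ω, fderiv ℝ f x e = 0 := by
  rw [← integral_fderiv_eq_zero (contDiff_indicator ho hf hz) (hasCompactSupport_indicator hb f) e,
    ← integral_indicator ho.measurableSet]
  congr 1; funext x
  by_cases hx : x ∈ Ω
  · rw [indicator_of_mem hx, fderiv_indicator ho f hx]
  · rw [indicator_of_notMem hx, fderiv_indicator_of_not ho hz hx]; rfl

lemma setIntegral_det_eq (ho : IsOpen Ω) (hb : Bornology.IsBounded Ω) {f g : Plane → ℝ}
    (hf : CNearCl 1 Ω f) (hz : ∀ x ∈ frontier Ω, ∀ᶠ y in 𝓝 x, f y = 0)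
    (hg : CNearCl 1 Ω g) (hz' : ∀ x ∈ frontier Ω, ∀ᶠ y in 𝓝 x, g y = 0) (e e' : Plane) :
    ∫ x in Ω, fderiv ℝ f x e * fderiv ℝ g x e' = ∫ x in Ω, fderiv ℝ g x e * fderiv ℝ f x e' := by
  have := integral_det_eq_zero (contDiff_indicator ho hf hz) (hasCompactSupport_indicator hb f)
    (contDiff_indicator ho hg hz') (hasCompactSupport_indicator hb g) e e'
  convert this using 1
  · rw [← integral_indicator ho.measurableSet]
    congr 1; funext x
    by_cases hx : x ∈ Ω
    · rw [indicator_of_mem hx, fderiv_indicator ho f hx, fderiv_indicator ho g hx]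
    · rw [indicator_of_notMem hx, fderiv_indicator_of_not ho hz hx]; simp
  · rw [← integral_indicator ho.measurableSet]
    congr 1; funext x
    by_cases hx : x ∈ Ω
    · rw [indicator_of_mem hx, fderiv_indicator ho f hx, fderiv_indicator ho g hx]
    · rw [indicator_of_notMem hx, fderiv_indicator_of_not ho hz hx]; simp

lemma CNearCl.continuousOn_curl2 {a : Plane → Plane} (ha : CNearCl 1 Ω a) :
    ContinuousOn (curl2 a) (closure Ω) := by
  unfold curl2
  exact (ha.snd.continuousOn_fderiv_apply _).sub (ha.fst.continuousOn_fderiv_apply _)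

/-- The magnetic field bounds the energy from below away from the boundary. -/
lemma interior_lower (ho : IsOpen Ω) (hb : Bornology.IsBounded Ω) {a : Plane → Plane}
    (ha : CNearCl 1 Ω a) {v : Plane → ℂ} (hv : CNearCl 1 Ω v)
    (hz : ∀ x ∈ frontier Ω, ∀ᶠ y in 𝓝 x, v y = 0) :
    ∫ x in Ω, curl2 a x * ‖v x‖ ^ 2 ≤ ∫ x in Ω, en a v x := by
  have hp : CNearCl 1 Ω (fun x => (v x).re) := hv.map Complex.reCLM.contDiff
  have hq : CNearCl 1 Ω (fun x => (v x).im) := hv.map Complex.imCLM.contDiff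
  have hn : CNearCl 1 Ω (fun x => (v x).re ^ 2 + (v x).im ^ 2) :=
    (hp.map (g := fun y => y ^ 2) (by fun_prop)).add (hq.map (g := fun y => y ^ 2) (by fun_prop))
  have hmul : ∀ {f g : Plane → ℝ}, CNearCl 1 Ω f → CNearCl 1 Ω g →
      CNearCl 1 Ω (fun x => f x * g x) := fun hf hg =>
    (hf.prodMk hg).map (g := fun y : ℝ × ℝ => y.1 * y.2) (by fun_prop)
  set e₁ : Plane := ((1 : ℝ), (0 : ℝ)) with he₁
  set e₂ : Plane := ((0 : ℝ), (1 : ℝ)) with he₂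
  set g1 : Plane → ℝ := fun x => (a x).1 * ((v x).re ^ 2 + (v x).im ^ 2) with hg1
  set g2 : Plane → ℝ := fun x => (a x).2 * ((v x).re ^ 2 + (v x).im ^ 2) with hg2
  have hG1 : CNearCl 1 Ω g1 := hmul ha.fst hn
  have hG2 : CNearCl 1 Ω g2 := hmul ha.snd hn
  have z1 := setIntegral_fderiv_eq_zero ho hb hG1 (fun x hx => (hz x hx).mono fun y hy => by
    simp [hg1, hy]) e₂
  have z2 := setIntegral_fderiv_eq_zero ho hb hG2 (fun x hx => (hz x hx).mono fun y hy => by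
    simp [hg2, hy]) e₁
  have z3 := setIntegral_det_eq ho hb hp (fun x hx => (hz x hx).mono fun y hy => by simp [hy])
    hq (fun x hx => (hz x hx).mono fun y hy => by simp [hy]) e₁ e₂
  have int : ∀ {f : Plane → ℝ}, ContinuousOn f (closure Ω) → IntegrableOn f Ω := fun h =>
    integrableOn_of_continuousOn_closure hb h
  have i1 := int (hG1.continuousOn_fderiv_apply e₂)
  have i2 := int (hG2.continuousOn_fderiv_apply e₁)
  have i3 := int ((hp.continuousOn_fderiv_apply e₁).mul (hq.continuousOn_fderiv_apply e₂))
  have i4 := int ((hq.continuousOn_fderiv_apply e₁).mul (hp.continuousOn_fderiv_apply e₂))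
  have i5 : IntegrableOn (fun x => curl2 a x * ‖v x‖ ^ 2) Ω :=
    int (ha.continuousOn_curl2.mul (hv.continuousOn.norm.pow 2))
  have i6 := integrableOn_en hb ha.continuousOn hv
  have key : ∫ x in Ω, (curl2 a x * ‖v x‖ ^ 2 + (2 * (fderiv ℝ (fun x => (v x).re) x e₁ *
      fderiv ℝ (fun x => (v x).im) x e₂ - fderiv ℝ (fun x => (v x).im) x e₁ *
      fderiv ℝ (fun x => (v x).re) x e₂) - fderiv ℝ g2 x e₁ + fderiv ℝ g1 x e₂)) ≤
      ∫ x in Ω, en a v x := by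
    refine setIntegral_mono_on ?_ i6 ho.measurableSet fun x hx => ?_
    · exact i5.add ((((i3.sub i4).const_mul 2).sub i2).add i1)
    · have hxc := subset_closure hx
      have hvd := hv.differentiableAt hxc
      have d1 : ∀ e, fderiv ℝ (fun x => (v x).re) x e = (fderiv ℝ v x e).re := fun e => by
        have := (Complex.reCLM.hasFDerivAt.comp x hvd.hasFDerivAt).fderiv
        have h' : fderiv ℝ (fun x => (v x).re) x = _ := this
        rw [h']; simp
      have d2 : ∀ e, fderiv ℝ (fun x => (v x).im) x e = (fderiv ℝ v x e).im := fun e => by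
        have := (Complex.imCLM.hasFDerivAt.comp x hvd.hasFDerivAt).fderiv
        have h' : fderiv ℝ (fun x => (v x).im) x = _ := this
        rw [h']; simp
      have hpd := (hp.differentiableAt hxc).hasFDerivAt
      have hqd := (hq.differentiableAt hxc).hasFDerivAt
      have d3 : ∀ (f : Plane → ℝ), CNearCl 1 Ω f → ∀ e,
          fderiv ℝ (fun x => f x * ((v x).re ^ 2 + (v x).im ^ 2)) x e =
          fderiv ℝ f x e * ((v x).re ^ 2 + (v x).im ^ 2) + f x * (2 * (v x).re *
            (fderiv ℝ v x e).re + 2 * (v x).im * (fderiv ℝ v x e).im) := fun f hf e => by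
        have := ((hf.differentiableAt hxc).hasFDerivAt.mul ((hpd.pow 2).add (hqd.pow 2))).fderiv
        have h' : fderiv ℝ (fun x => f x * ((v x).re ^ 2 + (v x).im ^ 2)) x = _ := this
        rw [h']; simp [d1, d2]; ring
      rw [d1, d1, d2, d2, hg1, hg2, d3 _ ha.fst, d3 _ ha.snd, nsq, en, Dx, Dy, nsq, nsq, curl2]
      set D1 := fderiv ℝ v x ((1 : ℝ), (0 : ℝ))
      set D2 := fderiv ℝ v x ((0 : ℝ), (1 : ℝ))
      simp
      nlinarith [sq_nonneg (D1.im - (a x).1 * (v x).re + D2.re + (a x).2 * (v x).im),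
        sq_nonneg (-D1.re - (a x).1 * (v x).im + D2.im - (a x).2 * (v x).re)]
  have j : IntegrableOn (fun x => 2 * (fderiv ℝ (fun x => (v x).re) x e₁ *
      fderiv ℝ (fun x => (v x).im) x e₂ - fderiv ℝ (fun x => (v x).im) x e₁ *
      fderiv ℝ (fun x => (v x).re) x e₂) - fderiv ℝ g2 x e₁ + fderiv ℝ g1 x e₂) Ω :=
    (((i3.sub i4).const_mul 2).sub i2).add i1
  have hS : ∫ x in Ω, (2 * (fderiv ℝ (fun x => (v x).re) x e₁ *
      fderiv ℝ (fun x => (v x).im) x e₂ - fderiv ℝ (fun x => (v x).im) x e₁ *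
      fderiv ℝ (fun x => (v x).re) x e₂) - fderiv ℝ g2 x e₁ + fderiv ℝ g1 x e₂) = 0 := by
    have a1 := integral_add (((i3.sub i4).const_mul 2).sub i2) i1
    have a2 := integral_sub ((i3.sub i4).const_mul 2) i2
    have a3 := integral_const_mul (μ := volume.restrict Ω) 2 (fun x =>
      fderiv ℝ (fun x => (v x).re) x e₁ * fderiv ℝ (fun x => (v x).im) x e₂ -
        fderiv ℝ (fun x => (v x).im) x e₁ * fderiv ℝ (fun x => (v x).re) x e₂)
    have a4 : ∫ x in Ω, (fderiv ℝ (fun x => (v x).re) x e₁ * fderiv ℝ (fun x => (v x).im) x e₂ -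
        fderiv ℝ (fun x => (v x).im) x e₁ * fderiv ℝ (fun x => (v x).re) x e₂) = _ :=
      integral_sub i3 i4
    simp only [Pi.sub_apply] at a1 a2 a3 a4
    refine a1.trans ?_
    rw [z1, add_zero]
    refine a2.trans ?_
    rw [z2, sub_zero]
    refine a3.trans ?_
    rw [a4, z3, sub_self, mul_zero]
  have := integral_add i5 j
  linarith [this, hS, key]

end SC

namespace SC

lemma setIntegral_cell {L c : ℝ} (hL : 0 ≤ L) (hc : 0 ≤ c) {f : ℝ × ℝ → ℝ} (hf : Continuous f) :
    (∫ p in Ico 0 L ×ˢ Ioo (0 : ℝ) c, f p) = ∫ t in (0 : ℝ)..c, ∫ s in (0 : ℝ)..L, f (s, t) := by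
  have hi : IntegrableOn f (Ico 0 L ×ˢ Ioo (0 : ℝ) c) :=
    (hf.continuousOn.integrableOn_compact (isCompact_Icc.prod isCompact_Icc)).mono_set
      (prod_mono Ico_subset_Icc_self Ioo_subset_Icc_self)
  rw [Measure.volume_eq_prod] at hi ⊢
  rw [← setIntegral_prod_swap]
  have hi' : IntegrableOn (fun z : ℝ × ℝ => f z.swap) (Ioo (0 : ℝ) c ×ˢ Ico 0 L)
      ((volume : Measure ℝ).prod volume) := by
    have := ((hf.comp continuous_swap).continuousOn.integrableOn_compact (μ := (volume : Measure ℝ).prod volume)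
      (isCompact_Icc.prod isCompact_Icc)).mono_set
      (prod_mono (Ioo_subset_Icc_self (a := (0 : ℝ)) (b := c)) (Ico_subset_Icc_self (a := L) (b := (0 : ℝ))))
    exact this
  rw [setIntegral_prod _ hi', intervalIntegral.integral_of_le hc, integral_Ioc_eq_integral_Ioo]
  refine setIntegral_congr_fun measurableSet_Ioo fun t _ => ?_
  simp only [Prod.swap_prod_mk]
  rw [intervalIntegral.integral_of_le hL, integral_Ico_eq_integral_Ioc]

lemma integrableOn_cell {L c : ℝ} {f : ℝ × ℝ → ℝ} (hf : Continuous f) :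
    IntegrableOn f (Ico 0 L ×ˢ Ioo (0 : ℝ) c) :=
  (hf.continuousOn.integrableOn_compact (isCompact_Icc.prod isCompact_Icc)).mono_set
    (prod_mono Ico_subset_Icc_self Ioo_subset_Icc_self)

lemma norm_sub_sq_ge (X Y : ℂ) {δ : ℝ} (hδ : 0 < δ) :
    (1 - δ) * ‖X‖ ^ 2 - δ⁻¹ * ‖Y‖ ^ 2 ≤ ‖X - Y‖ ^ 2 := by
  have h := norm_sub_norm_le X Y
  have h' : (‖X‖ - ‖Y‖) ^ 2 ≤ ‖X - Y‖ ^ 2 := by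
    apply sq_le_sq'
    · have := norm_sub_norm_le Y X
      rw [norm_sub_rev] at this; linarith
    · exact h
  have h1 : 2 * (‖X‖ * ‖Y‖) ≤ δ * ‖X‖ ^ 2 + δ⁻¹ * ‖Y‖ ^ 2 := by
    have : 0 ≤ δ⁻¹ * (δ * ‖X‖ - ‖Y‖) ^ 2 := by positivity
    have e : δ⁻¹ * (δ * ‖X‖ - ‖Y‖) ^ 2 =
      δ * ‖X‖ ^ 2 + δ⁻¹ * ‖Y‖ ^ 2 - 2 * (‖X‖ * ‖Y‖) := by
      field_simp; ring
    linarith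
  nlinarith [sq_nonneg ‖Y‖]

lemma strip_scalar {k δ J a x W Z : ℝ} (hk : 0 ≤ k) (hk1 : k ≤ 1 / 4) (hδ : 0 ≤ δ)
    (h1 : 1 - k ≤ J) (h2 : J ≤ 1 + k) (ha : 0 ≤ a) (hZ : (1 - δ) * x - W ≤ Z) (hZ0 : 0 ≤ Z) :
    (1 - k) * ((1 - δ) * (a + x)) - (1 - k) * W ≤ J * (a + (J ^ 2)⁻¹ * Z) := by
  have hJ0 : 0 < J := by linarith
  have hinv : 1 - k ≤ J * (J ^ 2)⁻¹ := by
    have e : J * (J ^ 2)⁻¹ = 1 / J := by field_simp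
    rw [e, le_div_iff₀ hJ0]
    nlinarith [mul_nonneg (show 0 ≤ 1 - k by linarith) (sub_nonneg.2 h2)]
  have f1 := mul_le_mul_of_nonneg_right hinv hZ0
  have f2 := mul_le_mul_of_nonneg_left hZ (show 0 ≤ 1 - k by linarith)
  have f3 := mul_le_mul_of_nonneg_right h1 ha
  have f4 : 0 ≤ (1 - k) * (δ * a) := mul_nonneg (by linarith) (mul_nonneg hδ ha)
  linarith

lemma strip_scalar' {k δ T D N M E1 E E2 : ℝ} (hk1 : k ≤ 1 / 4) (hδ : δ ≤ 1)
    (hT : 0 ≤ T) (hD : 0 ≤ D) (hM : 0 ≤ M) (h1 : N ≤ (1 + k) * M) (h2 : (1 - k) * M ≤ N)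
    (h3 : T * M ≤ E1) (h4 : (1 - k) * ((1 - δ) * E1) - (1 - k) * (D / 4) * M ≤ E) (h5 : E ≤ E2) :
    ((1 - k) ^ 2 * (1 - δ) * T - D) * N ≤ E2 := by
  have hk0 : 0 ≤ 1 - k := by linarith
  have hN : 0 ≤ N := le_trans (mul_nonneg hk0 hM) h2
  have a1 : (1 - k) * N ≤ M := by
    have := mul_le_mul_of_nonneg_left h1 hk0
    nlinarith [mul_nonneg (sq_nonneg k) hM]
  have a2 := mul_le_mul_of_nonneg_left a1
    (mul_nonneg (mul_nonneg hk0 (show 0 ≤ 1 - δ by linarith)) hT)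
  have a3 := mul_le_mul_of_nonneg_left h3 (mul_nonneg hk0 (show 0 ≤ 1 - δ by linarith))
  have a4 := mul_le_mul_of_nonneg_left h2 hD
  have a5 := mul_nonneg hD hN
  linarith

namespace BoundaryParam
namespace Collar

variable {Ω : Set Plane} {P : BoundaryParam Ω} {t₀ : ℝ} (hc : P.Collar t₀)

include hc

/-- A function near the closure extends smoothly in boundary coordinates across the boundary. -/
lemma exists_strip_fun (ho : IsOpen Ω) {v : Plane → ℂ} (hv : CNearCl 1 Ω v) {c : ℝ}
    (hc0 : 0 < c) (hct : c ≤ t₀ / 4) (hz : ∀ x ∈ Ω, c ≤ P.dst t₀ x → v x = 0) :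
    ∃ F : ℝ × ℝ → ℂ, ContDiff ℝ 1 F ∧ P.PerS F ∧ (∀ s t, c ≤ t → F (s, t) = 0) ∧
      ∀ p : ℝ × ℝ, p.2 ∈ Ioo 0 c → F =ᶠ[𝓝 p] fun q => v (P.Psi q) := by
  obtain ⟨U, hU, hcl, hvU⟩ := hv
  have ht := hc.pos
  obtain ⟨σ, hσ, hσU⟩ : ∃ σ > 0, ∀ s t, -σ < t → t ≤ 0 → P.Psi (s, t) ∈ U := by
    have h1 : IsOpen (P.Psi ⁻¹' U) := hU.preimage P.continuous_Psi
    have h2 : Icc 0 P.L ×ˢ {(0 : ℝ)} ⊆ P.Psi ⁻¹' U := by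
      rintro ⟨s, t⟩ ⟨-, ht'⟩
      rw [mem_singleton_iff] at ht'
      subst ht'
      exact hcl (hc.Psi_mem_closure ho (by simpa [strip] using ht) le_rfl)
    obtain ⟨V, W, hV, hW, hV', hW', hVW⟩ :=
      generalized_tube_lemma isCompact_Icc isCompact_singleton h1 h2
    obtain ⟨σ, hσ, hb⟩ := Metric.isOpen_iff.1 hW 0 (hW' rfl)
    refine ⟨σ, hσ, fun s t h h' => ?_⟩
    obtain ⟨n, hn⟩ : ∃ n : ℤ, s + n * P.L ∈ Icc 0 P.L := by
      obtain ⟨m, hm, -⟩ := existsUnique_add_zsmul_mem_Ico P.L_pos s 0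
      refine ⟨m, ?_⟩
      rw [zsmul_eq_mul, zero_add] at hm
      exact ⟨hm.1, hm.2.le⟩
    rw [← P.Psi_per s t n]
    refine hVW ⟨hV' hn, hb ?_⟩
    rw [Metric.mem_ball, dist_zero_right, Real.norm_eq_abs, abs_lt]
    constructor <;> linarith
  set ρ : ℝ → ℝ := fun t => Real.smoothTransition ((t + σ / 2) / (σ / 2)) with hρ
  have hρs : ContDiff ℝ 1 ρ :=
    Real.smoothTransition.contDiff.comp ((contDiff_id.add contDiff_const).div_const _)
  have hρ1 : ∀ t, 0 ≤ t → ρ t = 1 := fun t h =>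
    Real.smoothTransition.one_of_one_le (by rw [le_div_iff₀ (by positivity)]; linarith)
  have hρ0 : ∀ t, t ≤ -(σ / 2) → ρ t = 0 := fun t h =>
    Real.smoothTransition.zero_of_nonpos (div_nonpos_of_nonpos_of_nonneg (by linarith) (by positivity))
  refine ⟨fun p => ((ρ p.2 * xi (t₀ / 2) p.2 : ℝ) : ℂ) * v (P.Psi p), ?_, ?_, ?_, ?_⟩
  · refine contDiff_iff_contDiffAt.2 fun p => ?_
    by_cases h1 : p.2 < -(σ / 2)
    · have : (fun p : ℝ × ℝ => ((ρ p.2 * xi (t₀ / 2) p.2 : ℝ) : ℂ) * v (P.Psi p)) =ᶠ[𝓝 p]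
          fun _ => 0 := by
        filter_upwards [(isOpen_lt continuous_snd continuous_const).mem_nhds h1] with q hq
        have hq' : q.2 < -(σ / 2) := hq
        rw [hρ0 _ hq'.le]; simp
      exact contDiffAt_const.congr_of_eventuallyEq this
    by_cases h2 : t₀ / 2 < p.2
    · have : (fun p : ℝ × ℝ => ((ρ p.2 * xi (t₀ / 2) p.2 : ℝ) : ℂ) * v (P.Psi p)) =ᶠ[𝓝 p]
          fun _ => 0 := by
        filter_upwards [(isOpen_lt continuous_const continuous_snd).mem_nhds h2] with q hq
        have hq' : t₀ / 2 < q.2 := hq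
        rw [xi_zero (by positivity) hq'.le]; simp
      exact contDiffAt_const.congr_of_eventuallyEq this
    push Not at h1 h2
    have hpU : P.Psi p ∈ U := by
      by_cases h0 : 0 ≤ p.2
      · exact hcl (hc.Psi_mem_closure ho (by rw [strip, mem_ofPred_eq, abs_of_nonneg h0]; linarith) h0)
      · exact hσU p.1 p.2 (by linarith) (not_le.1 h0).le
    have a1 : ContDiffAt ℝ 1 (fun q : ℝ × ℝ => v (P.Psi q)) p :=
      (hvU.contDiffAt (hU.mem_nhds hpU)).comp p (P.contDiff_Psi.of_le (mod_cast le_top)).contDiffAt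
    have a2 : ContDiff ℝ 1 fun q : ℝ × ℝ => ((ρ q.2 * xi (t₀ / 2) q.2 : ℝ) : ℂ) :=
      Complex.ofRealCLM.contDiff.comp
        ((hρs.comp contDiff_snd).mul ((contDiff_xi (t₀ / 2) (n := 1)).comp contDiff_snd))
    exact a2.contDiffAt.mul a1
  · intro s t
    have := P.Psi_per s t 1
    rw [Int.cast_one, one_mul] at this
    simp only [this]
  · intro s t h
    by_cases h2 : t₀ / 2 ≤ t
    · simp only; rw [xi_zero (by positivity) h2]; simp
    · push Not at h2
      have hs : ((s, t) : ℝ × ℝ) ∈ strip t₀ := by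
        rw [strip, mem_ofPred_eq, abs_of_nonneg (by simp only; linarith)]; simp only; linarith
      have : v (P.Psi (s, t)) = 0 := by
        refine hz _ ((hc.Psi_mem_iff hs).2 (by simp only; linarith)) ?_
        rw [hc.dst_Psi_low hs h2.le]; exact h
      simp only [this, mul_zero]
  · intro p hp
    filter_upwards [(isOpen_Ioo.preimage continuous_snd).mem_nhds hp] with q hq
    have hq' : q.2 ∈ Ioo 0 c := hq
    rw [hρ1 _ hq'.1.le, xi_one (by positivity) (by linarith [hq'.2])]
    simp

lemma strip_bound (ho : IsOpen Ω) (hb : Bornology.IsBounded Ω) {K : ℝ} (hK0 : 0 < K)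
    (hK : ∀ s, |P.kap s| ≤ K) {v : Plane → ℂ} (hv : CNearCl 1 Ω v) {c : ℝ}
    (hc0 : 0 < c) (hct : c ≤ t₀ / 4) (hKc : K * c ≤ 1 / 4)
    (hz : ∀ x ∈ Ω, c ≤ P.dst t₀ x → v x = 0) {B δ : ℝ} (hB : 0 < B) (hδ : 0 < δ) (hδ1 : δ < 1) :
    ((1 - K * c) ^ 2 * (1 - δ) * Th * B - δ⁻¹ * B ^ 2 * K ^ 2 * c ^ 4) *
      ∫ x in Ω, ‖v x‖ ^ 2 ≤ ∫ x in Ω, en (fun y => B • P.G t₀ y) v x := by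
  have ht := hc.pos
  obtain ⟨F, hF, hFp, hF0, hFv⟩ := hc.exists_strip_fun ho hv hc0 hct hz
  have hct' : c ≤ t₀ := by linarith
  set S := P.Psi '' (univ ×ˢ Ioo (0 : ℝ) c) with hS
  have hSm : MeasurableSet S := (hc.isOpen_inner hct').measurableSet
  have hSΩ : S ⊆ Ω := hc.inner_subset hct'
  set Fs : ℝ × ℝ → ℂ := fun p => fderiv ℝ F p (1, 0) with hFs
  set Ft : ℝ × ℝ → ℂ := fun p => fderiv ℝ F p (0, 1) with hFt
  have cF : Continuous F := hF.continuous
  have cFs : Continuous Fs := (hF.continuous_fderiv (by norm_num)).clm_apply continuous_const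
  have cFt : Continuous Ft := (hF.continuous_fderiv (by norm_num)).clm_apply continuous_const
  have hFd : ∀ p, HasFDerivAt F (fderiv ℝ F p) p := fun p =>
    (hF.differentiable (by norm_num) p).hasFDerivAt
  set b := B * (P.area / P.L) with hbdef
  have hstrip : Strip P.L c (fun t s => F (s, t)) (fun t s => Fs (s, t)) (fun t s => Ft (s, t)) := by
    constructor
    · exact cF.comp continuous_swap
    · exact cFs.comp continuous_swap
    · exact cFt.comp continuous_swap
    · intro t s
      exact (hFd (s, t)).comp_hasDerivAt s ((hasDerivAt_id s).prodMk (hasDerivAt_const s t))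
    · intro t s
      exact (hFd (s, t)).comp_hasDerivAt t ((hasDerivAt_const t s).prodMk (hasDerivAt_id t))
    · intro t
      have := hFp 0 t
      rwa [zero_add] at this
    · intro t s h
      exact hF0 s t h
  have hlow := strip_lower hstrip P.L_pos hc0 hB b
  set X : ℝ × ℝ → ℂ := fun p => -Complex.I * Fs p - ((b - B * p.2 : ℝ) : ℂ) * F p with hX
  have cX : Continuous X := by fun_prop
  set h2 : ℝ × ℝ → ℝ := fun p => ‖F p‖ ^ 2 with hh2
  set h1 : ℝ × ℝ → ℝ := fun p => ‖Ft p‖ ^ 2 + ‖X p‖ ^ 2 with hh1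
  have ch1 : Continuous h1 := by fun_prop
  have ch2 : Continuous h2 := by fun_prop
  rw [← setIntegral_cell P.L_pos.le hc0.le ch2, ← setIntegral_cell P.L_pos.le hc0.le ch1] at hlow
  set C : Set (ℝ × ℝ) := Ico 0 P.L ×ˢ Ioo (0 : ℝ) c with hC
  have hCm : MeasurableSet C := measurableSet_Ico.prod measurableSet_Ioo
  have hcellS : ∀ p ∈ C, p ∈ strip t₀ := fun p hp => cell_subset_strip hct' hp.2
  have hJ : ∀ p ∈ C, |p.2 * P.kap p.1| ≤ K * c := by
    intro p hp
    rw [abs_mul, mul_comm K c, abs_of_pos hp.2.1]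
    exact mul_le_mul hp.2.2.le (hK _) (abs_nonneg _) hc0.le
  have hchain : ∀ p ∈ C, ∀ w, fderiv ℝ v (P.Psi p) (P.DPsi p w) = fderiv ℝ F p w := by
    intro p hp w
    rw [(hFv p hp.2).fderiv_eq]
    have h := ((hv.differentiableAt (subset_closure (hSΩ ⟨p, ⟨trivial, hp.2⟩, rfl⟩))).hasFDerivAt.comp p
      (P.hasFDerivAt_Psi p)).fderiv
    have h' : fderiv ℝ (fun q => v (P.Psi q)) p = _ := h
    rw [h']; rfl
  -- mass
  have hmass : (∫ x in Ω, ‖v x‖ ^ 2) = ∫ p in C, (1 - p.2 * P.kap p.1) * h2 p := by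
    have e1 : (∫ x in Ω, ‖v x‖ ^ 2) = ∫ x in S, ‖v x‖ ^ 2 := by
      refine (setIntegral_eq_of_subset_of_forall_sdiff_eq_zero ho.measurableSet hSΩ fun x hx => ?_)
      have : c ≤ P.dst t₀ x := by
        by_contra h
        exact hx.2 (hc.mem_inner_of_dst_lt hx.1 hct' (not_le.1 h))
      rw [hz x hx.1 this]; simp
    rw [e1, hc.integral_inner hct']
    refine setIntegral_congr_fun hCm fun p hp => ?_
    simp only [hh2, smul_eq_mul]
    rw [(hFv p hp.2).eq_of_nhds]
  have ckap : Continuous fun p : ℝ × ℝ => 1 - p.2 * P.kap p.1 :=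
    continuous_const.sub (continuous_snd.mul (P.contDiff_kap.continuous.comp continuous_fst))
  have ih2 : IntegrableOn h2 C := integrableOn_cell ch2
  have ih1 : IntegrableOn h1 C := integrableOn_cell ch1
  have hN0 : 0 ≤ ∫ p in C, h2 p := setIntegral_nonneg hCm fun p _ => sq_nonneg _
  have hmass_le : (∫ x in Ω, ‖v x‖ ^ 2) ≤ (1 + K * c) * ∫ p in C, h2 p := by
    rw [hmass, ← integral_const_mul]
    refine setIntegral_mono_on (integrableOn_cell (ckap.mul ch2)) (ih2.const_mul _) hCm fun p hp => ?_
    have := (abs_le.1 (hJ p hp)).1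
    exact mul_le_mul_of_nonneg_right (by linarith) (sq_nonneg _)
  have hmass_ge : (1 - K * c) * (∫ p in C, h2 p) ≤ ∫ x in Ω, ‖v x‖ ^ 2 := by
    rw [hmass, ← integral_const_mul]
    refine setIntegral_mono_on (ih2.const_mul _) (integrableOn_cell (ckap.mul ch2)) hCm fun p hp => ?_
    have := (abs_le.1 (hJ p hp)).2
    exact mul_le_mul_of_nonneg_right (by linarith) (sq_nonneg _)
  -- energy
  have hien : IntegrableOn (en (fun y => B • P.G t₀ y) v) Ω :=
    integrableOn_en hb ((hc.continuousOn_G ho).const_smul B) hv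
  have henS : (∫ x in S, en (fun y => B • P.G t₀ y) v x) ≤
      ∫ x in Ω, en (fun y => B • P.G t₀ y) v x :=
    setIntegral_mono_set hien (ae_of_all _ fun x => en_nonneg _ _ _) hSΩ.eventuallyLE
  have hpt : ∀ p ∈ C, (1 - K * c) * ((1 - δ) * h1 p) - (1 - K * c) * (δ⁻¹ * B ^ 2 * K ^ 2 * c ^ 4 / 4) * h2 p ≤
      (1 - p.2 * P.kap p.1) • en (fun y => B • P.G t₀ y) v (P.Psi p) := by
    intro p hp
    have hJp := abs_le.1 (hJ p hp)
    set J := 1 - p.2 * P.kap p.1 with hJdef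
    have hJ1 : 1 - K * c ≤ J := by linarith
    have hJ2 : J ≤ 1 + K * c := by linarith
    have hJ0 : 0 < J := by nlinarith
    have e := en_coord (P := P) (fun y => B • P.G t₀ y) v p hJ0.ne'
    have hG : ∀ w, dot2 (B • P.G t₀ (P.Psi p)) (P.DPsi p w) =
        B * ((P.area / P.L - p.2 + P.kap p.1 * p.2 ^ 2 / 2) * w.1) := by
      intro w
      rw [← hc.G_coord (hcellS p hp) (by linarith [hp.2.2]) w]
      simp [dot2]; ring
    rw [hchain p hp, hchain p hp, hG, hG, ← (hFv p hp.2).eq_of_nhds] at e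
    rw [e, smul_eq_mul]
    have eX : (-Complex.I) * fderiv ℝ F p (1, 0) -
        ((B * ((P.area / P.L - p.2 + P.kap p.1 * p.2 ^ 2 / 2) * ((1 : ℝ), (0 : ℝ)).1) : ℝ) : ℂ) * F p =
        X p - ((B * (P.kap p.1 * p.2 ^ 2 / 2) : ℝ) : ℂ) * F p := by
      simp only [hX, hFs, hbdef]; push_cast; ring
    have eT : (-Complex.I) * fderiv ℝ F p (0, 1) -
        ((B * ((P.area / P.L - p.2 + P.kap p.1 * p.2 ^ 2 / 2) * ((0 : ℝ), (1 : ℝ)).1) : ℝ) : ℂ) * F p =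
        (-Complex.I) * Ft p := by
      simp [hFt]
    rw [eX, eT, norm_mul, norm_neg, Complex.norm_I, one_mul]
    set Y := ((B * (P.kap p.1 * p.2 ^ 2 / 2) : ℝ) : ℂ) * F p with hY
    have hYn : ‖Y‖ ^ 2 ≤ B ^ 2 * K ^ 2 * c ^ 4 / 4 * h2 p := by
      rw [hY, norm_mul, mul_pow, Complex.norm_real, Real.norm_eq_abs, sq_abs]
      refine mul_le_mul_of_nonneg_right ?_ (sq_nonneg _)
      have a1 : P.kap p.1 ^ 2 ≤ K ^ 2 := by
        rw [← sq_abs]; exact pow_le_pow_left₀ (abs_nonneg _) (hK _) 2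
      have a2 : p.2 ^ 4 ≤ c ^ 4 := pow_le_pow_left₀ hp.2.1.le hp.2.2.le 4
      have a3 : P.kap p.1 ^ 2 * p.2 ^ 4 ≤ K ^ 2 * c ^ 4 := mul_le_mul a1 a2 (by positivity) (by positivity)
      nlinarith [sq_nonneg B, mul_le_mul_of_nonneg_left a3 (sq_nonneg B)]
    have hXY := norm_sub_sq_ge (X p) Y hδ
    have hXY' : (1 - δ) * ‖X p‖ ^ 2 - δ⁻¹ * (B ^ 2 * K ^ 2 * c ^ 4 / 4 * h2 p) ≤ ‖X p - Y‖ ^ 2 := by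
      have := mul_le_mul_of_nonneg_left hYn (inv_nonneg.2 hδ.le)
      linarith
    simp only [hh1]
    have := strip_scalar (mul_pos hK0 hc0).le hKc hδ.le hJ1 hJ2 (sq_nonneg ‖Ft p‖) hXY' (sq_nonneg ‖X p - Y‖)
    calc _ = (1 - K * c) * ((1 - δ) * (‖Ft p‖ ^ 2 + ‖X p‖ ^ 2)) - (1 - K * c) *
          (δ⁻¹ * (B ^ 2 * K ^ 2 * c ^ 4 / 4 * h2 p)) := by ring
      _ ≤ _ := this
  have hen : (1 - K * c) * ((1 - δ) * ∫ p in C, h1 p) -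
      (1 - K * c) * (δ⁻¹ * B ^ 2 * K ^ 2 * c ^ 4 / 4) * (∫ p in C, h2 p) ≤
      ∫ x in S, en (fun y => B • P.G t₀ y) v x := by
    rw [hc.integral_inner hct']
    have i1 : IntegrableOn (fun p => (1 - K * c) * ((1 - δ) * h1 p)) C :=
      (ih1.const_mul _).const_mul _
    have i2 : IntegrableOn (fun p => (1 - K * c) * (δ⁻¹ * B ^ 2 * K ^ 2 * c ^ 4 / 4) * h2 p) C :=
      ih2.const_mul _
    have e : (1 - K * c) * ((1 - δ) * ∫ p in C, h1 p) -
      (1 - K * c) * (δ⁻¹ * B ^ 2 * K ^ 2 * c ^ 4 / 4) * (∫ p in C, h2 p) =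
      ∫ p in C, ((1 - K * c) * ((1 - δ) * h1 p) -
        (1 - K * c) * (δ⁻¹ * B ^ 2 * K ^ 2 * c ^ 4 / 4) * h2 p) := by
      rw [integral_sub i1 i2, integral_const_mul, integral_const_mul, integral_const_mul]
    rw [e]
    exact setIntegral_mono_on (i1.sub i2)
      ((hc.integrableOn_inner hct').1 (hien.mono_set hSΩ)) hCm hpt
  have hk : 0 < K * c := mul_pos hK0 hc0
  have hTh : 0 < Th := by linarith [half_lt_Th]
  have := strip_scalar' (D := δ⁻¹ * B ^ 2 * K ^ 2 * c ^ 4) hKc hδ1.le (mul_pos hTh hB).le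
    (by positivity) hN0 hmass_le hmass_ge hlow hen henS
  rwa [← mul_assoc] at this

end Collar
end BoundaryParam
end SC

namespace SC

section
variable {Ω : Set Plane}

lemma integrableOn_gsq_nsq (hb : Bornology.IsBounded Ω) {f : Plane → ℝ} {u : Plane → ℂ}
    (hf : CNearCl 1 Ω f) (hu : CNearCl 1 Ω u) : IntegrableOn (fun x => gsq f x * ‖u x‖ ^ 2) Ω :=
  integrableOn_of_continuousOn_closure hb ((continuousOn_gsq hf).mul (hu.continuousOn.norm.pow 2))

lemma integral_ims (ho : IsOpen Ω) (hb : Bornology.IsBounded Ω) {a : Plane → Plane}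
    (ha : ContinuousOn a (closure Ω)) {f g : Plane → ℝ} {u : Plane → ℂ} {M : ℝ}
    (hf : CNearCl 1 Ω f) (hg : CNearCl 1 Ω g) (hu : CNearCl 1 Ω u)
    (h : ∀ x ∈ Ω, f x ^ 2 + g x ^ 2 = M) :
    (∫ x in Ω, en a (fun y => (f y : ℂ) * u y) x) + (∫ x in Ω, en a (fun y => (g y : ℂ) * u y) x) =
      M * (∫ x in Ω, en a u x) + ∫ x in Ω, (gsq f x * ‖u x‖ ^ 2 + gsq g x * ‖u x‖ ^ 2) := by
  have i1 := integrableOn_en hb ha (hf.ofReal_mul hu)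
  have i2 := integrableOn_en hb ha (hg.ofReal_mul hu)
  have i3 := integrableOn_en hb ha hu
  have i4 : IntegrableOn (fun x => gsq f x * ‖u x‖ ^ 2 + gsq g x * ‖u x‖ ^ 2) Ω :=
    (integrableOn_gsq_nsq hb hf hu).add (integrableOn_gsq_nsq hb hg hu)
  rw [← integral_add i1 i2, ← integral_const_mul, ← integral_add (i3.const_mul M) i4]
  refine setIntegral_congr_fun ho.measurableSet fun x hx => ?_
  have hx' := subset_closure hx
  have := en_ims a (hf.differentiableAt hx') (hg.differentiableAt hx') (hu.differentiableAt hx')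
    (by filter_upwards [ho.mem_nhds hx] with y hy using h y hy)
  linarith

lemma integral_nsq_add (ho : IsOpen Ω) (hb : Bornology.IsBounded Ω) {f g : Plane → ℝ}
    {u : Plane → ℂ} {M : ℝ} (hf : CNearCl 1 Ω f) (hg : CNearCl 1 Ω g) (hu : CNearCl 1 Ω u)
    (h : ∀ x ∈ Ω, f x ^ 2 + g x ^ 2 = M) :
    (∫ x in Ω, ‖(f x : ℂ) * u x‖ ^ 2) + (∫ x in Ω, ‖(g x : ℂ) * u x‖ ^ 2) =
      M * ∫ x in Ω, ‖u x‖ ^ 2 := by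
  rw [← integral_add (integrableOn_nsq hb (hf.ofReal_mul hu)) (integrableOn_nsq hb (hg.ofReal_mul hu)),
    ← integral_const_mul]
  refine setIntegral_congr_fun ho.measurableSet fun x hx => ?_
  simp only [norm_mul, Complex.norm_real, Real.norm_eq_abs, mul_pow, sq_abs]
  rw [← h x hx]; ring

end

lemma contDiff_F0 {n : ℕ} : ContDiff ℝ n F0 :=
  (contDiff_snd.neg.div_const (2 : ℝ)).prodMk (contDiff_fst.div_const (2 : ℝ))

namespace BoundaryParam
namespace Collar

variable {Ω : Set Plane} {P : BoundaryParam Ω} {t₀ : ℝ} (hc : P.Collar t₀)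

include hc

lemma dst_frontier {x : Plane} (hx : x ∈ frontier Ω) : P.dst t₀ x = 0 := by
  have ht := hc.pos
  rw [← P.range_eq] at hx
  obtain ⟨s, rfl⟩ := hx
  rw [← P.Psi_zero, hc.dst_Psi_low (by simpa [strip] using ht) (by simp only; linarith)]

lemma eventually_dst_lt (ho : IsOpen Ω) {σ : ℝ} (hσ : 0 < σ) {x : Plane} (hx : x ∈ frontier Ω) :
    ∀ᶠ y in 𝓝 x, P.dst t₀ y < σ := by
  have h1 := ((hc.cNearCl_dst ho 1).contDiffAt (frontier_subset_closure hx)).continuousAt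
  refine h1.eventually_lt continuousAt_const ?_
  rw [hc.dst_frontier hx]; exact hσ

/-- Lower bound away from the boundary, in the gauge adapted to the boundary. -/
lemma interior_bound (ho : IsOpen Ω) (hb : Bornology.IsBounded Ω) (B : ℝ) {v : Plane → ℂ}
    (hv : CNearCl 1 Ω v) {σ : ℝ} (hσ : 0 < σ) (hz : ∀ x, P.dst t₀ x < σ → v x = 0) :
    B * ∫ x in Ω, ‖v x‖ ^ 2 ≤ ∫ x in Ω, en (fun y => B • P.G t₀ y) v x := by
  have hF : CNearCl 1 Ω (fun y => B • F0 y) :=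
    CNearCl.of_contDiff (contDiff_F0.const_smul B)
  have h := interior_lower ho hb hF (hc.cNearCl_gau_mul ho B hv) (fun x hx => by
    filter_upwards [hc.eventually_dst_lt ho hσ hx] with y hy
    rw [hz y hy, mul_zero])
  rw [← integral_const_mul]
  refine (le_of_eq ?_).trans (h.trans (le_of_eq ?_))
  · refine setIntegral_congr_fun ho.measurableSet fun x hx => ?_
    have e : curl2 (fun y => B • F0 y) x = B := by
      have := curl2_F0 x
      have hd1 : DifferentiableAt ℝ (fun y : Plane => (F0 y).2) x :=
        (((contDiff_F0 (n := 1)).snd).differentiable (by norm_num)) x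
      have hd2 : DifferentiableAt ℝ (fun y : Plane => (F0 y).1) x :=
        (((contDiff_F0 (n := 1)).fst).differentiable (by norm_num)) x
      simp only [curl2, Prod.smul_snd, Prod.smul_fst, smul_eq_mul] at this ⊢
      rw [fderiv_const_mul hd1, fderiv_const_mul hd2]
      simp only [smul_apply, smul_eq_mul]
      rw [← mul_sub, this, mul_one]
    simp only [e, norm_gau_mul]
  · exact setIntegral_congr_fun ho.measurableSet fun x hx =>
      hc.en_gau ho B hx (hv.differentiableAt (subset_closure hx))

lemma exists_form_lower (ho : IsOpen Ω) (hb : Bornology.IsBounded Ω) :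
    ∃ C > 0, ∃ K > 0, ∀ B > 0, ∀ δ > 0, δ < 1 → ∀ c > 0, c ≤ t₀ / 4 → K * c ≤ 1 / 4 →
      ∀ u, CNearCl 1 Ω u →
      (((1 - K * c) ^ 2 * (1 - δ) * Th * B - δ⁻¹ * B ^ 2 * K ^ 2 * c ^ 4) - C / c ^ 2) *
        (∫ x in Ω, ‖u x‖ ^ 2) ≤ ∫ x in Ω, en (fun y => B • P.G t₀ y) u x := by
  obtain ⟨C, hC, hCb⟩ := hc.exists_cut_gsq_bound ho hb
  obtain ⟨K, hK0, hK⟩ := P.exists_kap_bound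
  refine ⟨C, hC, K, hK0, fun B hB δ hδ hδ1 c hc0 hct hKc u hu => ?_⟩
  have hξ : CNearCl 1 Ω fun x => xi c (P.dst t₀ x) := hc.cNearCl_comp_dst ho (contDiff_xi c)
  have hη : CNearCl 1 Ω fun x => eta c (P.dst t₀ x) := hc.cNearCl_comp_dst ho (contDiff_eta c)
  have ha : ContinuousOn (fun y => B • P.G t₀ y) (closure Ω) := (hc.continuousOn_G ho).const_smul B
  have hsum : ∀ x ∈ Ω, xi c (P.dst t₀ x) ^ 2 + eta c (P.dst t₀ x) ^ 2 = 1 := fun x _ => xi_sq_add _ _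
  have h1 := integral_ims ho hb ha hξ hη hu hsum
  have h2 := integral_nsq_add ho hb hξ hη hu hsum
  have h3 := hc.strip_bound ho hb hK0 hK (hξ.ofReal_mul hu) hc0 hct hKc
    (fun x _ h => by rw [xi_zero hc0 h]; simp) hB hδ hδ1
  have h4 := hc.interior_bound ho hb B (hη.ofReal_mul hu) (half_pos hc0)
    (fun x h => by rw [eta_zero hc0 h.le]; simp)
  have h5 : (∫ x in Ω, (gsq (fun x => xi c (P.dst t₀ x)) x * ‖u x‖ ^ 2 +
      gsq (fun x => eta c (P.dst t₀ x)) x * ‖u x‖ ^ 2)) ≤ C / c ^ 2 * ∫ x in Ω, ‖u x‖ ^ 2 := by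
    rw [← integral_const_mul]
    refine setIntegral_mono_on ((integrableOn_gsq_nsq hb hξ hu).add (integrableOn_gsq_nsq hb hη hu))
      ((integrableOn_nsq hb hu).const_mul _) ho.measurableSet fun x hx => ?_
    rw [← add_mul]
    exact mul_le_mul_of_nonneg_right (hCb c hc0 x (subset_closure hx)) (sq_nonneg _)
  set N1 := ∫ x in Ω, ‖(xi c (P.dst t₀ x) : ℂ) * u x‖ ^ 2
  set N2 := ∫ x in Ω, ‖(eta c (P.dst t₀ x) : ℂ) * u x‖ ^ 2
  have hN2 : 0 ≤ N2 := integral_nonneg fun x => sq_nonneg _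
  have hle : (1 - K * c) ^ 2 * (1 - δ) * Th * B - δ⁻¹ * B ^ 2 * K ^ 2 * c ^ 4 ≤ B := by
    have a1 : 0 ≤ δ⁻¹ * B ^ 2 * K ^ 2 * c ^ 4 := by positivity
    have a0 := mul_pos hK0 hc0
    have a2 : (1 - K * c) ^ 2 ≤ 1 := by nlinarith
    have hT := half_lt_Th
    have a3 : (1 - K * c) ^ 2 * (1 - δ) ≤ 1 * 1 := mul_le_mul a2 (by linarith) (by linarith) zero_le_one
    have a4 : (1 - K * c) ^ 2 * (1 - δ) * Th ≤ 1 * 1 * 1 :=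
      mul_le_mul a3 Th_lt_one.le (by linarith) (by norm_num)
    nlinarith [mul_le_mul_of_nonneg_right a4 hB.le]
  have h6 := mul_le_mul_of_nonneg_right hle hN2
  rw [one_mul] at h1 h2
  rw [← h2]
  rw [← h2] at h5
  linarith

lemma lam_lower (ho : IsOpen Ω) (hne : Ω.Nonempty) (hb : Bornology.IsBounded Ω) {δ : ℝ}
    (hδ : 0 < δ) : ∀ᶠ B in atTop, (Th - δ) * B ≤ lam1 Ω B := by
  obtain ⟨C, hC, K, hK, h⟩ := hc.exists_form_lower ho hb
  set d := min (δ / 4) (1 / 2) with hd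
  have hd0 : 0 < d := by positivity
  have hd1 : d < 1 := (min_le_right _ _).trans_lt (by norm_num)
  have hd2 : d ≤ δ / 4 := min_le_left _ _
  set R := Real.sqrt (4 * C / δ) with hR
  have hR2 : R ^ 2 = 4 * C / δ := Real.sq_sqrt (by positivity)
  have hR0 : 0 < R := Real.sqrt_pos.2 (by positivity)
  have hct : Tendsto (fun B : ℝ => R / Real.sqrt B) atTop (𝓝 0) :=
    Tendsto.const_div_atTop Real.tendsto_sqrt_atTop R
  have hl : Tendsto (fun B : ℝ => (1 - K * (R / Real.sqrt B)) ^ 2 * (1 - d) * Th -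
      d⁻¹ * K ^ 2 * R ^ 4 / B - C / R ^ 2) atTop
      (𝓝 ((1 - K * 0) ^ 2 * (1 - d) * Th - 0 - C / R ^ 2)) :=
    (((((tendsto_const_nhds.sub (hct.const_mul K)).pow 2).mul_const _).mul_const _).sub
      (Tendsto.const_div_atTop tendsto_id _)).sub_const _
  have hlim : Th - δ < (1 - K * 0) ^ 2 * (1 - d) * Th - 0 - C / R ^ 2 := by
    have : C / R ^ 2 = δ / 4 := by rw [hR2]; field_simp
    rw [this]
    nlinarith [Th_lt_one, half_lt_Th]
  filter_upwards [hl.eventually_const_lt hlim, eventually_gt_atTop 0,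
    hct.eventually_le_const (show 0 < t₀ / 4 by linarith [hc.pos]),
    hct.eventually_le_const (show 0 < 1 / (4 * K) by positivity)] with B h1 hB h2 h3
  have hs : 0 < Real.sqrt B := Real.sqrt_pos.2 hB
  have hs2 : Real.sqrt B ^ 2 = B := Real.sq_sqrt hB.le
  have hc0 : 0 < R / Real.sqrt B := by positivity
  refine le_of_forall_pos_le_add fun ε hε => ?_
  obtain ⟨u, hu, hu1, hu2⟩ := hc.exists_near_min_G ho hne hb B hε
  refine le_trans ?_ hu2
  have h4 := h B hB d hd0 hd1 _ hc0 h2 (by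
    have := mul_le_mul_of_nonneg_left h3 hK.le
    refine this.trans (le_of_eq ?_); field_simp) u hu
  rw [hu1, mul_one] at h4
  refine le_trans ?_ h4
  have e : (1 - K * (R / Real.sqrt B)) ^ 2 * (1 - d) * Th * B -
      d⁻¹ * B ^ 2 * K ^ 2 * (R / Real.sqrt B) ^ 4 - C / (R / Real.sqrt B) ^ 2 =
      ((1 - K * (R / Real.sqrt B)) ^ 2 * (1 - d) * Th - d⁻¹ * K ^ 2 * R ^ 4 / B - C / R ^ 2) * B := by
    have e1 : (R / Real.sqrt B) ^ 4 = R ^ 4 / B ^ 2 := by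
      rw [div_pow, show Real.sqrt B ^ 4 = (Real.sqrt B ^ 2) ^ 2 by ring, hs2]
    have e2 : (R / Real.sqrt B) ^ 2 = R ^ 2 / B := by rw [div_pow, hs2]
    rw [e1, e2]; field_simp
  rw [e]
  exact mul_le_mul_of_nonneg_right h1.le hB.le

end Collar
end BoundaryParam
end SC

namespace SC

lemma Trial.deriv_zero {φ : ℝ → ℝ} {R : ℝ} (h : Trial φ R) {t : ℝ} (ht : R ≤ t) :
    deriv φ t = 0 := by
  have h1 : EqOn (deriv φ) (fun _ => 0) (Ioi R) := fun s hs => by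
    have : φ =ᶠ[𝓝 s] fun _ => 0 := by
      filter_upwards [isOpen_Ioi.mem_nhds hs] with y hy using h.zero y (le_of_lt hy)
    rw [this.deriv_eq]; simp
  have := h1.closure (h.smooth.continuous_deriv (by norm_num)) continuous_const
  rw [closure_Ioi] at this
  exact this ht

lemma trial_scalar {k δ J A X Y Z : ℝ} (hk : 0 ≤ k) (hk1 : k ≤ 1 / 4) (hδ : 0 < δ)
    (h1 : 1 - k ≤ J) (h2 : J ≤ 1 + k) (hA : 0 ≤ A) (hY : Y ^ 2 ≤ Z) :
    J * (A + (J ^ 2)⁻¹ * (X + Y) ^ 2) ≤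
      (1 + 2 * k) * ((1 + δ) * (A + X ^ 2) + (1 + δ⁻¹) * Z) := by
  have hJ0 : 0 < J := by linarith
  have hinv : J * (J ^ 2)⁻¹ ≤ 1 + 2 * k := by
    have e : J * (J ^ 2)⁻¹ = 1 / J := by field_simp
    rw [e, div_le_iff₀ hJ0]
    nlinarith
  have h3 : (X + Y) ^ 2 ≤ (1 + δ) * X ^ 2 + (1 + δ⁻¹) * Z := by
    have e : (1 + δ) * X ^ 2 + (1 + δ⁻¹) * Y ^ 2 - (X + Y) ^ 2 = δ⁻¹ * (δ * X - Y) ^ 2 := by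
      field_simp; ring
    have := mul_le_mul_of_nonneg_left hY (show 0 ≤ 1 + δ⁻¹ by positivity)
    nlinarith [mul_nonneg (inv_nonneg.2 hδ.le) (sq_nonneg (δ * X - Y))]
  have f1 : J * (J ^ 2)⁻¹ * (X + Y) ^ 2 ≤ (1 + 2 * k) * (X + Y) ^ 2 :=
    mul_le_mul_of_nonneg_right hinv (sq_nonneg _)
  have f2 := mul_le_mul_of_nonneg_left h3 (show 0 ≤ 1 + 2 * k by linarith)
  have f3 := mul_le_mul_of_nonneg_right (show J ≤ 1 + 2 * k by linarith) hA
  have f4 := mul_nonneg (mul_nonneg (show 0 ≤ 1 + 2 * k by linarith) hδ.le) hA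
  linarith

namespace BoundaryParam
namespace Collar

variable {Ω : Set Plane} {P : BoundaryParam Ω} {t₀ : ℝ} (hc : P.Collar t₀)

omit hc in
lemma integral_cell_scaled (P : BoundaryParam Ω) {β R : ℝ} (hβ : 0 < β) (hR : 0 < R) {g : ℝ → ℝ}
    (hg : Continuous g) :
    (∫ p in Ico 0 P.L ×ˢ Ioo (0 : ℝ) (R / β), g (β * p.2)) =
      P.L * (β⁻¹ * ∫ t in (0 : ℝ)..R, g t) := by
  rw [setIntegral_cell P.L_pos.le (by positivity) (f := fun p => g (β * p.2)) (by fun_prop)]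
  simp only [intervalIntegral.integral_const, sub_zero, smul_eq_mul,
    intervalIntegral.integral_const_mul]
  rw [intervalIntegral.integral_comp_mul_left g hβ.ne', mul_zero, mul_div_cancel₀ _ hβ.ne', smul_eq_mul]

include hc

lemma trial_bound (ho : IsOpen Ω) (hb : Bornology.IsBounded Ω) {K : ℝ} (hK0 : 0 < K)
    (hK : ∀ s, |P.kap s| ≤ K) {φ : ℝ → ℝ} {R a : ℝ} (hφ : Trial φ R) {β δ : ℝ} (hβ : 0 < β)
    (hδ : 0 < δ) (hct : R / β ≤ t₀ / 4) (hKc : K * (R / β) ≤ 1 / 4) :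
    lam1 Ω (β ^ 2) * ((1 - K * (R / β)) * ∫ t in (0 : ℝ)..R, φ t ^ 2) ≤
      (1 + 2 * (K * (R / β))) * ((1 + δ) * (β ^ 2 * halfForm a φ R) +
        (1 + δ⁻¹) * ((2 * Real.pi / P.L + K * R ^ 2 / 2) ^ 2 * ∫ t in (0 : ℝ)..R, φ t ^ 2)) := by
  have ht := hc.pos
  have hL := P.L_pos
  have hR := hφ.pos
  set c := R / β with hcdef
  have hc0 : 0 < c := by positivity
  have hct' : c ≤ t₀ := by linarith
  have cφ : Continuous φ := hφ.smooth.continuous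
  have cφ' : Continuous (deriv φ) := hφ.smooth.continuous_deriv (by norm_num)
  -- winding number
  obtain ⟨m, r, hr, hm⟩ : ∃ (m : ℤ) (r : ℝ), |r| ≤ 2 * Real.pi / P.L ∧
      2 * Real.pi * m / P.L - β ^ 2 * (P.area / P.L) = -(β * a) + r := by
    set q := (β ^ 2 * (P.area / P.L) - β * a) * (P.L / (2 * Real.pi)) with hq
    refine ⟨⌊q⌋, 2 * Real.pi / P.L * (⌊q⌋ - q), ?_, ?_⟩
    · have h1 := Int.floor_le q
      have h2 := Int.lt_floor_add_one q
      have h3 : |(⌊q⌋ : ℝ) - q| ≤ 1 := by rw [abs_le]; constructor <;> linarith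
      rw [abs_mul, abs_of_pos (by positivity : 0 < 2 * Real.pi / P.L)]
      exact mul_le_of_le_one_right (by positivity) h3
    · have : 2 * Real.pi / P.L * q = β ^ 2 * (P.area / P.L) - β * a := by
        rw [hq]; field_simp
      rw [mul_sub, this]; ring
  set ω := 2 * Real.pi * m / P.L with hω
  set E : ℝ × ℝ → ℂ := fun p => Complex.exp (Complex.I * ((ω * p.1 : ℝ) : ℂ)) with hE
  set F : ℝ × ℝ → ℂ := fun p => ((φ (β * p.2) : ℝ) : ℂ) * E p with hF
  have hEn : ∀ p, ‖E p‖ = 1 := fun p => by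
    rw [hE]; simp only; rw [mul_comm, Complex.norm_exp_ofReal_mul_I]
  have hEd : ∀ p, HasFDerivAt E ((Complex.I * ω * E p) • Complex.ofRealCLM.comp (ContinuousLinearMap.fst ℝ ℝ ℝ)) p := by
    intro p
    have h1 : HasFDerivAt (fun p : ℝ × ℝ => ((ω * p.1 : ℝ) : ℂ))
        (Complex.ofRealCLM.comp (ω • ContinuousLinearMap.fst ℝ ℝ ℝ)) p :=
      Complex.ofRealCLM.hasFDerivAt.comp p (hasFDerivAt_fst.const_mul ω)
    refine ((h1.const_mul Complex.I).cexp).congr_fderiv ?_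
    ext <;> simp [hE, mul_assoc, mul_comm, mul_left_comm]
  have hFd : ∀ p, HasFDerivAt F ((((φ (β * p.2) : ℝ) : ℂ) • ((Complex.I * ω * E p) •
      Complex.ofRealCLM.comp (ContinuousLinearMap.fst ℝ ℝ ℝ)) + E p •
      (Complex.ofRealCLM.comp ((β * deriv φ (β * p.2)) • ContinuousLinearMap.snd ℝ ℝ ℝ)) :
      ℝ × ℝ →L[ℝ] ℂ)) p := by
    intro p
    have h0 : HasFDerivAt (fun p : ℝ × ℝ => φ (β * p.2))
        ((β * deriv φ (β * p.2)) • ContinuousLinearMap.snd ℝ ℝ ℝ) p := by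
      refine (((hφ.smooth.differentiable (by norm_num) (β * p.2)).hasDerivAt).comp_hasFDerivAt p
        (hasFDerivAt_snd.const_mul β)).congr_fderiv ?_
      ext <;> simp [mul_comm]
    have h1 : HasFDerivAt (fun p : ℝ × ℝ => ((φ (β * p.2) : ℝ) : ℂ))
        (Complex.ofRealCLM.comp ((β * deriv φ (β * p.2)) • ContinuousLinearMap.snd ℝ ℝ ℝ)) p :=
      Complex.ofRealCLM.hasFDerivAt.comp p h0
    exact h1.mul (hEd p)
  have hFs : ContDiff ℝ 1 F := by
    have h1 : ContDiff ℝ 1 fun p : ℝ × ℝ => ((φ (β * p.2) : ℝ) : ℂ) :=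
      Complex.ofRealCLM.contDiff.comp (hφ.smooth.comp (contDiff_const.mul contDiff_snd))
    have h2 : ContDiff ℝ 1 E :=
      (contDiff_const.mul (Complex.ofRealCLM.contDiff.comp (contDiff_const.mul contDiff_fst))).cexp
    exact h1.mul h2
  have hFp : P.PerS F := by
    intro s t
    simp only [hF, hE]
    congr 1
    have h : Complex.I * ((ω * (s + P.L) : ℝ) : ℂ) =
        Complex.I * ((ω * s : ℝ) : ℂ) + m * (2 * Real.pi * Complex.I) := by
      have : (P.L : ℂ) ≠ 0 := by exact_mod_cast hL.ne'
      rw [hω]; push_cast; field_simp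
    rw [h, Complex.exp_add, Complex.exp_int_mul_two_pi_mul_I, mul_one]
  have hβt : ∀ t, c ≤ t → R ≤ β * t := fun t h => by
    rw [hcdef, div_le_iff₀ hβ] at h; linarith
  have hFz : ∀ s t, c ≤ t → F (s, t) = 0 := fun s t h => by
    simp only [hF]; rw [hφ.zero _ (hβt t h)]; simp
  set u := P.ext t₀ F with hu
  have huC : CNearCl 1 Ω u := hc.cNearCl_ext ho hFp hFs (by linarith) hFz
  set S := P.Psi '' (univ ×ˢ Ioo (0 : ℝ) c) with hS
  have hSΩ : S ⊆ Ω := hc.inner_subset hct'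
  set C : Set (ℝ × ℝ) := Ico 0 P.L ×ˢ Ioo (0 : ℝ) c with hC
  have hCm : MeasurableSet C := measurableSet_Ico.prod measurableSet_Ioo
  have hJ : ∀ p ∈ C, |p.2 * P.kap p.1| ≤ K * c := by
    intro p hp
    rw [abs_mul, mul_comm K c, abs_of_pos hp.2.1]
    exact mul_le_mul hp.2.2.le (hK _) (abs_nonneg _) hc0.le
  have ha : ContinuousOn (fun y => β ^ 2 • P.G t₀ y) (closure Ω) := (hc.continuousOn_G ho).const_smul (β ^ 2)
  have hien := integrableOn_en hb ha huC
  -- energy density in coordinates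
  have hen : ∀ p ∈ strip t₀, en (fun y => β ^ 2 • P.G t₀ y) u (P.Psi p) =
      (‖(-Complex.I) * fderiv ℝ F p (0, 1) -
        (dot2 (β ^ 2 • P.G t₀ (P.Psi p)) (P.DPsi p (0, 1)) : ℂ) * F p‖ ^ 2 +
      ((1 - p.2 * P.kap p.1) ^ 2)⁻¹ * ‖(-Complex.I) * fderiv ℝ F p (1, 0) -
        (dot2 (β ^ 2 • P.G t₀ (P.Psi p)) (P.DPsi p (1, 0)) : ℂ) * F p‖ ^ 2) := by
    intro p hp
    rw [en_coord P _ _ _ (hc.jac_ne hp), hc.fderiv_ext hFp hFs hp, hc.fderiv_ext hFp hFs hp,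
      hu, hc.ext_Psi hFp hp]
  have hzero : ∀ x ∈ Ω \ S, en (fun y => β ^ 2 • P.G t₀ y) u x = 0 := by
    intro x hx
    have hd : c ≤ P.dst t₀ x := by
      by_contra h
      exact hx.2 (hc.mem_inner_of_dst_lt hx.1 hct' (not_le.1 h))
    by_cases hxs : x ∈ P.Psi '' strip t₀
    · obtain ⟨p, hp, rfl⟩ := hxs
      have hpc : c ≤ p.2 := by
        by_contra hlt
        rw [hc.dst_Psi_low hp (by linarith)] at hd
        exact hlt hd
      rw [hen p hp, (hFd p).fderiv, hφ.deriv_zero (hβt _ hpc), hφ.zero _ (hβt _ hpc)]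
      have : F p = 0 := hFz p.1 p.2 hpc
      simp [this]
    · have h1 : u =ᶠ[𝓝 x] fun _ => 0 :=
        hc.ext_eventually_zero ho hFp (c := c) (by linarith) hFz hx.1
          (fun s t hs _ he => hxs ⟨(s, t), hs, he⟩)
      have h2 := h1.fderiv_eq (𝕜 := ℝ)
      have h3 := h1.eq_of_nhds
      simp only [en, Dx, Dy, h2, h3]; simp
  have hQ : (∫ x in Ω, en (fun y => β ^ 2 • P.G t₀ y) u x) =
      ∫ x in S, en (fun y => β ^ 2 • P.G t₀ y) u x :=
    setIntegral_eq_of_subset_of_forall_sdiff_eq_zero ho.measurableSet hSΩ hzero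
  set D := 2 * Real.pi / P.L + K * R ^ 2 / 2 with hD
  set g : ℝ → ℝ := fun τ => (1 + 2 * (K * c)) * ((1 + δ) * (β ^ 2 * (deriv φ τ ^ 2 + (τ - a) ^ 2 * φ τ ^ 2)) +
    (1 + δ⁻¹) * (D ^ 2 * φ τ ^ 2)) with hg
  have cg : Continuous g := by fun_prop
  have hpt : ∀ p ∈ C, (1 - p.2 * P.kap p.1) • en (fun y => β ^ 2 • P.G t₀ y) u (P.Psi p) ≤ g (β * p.2) := by
    intro p hp
    have hps : p ∈ strip t₀ := cell_subset_strip hct' hp.2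
    have hJp := abs_le.1 (hJ p hp)
    have hG : ∀ w, dot2 (β ^ 2 • P.G t₀ (P.Psi p)) (P.DPsi p w) =
        β ^ 2 * ((P.area / P.L - p.2 + P.kap p.1 * p.2 ^ 2 / 2) * w.1) := by
      intro w
      rw [← hc.G_coord hps (by linarith [hp.2.2]) w]
      simp [dot2]; ring
    rw [hen p hps, hG, hG, smul_eq_mul, (hFd p).fderiv]
    set τ := β * p.2 with hτ
    set Y := r - P.kap p.1 * τ ^ 2 / 2 with hY
    have eT : ‖(-Complex.I) * (((φ τ : ℝ) : ℂ) • ((Complex.I * ω * E p) •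
      Complex.ofRealCLM.comp (ContinuousLinearMap.fst ℝ ℝ ℝ)) + E p •
      (Complex.ofRealCLM.comp ((β * deriv φ τ) • ContinuousLinearMap.snd ℝ ℝ ℝ)) : ℝ × ℝ →L[ℝ] ℂ) (0, 1) -
        ((β ^ 2 * ((P.area / P.L - p.2 + P.kap p.1 * p.2 ^ 2 / 2) * ((0 : ℝ), (1 : ℝ)).1) : ℝ) : ℂ) * F p‖ ^ 2 =
        β ^ 2 * deriv φ τ ^ 2 := by
      simp [hEn, mul_pow]
    have eX : ‖(-Complex.I) * (((φ τ : ℝ) : ℂ) • ((Complex.I * ω * E p) •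
      Complex.ofRealCLM.comp (ContinuousLinearMap.fst ℝ ℝ ℝ)) + E p •
      (Complex.ofRealCLM.comp ((β * deriv φ τ) • ContinuousLinearMap.snd ℝ ℝ ℝ)) : ℝ × ℝ →L[ℝ] ℂ) (1, 0) -
        ((β ^ 2 * ((P.area / P.L - p.2 + P.kap p.1 * p.2 ^ 2 / 2) * ((1 : ℝ), (0 : ℝ)).1) : ℝ) : ℂ) * F p‖ ^ 2 =
        (β * (τ - a) * φ τ + Y * φ τ) ^ 2 := by
      have : (-Complex.I) * (((φ τ : ℝ) : ℂ) • ((Complex.I * ω * E p) •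
        Complex.ofRealCLM.comp (ContinuousLinearMap.fst ℝ ℝ ℝ)) + E p •
        (Complex.ofRealCLM.comp ((β * deriv φ τ) • ContinuousLinearMap.snd ℝ ℝ ℝ)) : ℝ × ℝ →L[ℝ] ℂ) (1, 0) -
        ((β ^ 2 * ((P.area / P.L - p.2 + P.kap p.1 * p.2 ^ 2 / 2) * ((1 : ℝ), (0 : ℝ)).1) : ℝ) : ℂ) * F p =
        ((β * (τ - a) * φ τ + Y * φ τ : ℝ) : ℂ) * E p := by
        have e1 : β * (τ - a) * φ τ + Y * φ τ = (ω - β ^ 2 * (P.area / P.L - p.2 + P.kap p.1 * p.2 ^ 2 / 2)) * φ τ := by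
          rw [hY, hτ]
          have : ω = β ^ 2 * (P.area / P.L) + (-(β * a) + r) := by linarith
          rw [this]; ring
        rw [e1]
        simp only [hF, ← hτ]
        simp
        linear_combination (-(φ τ * ω * E p : ℂ)) * Complex.I_mul_I
      rw [this, norm_mul, hEn, mul_one, Complex.norm_real, Real.norm_eq_abs, sq_abs]
    rw [eT, eX]
    have hτR : τ ^ 2 ≤ R ^ 2 := by
      have : τ ≤ R := by
        have := hp.2.2; rw [hcdef, lt_div_iff₀ hβ] at this; rw [hτ]; linarith
      exact pow_le_pow_left₀ (mul_nonneg hβ.le hp.2.1.le) this 2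
    have hYD : (Y * φ τ) ^ 2 ≤ D ^ 2 * φ τ ^ 2 := by
      rw [mul_pow]
      refine mul_le_mul_of_nonneg_right ?_ (sq_nonneg _)
      rw [← sq_abs]
      refine pow_le_pow_left₀ (abs_nonneg _) ?_ 2
      refine (abs_sub _ _).trans (add_le_add hr ?_)
      rw [abs_div, abs_mul, abs_of_nonneg (sq_nonneg τ), abs_two]
      have := mul_le_mul (hK p.1) hτR (sq_nonneg _) hK0.le
      linarith
    have := trial_scalar (X := β * (τ - a) * φ τ) (A := β ^ 2 * deriv φ τ ^ 2) (mul_pos hK0 hc0).le hKc hδ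
      (by linarith : 1 - K * c ≤ 1 - p.2 * P.kap p.1) (by linarith) (by positivity) hYD
    refine this.trans (le_of_eq ?_)
    simp only [hg]; ring
  have hQle : (∫ x in Ω, en (fun y => β ^ 2 • P.G t₀ y) u x) ≤ P.L * (β⁻¹ * ∫ t in (0 : ℝ)..R, g t) := by
    rw [hQ, hc.integral_inner hct', ← integral_cell_scaled P hβ hR cg]
    exact setIntegral_mono_on ((hc.integrableOn_inner hct').1 (hien.mono_set hSΩ))
      (integrableOn_cell (by fun_prop)) hCm hpt
  have hNge : P.L * (β⁻¹ * ∫ t in (0 : ℝ)..R, (1 - K * c) * φ t ^ 2) ≤ ∫ x in Ω, ‖u x‖ ^ 2 := by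
    have h1 : (∫ x in S, ‖u x‖ ^ 2) ≤ ∫ x in Ω, ‖u x‖ ^ 2 :=
      setIntegral_mono_set (integrableOn_nsq hb huC) (ae_of_all _ fun x => sq_nonneg _) hSΩ.eventuallyLE
    refine le_trans ?_ h1
    rw [hc.integral_inner hct', ← integral_cell_scaled P hβ hR (by fun_prop)]
    refine setIntegral_mono_on (integrableOn_cell (f := fun p => (1 - K * c) * φ (β * p.2) ^ 2) (by fun_prop))
      ((hc.integrableOn_inner hct').1 ((integrableOn_nsq hb huC).mono_set hSΩ)) hCm fun p hp => ?_
    have hps : p ∈ strip t₀ := cell_subset_strip hct' hp.2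
    rw [hu, hc.ext_Psi hFp hps, smul_eq_mul]
    have : ‖F p‖ ^ 2 = φ (β * p.2) ^ 2 := by
      simp [hF, hEn]
    rw [this]
    exact mul_le_mul_of_nonneg_right (by linarith [(abs_le.1 (hJ p hp)).2]) (sq_nonneg _)
  have hlam := hc.lam_le_G ho (β ^ 2) huC
  have h1 := (mul_le_mul_of_nonneg_left hNge (lam1_nonneg (Ω := Ω) (β ^ 2))).trans (hlam.trans hQle)
  have e2 : (∫ t in (0 : ℝ)..R, g t) = (1 + 2 * (K * c)) * ((1 + δ) * (β ^ 2 * halfForm a φ R) +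
        (1 + δ⁻¹) * (D ^ 2 * ∫ t in (0 : ℝ)..R, φ t ^ 2)) := by
    have i1 : Continuous fun t => (1 + δ) * (β ^ 2 * (deriv φ t ^ 2 + (t - a) ^ 2 * φ t ^ 2)) := by fun_prop
    have i2 : Continuous fun t => (1 + δ⁻¹) * (D ^ 2 * φ t ^ 2) := by fun_prop
    simp only [hg, halfForm]
    rw [intervalIntegral.integral_const_mul, intervalIntegral.integral_add (i1.intervalIntegrable _ _)
      (i2.intervalIntegrable _ _)]
    simp only [intervalIntegral.integral_const_mul]
  rw [e2, intervalIntegral.integral_const_mul] at h1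
  have hpos : 0 < P.L * β⁻¹ := by positivity
  refine le_of_mul_le_mul_left ?_ hpos
  calc _ = lam1 Ω (β ^ 2) * (P.L * (β⁻¹ * ((1 - K * c) * ∫ t in (0 : ℝ)..R, φ t ^ 2))) := by ring
    _ ≤ _ := h1
    _ = _ := by ring

lemma lam_upper (ho : IsOpen Ω) (hb : Bornology.IsBounded Ω) {δ : ℝ}
    (hδ : 0 < δ) : ∀ᶠ B in atTop, lam1 Ω B ≤ (Th + δ) * B := by
  obtain ⟨K, hK, hKb⟩ := P.exists_kap_bound
  set d := min (δ / 4) (1 / 2) with hd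
  have hd0 : 0 < d := by positivity
  have hd1 : d ≤ 1 / 2 := min_le_right _ _
  have hd2 : d ≤ δ / 4 := min_le_left _ _
  obtain ⟨φ, R, a, hφ, hpos, hform⟩ := exists_near_Th hd0
  set W := ∫ t in (0 : ℝ)..R, φ t ^ 2
  have hR := hφ.pos
  have hct : Tendsto (fun B : ℝ => R / Real.sqrt B) atTop (𝓝 0) :=
    Tendsto.const_div_atTop Real.tendsto_sqrt_atTop R
  set D := (1 + d⁻¹) * (2 * Real.pi / P.L + K * R ^ 2 / 2) ^ 2 with hD
  have hl : Tendsto (fun B : ℝ => (1 + 2 * (K * (R / Real.sqrt B))) * ((1 + d) * (Th + d) + D / B)) atTop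
      (𝓝 ((1 + 2 * (K * 0)) * ((1 + d) * (Th + d) + 0))) :=
    (((hct.const_mul K).const_mul 2).const_add 1).mul
      ((Tendsto.const_div_atTop tendsto_id _).const_add _)
  have hr : Tendsto (fun B : ℝ => (1 - K * (R / Real.sqrt B)) * (Th + δ)) atTop
      (𝓝 ((1 - K * 0) * (Th + δ))) :=
    (tendsto_const_nhds.sub (hct.const_mul K)).mul_const _
  have hlim : (1 + 2 * (K * 0)) * ((1 + d) * (Th + d) + 0) < (1 - K * 0) * (Th + δ) := by
    nlinarith [Th_lt_one, half_lt_Th]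
  filter_upwards [hl.eventually_lt hr hlim, eventually_gt_atTop 0,
    hct.eventually_le_const (show 0 < t₀ / 4 by linarith [hc.pos]),
    hct.eventually_le_const (show 0 < 1 / (4 * K) by positivity)] with B h1 hB h2 h3
  have hs : 0 < Real.sqrt B := Real.sqrt_pos.2 hB
  have hs2 : Real.sqrt B ^ 2 = B := Real.sq_sqrt hB.le
  have hKc : K * (R / Real.sqrt B) ≤ 1 / 4 := by
    have := mul_le_mul_of_nonneg_left h3 hK.le
    refine this.trans (le_of_eq ?_); field_simp
  have h4 := hc.trial_bound ho hb hK hKb (a := a) hφ hs hd0 h2 hKc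
  rw [hs2] at h4
  set k := K * (R / Real.sqrt B)
  have hk0 : 0 < k := by positivity
  have h5 : (1 + 2 * k) * ((1 + d) * (B * halfForm a φ R) + (1 + d⁻¹) *
      ((2 * Real.pi / P.L + K * R ^ 2 / 2) ^ 2 * W)) ≤
      (1 + 2 * k) * ((1 + d) * (Th + d) + D / B) * (B * W) := by
    have : (1 + 2 * k) * ((1 + d) * (Th + d) + D / B) * (B * W) =
      (1 + 2 * k) * ((1 + d) * (B * ((Th + d) * W)) + D * W) := by field_simp
    rw [this]
    have e := mul_le_mul_of_nonneg_left (mul_le_mul_of_nonneg_left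
      (mul_le_mul_of_nonneg_left hform hB.le) (show 0 ≤ 1 + d by linarith)) (show 0 ≤ 1 + 2 * k by linarith)
    rw [hD]
    linarith
  have h6 := mul_le_mul_of_nonneg_right h1.le (mul_pos hB hpos).le
  have h7 := h4.trans (h5.trans h6)
  have hkk : 0 < (1 - k) * W := mul_pos (by linarith) hpos
  refine le_of_mul_le_mul_right ?_ hkk
  linarith

end Collar
end BoundaryParam
end SC

namespace SC

section
variable {Ω : Set Plane}

lemma CNearCl.sqrt {n : ℕ} {f : Plane → ℝ} (hf : CNearCl n Ω f) (h : ∀ x ∈ closure Ω, 0 < f x) :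
    CNearCl n Ω (fun x => Real.sqrt (f x)) := by
  obtain ⟨U, hU, hs, hu⟩ := hf
  refine ⟨U ∩ f ⁻¹' Ioi 0, hu.continuousOn.isOpen_inter_preimage hU isOpen_Ioi,
    fun x hx => ⟨hs hx, h x hx⟩, ?_⟩
  exact (hu.mono inter_subset_left).sqrt fun x hx => (ne_of_gt hx.2)

lemma gsq_compl_le {η : Plane → ℝ} {m : ℝ} {x : Plane} (hη : DifferentiableAt ℝ η x) (hm : 0 < m)
    (h : η x ^ 2 ≤ m) : gsq (fun y => Real.sqrt (2 * m - η y ^ 2)) x ≤ gsq η x := by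
  have hpos : 0 < 2 * m - η x ^ 2 := by linarith
  have hd : HasFDerivAt (fun y => 2 * m - η y ^ 2) (-((2 * η x) • fderiv ℝ η x)) x := by
    refine ((hη.hasFDerivAt.pow 2).const_sub (2 * m)).congr_fderiv ?_
    ext <;> simp
  have hs := hd.sqrt hpos.ne'
  simp only [gsq, hs.fderiv]
  set g := Real.sqrt (2 * m - η x ^ 2) with hg
  have hg0 : 0 < g := Real.sqrt_pos.2 hpos
  have hg2 : g ^ 2 = 2 * m - η x ^ 2 := Real.sq_sqrt hpos.le
  have key : ∀ d : ℝ, (1 / (2 * g) * (-(2 * η x * d))) ^ 2 ≤ d ^ 2 := by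
    intro d
    have : (1 / (2 * g) * (-(2 * η x * d))) ^ 2 = η x ^ 2 / g ^ 2 * d ^ 2 := by
      field_simp
    rw [this]
    refine mul_le_of_le_one_left (sq_nonneg _) ?_
    rw [div_le_one (by positivity)]; linarith
  have h1 := key (fderiv ℝ η x ((1 : ℝ), (0 : ℝ)))
  have h2 := key (fderiv ℝ η x ((0 : ℝ), (1 : ℝ)))
  simp only [smul_apply, neg_apply, smul_eq_mul] at h1 h2 ⊢
  linarith

variable {P : BoundaryParam Ω} {t₀ : ℝ}

namespace BoundaryParam.Collar
variable (hc : P.Collar t₀)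
include hc

lemma near_min_mul (ho : IsOpen Ω) (hb : Bornology.IsBounded Ω) (B : ℝ) {u : Plane → ℂ}
    (hu : CNearCl 1 Ω u) {ε : ℝ} (hQ : (∫ x in Ω, en (fun y => B • P.G t₀ y) u x) ≤
      lam1 Ω B * (∫ x in Ω, ‖u x‖ ^ 2) + ε) {η : Plane → ℝ} (hη : CNearCl 1 Ω η) {m : ℝ}
    (hm : 0 < m) (hηm : ∀ x ∈ closure Ω, η x ^ 2 ≤ m) :
    (∫ x in Ω, en (fun y => B • P.G t₀ y) (fun y => (η y : ℂ) * u y) x) ≤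
      lam1 Ω B * (∫ x in Ω, ‖(η x : ℂ) * u x‖ ^ 2) + 2 * (∫ x in Ω, gsq η x * ‖u x‖ ^ 2) +
        2 * m * ε := by
  set g : Plane → ℝ := fun y => Real.sqrt (2 * m - η y ^ 2) with hg
  have hgC : CNearCl 1 Ω g :=
    CNearCl.sqrt (hη.map (g := fun r : ℝ => 2 * m - r ^ 2) (by fun_prop))
      fun x hx => by have := hηm x hx; linarith
  have hsum : ∀ x ∈ Ω, η x ^ 2 + g x ^ 2 = 2 * m := by
    intro x hx
    have := hηm x (subset_closure hx)
    simp only [hg]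
    rw [Real.sq_sqrt (by linarith)]; ring
  have ha : ContinuousOn (fun y => B • P.G t₀ y) (closure Ω) := (hc.continuousOn_G ho).const_smul B
  have e1 := integral_ims ho hb ha hη hgC hu hsum
  have e2 := integral_nsq_add ho hb hη hgC hu hsum
  have e3 := hc.lam_le_G ho B (hgC.ofReal_mul hu)
  have i1 := integrableOn_gsq_nsq hb hη hu
  have i2 := integrableOn_gsq_nsq hb hgC hu
  have e4 : (∫ x in Ω, gsq g x * ‖u x‖ ^ 2) ≤ ∫ x in Ω, gsq η x * ‖u x‖ ^ 2 :=
    setIntegral_mono_on i2 i1 ho.measurableSet fun x hx =>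
      mul_le_mul_of_nonneg_right (gsq_compl_le (hη.differentiableAt (subset_closure hx)) hm
        (hηm x (subset_closure hx))) (sq_nonneg _)
  rw [integral_add i1 i2] at e1
  have e5 := mul_le_mul_of_nonneg_left hQ (by linarith : 0 ≤ 2 * m)
  have e6 : lam1 Ω B * ((∫ x in Ω, ‖(η x : ℂ) * u x‖ ^ 2) + ∫ x in Ω, ‖(g x : ℂ) * u x‖ ^ 2) =
      lam1 Ω B * (2 * m * ∫ x in Ω, ‖u x‖ ^ 2) := by rw [e2]
  linarith

end BoundaryParam.Collar

/-- `(y - 1)₊²` -/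
def bump (y : ℝ) : ℝ := (max (y - 1) 0) ^ 2

lemma contDiff_bump : ContDiff ℝ 1 bump :=
  contDiff_posPart_sq.comp (contDiff_id.sub contDiff_const)

lemma deriv_bump (y : ℝ) : deriv bump y = 2 * max (y - 1) 0 := by
  have h := (hasDerivAt_posPart_sq (y - 1)).comp y ((hasDerivAt_id y).sub_const 1)
  have h' : HasDerivAt bump (2 * max (y - 1) 0 * 1) y := h
  rw [h'.deriv, mul_one]

lemma decay_scalar {g B S C D : ℝ} (hg : 0 < g) (hB : 1 ≤ B)
    (h : g * B * S ≤ 8 * B * C * (g / (16 * C) * S + 4 * C / g) + D) (hC : 0 < C) (hD : 0 ≤ D) :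
    S ≤ 64 * C ^ 2 / g ^ 2 + 2 * D / g := by
  have e : 8 * B * C * (g / (16 * C) * S + 4 * C / g) = B * (g * S / 2 + 32 * C ^ 2 / g) := by
    field_simp; ring
  rw [e] at h
  have h1 : B * (g * S / 2) ≤ B * (32 * C ^ 2 / g + D) := by nlinarith
  have h2 := le_of_mul_le_mul_left h1 (by linarith)
  have h3 : 64 * C ^ 2 / g ^ 2 + 2 * D / g = (32 * C ^ 2 / g + D) * (2 / g) := by
    field_simp; ring
  rw [h3]
  have h4 := mul_le_mul_of_nonneg_right h2 (by positivity : 0 ≤ 2 / g)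
  have h5 : g * S / 2 * (2 / g) = S := by field_simp
  linarith

lemma bump_pw (y : ℝ) (hy : 0 ≤ y) : y ^ 2 ≤ 3 + bump y ^ 2 := by
  unfold bump
  rcases le_total y 1 with h | h
  · nlinarith [sq_nonneg ((max (y - 1) 0) ^ 2)]
  · rw [max_eq_left (by linarith)]
    nlinarith [sq_nonneg ((y - 1) ^ 2 - 1), sq_nonneg (y - 2)]

lemma bump_ge {y : ℝ} (hy : 2 ≤ y) : y ^ 4 ≤ 16 * bump y ^ 2 := by
  unfold bump
  rw [max_eq_left (by linarith)]
  have h : y ≤ 2 * (y - 1) := by linarith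
  have := pow_le_pow_left₀ (by linarith) h 4
  calc y ^ 4 ≤ _ := this
    _ = _ := by ring

lemma eta_le_bump {c : ℝ} (hc0 : 0 < c) {β : ℝ} (hβ : 4 ≤ β * c) (hβ0 : 0 < β) (y : ℝ)
    {A X : ℝ} (hA : 0 ≤ A) (hX0 : y < c / 2 → X = 0) (hX : X ≤ A) :
    X ≤ 256 * A / (β ^ 4 * c ^ 4) * bump (β * y) ^ 2 := by
  rcases lt_or_ge y (c / 2) with h | h
  · rw [hX0 h]; positivity
  · have h1 : β * c / 2 ≤ β * y := by nlinarith
    have h2 := bump_ge (show 2 ≤ β * y by linarith)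
    have h3 := pow_le_pow_left₀ (by positivity) h1 4
    have h4 : β ^ 4 * c ^ 4 ≤ 256 * bump (β * y) ^ 2 := by
      have : (β * c / 2) ^ 4 = β ^ 4 * c ^ 4 / 16 := by ring
      linarith
    have h5 : 1 ≤ 256 * bump (β * y) ^ 2 / (β ^ 4 * c ^ 4) := by
      rw [one_le_div (by positivity)]; exact h4
    calc X ≤ A * 1 := by linarith
      _ ≤ A * (256 * bump (β * y) ^ 2 / (β ^ 4 * c ^ 4)) := mul_le_mul_of_nonneg_left h5 hA
      _ = _ := by ring

end
end SC

namespace SC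

section
variable {Ω : Set Plane} {P : BoundaryParam Ω} {t₀ : ℝ}

lemma CNearCl.integrableOn_mul_nsq (hb : Bornology.IsBounded Ω) {n : ℕ} {f : Plane → ℝ}
    {u : Plane → ℂ} (hf : CNearCl n Ω f) (hu : CNearCl 1 Ω u) :
    IntegrableOn (fun x => f x * ‖u x‖ ^ 2) Ω :=
  integrableOn_of_continuousOn_closure hb (hf.continuousOn.mul (hu.continuousOn.norm.pow 2))

lemma norm_ofReal_mul_sq (r : ℝ) (z : ℂ) : ‖(r : ℂ) * z‖ ^ 2 = r ^ 2 * ‖z‖ ^ 2 := by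
  rw [norm_mul, mul_pow, Complex.norm_real, Real.norm_eq_abs, sq_abs]

lemma deriv_eta_low {c y : ℝ} (hc : 0 < c) (h : y < c / 2) : deriv (eta c) y = 0 := by
  have : eta c =ᶠ[𝓝 y] fun _ => 0 := by
    filter_upwards [gt_mem_nhds h] with z hz using eta_zero hc (le_of_lt hz)
  rw [this.deriv_eq]; simp

lemma deriv_xi_low {c y : ℝ} (hc : 0 < c) (h : y < c / 2) : deriv (xi c) y = 0 := by
  have : xi c =ᶠ[𝓝 y] fun _ => 1 := by
    filter_upwards [gt_mem_nhds h] with z hz using xi_one hc (le_of_lt hz)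
  rw [this.deriv_eq]; simp

namespace BoundaryParam.Collar
variable (hc : P.Collar t₀)
include hc

lemma bump_decay (ho : IsOpen Ω) (hb : Bornology.IsBounded Ω) :
    ∃ C > 0, ∀ᶠ B in atTop, ∀ u : Plane → ℂ, CNearCl 1 Ω u → (∫ x in Ω, ‖u x‖ ^ 2) = 1 →
      (∫ x in Ω, en (fun y => B • P.G t₀ y) u x) ≤ lam1 Ω B + 1 / B ^ 2 →
      (∫ x in Ω, bump (Real.sqrt B * P.dst t₀ x) ^ 2 * ‖u x‖ ^ 2) ≤ C := by
  obtain ⟨Cg, hCg, hCgb⟩ := hc.exists_gsq_bound ho hb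
  have ht := hc.pos
  set g := (1 - Th) / 2 with hg
  have hg0 : 0 < g := by have := Th_lt_one; linarith
  refine ⟨64 * Cg ^ 2 / g ^ 2 + 2 * (2 * t₀ ^ 4) / g, by positivity, ?_⟩
  filter_upwards [hc.lam_upper ho hb hg0, eventually_ge_atTop 1] with B hlam hB1 u hu hN hQ
  have hB0 : 0 < B := by linarith
  set β := Real.sqrt B with hβ
  have hβ0 : 0 < β := Real.sqrt_pos.2 hB0
  have hβ2 : β ^ 2 = B := Real.sq_sqrt hB0.le
  set η : Plane → ℝ := fun x => bump (β * P.dst t₀ x) with hη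
  have hbC : ContDiff ℝ 1 fun y => bump (β * y) := contDiff_bump.comp (contDiff_const.mul contDiff_id)
  have hηC : CNearCl 1 Ω η := hc.cNearCl_comp_dst ho (n := 1) hbC
  have hηm : ∀ x ∈ closure Ω, η x ^ 2 ≤ B ^ 2 * t₀ ^ 4 := by
    intro x _
    have h1 : max (β * P.dst t₀ x - 1) 0 ≤ β * t₀ := by
      refine max_le ?_ (by positivity)
      have := mul_le_mul_of_nonneg_left (hc.dst_le x) hβ0.le
      linarith
    calc η x ^ 2 = (max (β * P.dst t₀ x - 1) 0) ^ 4 := by simp only [hη, bump]; ring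
      _ ≤ (β * t₀) ^ 4 := pow_le_pow_left₀ (le_max_right _ _) h1 4
      _ = _ := by rw [← hβ2]; ring
  have h1 := hc.near_min_mul ho hb B hu (ε := 1 / B ^ 2) (by rw [hN, mul_one]; exact hQ) hηC
    (by positivity) hηm
  have hz : ∀ x, P.dst t₀ x < 1 / β → (η x : ℂ) * u x = 0 := by
    intro x hx
    rw [lt_div_iff₀ hβ0] at hx
    have : η x = 0 := by
      simp only [hη, bump]
      rw [max_eq_right (by linarith)]; simp
    rw [this]; simp
  have h2 := hc.interior_bound ho hb B (hηC.ofReal_mul hu) (σ := 1 / β) (by positivity) hz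
  have eS : (∫ x in Ω, ‖(η x : ℂ) * u x‖ ^ 2) = ∫ x in Ω, η x ^ 2 * ‖u x‖ ^ 2 := by
    simp only [norm_ofReal_mul_sq]
  rw [eS] at h1 h2
  set S := ∫ x in Ω, η x ^ 2 * ‖u x‖ ^ 2 with hS
  have hS0 : 0 ≤ S := integral_nonneg fun x => by positivity
  have iη2 : IntegrableOn (fun x => η x ^ 2 * ‖u x‖ ^ 2) Ω :=
    (hηC.map (g := fun r : ℝ => r ^ 2) (by fun_prop)).integrableOn_mul_nsq hb hu
  have iu := integrableOn_nsq hb hu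
  have h3 : (∫ x in Ω, gsq η x * ‖u x‖ ^ 2) ≤
      4 * B * Cg * (g / (16 * Cg) * S + 4 * Cg / g) := by
    have : 4 * B * Cg * (g / (16 * Cg) * S + 4 * Cg / g) =
        ∫ x in Ω, (4 * B * Cg * (g / (16 * Cg)) * (η x ^ 2 * ‖u x‖ ^ 2) +
          4 * B * Cg * (4 * Cg / g) * ‖u x‖ ^ 2) := by
      rw [integral_add (iη2.const_mul _) (iu.const_mul _), integral_const_mul, integral_const_mul, hN]
      ring
    rw [this]
    refine setIntegral_mono_on (integrableOn_gsq_nsq hb hηC hu)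
      ((iη2.const_mul _).add (iu.const_mul _)) ho.measurableSet fun x hx => ?_
    have hx' := subset_closure hx
    have hd := (hc.cNearCl_dst ho 1).differentiableAt hx'
    have e1 : gsq η x = 4 * B * η x * gsq (P.dst t₀) x := by
      simp only [hη]
      rw [gsq_comp (hbC.differentiable (by norm_num) _) hd]
      have : deriv (fun y => bump (β * y)) (P.dst t₀ x) =
          β * (2 * max (β * P.dst t₀ x - 1) 0) := by
        have h := ((contDiff_bump.differentiable (by norm_num) (β * P.dst t₀ x)).hasDerivAt).comp
          (P.dst t₀ x) ((hasDerivAt_id (P.dst t₀ x)).const_mul β)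
        have h' : HasDerivAt (fun y => bump (β * y)) (deriv bump (β * P.dst t₀ x) * (β * 1))
          (P.dst t₀ x) := h
        rw [h'.deriv, deriv_bump]; ring
      rw [this, ← hβ2]
      simp only [bump]; ring
    have hη0 : 0 ≤ η x := sq_nonneg _
    have e2 : η x ≤ g / (16 * Cg) * η x ^ 2 + 4 * Cg / g := by
      have := sq_nonneg (g / (8 * Cg) * η x - 1)
      have e3 : g / (16 * Cg) * η x ^ 2 + 4 * Cg / g - η x =
          (4 * Cg / g) * (g / (8 * Cg) * η x - 1) ^ 2 := by field_simp; ring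
      have e4 : 0 ≤ (4 * Cg / g) * (g / (8 * Cg) * η x - 1) ^ 2 := by positivity
      linarith
    have e5 : gsq η x ≤ 4 * B * Cg * (g / (16 * Cg) * η x ^ 2 + 4 * Cg / g) := by
      rw [e1]
      calc 4 * B * η x * gsq (P.dst t₀) x ≤ 4 * B * η x * Cg :=
            mul_le_mul_of_nonneg_left (hCgb x hx') (by positivity)
        _ = 4 * B * Cg * η x := by ring
        _ ≤ _ := mul_le_mul_of_nonneg_left e2 (by positivity)
    have := mul_le_mul_of_nonneg_right e5 (sq_nonneg ‖u x‖)
    linarith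
  refine decay_scalar hg0 hB1 ?_ hCg (by positivity)
  have e : 2 * (B ^ 2 * t₀ ^ 4) * (1 / B ^ 2) = 2 * t₀ ^ 4 := by field_simp
  rw [e] at h1
  have h5 := mul_le_mul_of_nonneg_right hlam hS0
  have h6 : Th + g = 1 - g := by rw [hg]; ring
  rw [h6] at h5
  linarith

lemma decay (ho : IsOpen Ω) (hb : Bornology.IsBounded Ω) :
    ∃ C > 0, ∀ᶠ B in atTop, ∀ u : Plane → ℂ, CNearCl 1 Ω u → (∫ x in Ω, ‖u x‖ ^ 2) = 1 →
      (∫ x in Ω, en (fun y => B • P.G t₀ y) u x) ≤ lam1 Ω B + 1 / B ^ 2 →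
      B * (∫ x in Ω, P.dst t₀ x ^ 2 * ‖u x‖ ^ 2) ≤ C ∧
      (∫ x in Ω, ‖(eta (t₀ / 4) (P.dst t₀ x) : ℂ) * u x‖ ^ 2) ≤ C / B ^ 2 ∧
      (∫ x in Ω, en (fun y => B • P.G t₀ y) (fun y => (xi (t₀ / 4) (P.dst t₀ y) : ℂ) * u y) x) ≤
        lam1 Ω B * (∫ x in Ω, ‖(xi (t₀ / 4) (P.dst t₀ x) : ℂ) * u x‖ ^ 2) + C / B ^ 2 ∧
      (∫ x in Ω, en (fun y => B • P.G t₀ y) (fun y => (eta (t₀ / 4) (P.dst t₀ y) : ℂ) * u y) x) ≤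
        C / B := by
  obtain ⟨C₁, hC₁, h₁⟩ := hc.bump_decay ho hb
  obtain ⟨Cg, hCg, hCgb⟩ := hc.exists_gsq_bound ho hb
  obtain ⟨Cd, hCd, hCdb⟩ := exists_cut_deriv_bound
  have ht := hc.pos
  set c := t₀ / 4 with hcdef
  have hc0 : 0 < c := by positivity
  set D := 256 * 1 / c ^ 4 * C₁ with hD
  set E := 256 * (Cd / c ^ 2 * Cg) / c ^ 4 * C₁ with hE
  have hD0 : 0 < D := by positivity
  have hE0 : 0 < E := by positivity
  refine ⟨3 + C₁ + D + 2 * E + 2, by positivity, ?_⟩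
  have hbig : ∀ᶠ B : ℝ in atTop, 4 ≤ Real.sqrt B * c := by
    filter_upwards [(Real.tendsto_sqrt_atTop).eventually_ge_atTop (4 / c)] with B hB
    rwa [div_le_iff₀ hc0] at hB
  filter_upwards [h₁, eventually_ge_atTop 1, hbig, hc.lam_upper ho hb (sub_pos.2 Th_lt_one)] with
    B h₁ hB1 hβc hlam u hu hN hQ
  rw [add_sub_cancel, one_mul] at hlam
  have hB0 : 0 < B := by linarith
  have h₂ := h₁ u hu hN hQ
  set β := Real.sqrt B with hβ
  have hβ0 : 0 < β := Real.sqrt_pos.2 hB0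
  have hβ2 : β ^ 2 = B := Real.sq_sqrt hB0.le
  have hβ4 : β ^ 4 = B ^ 2 := by rw [← hβ2]; ring
  set η : Plane → ℝ := fun x => bump (β * P.dst t₀ x) with hη
  have hbC : ContDiff ℝ 1 fun y => bump (β * y) := contDiff_bump.comp (contDiff_const.mul contDiff_id)
  have hηC : CNearCl 1 Ω η := hc.cNearCl_comp_dst ho (n := 1) hbC
  have iη2 : IntegrableOn (fun x => η x ^ 2 * ‖u x‖ ^ 2) Ω :=
    (hηC.map (g := fun r : ℝ => r ^ 2) (by fun_prop)).integrableOn_mul_nsq hb hu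
  have iu := integrableOn_nsq hb hu
  have hdst := hc.cNearCl_dst ho 1
  have heC : CNearCl 1 Ω fun x => eta c (P.dst t₀ x) := hc.cNearCl_comp_dst ho (n := 1)
    ((contDiff_eta c (n := 1)))
  have hxC : CNearCl 1 Ω fun x => xi c (P.dst t₀ x) := hc.cNearCl_comp_dst ho (n := 1)
    ((contDiff_xi c (n := 1)))
  have hdom : ∀ (f : Plane → ℝ) (A : ℝ), 0 ≤ A → IntegrableOn (fun x => f x * ‖u x‖ ^ 2) Ω →
      (∀ x ∈ Ω, P.dst t₀ x < c / 2 → f x = 0) → (∀ x ∈ Ω, f x ≤ A) →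
      (∫ x in Ω, f x * ‖u x‖ ^ 2) ≤ 256 * A / c ^ 4 * C₁ / B ^ 2 := by
    intro f A hA hf h0 hfA
    have h3 : (∫ x in Ω, f x * ‖u x‖ ^ 2) ≤
        ∫ x in Ω, 256 * A / (β ^ 4 * c ^ 4) * (η x ^ 2 * ‖u x‖ ^ 2) := by
      refine setIntegral_mono_on hf (iη2.const_mul _) ho.measurableSet fun x hx => ?_
      have := eta_le_bump hc0 hβc hβ0 (P.dst t₀ x) hA (h0 x hx) (hfA x hx)
      have := mul_le_mul_of_nonneg_right this (sq_nonneg ‖u x‖)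
      linarith
    rw [integral_const_mul] at h3
    refine h3.trans ((mul_le_mul_of_nonneg_left h₂ (by positivity)).trans (le_of_eq ?_))
    rw [hβ4]; field_simp
  have hgs : ∀ g : ℝ → ℝ, ContDiff ℝ 1 g → (∀ y < c / 2, deriv g y = 0) →
      (∀ y, deriv g y ^ 2 ≤ Cd / c ^ 2) →
      (∫ x in Ω, gsq (fun x => g (P.dst t₀ x)) x * ‖u x‖ ^ 2) ≤ E / B ^ 2 := by
    intro g hg h0 hgb
    have e : ∀ x ∈ Ω, gsq (fun x => g (P.dst t₀ x)) x = deriv g (P.dst t₀ x) ^ 2 * gsq (P.dst t₀) x :=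
      fun x hx => gsq_comp (hg.differentiable (by norm_num) _) (hdst.differentiableAt (subset_closure hx))
    refine hdom _ (Cd / c ^ 2 * Cg) (by positivity)
      (integrableOn_gsq_nsq hb (hc.cNearCl_comp_dst ho (n := 1) hg) hu) ?_ ?_
    · intro x hx hlt
      rw [e x hx, h0 _ hlt]; simp
    · intro x hx
      rw [e x hx]
      exact mul_le_mul (hgb _) (hCgb x (subset_closure hx)) (gsq_nonneg _ _) (by positivity)
  have heta : (∫ x in Ω, ‖(eta c (P.dst t₀ x) : ℂ) * u x‖ ^ 2) ≤ D / B ^ 2 := by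
    simp only [norm_ofReal_mul_sq]
    refine hdom _ 1 (by norm_num)
      ((heC.map (g := fun r : ℝ => r ^ 2) (by fun_prop)).integrableOn_mul_nsq hb hu) ?_
      fun x _ => eta_sq_le _ _
    intro x _ hlt
    rw [eta_zero hc0 hlt.le]; simp
  have gxi := hgs (xi c) (contDiff_xi c (n := 1)) (fun y => deriv_xi_low hc0)
    fun y => by have := hCdb c hc0 y; nlinarith [sq_nonneg (deriv (eta c) y)]
  have geta := hgs (eta c) (contDiff_eta c (n := 1)) (fun y => deriv_eta_low hc0)
    fun y => by have := hCdb c hc0 y; nlinarith [sq_nonneg (deriv (xi c) y)]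
  have hQ' : (∫ x in Ω, en (fun y => B • P.G t₀ y) u x) ≤
      lam1 Ω B * (∫ x in Ω, ‖u x‖ ^ 2) + 1 / B ^ 2 := by rw [hN, mul_one]; exact hQ
  have q1 := hc.near_min_mul ho hb B hu hQ' hxC one_pos fun x _ => xi_sq_le _ _
  have q2 := hc.near_min_mul ho hb B hu hQ' heC one_pos fun x _ => eta_sq_le _ _
  have hBB : B ≤ B ^ 2 := by nlinarith
  refine ⟨?_, ?_, ?_, ?_⟩
  · have h3 : (∫ x in Ω, B * (P.dst t₀ x ^ 2 * ‖u x‖ ^ 2)) ≤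
        ∫ x in Ω, (3 * ‖u x‖ ^ 2 + η x ^ 2 * ‖u x‖ ^ 2) := by
      refine setIntegral_mono_on (((hdst.map (g := fun r : ℝ => r ^ 2)
        (by fun_prop)).integrableOn_mul_nsq hb hu).const_mul _)
        ((iu.const_mul 3).add iη2) ho.measurableSet fun x hx => ?_
      have := bump_pw (β * P.dst t₀ x) (mul_nonneg hβ0.le (hc.dst_pos hx).le)
      rw [mul_pow, hβ2] at this
      have := mul_le_mul_of_nonneg_right this (sq_nonneg ‖u x‖)
      simp only [hη]
      linarith
    rw [integral_const_mul, integral_add (iu.const_mul 3) iη2, integral_const_mul, hN] at h3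
    linarith
  · refine heta.trans (div_le_div_of_nonneg_right (by linarith) (by positivity))
  · refine q1.trans ?_
    have : (3 + C₁ + D + 2 * E + 2) / B ^ 2 = (3 + C₁ + D) / B ^ 2 + 2 * (E / B ^ 2) + 2 * 1 * (1 / B ^ 2) := by
      ring
    have : 0 ≤ (3 + C₁ + D) / B ^ 2 := by positivity
    linarith
  · refine q2.trans ?_
    have e1 : (3 + C₁ + D + 2 * E + 2) / B = (3 + C₁) / B + D / B + 2 * (E / B) + 2 * (1 / B) := by
      ring
    have e2 : 0 ≤ (3 + C₁) / B := by positivity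
    have e3 : lam1 Ω B * (∫ x in Ω, ‖(eta c (P.dst t₀ x) : ℂ) * u x‖ ^ 2) ≤ D / B := by
      calc _ ≤ B * (D / B ^ 2) := mul_le_mul hlam heta (integral_nonneg fun _ => sq_nonneg _) hB0.le
        _ = D / B := by field_simp
    have e4 : E / B ^ 2 ≤ E / B := div_le_div_of_nonneg_left hE0.le hB0 hBB
    have e5 : 1 / B ^ 2 ≤ 1 / B := div_le_div_of_nonneg_left one_pos.le hB0 hBB
    linarith

end BoundaryParam.Collar
end
end SC

namespace SC

section
variable {Ω : Set Plane}

lemma continuousOn_dot2 {a b : Plane → Plane} {S : Set Plane} (ha : ContinuousOn a S)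
    (hb : ContinuousOn b S) : ContinuousOn (fun x => dot2 (a x) (b x)) S :=
  (ha.fst.mul hb.fst).add (ha.snd.mul hb.snd)

lemma continuousOn_esq {a : Plane → Plane} {S : Set Plane} (ha : ContinuousOn a S) :
    ContinuousOn (fun x => esq (a x)) S :=
  (ha.fst.pow 2).add (ha.snd.pow 2)

lemma integrableOn_dot_cur (hb : Bornology.IsBounded Ω) {a c : Plane → Plane} {u : Plane → ℂ}
    (ha : ContinuousOn a (closure Ω)) (hc : ContinuousOn c (closure Ω)) (hu : CNearCl 1 Ω u) :
    IntegrableOn (fun x => dot2 (c x) (cur a u x)) Ω :=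
  integrableOn_of_continuousOn_closure hb (continuousOn_dot2 hc (continuousOn_cur ha hu))

lemma integrableOn_esq_nsq (hb : Bornology.IsBounded Ω) {c : Plane → Plane} {u : Plane → ℂ}
    (hc : ContinuousOn c (closure Ω)) (hu : CNearCl 1 Ω u) :
    IntegrableOn (fun x => esq (c x) * ‖u x‖ ^ 2) Ω :=
  integrableOn_of_continuousOn_closure hb ((continuousOn_esq hc).mul (hu.continuousOn.norm.pow 2))

lemma integral_en_shift (hb : Bornology.IsBounded Ω) {a c : Plane → Plane} {u : Plane → ℂ}
    (ha : ContinuousOn a (closure Ω)) (hc : ContinuousOn c (closure Ω)) (hu : CNearCl 1 Ω u) :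
    (∫ x in Ω, en (fun y => a y + c y) u x) = (∫ x in Ω, en a u x) -
      2 * (∫ x in Ω, dot2 (c x) (cur a u x)) + ∫ x in Ω, esq (c x) * ‖u x‖ ^ 2 := by
  have i1 := integrableOn_en hb ha hu
  have i2 := integrableOn_dot_cur hb ha hc hu
  have i3 := integrableOn_esq_nsq hb hc hu
  have i12 : IntegrableOn (fun x => en a u x - 2 * dot2 (c x) (cur a u x)) Ω := i1.sub (i2.const_mul 2)
  simp only [en_shift]
  rw [integral_add i12 i3, integral_sub i1 (i2.const_mul 2), integral_const_mul]

lemma esq_add_le (v w : Plane) : esq (v + w) ≤ 2 * esq v + 2 * esq w := by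
  simp only [esq, Prod.fst_add, Prod.snd_add]
  nlinarith [sq_nonneg (v.1 - w.1), sq_nonneg (v.2 - w.2)]

lemma esq_smul (r : ℝ) (v : Plane) : esq (r • v) = r ^ 2 * esq v := by
  simp only [esq, Prod.smul_fst, Prod.smul_snd, smul_eq_mul]; ring

lemma dot2_add_left (v w z : Plane) : dot2 (v + w) z = dot2 v z + dot2 w z := by
  simp only [dot2, Prod.fst_add, Prod.snd_add]; ring

lemma dot2_smul_left (r : ℝ) (v z : Plane) : dot2 (r • v) z = r * dot2 v z := by
  simp only [dot2, Prod.smul_fst, Prod.smul_snd, smul_eq_mul]; ring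

lemma dot2_smul_right (r : ℝ) (v z : Plane) : dot2 v (r • z) = r * dot2 v z := by
  simp only [dot2, Prod.smul_fst, Prod.smul_snd, smul_eq_mul]; ring

lemma eventually_div_le (C : ℝ) {s : ℝ} (hs : 0 < s) : ∀ᶠ B : ℝ in atTop, C / B ≤ s :=
  (tendsto_id.const_div_atTop C).eventually_le_const hs

lemma eventually_div_sqrt_le (C : ℝ) {s : ℝ} (hs : 0 < s) :
    ∀ᶠ B : ℝ in atTop, C / Real.sqrt B ≤ s :=
  (Real.tendsto_sqrt_atTop.const_div_atTop C).eventually_le_const hs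

variable (P : BoundaryParam Ω) (t₀ : ℝ)

/-- Normalized functions whose energy is within `1 / B²` of the ground state energy. -/
def BoundaryParam.NearMin (B : ℝ) (u : Plane → ℂ) : Prop :=
  CNearCl 1 Ω u ∧ (∫ x in Ω, ‖u x‖ ^ 2) = 1 ∧
    (∫ x in Ω, en (fun y => B • P.G t₀ y) u x) ≤ lam1 Ω B + 1 / B ^ 2

/-- Localization of a function to the boundary collar. -/
def BoundaryParam.loc (u : Plane → ℂ) (x : Plane) : ℂ := (xi (t₀ / 4) (P.dst t₀ x) : ℂ) * u x

/-- The angular current. -/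
def BoundaryParam.curI (B : ℝ) (u : Plane → ℂ) : ℝ :=
  -∫ x in Ω, dot2 (P.om t₀ x) (cur (fun y => B • P.G t₀ y) (P.loc t₀ u) x)

/-- The current paired with the part of the potential that vanishes on the boundary. -/
def BoundaryParam.curJ (B : ℝ) (u : Plane → ℂ) : ℝ :=
  -∫ x in Ω, dot2 (P.G t₀ x - P.area • P.om t₀ x) (cur (fun y => B • P.G t₀ y) (P.loc t₀ u) x)

variable {P t₀}

lemma norm_loc_sq (u : Plane → ℂ) (x : Plane) :
    ‖P.loc t₀ u x‖ ^ 2 = xi (t₀ / 4) (P.dst t₀ x) ^ 2 * ‖u x‖ ^ 2 := norm_ofReal_mul_sq _ _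

lemma norm_loc_le (u : Plane → ℂ) (x : Plane) : ‖P.loc t₀ u x‖ ^ 2 ≤ ‖u x‖ ^ 2 := by
  rw [norm_loc_sq]
  exact mul_le_of_le_one_left (sq_nonneg _) (xi_sq_le _ _)

namespace BoundaryParam.Collar
variable (hc : P.Collar t₀)
include hc

lemma loc_zero (u : Plane → ℂ) {x : Plane} (h : t₀ / 4 ≤ P.dst t₀ x) : P.loc t₀ u x = 0 := by
  simp [loc, xi_zero (by linarith [hc.pos] : 0 < t₀ / 4) h]

lemma cNearCl_loc (ho : IsOpen Ω) {u : Plane → ℂ} (hu : CNearCl 1 Ω u) : CNearCl 1 Ω (P.loc t₀ u) :=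
  (hc.cNearCl_comp_dst ho (n := 1) (contDiff_xi (t₀ / 4) (n := 1))).ofReal_mul hu

lemma lam_loc_le (ho : IsOpen Ω) (B : ℝ) (n : ℤ) {u : Plane → ℂ} (hu : CNearCl 1 Ω u) :
    lam1 Ω B * (∫ x in Ω, ‖P.loc t₀ u x‖ ^ 2) ≤
      ∫ x in Ω, en (fun y => B • P.G t₀ y - (2 * Real.pi * n) • P.om t₀ y) (P.loc t₀ u) x := by
  have h := hc.lam_le_G ho B ((hc.cNearCl_wnd ho n 1).mul hu)
  have e1 : (∫ x in Ω, ‖P.wnd t₀ n x * u x‖ ^ 2) = ∫ x in Ω, ‖P.loc t₀ u x‖ ^ 2 :=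
    setIntegral_congr_fun ho.measurableSet fun x hx => by
      rw [norm_mul, mul_pow, hc.norm_wnd hx, norm_loc_sq]
  have e2 : (∫ x in Ω, en (fun y => B • P.G t₀ y) (fun y => P.wnd t₀ n y * u y) x) =
      ∫ x in Ω, en (fun y => B • P.G t₀ y - (2 * Real.pi * n) • P.om t₀ y) (P.loc t₀ u) x :=
    setIntegral_congr_fun ho.measurableSet fun x hx =>
      hc.en_wnd ho _ n hx (hu.differentiableAt (subset_closure hx))
  rwa [e1, e2] at h

lemma mass_om (ho : IsOpen Ω) (hb : Bornology.IsBounded Ω) :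
    ∃ C > 0, ∀ᶠ B in atTop, ∀ u, P.NearMin t₀ B u →
      (∫ x in Ω, esq (P.om t₀ x) * ‖P.loc t₀ u x‖ ^ 2) ≤ 1 / P.L ^ 2 + C / Real.sqrt B := by
  obtain ⟨C, hC, h⟩ := hc.decay ho hb
  obtain ⟨K, hK, hKb⟩ := P.exists_kap_bound
  have hL := P.L_pos
  have ht := hc.pos
  refine ⟨3 * K / P.L ^ 2 * (C + 1), by positivity, ?_⟩
  filter_upwards [h, eventually_gt_atTop 0] with B h hB u hu
  obtain ⟨h1, -⟩ := h u hu.1 hu.2.1 hu.2.2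
  set β := Real.sqrt B with hβ
  have hβ0 : 0 < β := Real.sqrt_pos.2 hB
  have hβ2 : β ^ 2 = B := Real.sq_sqrt hB.le
  have iu := integrableOn_nsq hb hu.1
  have id : IntegrableOn (fun x => P.dst t₀ x ^ 2 * ‖u x‖ ^ 2) Ω := (((hc.cNearCl_dst ho 1).map
    (g := fun r : ℝ => r ^ 2) (by fun_prop)).integrableOn_mul_nsq hb hu.1)
  have h2 : (∫ x in Ω, esq (P.om t₀ x) * ‖P.loc t₀ u x‖ ^ 2) ≤
      ∫ x in Ω, ((1 / P.L ^ 2 + 3 * K / P.L ^ 2 * β⁻¹) * ‖u x‖ ^ 2 +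
        3 * K / P.L ^ 2 * β * (P.dst t₀ x ^ 2 * ‖u x‖ ^ 2)) := by
    refine setIntegral_mono_on (integrableOn_esq_nsq hb (hc.continuousOn_om ho) (hc.cNearCl_loc ho hu.1))
      ((iu.const_mul _).add (id.const_mul _)) ho.measurableSet fun x hx => ?_
    rcases lt_or_ge (P.dst t₀ x) (t₀ / 4) with hd | hd
    · have e1 := hc.esq_om_le hKb hx (by linarith)
      have e2 : 2 * P.dst t₀ x ≤ β * P.dst t₀ x ^ 2 + β⁻¹ := by
        have : β * P.dst t₀ x ^ 2 + β⁻¹ - 2 * P.dst t₀ x = β⁻¹ * (β * P.dst t₀ x - 1) ^ 2 := by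
          field_simp; ring
        have h0 : 0 ≤ β⁻¹ * (β * P.dst t₀ x - 1) ^ 2 := by positivity
        linarith
      have e3 : (1 + 6 * K * P.dst t₀ x) / P.L ^ 2 ≤ 1 / P.L ^ 2 + 3 * K / P.L ^ 2 * β⁻¹ +
          3 * K / P.L ^ 2 * β * P.dst t₀ x ^ 2 := by
        have := mul_le_mul_of_nonneg_left e2 (by positivity : 0 ≤ 3 * K / P.L ^ 2)
        have e : (1 + 6 * K * P.dst t₀ x) / P.L ^ 2 = 1 / P.L ^ 2 + 3 * K / P.L ^ 2 * (2 * P.dst t₀ x) := by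
          ring
        rw [e]; linarith
      calc esq (P.om t₀ x) * ‖P.loc t₀ u x‖ ^ 2 ≤ esq (P.om t₀ x) * ‖u x‖ ^ 2 :=
            mul_le_mul_of_nonneg_left (norm_loc_le u x) (esq_nonneg _)
        _ ≤ _ := mul_le_mul_of_nonneg_right (e1.trans e3) (sq_nonneg _)
        _ = _ := by ring
    · rw [hc.loc_zero u hd]
      simp only [norm_zero, ne_eq, OfNat.ofNat_ne_zero, not_false_eq_true, zero_pow, mul_zero]
      positivity
  rw [integral_add (iu.const_mul _) (id.const_mul _), integral_const_mul, integral_const_mul, hu.2.1] at h2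
  refine h2.trans ?_
  have h3 : β * (∫ x in Ω, P.dst t₀ x ^ 2 * ‖u x‖ ^ 2) ≤ C / β := by
    rw [le_div_iff₀ hβ0]; rw [← hβ2] at h1; linarith
  have h4 := mul_le_mul_of_nonneg_left h3 (by positivity : 0 ≤ 3 * K / P.L ^ 2)
  have h5 : 3 * K / P.L ^ 2 * (C + 1) / β = 3 * K / P.L ^ 2 * (C / β) + 3 * K / P.L ^ 2 * β⁻¹ := by ring
  rw [h5]; linarith

lemma curI_le (ho : IsOpen Ω) (hb : Bornology.IsBounded Ω) :
    ∃ C > 0, ∀ᶠ B in atTop, ∀ u, P.NearMin t₀ B u →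
      |P.curI t₀ B u| ≤ Real.pi / P.L ^ 2 + C / Real.sqrt B := by
  obtain ⟨C, hC, h⟩ := hc.decay ho hb
  obtain ⟨D, hD, h'⟩ := hc.mass_om ho hb
  have hpi := Real.pi_pos
  refine ⟨C + Real.pi * D, by positivity, ?_⟩
  filter_upwards [h, h', eventually_ge_atTop 1] with B h h' hB u hu
  obtain ⟨-, -, h1, -⟩ := h u hu.1 hu.2.1 hu.2.2
  have h2 := h' u hu
  have hv := hc.cNearCl_loc ho hu.1
  have ha : ContinuousOn (fun y => B • P.G t₀ y) (closure Ω) := (hc.continuousOn_G ho).const_smul B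
  have hom := hc.continuousOn_om ho
  have key : ∀ n : ℤ, 4 * Real.pi * n * P.curI t₀ B u ≤ C / B ^ 2 + 4 * Real.pi ^ 2 * n ^ 2 *
      ∫ x in Ω, esq (P.om t₀ x) * ‖P.loc t₀ u x‖ ^ 2 := by
    intro n
    have e1 := hc.lam_loc_le ho B n hu.1
    have e2 := integral_en_shift hb (a := fun y => B • P.G t₀ y)
      (c := fun y => (-(2 * Real.pi * n)) • P.om t₀ y) ha (hom.const_smul (-(2 * Real.pi * n))) hv
    simp only [esq_smul, dot2_smul_left, mul_assoc, integral_const_mul] at e2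
    have e3 : (fun y => B • P.G t₀ y - (2 * Real.pi * n) • P.om t₀ y) =
        fun y => B • P.G t₀ y + (-(2 * (Real.pi * n))) • P.om t₀ y := by
      funext y; rw [neg_smul, ← sub_eq_add_neg, mul_assoc]
    rw [e3, e2] at e1
    simp only [BoundaryParam.curI]
    have h1' : (∫ x in Ω, en (fun y => B • P.G t₀ y) (P.loc t₀ u) x) ≤
      lam1 Ω B * (∫ x in Ω, ‖P.loc t₀ u x‖ ^ 2) + C / B ^ 2 := h1
    linarith
  have k1 := key 1
  have k2 := key (-1)
  push_cast at k1 k2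
  set W := ∫ x in Ω, esq (P.om t₀ x) * ‖P.loc t₀ u x‖ ^ 2
  have hβ : 1 ≤ Real.sqrt B := Real.one_le_sqrt.2 hB
  have hβ2 : Real.sqrt B ^ 2 = B := Real.sq_sqrt (by linarith)
  have h3 : C / B ^ 2 ≤ C / Real.sqrt B := by
    refine div_le_div_of_nonneg_left hC.le (by linarith) ?_
    nlinarith
  have h4 : C / Real.sqrt B ≤ 4 * Real.pi * (C / Real.sqrt B) := by
    have : 1 ≤ 4 * Real.pi := by linarith [Real.pi_gt_three]
    have h0 : 0 ≤ C / Real.sqrt B := by positivity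
    nlinarith
  have h5 := mul_le_mul_of_nonneg_left h2 (by positivity : 0 ≤ 4 * Real.pi ^ 2)
  have e6 : 4 * Real.pi ^ 2 * (1 / P.L ^ 2 + D / Real.sqrt B) + 4 * Real.pi * (C / Real.sqrt B) =
      4 * Real.pi * (Real.pi / P.L ^ 2 + (C + Real.pi * D) / Real.sqrt B) := by ring
  rw [abs_le]
  have hp4 : 0 < 4 * Real.pi := by positivity
  constructor
  · refine le_of_mul_le_mul_left ?_ hp4
    linarith
  · refine le_of_mul_le_mul_left ?_ hp4
    linarith

lemma mass_loc (ho : IsOpen Ω) (hb : Bornology.IsBounded Ω) {u : Plane → ℂ} (hu : CNearCl 1 Ω u) :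
    (∫ x in Ω, ‖P.loc t₀ u x‖ ^ 2) +
      (∫ x in Ω, ‖(eta (t₀ / 4) (P.dst t₀ x) : ℂ) * u x‖ ^ 2) = ∫ x in Ω, ‖u x‖ ^ 2 := by
  have := integral_nsq_add ho hb (M := 1)
    (hc.cNearCl_comp_dst ho (n := 1) (contDiff_xi (t₀ / 4) (n := 1)))
    (hc.cNearCl_comp_dst ho (n := 1) (contDiff_eta (t₀ / 4) (n := 1))) hu fun x _ => xi_sq_add _ _
  rw [one_mul] at this
  exact this

end BoundaryParam.Collar
end
end SC

namespace SC

lemma curJ_scalar {T C D B m η s' J : ℝ} (hT0 : 0 < T) (hT1 : T < 1) (hB : 1 ≤ B) (hη : 0 < η) (hη1 : η ≤ 1)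
    (hm1 : m ≤ 1) (hm : 1 - C / B ≤ m) (hm0 : 0 ≤ m) (hs : 0 < s')
    (h : (T - s' * η) * ((1 + η) * B) * m ≤ (T + s' * η) * B * m + 2 * (η * B) * J + D +
      18 * (η * B) ^ 2 * (C / B)) :
    T - 3 * s' - C / B - D / (η * B) - 18 * η * C ≤ 2 * J := by
  have hB0 : 0 < B := by linarith
  have hηB : 0 < η * B := by positivity
  have e1 : 18 * (η * B) ^ 2 * (C / B) = η * B * (18 * η * C) := by field_simp
  have e2 : D = η * B * (D / (η * B)) := by field_simp
  rw [e1] at h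
  have e3 : η * B * (m * (T - 3 * s')) ≤ (T - s' * η) * ((1 + η) * B) * m - (T + s' * η) * B * m := by
    have h1 : 0 ≤ s' * η * (B * m) * (1 - η) := by
      have : 0 ≤ 1 - η := by linarith
      positivity
    have : (T - s' * η) * ((1 + η) * B) * m - (T + s' * η) * B * m - η * B * (m * (T - 3 * s')) =
      s' * η * (B * m) * (1 - η) := by ring
    linarith
  have e4 : η * B * (m * (T - 3 * s')) ≤ η * B * (2 * J + D / (η * B) + 18 * η * C) := by
    have : η * B * (2 * J + D / (η * B) + 18 * η * C) =
        2 * (η * B) * J + η * B * (D / (η * B)) + η * B * (18 * η * C) := by ring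
    rw [this, ← e2]; linarith
  have e5 := le_of_mul_le_mul_left e4 hηB
  have e6 : T - 3 * s' - C / B ≤ m * (T - 3 * s') := by nlinarith
  linarith

section
variable {Ω : Set Plane} {P : BoundaryParam Ω} {t₀ : ℝ}

namespace BoundaryParam.Collar
variable (hc : P.Collar t₀)
include hc

lemma curJ_ge (ho : IsOpen Ω) (hne : Ω.Nonempty) (hb : Bornology.IsBounded Ω) {s : ℝ} (hs : 0 < s) :
    ∀ᶠ B in atTop, ∀ u, P.NearMin t₀ B u → Th - s ≤ 2 * P.curJ t₀ B u := by
  obtain ⟨C, hC, h⟩ := hc.decay ho hb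
  obtain ⟨C₂, hC₂, h₂⟩ := hc.mass_om ho hb
  obtain ⟨C₃, hC₃, h₃⟩ := hc.curI_le ho hb
  have hpi := Real.pi_pos
  have hL := P.L_pos
  have hT0 : 0 < Th := by linarith [half_lt_Th]
  set η := min 1 (s / (72 * C)) with hη
  have hη0 : 0 < η := by positivity
  have hη1 : η ≤ 1 := min_le_left _ _
  have hηC : 18 * η * C ≤ s / 4 := by
    have : η ≤ s / (72 * C) := min_le_right _ _
    have h1 := mul_le_mul_of_nonneg_right this (by positivity : 0 ≤ 18 * C)
    have h2 : s / (72 * C) * (18 * C) = s / 4 := by field_simp; norm_num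
    linarith
  set s' := s / 12 with hs'
  have hs'0 : 0 < s' := by positivity
  set D := C + 2 * Real.pi * (Real.pi / P.L ^ 2 + C₃) + 2 * Real.pi ^ 2 * (1 / P.L ^ 2 + C₂) with hD
  have hlow : ∀ᶠ B : ℝ in atTop, (Th - s' * η) * ((1 + η) * B) ≤ lam1 Ω ((1 + η) * B) :=
    (tendsto_id.const_mul_atTop (by positivity : 0 < 1 + η)).eventually
      (hc.lam_lower ho hne hb (by positivity : 0 < s' * η))
  filter_upwards [h, h₂, h₃, eventually_ge_atTop 1, hlow, hc.lam_upper ho hb (by positivity : 0 < s' * η),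
    eventually_div_le C (by positivity : 0 < s / 4), eventually_div_le (D / η) (by positivity : 0 < s / 4)]
    with B h h₂ h₃ hB hlow hup hCB hDB u hu
  have hB0 : 0 < B := by linarith
  obtain ⟨h1, hm2, hQ, -⟩ := h u hu.1 hu.2.1 hu.2.2
  have hW := h₂ u hu
  have hI := h₃ u hu
  have hv := hc.cNearCl_loc ho hu.1
  have hG := hc.continuousOn_G ho
  have hom := hc.continuousOn_om ho
  have ha : ContinuousOn (fun y => B • P.G t₀ y) (closure Ω) := hG.const_smul B
  have hGo : ContinuousOn (fun y => P.G t₀ y - P.area • P.om t₀ y) (closure Ω) :=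
    hG.sub (hom.const_smul P.area)
  set β := η * B with hβ
  have hβ0 : 0 < β := by positivity
  set n : ℤ := round (β * P.area / (2 * Real.pi)) with hn
  set r := β * P.area - 2 * Real.pi * n with hr
  have hrpi : |r| ≤ Real.pi := by
    have h1 := abs_sub_round (β * P.area / (2 * Real.pi))
    have h2 : r = 2 * Real.pi * (β * P.area / (2 * Real.pi) - n) := by
      rw [hr]; field_simp
    rw [h2, abs_mul, abs_of_pos (by positivity : 0 < 2 * Real.pi)]
    have := mul_le_mul_of_nonneg_left h1 (by positivity : 0 ≤ 2 * Real.pi)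
    linarith
  set m := ∫ x in Ω, ‖P.loc t₀ u x‖ ^ 2 with hm
  have hmass := hc.mass_loc ho hb hu.1
  rw [hu.2.1] at hmass
  have hm1 : m ≤ 1 := by
    have : 0 ≤ ∫ x in Ω, ‖(eta (t₀ / 4) (P.dst t₀ x) : ℂ) * u x‖ ^ 2 :=
      integral_nonneg fun _ => sq_nonneg _
    linarith
  have hm0 : 0 ≤ m := integral_nonneg fun _ => sq_nonneg _
  have hCB2 : C / B ^ 2 ≤ C / B := div_le_div_of_nonneg_left hC.le hB0 (by nlinarith)
  have hmC : 1 - C / B ≤ m := by linarith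
  set c : Plane → Plane := fun y => β • (P.G t₀ y - P.area • P.om t₀ y) + r • P.om t₀ y with hcdef
  have hcC : ContinuousOn c (closure Ω) := (hGo.const_smul β).add (hom.const_smul r)
  have e1 := hc.lam_loc_le ho ((1 + η) * B) n hu.1
  have e2 : (fun y => ((1 + η) * B) • P.G t₀ y - (2 * Real.pi * n) • P.om t₀ y) =
      fun y => B • P.G t₀ y + c y := by
    funext y
    simp only [hcdef, hr, hβ]
    module
  rw [e2, integral_en_shift hb (a := fun y => B • P.G t₀ y) ha hcC hv] at e1
  have e3 : (∫ x in Ω, dot2 (c x) (cur (fun y => B • P.G t₀ y) (P.loc t₀ u) x)) =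
      -(β * P.curJ t₀ B u) - r * P.curI t₀ B u := by
    simp only [hcdef, dot2_add_left, dot2_smul_left, curJ, curI]
    rw [integral_add ((integrableOn_dot_cur hb ha hGo hv).const_mul β)
      ((integrableOn_dot_cur hb ha hom hv).const_mul r), integral_const_mul, integral_const_mul]
    ring
  have e4 : (∫ x in Ω, esq (c x) * ‖P.loc t₀ u x‖ ^ 2) ≤ 18 * β ^ 2 * (C / B) +
      2 * Real.pi ^ 2 * ∫ x in Ω, esq (P.om t₀ x) * ‖P.loc t₀ u x‖ ^ 2 := by
    have id : IntegrableOn (fun x => P.dst t₀ x ^ 2 * ‖u x‖ ^ 2) Ω := (((hc.cNearCl_dst ho 1).map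
      (g := fun r : ℝ => r ^ 2) (by fun_prop)).integrableOn_mul_nsq hb hu.1)
    have iw := integrableOn_esq_nsq hb hom hv
    have h5 : (∫ x in Ω, esq (c x) * ‖P.loc t₀ u x‖ ^ 2) ≤
        ∫ x in Ω, (18 * β ^ 2 * (P.dst t₀ x ^ 2 * ‖u x‖ ^ 2) +
          2 * Real.pi ^ 2 * (esq (P.om t₀ x) * ‖P.loc t₀ u x‖ ^ 2)) := by
      refine setIntegral_mono_on (integrableOn_esq_nsq hb hcC hv)
        ((id.const_mul _).add (iw.const_mul _)) ho.measurableSet fun x hx => ?_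
      rcases lt_or_ge (P.dst t₀ x) (t₀ / 4) with hd | hd
      · have f1 := esq_add_le (β • (P.G t₀ x - P.area • P.om t₀ x)) (r • P.om t₀ x)
        rw [esq_smul, esq_smul] at f1
        have f2 := hc.esq_G_sub_le hx (by linarith [hc.pos])
        have f3 : r ^ 2 ≤ Real.pi ^ 2 := sq_le_sq' (by linarith [(abs_le.1 hrpi).1]) (abs_le.1 hrpi).2
        have f4 := mul_le_mul_of_nonneg_left f2 (sq_nonneg β)
        have f5 := mul_le_mul_of_nonneg_right f3 (esq_nonneg (P.om t₀ x))
        have f6 : esq (c x) ≤ 18 * β ^ 2 * P.dst t₀ x ^ 2 + 2 * Real.pi ^ 2 * esq (P.om t₀ x) := by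
          simp only [hcdef]; linarith
        have f7 := mul_le_mul_of_nonneg_right f6 (sq_nonneg ‖P.loc t₀ u x‖)
        have f8 := mul_le_mul_of_nonneg_left (norm_loc_le (P := P) (t₀ := t₀) u x)
          (by positivity : 0 ≤ 18 * β ^ 2 * P.dst t₀ x ^ 2)
        linarith
      · rw [hc.loc_zero u hd]
        simp only [norm_zero, ne_eq, OfNat.ofNat_ne_zero, not_false_eq_true, zero_pow, mul_zero, add_zero]
        positivity
    rw [integral_add (id.const_mul _) (iw.const_mul _), integral_const_mul, integral_const_mul] at h5
    refine h5.trans ?_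
    have h6 : (∫ x in Ω, P.dst t₀ x ^ 2 * ‖u x‖ ^ 2) ≤ C / B := by
      rw [le_div_iff₀ hB0]; linarith
    have := mul_le_mul_of_nonneg_left h6 (by positivity : 0 ≤ 18 * β ^ 2)
    linarith
  rw [e3] at e1
  have hQ' : (∫ x in Ω, en (fun y => B • P.G t₀ y) (P.loc t₀ u) x) ≤ lam1 Ω B * m + C / B ^ 2 := hQ
  have hβ1 : 1 ≤ Real.sqrt B := Real.one_le_sqrt.2 hB
  have hdiv : ∀ X : ℝ, 0 < X → X / Real.sqrt B ≤ X := fun X hX => div_le_self hX.le hβ1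
  have g1 : C / B ^ 2 ≤ C := div_le_self hC.le (one_le_pow₀ hB)
  have g2 : r * P.curI t₀ B u ≤ Real.pi * (Real.pi / P.L ^ 2 + C₃) := by
    refine (le_abs_self _).trans ?_
    rw [abs_mul]
    exact mul_le_mul hrpi (hI.trans (by linarith [hdiv C₃ hC₃])) (abs_nonneg _) hpi.le
  have g3 := mul_le_mul_of_nonneg_left (hW.trans (by linarith [hdiv C₂ hC₂] :
    _ ≤ 1 / P.L ^ 2 + C₂)) (by positivity : 0 ≤ 2 * Real.pi ^ 2)
  have g4 := mul_le_mul_of_nonneg_right hlow hm0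
  have g5 := mul_le_mul_of_nonneg_right hup hm0
  have fin := curJ_scalar hT0 Th_lt_one hB hη0 hη1 hm1 hmC hm0 hs'0 (J := P.curJ t₀ B u) (D := D)
    (by rw [← hβ]; linarith)
  have e5 : D / (η * B) = D / η / B := by rw [div_div]
  rw [e5] at fin
  have : 3 * s' = s / 4 := by rw [hs']; ring
  linarith

end BoundaryParam.Collar
end
end SC

namespace SC

lemma monotone_of_local {f : ℝ → ℝ} {B₀ d : ℝ} (hd : 0 < d)
    (h : ∀ B ≥ B₀, ∀ β, 0 < β → β ≤ d → f (B - β) ≤ f B) {B B' : ℝ} (hB : B₀ ≤ B) (hBB : B ≤ B') :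
    f B ≤ f B' := by
  rcases hBB.eq_or_lt with rfl | hlt
  · exact le_rfl
  obtain ⟨n, hn⟩ := exists_nat_gt ((B' - B) / d)
  have hpos : 0 < (B' - B) / d := div_pos (by linarith) hd
  have hn0 : (0 : ℝ) < n := hpos.trans hn
  set σ := (B' - B) / n with hσ
  have hσ0 : 0 < σ := div_pos (by linarith) hn0
  have hσd : σ ≤ d := by
    rw [div_lt_iff₀ hd] at hn
    rw [hσ, div_le_iff₀ hn0]; linarith
  have key : ∀ k : ℕ, f B ≤ f (B + k * σ) := by
    intro k
    induction k with
    | zero => simp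
    | succ k ih =>
      have hk : 0 ≤ (k : ℝ) * σ := by positivity
      have := h (B + (k + 1 : ℕ) * σ) (by push_cast; nlinarith) σ hσ0 hσd
      have e : B + ((k + 1 : ℕ) : ℝ) * σ - σ = B + k * σ := by push_cast; ring
      rw [e] at this
      exact ih.trans this
  have := key n
  have e : B + n * σ = B' := by rw [hσ]; field_simp; ring
  rwa [e] at this

section
variable {Ω : Set Plane} {P : BoundaryParam Ω} {t₀ : ℝ}

namespace BoundaryParam.Collar
variable (hc : P.Collar t₀)
include hc

lemma exists_esq_G_bound (ho : IsOpen Ω) (hb : Bornology.IsBounded Ω) :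
    ∃ C > 0, ∀ x ∈ Ω, esq (P.G t₀ x) ≤ C := by
  obtain ⟨C, hC, h⟩ := exists_bound_of_continuousOn_closure hb (continuousOn_esq (hc.continuousOn_G ho))
  exact ⟨C, hC, fun x hx => (le_abs_self _).trans (h x (subset_closure hx))⟩

lemma slope_ge (ho : IsOpen Ω) (hne : Ω.Nonempty) (hb : Bornology.IsBounded Ω) :
    ∃ c > 0, ∀ᶠ B in atTop, ∀ u, P.NearMin t₀ B u →
      2 * (∫ x in Ω, dot2 (P.G t₀ x) (cur (fun y => B • P.G t₀ y) u x)) ≤ -c := by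
  obtain ⟨C, hC, h⟩ := hc.decay ho hb
  obtain ⟨C₃, hC₃, h₃⟩ := hc.curI_le ho hb
  obtain ⟨Cg, hCg, hG⟩ := hc.exists_esq_G_bound ho hb
  have hpi := Real.pi_pos
  have hL := P.L_pos
  set s := (Th - 1 / 2) / 4 with hs
  have hs0 : 0 < s := by have := half_lt_Th; simp only [hs]; linarith
  refine ⟨s, hs0, ?_⟩
  filter_upwards [h, h₃, hc.curJ_ge ho hne hb hs0, eventually_ge_atTop 1,
    eventually_div_sqrt_le (P.L ^ 2 / (2 * Real.pi) * C₃) hs0, eventually_div_le (C * (Cg + 1)) hs0] with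
    B h h₃ hJ hB hs1 hs2 u hu
  have hB0 : 0 < B := by linarith
  obtain ⟨-, hw, -, hQw⟩ := h u hu.1 hu.2.1 hu.2.2
  have hI := h₃ u hu
  have hJ := hJ u hu
  set w : Plane → ℂ := fun y => (eta (t₀ / 4) (P.dst t₀ y) : ℂ) * u y with hwdef
  have hxC := hc.cNearCl_comp_dst ho (n := 1) (contDiff_xi (t₀ / 4) (n := 1))
  have heC := hc.cNearCl_comp_dst ho (n := 1) (contDiff_eta (t₀ / 4) (n := 1))
  have hwC : CNearCl 1 Ω w := heC.ofReal_mul hu.1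
  have hv := hc.cNearCl_loc ho hu.1
  have hGC := hc.continuousOn_G ho
  have hom := hc.continuousOn_om ho
  have ha : ContinuousOn (fun y => B • P.G t₀ y) (closure Ω) := hGC.const_smul B
  have hGo : ContinuousOn (fun y => P.G t₀ y - P.area • P.om t₀ y) (closure Ω) :=
    hGC.sub (hom.const_smul P.area)
  have i1 := integrableOn_dot_cur hb ha hGo hv
  have i2 := integrableOn_dot_cur hb ha hom hv
  have i3 := integrableOn_dot_cur hb ha hGC hwC
  have e1 : (∫ x in Ω, dot2 (P.G t₀ x) (cur (fun y => B • P.G t₀ y) u x)) =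
      -P.curJ t₀ B u - P.area * P.curI t₀ B u +
        ∫ x in Ω, dot2 (P.G t₀ x) (cur (fun y => B • P.G t₀ y) w x) := by
    have i12 : IntegrableOn (fun x => dot2 (P.G t₀ x - P.area • P.om t₀ x)
        (cur (fun y => B • P.G t₀ y) (P.loc t₀ u) x) + P.area * dot2 (P.om t₀ x)
        (cur (fun y => B • P.G t₀ y) (P.loc t₀ u) x)) Ω := i1.add (i2.const_mul P.area)
    have : -P.curJ t₀ B u - P.area * P.curI t₀ B u +
        (∫ x in Ω, dot2 (P.G t₀ x) (cur (fun y => B • P.G t₀ y) w x)) =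
        ∫ x in Ω, (dot2 (P.G t₀ x - P.area • P.om t₀ x)
          (cur (fun y => B • P.G t₀ y) (P.loc t₀ u) x) + P.area * dot2 (P.om t₀ x)
          (cur (fun y => B • P.G t₀ y) (P.loc t₀ u) x) +
          dot2 (P.G t₀ x) (cur (fun y => B • P.G t₀ y) w x)) := by
      rw [integral_add i12 i3, integral_add i1 (i2.const_mul P.area), integral_const_mul, curJ, curI]
      ring
    rw [this]
    refine setIntegral_congr_fun ho.measurableSet fun x hx => ?_
    have hx' := subset_closure hx
    have c1 : cur (fun y => B • P.G t₀ y) (P.loc t₀ u) x =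
        xi (t₀ / 4) (P.dst t₀ x) ^ 2 • cur (fun y => B • P.G t₀ y) u x :=
      cur_mul _ (hxC.differentiableAt hx') (hu.1.differentiableAt hx')
    have c2 : cur (fun y => B • P.G t₀ y) w x =
        eta (t₀ / 4) (P.dst t₀ x) ^ 2 • cur (fun y => B • P.G t₀ y) u x :=
      cur_mul _ (heC.differentiableAt hx') (hu.1.differentiableAt hx')
    have c3 := xi_sq_add (t₀ / 4) (P.dst t₀ x)
    simp only [c1, c2, dot2_smul_right, sub_eq_add_neg, dot2_add_left, ← neg_smul, dot2_smul_left]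
    linear_combination (-dot2 (P.G t₀ x) (cur (fun y => B • P.G t₀ y) u x)) * c3
  have e2 : 2 * (∫ x in Ω, dot2 (P.G t₀ x) (cur (fun y => B • P.G t₀ y) w x)) ≤ C * (Cg + 1) / B := by
    have iw := integrableOn_nsq hb hwC
    have ie := integrableOn_en hb ha hwC
    have h5 : (∫ x in Ω, 2 * dot2 (P.G t₀ x) (cur (fun y => B • P.G t₀ y) w x)) ≤
        ∫ x in Ω, (Cg * ‖w x‖ ^ 2 + en (fun y => B • P.G t₀ y) w x) := by
      refine setIntegral_mono_on (i3.const_mul 2) ((iw.const_mul Cg).add ie) ho.measurableSet fun x hx => ?_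
      have f1 := cur_bound (fun y => B • P.G t₀ y) (P.G t₀) w x 1 one_pos
      have f2 := mul_le_mul_of_nonneg_right (hG x hx) (sq_nonneg ‖w x‖)
      have f3 := le_abs_self (dot2 (P.G t₀ x) (cur (fun y => B • P.G t₀ y) w x))
      rw [inv_one] at f1
      linarith
    rw [integral_const_mul, integral_add (iw.const_mul Cg) ie, integral_const_mul] at h5
    have f4 := mul_le_mul_of_nonneg_left hw hCg.le
    have f5 : C / B ^ 2 ≤ C / B := div_le_div_of_nonneg_left hC.le hB0 (by nlinarith)
    have f6 := mul_le_mul_of_nonneg_left f5 hCg.le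
    have f7 : C * (Cg + 1) / B = Cg * (C / B) + C / B := by ring
    rw [f7]
    linarith
  have e3 : -(2 * (P.area * P.curI t₀ B u)) ≤ 1 / 2 + P.L ^ 2 / (2 * Real.pi) * C₃ / Real.sqrt B := by
    have g1 : -(P.area * P.curI t₀ B u) ≤ |P.area| * |P.curI t₀ B u| := by
      rw [← abs_mul]; exact neg_le_abs _
    have g2 := mul_le_mul P.abs_area_le hI (abs_nonneg _) (by positivity)
    have g3 : 2 * (P.L ^ 2 / (4 * Real.pi) * (Real.pi / P.L ^ 2 + C₃ / Real.sqrt B)) =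
        1 / 2 + P.L ^ 2 / (2 * Real.pi) * C₃ / Real.sqrt B := by
      field_simp; ring
    linarith
  rw [e1]
  have : Th = 4 * s + 1 / 2 := by rw [hs]; ring
  linarith

lemma lam_monotone (ho : IsOpen Ω) (hne : Ω.Nonempty) (hb : Bornology.IsBounded Ω) :
    ∃ B₀ > 0, ∀ B B', B₀ ≤ B → B ≤ B' → lam1 Ω B ≤ lam1 Ω B' := by
  obtain ⟨c, hc0, h⟩ := hc.slope_ge ho hne hb
  obtain ⟨C, hC, hG⟩ := hc.exists_esq_G_bound ho hb
  obtain ⟨B₀, hB₀⟩ := (h.and (eventually_ge_atTop 1)).exists_forall_of_atTop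
  refine ⟨max B₀ 1, by positivity, fun B B' hB hBB => ?_⟩
  refine monotone_of_local (B₀ := max B₀ 1) (d := c / C) (by positivity) ?_ hB hBB
  intro B hB β hβ0 hβ
  obtain ⟨h1, hB1⟩ := hB₀ B ((le_max_left _ _).trans hB)
  refine le_of_forall_pos_le_add fun ε hε => ?_
  obtain ⟨u, hu, hN, hQ⟩ := hc.exists_near_min_G ho hne hb B (ε := min ε (1 / B ^ 2)) (by positivity)
  have hu' : P.NearMin t₀ B u := ⟨hu, hN, hQ.trans (by gcongr; exact min_le_right _ _)⟩
  have h2 := h1 u hu'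
  have hGC := hc.continuousOn_G ho
  have ha : ContinuousOn (fun y => B • P.G t₀ y) (closure Ω) := hGC.const_smul B
  have h3 := hc.lam_le_G ho (B - β) hu
  have e3 : (fun y => (B - β) • P.G t₀ y) = fun y => B • P.G t₀ y + (-β) • P.G t₀ y := by
    funext y; module
  rw [e3, integral_en_shift hb (a := fun y => B • P.G t₀ y) (c := fun y => (-β) • P.G t₀ y) ha
    (hGC.const_smul (-β)) hu, hN, mul_one] at h3
  simp only [esq_smul, dot2_smul_left, mul_assoc, integral_const_mul] at h3
  have h4 : (∫ x in Ω, esq (P.G t₀ x) * ‖u x‖ ^ 2) ≤ C := by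
    calc _ ≤ ∫ x in Ω, C * ‖u x‖ ^ 2 :=
          setIntegral_mono_on (integrableOn_esq_nsq hb hGC hu) ((integrableOn_nsq hb hu).const_mul C)
            ho.measurableSet fun x hx => mul_le_mul_of_nonneg_right (hG x hx) (sq_nonneg _)
      _ = C := by rw [integral_const_mul, hN, mul_one]
  have h5 : β * C ≤ c := by rwa [le_div_iff₀ hC] at hβ
  have h6 := mul_le_mul_of_nonneg_left h4 (sq_nonneg β)
  have h7 := mul_le_mul_of_nonneg_left h5 hβ0.le
  have h8 := mul_le_mul_of_nonneg_left h2 hβ0.le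
  have h9 : min ε (1 / B ^ 2) ≤ ε := min_le_left _ _
  have h10 : (-β) ^ 2 = β ^ 2 := by ring
  rw [h10] at h3
  linarith

end BoundaryParam.Collar
end
end SC

namespace SC

/-- The real numbers with the discrete topology. -/
def DiscreteReal : Type := ℝ

/-- The underlying real number. -/
def DiscreteReal.val (v : DiscreteReal) : ℝ := v

/-- A real number as an element of the discrete copy. -/
def DiscreteReal.of (v : ℝ) : DiscreteReal := v

instance : TopologicalSpace DiscreteReal := ⊥
instance : DiscreteTopology DiscreteReal := ⟨rfl⟩

/-- The covering whose sections glue functions that differ by locally constant ones. -/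
def glueCore {X : Type*} [TopologicalSpace X] (U : X → Set X) (hU : ∀ i, IsOpen (U i))
    (hm : ∀ x, x ∈ U x) (f : X → X → ℝ)
    (hf : ∀ i j, ∀ x ∈ U i ∩ U j, ∀ᶠ y in 𝓝 x, f i y - f j y = f i x - f j x) :
    FiberBundleCore X X DiscreteReal where
  baseSet := U
  isOpen_baseSet := hU
  indexAt := id
  mem_baseSet_at := hm
  coordChange i j x v := DiscreteReal.of (v.val + (f i x - f j x))
  coordChange_self i x _ v := by
    rw [sub_self, add_zero]
    rfl
  continuousOn_coordChange i j := by
    rintro ⟨x, v⟩ ⟨hx, -⟩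
    refine ContinuousAt.continuousWithinAt ?_
    refine (continuousAt_const (y := DiscreteReal.of
      (v.val + (f i x - f j x)))).congr ?_
    rw [nhds_prod_eq]
    have hv : ∀ᶠ w in 𝓝 v, w = v := by
      rw [nhds_discrete]; exact Filter.eventually_pure.2 rfl
    filter_upwards [(hf i j x hx).prod_mk hv] with p hp
    rw [hp.1, hp.2]
  coordChange_comp i j k x _ v := by
    change DiscreteReal.of ((v.val + (f i x - f j x)) + (f j x - f k x))
      = DiscreteReal.of (v.val + (f i x - f k x))
    congr 1
    ring

theorem exists_glue {X : Type*} [TopologicalSpace X] [SimplyConnectedSpace X]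
    [LocallyPathConnectedSpace X] (U : X → Set X) (hU : ∀ i, IsOpen (U i))
    (hm : ∀ x, x ∈ U x) (f : X → X → ℝ)
    (hf : ∀ i j, ∀ x ∈ U i ∩ U j, ∀ᶠ y in 𝓝 x, f i y - f j y = f i x - f j x) :
    ∃ φ : X → ℝ, ∀ x, ∀ᶠ y in 𝓝 x, φ y - f x y = φ x - f x x := by
  let Z := glueCore U hU hm f hf
  have hcov : IsCoveringMap Z.proj :=
    IsCoveringMap.mk _ (fun _ => DiscreteReal) (fun x => Z.localTriv x) (fun x => hm x)
  obtain ⟨x₀⟩ : Nonempty X := inferInstance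
  obtain ⟨s, ⟨-, hs⟩, -⟩ := hcov.existsUnique_continuousMap_lifts (ContinuousMap.id X) x₀
    (⟨x₀, DiscreteReal.of 0⟩ : Z.TotalSpace) rfl
  have hs' : ∀ x, (s x).1 = x := fun x => congrFun hs x
  refine ⟨fun x => f (s x).1 (s x).1 + DiscreteReal.val (s x).2, fun x => ?_⟩
  have hcoord : ∀ y, (Z.localTriv x (s y)).2 =
      DiscreteReal.of (DiscreteReal.val (s y).2 + (f (s y).1 (s y).1 - f x (s y).1)) := fun y => rfl
  have hxs : s x ∈ (Z.localTriv x).source := by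
    rw [Z.mem_localTriv_source, hs']; exact hm x
  have hc : ContinuousAt (fun y => (Z.localTriv x (s y)).2) x :=
    continuous_snd.continuousAt.comp
      (((Z.localTriv x).continuousAt hxs).comp s.continuous.continuousAt)
  have hev := hc.eventually (p := fun w => w = (Z.localTriv x (s x)).2)
    (by rw [nhds_discrete]; exact Filter.eventually_pure.2 rfl)
  filter_upwards [hev] with y hy
  rw [hcoord, hcoord] at hy
  have hy' : (DiscreteReal.val (s y).2 + (f (s y).1 (s y).1 - f x (s y).1) : ℝ) =
    DiscreteReal.val (s x).2 + (f (s x).1 (s x).1 - f x (s x).1) := hy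
  rw [hs' y, hs' x] at hy'
  simp only [hs']
  linarith

/-- The linear form `v ↦ ⟨w, v⟩`. -/
def dotL (w : Plane) : Plane →L[ℝ] ℝ :=
  w.1 • ContinuousLinearMap.fst ℝ ℝ ℝ + w.2 • ContinuousLinearMap.snd ℝ ℝ ℝ

theorem dotL_apply (w v : Plane) : dotL w v = dot2 w v := by
  simp [dotL, dot2]

theorem exists_primitive {Ω : Set Plane} (ho : IsOpen Ω) [SimplyConnectedSpace Ω]
    {w : Plane → Plane} (hw : DifferentiableOn ℝ w Ω) (hcl : ∀ x ∈ Ω, curl2 w x = 0) :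
    ∃ φ : Plane → ℝ, ∀ x ∈ Ω, HasFDerivAt φ (dotL (w x)) x := by
  classical
  have : LocallyPathConnectedSpace Ω := ho.locallyPathConnectedSpace
  have hball : ∀ x : Ω, ∃ r > 0, Metric.ball (x : Plane) r ⊆ Ω :=
    fun x => Metric.isOpen_iff.1 ho x x.2
  choose r hr hrΩ using hball
  have hloc : ∀ x : Ω, ∃ f : Plane → ℝ, ∀ a ∈ Metric.ball (x : Plane) (r x),
      HasFDerivAt f (dotL (w a)) a := by
    intro x
    have hd : ∀ a ∈ Ω, DifferentiableAt ℝ w a := fun a ha => hw.differentiableAt (ho.mem_nhds ha)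
    have hder : ∀ a ∈ Ω, HasFDerivAt (fun y => dotL (w y))
        ((((ContinuousLinearMap.fst ℝ ℝ ℝ).comp (fderiv ℝ w a)).smulRight
            (ContinuousLinearMap.fst ℝ ℝ ℝ) +
          ((ContinuousLinearMap.snd ℝ ℝ ℝ).comp (fderiv ℝ w a)).smulRight
            (ContinuousLinearMap.snd ℝ ℝ ℝ) : Plane →L[ℝ] (Plane →L[ℝ] ℝ))) a := by
      intro a ha
      have h1 := (hd a ha).hasFDerivAt.fst
      have h2 := (hd a ha).hasFDerivAt.snd
      exact (h1.smul_const (ContinuousLinearMap.fst ℝ ℝ ℝ : Plane →L[ℝ] ℝ)).add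
        (h2.smul_const (ContinuousLinearMap.snd ℝ ℝ ℝ : Plane →L[ℝ] ℝ))
    refine (convex_ball (x : Plane) (r x)).exists_forall_hasFDerivAt_of_fderiv_symmetric
      Metric.isOpen_ball (fun a ha => (hder a (hrΩ x ha)).differentiableAt.differentiableWithinAt)
      fun a ha u v => ?_
    rw [(hder a (hrΩ x ha)).fderiv]
    have hc := hcl a (hrΩ x ha)
    have e : ∀ u : Plane, fderiv ℝ w a u = u.1 • fderiv ℝ w a (1, 0) + u.2 • fderiv ℝ w a (0, 1) := by
      intro u
      rw [← map_smul, ← map_smul, ← map_add]; simp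
    unfold curl2 at hc
    have hd' := hd a (hrΩ x ha)
    have hc' : (fderiv ℝ w a (1, 0)).2 - (fderiv ℝ w a (0, 1)).1 = 0 := by
      rw [hd'.hasFDerivAt.fst.fderiv, hd'.hasFDerivAt.snd.fderiv] at hc
      exact hc
    simp only [add_apply, ContinuousLinearMap.smulRight_apply, ContinuousLinearMap.comp_apply,
      ContinuousLinearMap.coe_fst', ContinuousLinearMap.coe_snd', smul_apply, smul_eq_mul]
    rw [e u, e v]
    simp only [Prod.fst_add, Prod.snd_add, Prod.smul_fst, Prod.smul_snd, smul_eq_mul]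
    linear_combination (u.1 * v.2 - u.2 * v.1) * hc'
  choose f hf using hloc
  obtain ⟨φ, hφ⟩ := exists_glue (X := Ω) (fun i => {y | (y : Plane) ∈ Metric.ball (i : Plane) (r i)})
    (fun i => Metric.isOpen_ball.preimage continuous_subtype_val)
    (fun x => Metric.mem_ball_self (hr x)) (fun i y => f i y) (by
      rintro i j x ⟨hi, hj⟩
      have hO : IsOpen (Metric.ball (i : Plane) (r i) ∩ Metric.ball (j : Plane) (r j)) :=
        Metric.isOpen_ball.inter Metric.isOpen_ball
      obtain ⟨ε, hε, hsub⟩ := Metric.isOpen_iff.1 hO x ⟨hi, hj⟩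
      have hconst : ∀ y ∈ Metric.ball (x : Plane) ε, f i y - f j y = f i x - f j x := by
        intro y hy
        refine (convex_ball (x : Plane) ε).is_const_of_fderivWithin_eq_zero (𝕜 := ℝ)
          (f := fun z => f i z - f j z) ?_ ?_ hy (Metric.mem_ball_self hε)
        · exact fun z hz => ((hf i z (hsub hz).1).sub
            (hf j z (hsub hz).2)).differentiableAt.differentiableWithinAt
        · intro z hz
          rw [fderivWithin_of_isOpen Metric.isOpen_ball hz]
          have := ((hf i z (hsub hz).1).sub (hf j z (hsub hz).2)).fderiv
          rw [sub_self] at this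
          exact this
      exact continuous_subtype_val.continuousAt.eventually
        (eventually_of_mem (Metric.ball_mem_nhds _ hε) hconst))
  refine ⟨fun y => if h : y ∈ Ω then φ ⟨y, h⟩ else 0, fun x hx => ?_⟩
  have h1 := hf ⟨x, hx⟩ x (Metric.mem_ball_self (hr _))
  have h2 := hφ ⟨x, hx⟩
  rw [nhds_subtype_eq_comap] at h2
  have h3 : ∀ᶠ y in 𝓝 x, ∀ h : y ∈ Ω, φ ⟨y, h⟩ - f ⟨x, hx⟩ y = φ ⟨x, hx⟩ - f ⟨x, hx⟩ x := by
    rw [Filter.eventually_comap] at h2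
    filter_upwards [h2] with y hy h using hy ⟨y, h⟩ rfl
  refine (h1.add_const (φ ⟨x, hx⟩ - f ⟨x, hx⟩ x)).congr_of_eventuallyEq ?_
  filter_upwards [h3, ho.mem_nhds hx] with y hy hyΩ
  rw [dif_pos hyΩ]
  linarith [hy hyΩ]

end SC

namespace SC

/-- First component of the Biot–Savart kernel. -/
def bsK₁ (z : Plane) : ℝ := -z.2 / (z.1 ^ 2 + z.2 ^ 2)

/-- Second component of the Biot–Savart kernel. -/
def bsK₂ (z : Plane) : ℝ := z.1 / (z.1 ^ 2 + z.2 ^ 2)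

theorem abs_div_sq_le {a b n : ℝ} (hn : max |a| |b| = n) : |a / (a ^ 2 + b ^ 2)| ≤ n⁻¹ := by
  have ha : |a| ≤ n := hn ▸ le_max_left _ _
  have hn0 : 0 ≤ n := (abs_nonneg a).trans ha
  have hsq : n ^ 2 ≤ a ^ 2 + b ^ 2 := by
    rcases max_choice |a| |b| with h | h
    · rw [← hn, h, sq_abs]; nlinarith [sq_nonneg b]
    · rw [← hn, h, sq_abs]; nlinarith [sq_nonneg a]
  rcases hn0.eq_or_lt with h0 | h0
  · have : a = 0 := abs_nonpos_iff.1 (h0 ▸ ha)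
    simp [this, ← h0]
  · rw [abs_div, abs_of_nonneg (by positivity : 0 ≤ a ^ 2 + b ^ 2), div_le_iff₀ (by nlinarith)]
    calc |a| ≤ n := ha
      _ = n⁻¹ * n ^ 2 := by field_simp
      _ ≤ _ := by gcongr

theorem abs_bsK₂_le (z : Plane) : |bsK₂ z| ≤ ‖z‖⁻¹ :=
  abs_div_sq_le (by rw [Prod.norm_def]; rfl)

theorem abs_bsK₁_le (z : Plane) : |bsK₁ z| ≤ ‖z‖⁻¹ := by
  have : |bsK₁ z| = |z.2 / (z.2 ^ 2 + z.1 ^ 2)| := by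
    rw [bsK₁, neg_div, abs_neg, add_comm]
  rw [this]
  exact abs_div_sq_le (by rw [Prod.norm_def, max_comm]; rfl)

theorem measurable_bsK₁ : Measurable bsK₁ := by unfold bsK₁; fun_prop

theorem measurable_bsK₂ : Measurable bsK₂ := by unfold bsK₂; fun_prop

theorem finrank_plane : Module.finrank ℝ Plane = 2 := by
  simp [Plane]

theorem locallyIntegrable_of_le_inv {f : Plane → ℝ} (hf : Measurable f)
    (h : ∀ z, |f z| ≤ ‖z‖⁻¹) : LocallyIntegrable f := by
  refine locallyIntegrable_of_norm_le_rpow (C := 1) (α := 1) (by rw [finrank_plane]; norm_num)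
    (by rw [finrank_plane]; norm_num) (ae_of_all _ fun z => ?_) hf.aestronglyMeasurable
  rw [one_mul, Real.rpow_neg_one]
  exact h z

/-- The Biot–Savart field of a vorticity. -/
def bs (β : Plane → ℝ) (x : Plane) : Plane :=
  ((2 * Real.pi)⁻¹ * ∫ z, bsK₁ z * β (x - z), (2 * Real.pi)⁻¹ * ∫ z, bsK₂ z * β (x - z))

theorem hasFDerivAt_conv {k β : Plane → ℝ} (hk : LocallyIntegrable k) (hβ : ContDiff ℝ 1 β)
    (hc : HasCompactSupport β) :
    ContDiff ℝ 1 (fun x => ∫ z, k z * β (x - z)) ∧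
    ∀ x v, fderiv ℝ (fun x => ∫ z, k z * β (x - z)) x v = ∫ z, k z * fderiv ℝ β (x - z) v := by
  have e : (fun x => ∫ z, k z * β (x - z)) =
      convolution k β (ContinuousLinearMap.mul ℝ ℝ) volume := by
    ext x; rw [convolution_def]; rfl
  rw [e]
  refine ⟨hc.contDiff_convolution_right (n := 1) _ hk (by exact_mod_cast hβ), fun x v => ?_⟩
  rw [(hc.hasFDerivAt_convolution_right (ContinuousLinearMap.mul ℝ ℝ) hk hβ x).fderiv,
    convolution_precompR_apply _ hk (hc.fderiv ℝ) (hβ.continuous_fderiv one_ne_zero),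
    convolution_def]
  rfl

theorem contDiff_bs {β : Plane → ℝ} (hβ : ContDiff ℝ 1 β) (hc : HasCompactSupport β) :
    ContDiff ℝ 1 (bs β) :=
  (contDiff_const.mul (hasFDerivAt_conv
    (locallyIntegrable_of_le_inv measurable_bsK₁ abs_bsK₁_le) hβ hc).1).prodMk
  (contDiff_const.mul (hasFDerivAt_conv
    (locallyIntegrable_of_le_inv measurable_bsK₂ abs_bsK₂_le) hβ hc).1)

theorem integral_radial {β : Plane → ℝ} (hβ : ContDiff ℝ 1 β) (hc : HasCompactSupport β)
    (x : Plane) :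
    ∫ z : Plane, (bsK₂ z * fderiv ℝ β (x - z) (1, 0) - bsK₁ z * fderiv ℝ β (x - z) (0, 1)) =
      2 * Real.pi * β x := by
  rw [← integral_comp_polarCoord_symm]
  set E : ℝ → Plane := fun θ => (Real.cos θ, Real.sin θ) with hE
  set G : ℝ × ℝ → ℝ := fun p => fderiv ℝ β (x - p.1 • E p.2) (E p.2) with hG
  have hEc : Continuous E := by fun_prop
  have hGc : Continuous G := by
    have := hβ.continuous_fderiv one_ne_zero
    have h1 : Continuous fun p : ℝ × ℝ => x - p.1 • E p.2 := by fun_prop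
    have h2 : Continuous fun p : ℝ × ℝ => E p.2 := by fun_prop
    exact (this.comp h1).clm_apply h2
  obtain ⟨R, hR⟩ : ∃ R : ℝ, 0 < R ∧ ∀ r θ, R < r → x - r • E θ ∉ tsupport β := by
    obtain ⟨C, hC⟩ := hc.isCompact.isBounded.exists_norm_le
    refine ⟨2 * (‖x‖ + |C| + 1), by positivity, fun r θ hr hmem => ?_⟩
    have h1 := hC _ hmem
    have h2 : r * ‖E θ‖ ≤ ‖x‖ + C := by
      have : ‖r • E θ‖ ≤ ‖x‖ + ‖x - r • E θ‖ := by
        have := norm_sub_le x (x - r • E θ)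
        simpa using this
      rw [norm_smul, Real.norm_of_nonneg (by linarith [norm_nonneg x, abs_nonneg C])] at this
      linarith
    have h3 : (1 : ℝ) / 2 ≤ ‖E θ‖ := by
      rw [Prod.norm_def]
      by_contra! h
      have ha : ‖Real.cos θ‖ < 1 / 2 := (le_max_left _ _).trans_lt h
      have hb : ‖Real.sin θ‖ < 1 / 2 := (le_max_right _ _).trans_lt h
      rw [Real.norm_eq_abs] at ha hb
      nlinarith [Real.sin_sq_add_cos_sq θ, sq_abs (Real.cos θ), sq_abs (Real.sin θ),
        abs_nonneg (Real.cos θ), abs_nonneg (Real.sin θ)]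
    have h4 := le_abs_self C
    nlinarith [norm_nonneg x, abs_nonneg C]
  have hG0 : ∀ r θ, R < r → G (r, θ) = 0 := by
    intro r θ hr
    have : fderiv ℝ β (x - r • E θ) = 0 := by
      by_contra h
      exact hR.2 r θ hr (support_fderiv_subset ℝ h)
    simp only [hG, this]
    rfl
  have hintg : IntegrableOn G (Ioi 0 ×ˢ Ioo (-Real.pi) Real.pi) := by
    have h1 : IntegrableOn G (Icc 0 R ×ˢ Icc (-Real.pi) Real.pi) :=
      hGc.continuousOn.integrableOn_compact (isCompact_Icc.prod isCompact_Icc)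
    refine h1.of_forall_sdiff_eq_zero (measurableSet_Ioi.prod measurableSet_Ioo) ?_
    rintro ⟨r, θ⟩ ⟨⟨hr, hθ⟩, hn⟩
    apply hG0
    by_contra! h
    exact hn ⟨⟨le_of_lt hr, h⟩, ⟨hθ.1.le, hθ.2.le⟩⟩
  have hcongr : ∫ p in polarCoord.target, p.1 • (fun z : Plane =>
      bsK₂ z * fderiv ℝ β (x - z) (1, 0) - bsK₁ z * fderiv ℝ β (x - z) (0, 1))
        (polarCoord.symm p) = ∫ p in Ioi (0 : ℝ) ×ˢ Ioo (-Real.pi) Real.pi, G p := by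
    refine setIntegral_congr_fun (measurableSet_Ioi.prod measurableSet_Ioo) ?_
    rintro ⟨r, θ⟩ ⟨hr, -⟩
    have hr' : (0 : ℝ) < r := hr
    have hs : polarCoord.symm (r, θ) = r • E θ := by simp [hE]
    have hsplit : G (r, θ) = Real.cos θ * fderiv ℝ β (x - r • E θ) (1, 0) +
        Real.sin θ * fderiv ℝ β (x - r • E θ) (0, 1) := by
      have : E θ = Real.cos θ • ((1, 0) : Plane) + Real.sin θ • ((0, 1) : Plane) := by
        simp [hE]
      simp only [hG]
      conv_lhs => rw [this]
      rw [map_add, map_smul, map_smul, ← this]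
      rfl
    simp only [hs]
    rw [hsplit]
    have hd : (r • E θ).1 ^ 2 + (r • E θ).2 ^ 2 = r ^ 2 := by
      simp only [hE, Prod.smul_fst, Prod.smul_snd, smul_eq_mul]
      linear_combination r ^ 2 * Real.sin_sq_add_cos_sq θ
    simp only [bsK₁, bsK₂, hd, smul_eq_mul]
    simp only [hE, Prod.smul_fst, Prod.smul_snd, smul_eq_mul]
    field_simp
    ring
  refine hcongr.trans ?_
  have hray : ∀ θ, ∫ r in Ioi (0 : ℝ), G (r, θ) = β x := by
    intro θ
    have hd : ∀ r ∈ Ici (0 : ℝ), HasDerivAt (fun r => -β (x - r • E θ)) (G (r, θ)) r := by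
      intro r _
      have h1 : HasDerivAt (fun r : ℝ => x - r • E θ) (-E θ) r := by
        have := ((hasDerivAt_id r).smul_const (E θ)).const_sub x
        simpa using this
      have h2 := ((hβ.differentiable one_ne_zero _).hasFDerivAt.comp_hasDerivAt r h1).neg
      refine h2.congr_deriv ?_
      simp [hG]
    have hi : IntegrableOn (fun r => G (r, θ)) (Ioi 0) := by
      have h1 : IntegrableOn (fun r => G (r, θ)) (Icc 0 R) :=
        (hGc.comp (by fun_prop : Continuous fun r : ℝ => (r, θ))).continuousOn.integrableOn_compact
          isCompact_Icc
      refine h1.of_forall_sdiff_eq_zero measurableSet_Ioi ?_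
      rintro r ⟨hr, hn⟩
      apply hG0
      by_contra! h
      exact hn ⟨le_of_lt hr, h⟩
    have ht : Tendsto (fun r : ℝ => -β (x - r • E θ)) atTop (𝓝 0) := by
      refine tendsto_const_nhds.congr' ?_
      filter_upwards [eventually_gt_atTop R] with r hr
      rw [image_eq_zero_of_notMem_tsupport (hR.2 r θ hr), neg_zero]
    rw [integral_Ioi_of_hasDerivAt_of_tendsto' hd hi ht]
    simp
  rw [Measure.volume_eq_prod, ← Measure.prod_restrict, integral_prod_symm]
  · simp only [hray]
    rw [setIntegral_const]
    simp only [Real.volume_real_Ioo, smul_eq_mul]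
    rw [max_eq_left (by linarith [Real.pi_pos])]
    ring
  · rw [Measure.prod_restrict]; exact hintg

theorem curl2_bs {β : Plane → ℝ} (hβ : ContDiff ℝ 1 β) (hc : HasCompactSupport β) (x : Plane) :
    curl2 (bs β) x = β x := by
  have hk1 := locallyIntegrable_of_le_inv measurable_bsK₁ abs_bsK₁_le
  have hk2 := locallyIntegrable_of_le_inv measurable_bsK₂ abs_bsK₂_le
  obtain ⟨c1, d1⟩ := hasFDerivAt_conv hk1 hβ hc
  obtain ⟨c2, d2⟩ := hasFDerivAt_conv hk2 hβ hc
  have i : ∀ {k : Plane → ℝ}, LocallyIntegrable k → ∀ v,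
      Integrable fun z => k z * fderiv ℝ β (x - z) v := by
    intro k hk v
    have hc' : HasCompactSupport fun y => fderiv ℝ β y v :=
      (hc.fderiv ℝ).comp_left (g := fun L : Plane →L[ℝ] ℝ => L v) rfl
    exact (hc'.convolutionExists_right (ContinuousLinearMap.mul ℝ ℝ) hk
      ((hβ.continuous_fderiv one_ne_zero).clm_apply continuous_const)) x
  have e1 : fderiv ℝ (fun y => (bs β y).1) x (0, 1) =
      (2 * Real.pi)⁻¹ * ∫ z, bsK₁ z * fderiv ℝ β (x - z) (0, 1) := by
    have := ((c1.differentiable one_ne_zero x).hasFDerivAt.const_mul (2 * Real.pi)⁻¹).fderiv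
    rw [← d1, show (fun y => (bs β y).1) =
      fun y => (2 * Real.pi)⁻¹ * ∫ z, bsK₁ z * β (y - z) from rfl, this]
    rfl
  have e2 : fderiv ℝ (fun y => (bs β y).2) x (1, 0) =
      (2 * Real.pi)⁻¹ * ∫ z, bsK₂ z * fderiv ℝ β (x - z) (1, 0) := by
    have := ((c2.differentiable one_ne_zero x).hasFDerivAt.const_mul (2 * Real.pi)⁻¹).fderiv
    rw [← d2, show (fun y => (bs β y).2) =
      fun y => (2 * Real.pi)⁻¹ * ∫ z, bsK₂ z * β (y - z) from rfl, this]
    rfl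
  rw [curl2, e1, e2, ← mul_sub, ← integral_sub (i hk2 _) (i hk1 _), integral_radial hβ hc]
  field_simp [Real.pi_pos.ne']

end SC

namespace SC
open scoped ENNReal

theorem lintegral_mul_sq_le {α : Type*} [MeasurableSpace α] (μ : Measure α) {f g : α → ℝ≥0∞}
    (hf : AEMeasurable f μ) (hg : AEMeasurable g μ) :
    (∫⁻ a, f a * g a ∂μ) ^ 2 ≤ (∫⁻ a, f a ^ 2 ∂μ) * ∫⁻ a, g a ^ 2 ∂μ := by
  have h := ENNReal.lintegral_mul_le_Lp_mul_Lq μ Real.HolderConjugate.two_two hf hg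
  simp only [Pi.mul_apply, ENNReal.rpow_two] at h
  calc _ ≤ ((∫⁻ a, f a ^ 2 ∂μ) ^ (1 / 2 : ℝ) * (∫⁻ a, g a ^ 2 ∂μ) ^ (1 / 2 : ℝ)) ^ 2 := by gcongr
    _ = _ := by
      rw [mul_pow, ← ENNReal.rpow_natCast, ← ENNReal.rpow_natCast, ← ENNReal.rpow_mul,
        ← ENNReal.rpow_mul]
      norm_num

theorem lintegral_mul_le_sqrt {α : Type*} [MeasurableSpace α] (μ : Measure α) {f g : α → ℝ≥0∞}
    (hf : AEMeasurable f μ) (hg : AEMeasurable g μ) :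
    ∫⁻ a, f a * g a ∂μ ≤ ((∫⁻ a, f a ^ 2 ∂μ) * ∫⁻ a, g a ^ 2 ∂μ) ^ (1 / 2 : ℝ) := by
  have h := ENNReal.rpow_le_rpow (lintegral_mul_sq_le μ hf hg) (by norm_num : (0 : ℝ) ≤ 1 / 2)
  rw [← ENNReal.rpow_natCast, ← ENNReal.rpow_mul] at h
  norm_num at h ⊢
  exact h

theorem lintegral_conv_sq_le {a c b p : Plane → ℝ≥0∞} (ha : Measurable a) (hc : Measurable c)
    (hb : Measurable b) (hp : Measurable p) :
    ∫⁻ x, (∫⁻ z, a z * c z * b (x - z)) ^ 2 * p x ^ 2 ≤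
      (∫⁻ z, a z ^ 2) * ((∫⁻ y, b y ^ 2) *
        ((∫⁻ z, c z ^ 4) * ∫⁻ x, p x ^ 4) ^ (1 / 2 : ℝ)) := by
  have h1 : ∀ x, (∫⁻ z, a z * c z * b (x - z)) ^ 2 * p x ^ 2 ≤
      (∫⁻ z, a z ^ 2) * ∫⁻ y, (c (x - y) ^ 2 * b y ^ 2) * p x ^ 2 := by
    intro x
    rw [lintegral_mul_const _ (by fun_prop), ← mul_assoc]
    gcongr
    have e : ∫⁻ y, c (x - y) ^ 2 * b y ^ 2 = ∫⁻ z, (c z * b (x - z)) ^ 2 := by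
      rw [← lintegral_sub_left_eq_self (fun z => (c z * b (x - z)) ^ 2) x]
      simp only [sub_sub_cancel, mul_pow]
    rw [e]
    simp only [mul_assoc]
    exact lintegral_mul_sq_le _ ha.aemeasurable (by fun_prop)
  have h2 : ∀ y, ∫⁻ x, (c (x - y) ^ 2 * b y ^ 2) * p x ^ 2 ≤
      b y ^ 2 * ((∫⁻ z, c z ^ 4) * ∫⁻ x, p x ^ 4) ^ (1 / 2 : ℝ) := by
    intro y
    have : ∀ x, (c (x - y) ^ 2 * b y ^ 2) * p x ^ 2 = b y ^ 2 * (c (x - y) ^ 2 * p x ^ 2) :=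
      fun x => by ring
    simp only [this]
    rw [lintegral_const_mul _ (by fun_prop)]
    gcongr
    have h := lintegral_mul_le_sqrt (volume : Measure Plane)
      (f := fun x => c (x - y) ^ 2) (g := fun x => p x ^ 2) (by fun_prop) (by fun_prop)
    simp only [← pow_mul] at h
    norm_num only at h
    rw [lintegral_sub_right_eq_self (fun z => c z ^ 4) y] at h
    norm_num at h ⊢
    exact h
  calc _ ≤ ∫⁻ x, (∫⁻ z, a z ^ 2) * ∫⁻ y, (c (x - y) ^ 2 * b y ^ 2) * p x ^ 2 :=
        lintegral_mono h1
    _ = (∫⁻ z, a z ^ 2) * ∫⁻ x, ∫⁻ y, (c (x - y) ^ 2 * b y ^ 2) * p x ^ 2 := by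
      rw [lintegral_const_mul]
      exact Measurable.lintegral_prod_right' (f := fun q : Plane × Plane =>
        (c (q.1 - q.2) ^ 2 * b q.2 ^ 2) * p q.1 ^ 2) (by fun_prop)
    _ = (∫⁻ z, a z ^ 2) * ∫⁻ y, ∫⁻ x, (c (x - y) ^ 2 * b y ^ 2) * p x ^ 2 := by
      congr 1
      exact lintegral_lintegral_swap (f := fun x y : Plane =>
        (c (x - y) ^ 2 * b y ^ 2) * p x ^ 2)
        (by unfold Function.uncurry; fun_prop)
    _ ≤ _ := by
      gcongr
      calc _ ≤ ∫⁻ y, b y ^ 2 * ((∫⁻ z, c z ^ 4) * ∫⁻ x, p x ^ 4) ^ (1 / 2 : ℝ) :=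
            lintegral_mono h2
        _ = _ := by rw [lintegral_mul_const _ (by fun_prop)]

/-- A truncated negative power of the norm. -/
def trPow (R s : ℝ) (z : Plane) : ℝ≥0∞ :=
  (Metric.ball (0 : Plane) R).indicator (fun z => ENNReal.ofReal (‖z‖ ^ (-s))) z

theorem measurable_trPow (R s : ℝ) : Measurable (trPow R s) :=
  Measurable.indicator (by fun_prop) Metric.isOpen_ball.measurableSet

theorem trPow_pow (R s : ℝ) {n : ℕ} (hn : n ≠ 0) (z : Plane) :
    trPow R s z ^ n = trPow R (s * n) z := by
  unfold trPow
  by_cases h : z ∈ Metric.ball (0 : Plane) R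
  · rw [indicator_of_mem h, indicator_of_mem h, ← ENNReal.ofReal_pow (by positivity),
      ← Real.rpow_natCast, ← Real.rpow_mul (norm_nonneg z), neg_mul]
  · rw [indicator_of_notMem h, indicator_of_notMem h, zero_pow hn]

theorem trPow_mul (R : ℝ) {s t : ℝ} (hs : 0 < s) (ht : 0 < t) (z : Plane) :
    trPow R s z * trPow R t z = trPow R (s + t) z := by
  unfold trPow
  by_cases h : z ∈ Metric.ball (0 : Plane) R
  · rw [indicator_of_mem h, indicator_of_mem h, indicator_of_mem h,
      ← ENNReal.ofReal_mul (by positivity)]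
    rcases (norm_nonneg z).eq_or_lt with h0 | h0
    · rw [← h0, Real.zero_rpow (by linarith), zero_mul, Real.zero_rpow (by linarith)]
    · rw [← Real.rpow_add h0, neg_add]
  · simp [indicator_of_notMem h]

theorem lintegral_trPow_lt_top (R : ℝ) {s : ℝ} (hs : s < 2) : ∫⁻ z, trPow R s z < ∞ := by
  have h : IntegrableOn (fun z : Plane => ‖z‖ ^ (-s)) (Metric.ball 0 R) := by
    refine integrableOn_ball_of_norm_le_rpow (C := 1) (α := s) (by rw [finrank_plane]; norm_num)
      (by rw [finrank_plane]; exact_mod_cast hs) (ae_of_all _ fun z => ?_)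
      (by fun_prop : Measurable _).aestronglyMeasurable
    rw [one_mul, Real.norm_of_nonneg (by positivity)]
  have h2 := h.2
  unfold trPow
  rw [lintegral_indicator Metric.isOpen_ball.measurableSet]
  rw [HasFiniteIntegral] at h2
  refine lt_of_le_of_lt (lintegral_mono fun z => ?_) h2
  rw [Real.enorm_of_nonneg (by positivity)]

theorem enorm_conv_le {k β : Plane → ℝ} {R : ℝ} (hk : ∀ z, |k z| ≤ ‖z‖⁻¹)
    (hβ : ∀ y, R ≤ ‖y‖ → β y = 0) {x : Plane} (hx : ‖x‖ < R) :
    ‖∫ z, k z * β (x - z)‖ₑ ≤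
      ∫⁻ z, trPow (2 * R) (3 / 4) z * trPow (2 * R) (1 / 4) z * ‖β (x - z)‖ₑ := by
  refine (enorm_integral_le_lintegral_enorm _).trans (lintegral_mono fun z => ?_)
  rw [trPow_mul _ (by norm_num) (by norm_num), enorm_mul]
  by_cases hz : z ∈ Metric.ball (0 : Plane) (2 * R)
  · gcongr
    rw [trPow, indicator_of_mem hz]
    norm_num only
    rw [Real.rpow_neg_one, ← ofReal_norm]
    exact ENNReal.ofReal_le_ofReal (hk z)
  · have : β (x - z) = 0 := by
      apply hβ
      rw [mem_ball_zero_iff, not_lt] at hz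
      have := norm_sub_norm_le z x
      rw [norm_sub_rev] at this
      linarith
    simp [this]

theorem bs_lintegral_bound (R : ℝ) : ∃ C : ℝ, 0 < C ∧ ∀ (k β : Plane → ℝ) (p : Plane → ℝ≥0∞),
    (∀ z, |k z| ≤ ‖z‖⁻¹) → Continuous β → (∀ y, R ≤ ‖y‖ → β y = 0) → Measurable p →
    (∀ y, R ≤ ‖y‖ → p y = 0) →
    ∫⁻ x, ‖∫ z, k z * β (x - z)‖ₑ ^ 2 * p x ^ 2 ≤
      ENNReal.ofReal C * ((∫⁻ y, ‖β y‖ₑ ^ 2) * (∫⁻ x, p x ^ 4) ^ (1 / 2 : ℝ)) := by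
  set A := ∫⁻ z, trPow (2 * R) (3 / 4) z ^ 2 with hA
  set D := ∫⁻ z, trPow (2 * R) (1 / 4) z ^ 4 with hD
  have hA' : A < ∞ := by
    rw [hA]; simp only [trPow_pow _ _ two_ne_zero]
    exact lintegral_trPow_lt_top _ (by norm_num)
  have hD' : D < ∞ := by
    rw [hD]; simp only [trPow_pow _ _ four_ne_zero]
    exact lintegral_trPow_lt_top _ (by norm_num)
  have hAD : A * D ^ (1 / 2 : ℝ) ≠ ∞ :=
    ENNReal.mul_ne_top hA'.ne (ENNReal.rpow_ne_top_of_nonneg (by norm_num) hD'.ne)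
  refine ⟨(A * D ^ (1 / 2 : ℝ)).toReal + 1, by positivity, fun k β p hk hβ hβ0 hp hp0 => ?_⟩
  calc _ ≤ ∫⁻ x, (∫⁻ z, trPow (2 * R) (3 / 4) z * trPow (2 * R) (1 / 4) z * ‖β (x - z)‖ₑ) ^ 2
          * p x ^ 2 := by
        refine lintegral_mono fun x => ?_
        by_cases hx : ‖x‖ < R
        · gcongr
          exact enorm_conv_le hk hβ0 hx
        · simp [hp0 x (not_lt.1 hx)]
    _ ≤ A * ((∫⁻ y, ‖β y‖ₑ ^ 2) * (D * ∫⁻ x, p x ^ 4) ^ (1 / 2 : ℝ)) :=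
        lintegral_conv_sq_le (measurable_trPow _ _) (measurable_trPow _ _)
          hβ.measurable.enorm hp
    _ = (A * D ^ (1 / 2 : ℝ)) * ((∫⁻ y, ‖β y‖ₑ ^ 2) * (∫⁻ x, p x ^ 4) ^ (1 / 2 : ℝ)) := by
        rw [ENNReal.mul_rpow_of_nonneg _ _ (by norm_num)]; ring
    _ ≤ _ := by
        gcongr
        refine (ENNReal.ofReal_toReal hAD).symm.le.trans (ENNReal.ofReal_le_ofReal (by linarith))

end SC

namespace SC
open scoped ENNReal

theorem CNearCl.integrableOn_pow_four {Ω : Set Plane} (hb : Bornology.IsBounded Ω) {u : Plane → ℂ}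
    (hu : CNearCl 1 Ω u) : IntegrableOn (fun x => ‖u x‖ ^ 4) Ω :=
  integrableOn_of_continuousOn_closure hb (hu.continuousOn.norm.pow 4)

theorem ofReal_setIntegral {Ω : Set Plane} (hm : MeasurableSet Ω) {f : Plane → ℝ} (hf : IntegrableOn f Ω)
    (h0 : ∀ x, 0 ≤ f x) {g : Plane → ℝ≥0∞} (hg : ∀ x ∈ Ω, ENNReal.ofReal (f x) = g x)
    (hg0 : ∀ x ∉ Ω, g x = 0) : ENNReal.ofReal (∫ x in Ω, f x) = ∫⁻ x, g x := by
  rw [ofReal_integral_eq_lintegral_ofReal hf (ae_of_all _ h0),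
    setLIntegral_congr_fun hm hg, setLIntegral_eq_of_support_subset]
  intro x hx
  by_contra h
  exact hx (hg0 x h)

theorem conv_bound {Ω : Set Plane} (ho : IsOpen Ω) (hb : Bornology.IsBounded Ω) {R : ℝ}
    (hR : ∀ x ∈ Ω, ‖x‖ < R) : ∃ C > 0, ∀ (k β : Plane → ℝ) (u : Plane → ℂ),
    LocallyIntegrable k → (∀ z, |k z| ≤ ‖z‖⁻¹) → ContDiff ℝ 1 β → HasCompactSupport β →
    (∀ y, R ≤ ‖y‖ → β y = 0) → CNearCl 1 Ω u →
    ∫ x in Ω, (∫ z, k z * β (x - z)) ^ 2 * ‖u x‖ ^ 2 ≤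
      C * ((∫ y, β y ^ 2) * √(∫ x in Ω, ‖u x‖ ^ 4)) := by
  obtain ⟨C, hC, h⟩ := bs_lintegral_bound R
  refine ⟨C, hC, fun k β u hkl hk hβ hc hβ0 hu => ?_⟩
  have hcont := (hasFDerivAt_conv hkl hβ hc).1.continuous
  generalize hcdef : (fun x : Plane => ∫ z, k z * β (x - z)) = c at hcont
  have hcx : ∀ x, ∫ z, k z * β (x - z) = c x := fun x => congrFun hcdef x
  set p : Plane → ℝ≥0∞ := Ω.indicator fun x => ‖u x‖ₑ with hp
  have hpm : Measurable p := by
    have : p = fun x => ‖Ω.indicator u x‖ₑ := by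
      ext x; rw [hp, enorm_indicator_eq_indicator_enorm]
    rw [this]
    refine Measurable.enorm ?_
    classical
    have := (hu.continuousOn.mono subset_closure).measurable_piecewise
      (continuousOn_const (c := (0 : ℂ))) ho.measurableSet
    rwa [← piecewise_eq_indicator]
  have hp0 : ∀ x ∉ Ω, p x = 0 := fun x hx => indicator_of_notMem hx _
  have hp1 : ∀ x ∈ Ω, p x = ‖u x‖ₑ := fun x hx => indicator_of_mem hx _
  have key := h k β p hk hβ.continuous hβ0 hpm
    (fun y hy => hp0 y fun hy' => absurd (hR y hy') (not_lt.2 hy))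
  simp only [hcx] at key ⊢
  have i1 : IntegrableOn (fun x => c x ^ 2 * ‖u x‖ ^ 2) Ω :=
    integrableOn_of_continuousOn_closure hb
      ((hcont.continuousOn.pow 2).mul (hu.continuousOn.norm.pow 2))
  have i2 : Integrable fun y => β y ^ 2 := by
    have hc2 : HasCompactSupport fun y => β y ^ 2 :=
      hc.comp_left (g := fun t : ℝ => t ^ 2) (by norm_num)
    exact (hβ.continuous.pow 2).integrable_of_hasCompactSupport hc2
  have e1 : ENNReal.ofReal (∫ x in Ω, c x ^ 2 * ‖u x‖ ^ 2) = ∫⁻ x, ‖c x‖ₑ ^ 2 * p x ^ 2 := by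
    refine ofReal_setIntegral ho.measurableSet i1 (fun x => by positivity)
      (fun x hx => ?_) (fun x hx => by rw [hp0 x hx]; simp)
    rw [hp1 x hx, ENNReal.ofReal_mul (by positivity), ← sq_abs, ENNReal.ofReal_pow (abs_nonneg _),
      ENNReal.ofReal_pow (norm_nonneg _), ofReal_norm, ← Real.norm_eq_abs, ofReal_norm]
  have e2 : ∫⁻ x, p x ^ 4 = ENNReal.ofReal (∫ x in Ω, ‖u x‖ ^ 4) := by
    refine (ofReal_setIntegral ho.measurableSet (hu.integrableOn_pow_four hb)
      (fun x => by positivity) (fun x hx => ?_) (fun x hx => by rw [hp0 x hx]; simp)).symm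
    rw [hp1 x hx, ENNReal.ofReal_pow (norm_nonneg _), ofReal_norm]
  have e3 : ∫⁻ y, ‖β y‖ₑ ^ 2 = ENNReal.ofReal (∫ y, β y ^ 2) := by
    rw [ofReal_integral_eq_lintegral_ofReal i2 (ae_of_all _ fun x => sq_nonneg _)]
    refine lintegral_congr fun y => ?_
    rw [← sq_abs, ENNReal.ofReal_pow (abs_nonneg _), ← Real.norm_eq_abs, ofReal_norm]
  have h4 : 0 ≤ ∫ x in Ω, ‖u x‖ ^ 4 := integral_nonneg fun x => by positivity
  have hb2 : 0 ≤ ∫ y, β y ^ 2 := integral_nonneg fun x => by positivity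
  rw [← e1, e2, e3, ENNReal.ofReal_rpow_of_nonneg h4 (by norm_num), ← Real.sqrt_eq_rpow,
    ← ENNReal.ofReal_mul hb2, ← ENNReal.ofReal_mul hC.le,
    ENNReal.ofReal_le_ofReal_iff (by positivity)] at key
  exact key

theorem bs_bound {Ω : Set Plane} (ho : IsOpen Ω) (hb : Bornology.IsBounded Ω) {R : ℝ}
    (hR : ∀ x ∈ Ω, ‖x‖ < R) : ∃ C > 0, ∀ (β : Plane → ℝ) (u : Plane → ℂ),
    ContDiff ℝ 1 β → HasCompactSupport β → (∀ y, R ≤ ‖y‖ → β y = 0) → CNearCl 1 Ω u →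
    ∫ x in Ω, esq (bs β x) * ‖u x‖ ^ 2 ≤
      C * ((∫ y, β y ^ 2) * √(∫ x in Ω, ‖u x‖ ^ 4)) := by
  obtain ⟨C, hC, h⟩ := conv_bound ho hb hR
  refine ⟨2 * C, by positivity, fun β u hβ hc hβ0 hu => ?_⟩
  have hk1 := locallyIntegrable_of_le_inv measurable_bsK₁ abs_bsK₁_le
  have hk2 := locallyIntegrable_of_le_inv measurable_bsK₂ abs_bsK₂_le
  have h1 := h _ β u hk1 abs_bsK₁_le hβ hc hβ0 hu
  have h2 := h _ β u hk2 abs_bsK₂_le hβ hc hβ0 hu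
  have c1 := (hasFDerivAt_conv hk1 hβ hc).1.continuous
  have c2 := (hasFDerivAt_conv hk2 hβ hc).1.continuous
  have i : ∀ {f : Plane → ℝ}, Continuous f → IntegrableOn (fun x => f x * ‖u x‖ ^ 2) Ω :=
    fun hf => integrableOn_of_continuousOn_closure hb
      (hf.continuousOn.mul (hu.continuousOn.norm.pow 2))
  have i1 : IntegrableOn (fun x => (∫ z, bsK₁ z * β (x - z)) ^ 2 * ‖u x‖ ^ 2) Ω := i (c1.pow 2)
  have i2 : IntegrableOn (fun x => (∫ z, bsK₂ z * β (x - z)) ^ 2 * ‖u x‖ ^ 2) Ω := i (c2.pow 2)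
  have ib : Continuous fun x => esq (bs β x) := by
    have := (contDiff_bs hβ hc).continuous
    unfold esq
    fun_prop
  have hπ : (2 * Real.pi)⁻¹ ^ 2 ≤ 1 := by
    have : (2 * Real.pi)⁻¹ ≤ 1 := inv_le_one_of_one_le₀ (by linarith [Real.pi_gt_three])
    exact pow_le_one₀ (by positivity) this
  calc _ ≤ ∫ x in Ω, ((∫ z, bsK₁ z * β (x - z)) ^ 2 * ‖u x‖ ^ 2 +
        (∫ z, bsK₂ z * β (x - z)) ^ 2 * ‖u x‖ ^ 2) := by
        refine integral_mono (i ib) (i1.add i2) fun x => ?_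
        simp only [← add_mul]
        gcongr
        simp only [esq, bs, mul_pow, ← mul_add]
        exact mul_le_of_le_one_left (by positivity) hπ
    _ ≤ _ := by rw [integral_add i1 i2]; linarith

end SC

namespace SC
open scoped Manifold Convolution

theorem exists_cutoff {K V : Set Plane} (hK : IsCompact K) (hV : IsOpen V) (h : K ⊆ V) :
    ∃ χ : Plane → ℝ, ContDiff ℝ (⊤ : ℕ∞) χ ∧ HasCompactSupport χ ∧ tsupport χ ⊆ V ∧
      (∀ᶠ x in 𝓝ˢ K, χ x = 1) ∧ ∀ x, χ x ∈ Icc (0 : ℝ) 1 := by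
  obtain ⟨W, hW, hKW, hWV, hWc⟩ := exists_open_between_and_isCompact_closure hK hV h
  obtain ⟨f, hf1, hf0, hf⟩ := exists_contMDiffMap_one_nhds_of_subset_interior
    (n := (⊤ : ℕ∞)) 𝓘(ℝ, Plane)
    hK.isClosed (t := W) (by rwa [hW.interior_eq])
  have hs : tsupport f ⊆ closure W := by
    refine closure_mono fun x hx => ?_
    by_contra hxW
    exact hx (hf0 x hxW)
  exact ⟨f, f.contMDiff.contDiff, hWc.of_isClosed_subset (isClosed_tsupport _) hs, hs.trans hWV,
    hf1, hf⟩

theorem exists_contDiff_extension {Ω : Set Plane} (hb : Bornology.IsBounded Ω) {E : Type*}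
    [NormedAddCommGroup E] [NormedSpace ℝ E] {A : Plane → E} (hA : CNearCl 1 Ω A) :
    ∃ g : Plane → E, ContDiff ℝ 1 g ∧ HasCompactSupport g ∧ ∀ x ∈ closure Ω, g =ᶠ[𝓝 x] A := by
  obtain ⟨U, hU, hcU, hAU⟩ := hA
  obtain ⟨χ, hχ, hχc, hχs, hχ1, -⟩ := exists_cutoff (isCompact_closure_of_bdd hb) hU hcU
  refine ⟨fun x => χ x • A x, ?_, hχc.smul_right, fun x hx => ?_⟩
  · refine contDiff_iff_contDiffAt.2 fun x => ?_
    by_cases hx : x ∈ tsupport χ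
    swap
    · refine (contDiffAt_const (c := (0 : E))).congr_of_eventuallyEq ?_
      filter_upwards [notMem_tsupport_iff_eventuallyEq.1 hx] with y hy
      simp [hy]
    have hx' : x ∈ U := hχs hx
    exact (hχ.contDiffAt.of_le (by norm_num)).smul (hAU.contDiffAt (hU.mem_nhds hx'))
  · filter_upwards [eventually_nhdsSet_iff_forall.1 hχ1 x hx] with y hy
    rw [hy, one_smul]

theorem exists_smooth_approx {Ω : Set Plane} (hb : Bornology.IsBounded Ω) {A : Plane → Plane}
    (hA : CNearCl 1 Ω A) {ε : ℝ} (hε : 0 < ε) : ∃ A' : Plane → Plane, ContDiff ℝ 2 A' ∧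
      ∀ x ∈ closure Ω, ‖A' x - A x‖ ≤ ε ∧ ‖fderiv ℝ A' x - fderiv ℝ A x‖ ≤ ε := by
  obtain ⟨g, hg, hgc, hgA⟩ := exists_contDiff_extension hb hA
  have hg' := hg.continuous_fderiv one_ne_zero
  obtain ⟨δ₁, hδ₁, h1⟩ := Metric.uniformContinuous_iff.1
    (hgc.uniformContinuous_of_continuous hg.continuous) ε hε
  obtain ⟨δ₂, hδ₂, h2⟩ := Metric.uniformContinuous_iff.1
    ((hgc.fderiv ℝ).uniformContinuous_of_continuous hg') ε hε
  let φ : ContDiffBump (0 : Plane) :=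
    ⟨min δ₁ δ₂ / 2, min δ₁ δ₂, by positivity, half_lt_self (by positivity)⟩
  have hd : ∀ x, HasFDerivAt (φ.normed volume ⋆[ContinuousLinearMap.lsmul ℝ ℝ, volume] g)
      ((φ.normed volume ⋆[ContinuousLinearMap.lsmul ℝ ℝ, volume] fderiv ℝ g) x) x := by
    intro x
    exact hgc.hasFDerivAt_convolution_right (ContinuousLinearMap.lsmul ℝ ℝ)
      φ.continuous_normed.locallyIntegrable hg x
  refine ⟨φ.normed volume ⋆[ContinuousLinearMap.lsmul ℝ ℝ, volume] g,
    φ.hasCompactSupport_normed.contDiff_convolution_left _ φ.contDiff_normed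
      hg.continuous.locallyIntegrable, fun x hx => ?_⟩
  rw [(hd x).fderiv, ← (hgA x hx).fderiv_eq (𝕜 := ℝ), ← (hgA x hx).eq_of_nhds, ← dist_eq_norm,
    ← dist_eq_norm]
  exact ⟨φ.dist_normed_convolution_le hg.continuous.aestronglyMeasurable fun y hy =>
      (h1 (lt_of_lt_of_le hy (min_le_left _ _))).le,
    φ.dist_normed_convolution_le hg'.aestronglyMeasurable fun y hy =>
      (h2 (lt_of_lt_of_le hy (min_le_right _ _))).le⟩

theorem BoundaryParam.volume_frontier {Ω : Set Plane} (P : BoundaryParam Ω) :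
    volume (frontier Ω) = 0 := by
  have h0 : volume ((univ : Set ℝ) ×ˢ ({0} : Set ℝ)) = 0 := by
    rw [Measure.volume_eq_prod, Measure.prod_prod]; simp
  have h := addHaar_image_eq_zero_of_differentiableOn_of_addHaar_eq_zero (μ := volume)
    (f := P.Psi) (s := (univ : Set ℝ) ×ˢ ({0} : Set ℝ))
    ((P.contDiff_Psi.differentiable (by norm_num)).differentiableOn) h0
  refine measure_mono_null (fun x hx => ?_) h
  rw [← P.range_eq] at hx
  obtain ⟨s, rfl⟩ := hx
  exact ⟨(s, 0), by simp, P.Psi_zero s⟩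

theorem exists_cutoff_extension {Ω : Set Plane} (ho : IsOpen Ω) (hb : Bornology.IsBounded Ω)
    (h0 : volume (frontier Ω) = 0) {R : ℝ} (hR : ∀ x ∈ closure Ω, ‖x‖ < R) {b : Plane → ℝ}
    (hbc : ContDiff ℝ 1 b) {ε : ℝ} (hε : 0 < ε) : ∃ β : Plane → ℝ, ContDiff ℝ 1 β ∧
      HasCompactSupport β ∧ (∀ y, R ≤ ‖y‖ → β y = 0) ∧ (∀ x ∈ Ω, β x = b x) ∧
      ∫ y, β y ^ 2 ≤ (∫ x in Ω, b x ^ 2) + ε := by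
  have hK := isCompact_closure_of_bdd hb
  obtain ⟨M, hM⟩ := (isCompact_closedBall (0 : Plane) R).exists_bound_of_continuousOn
    hbc.continuous.continuousOn
  have hv : volume (closure Ω) = volume Ω := by
    rw [closure_eq_self_union_frontier]
    exact le_antisymm ((measure_union_le _ _).trans (by rw [h0, add_zero]))
      (measure_mono subset_union_left)
  have hfin : volume Ω ≠ ⊤ := (volume_lt_top_of_bdd hb).ne
  have hε' : 0 < ε / (M ^ 2 + 1) := by positivity
  obtain ⟨V, hKV, hV, hVlt⟩ := (closure Ω).exists_isOpen_lt_add (μ := volume)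
    (by rwa [hv]) (ENNReal.ofReal_pos.2 hε').ne'
  obtain ⟨χ, hχ, hχc, hχs, hχ1, hχI⟩ := exists_cutoff hK (hV.inter Metric.isOpen_ball)
    (V := V ∩ Metric.ball 0 R) (fun x hx => ⟨hKV hx, by simpa using hR x hx⟩)
  have hβ : ContDiff ℝ 1 fun x => χ x * b x := (hχ.of_le (by norm_num)).mul hbc
  have hβc : HasCompactSupport fun x => χ x * b x := hχc.mul_right
  have hz : ∀ x, x ∉ V ∩ Metric.ball (0 : Plane) R → χ x = 0 := fun x hx =>
    image_eq_zero_of_notMem_tsupport fun h => hx (hχs h)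
  have h1 : ∀ x ∈ closure Ω, χ x = 1 := fun x hx => hχ1.self_of_nhdsSet x hx
  refine ⟨_, hβ, hβc, fun y hy => ?_, fun x hx => ?_, ?_⟩
  · rw [hz y fun h => by have := h.2; simp at this; linarith, zero_mul]
  · rw [h1 x (subset_closure hx), one_mul]
  have hVfin : volume (V \ Ω) ≤ ENNReal.ofReal (ε / (M ^ 2 + 1)) := by
    rw [measure_sdiff (subset_closure.trans hKV) ho.measurableSet.nullMeasurableSet hfin]
    rw [hv] at hVlt
    exact tsub_le_iff_left.2 hVlt.le
  have hVm : MeasurableSet (V \ Ω) := hV.measurableSet.diff ho.measurableSet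
  have hi1 : Integrable (Ω.indicator fun x => b x ^ 2) :=
    (integrable_indicator_iff ho.measurableSet).2
      (integrableOn_of_continuousOn_closure hb (hbc.continuous.pow 2).continuousOn)
  have hi2 : Integrable ((V \ Ω).indicator fun _ => M ^ 2) :=
    (integrable_indicator_iff hVm).2
      (integrableOn_const (hVfin.trans_lt ENNReal.ofReal_lt_top).ne)
  calc ∫ y, (χ y * b y) ^ 2
      ≤ ∫ y, (Ω.indicator (fun x => b x ^ 2) y + (V \ Ω).indicator (fun _ => M ^ 2) y) := by
        refine integral_mono_of_nonneg (ae_of_all _ fun y => sq_nonneg _) (hi1.add hi2)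
          (ae_of_all _ fun y => ?_)
        change (χ y * b y) ^ 2 ≤ _
        by_cases hy : y ∈ Ω
        · simp [hy, h1 y (subset_closure hy)]
        by_cases hyV : y ∈ V ∩ Metric.ball (0 : Plane) R
        · have hb' := hM y (Metric.ball_subset_closedBall hyV.2)
          rw [Real.norm_eq_abs] at hb'
          have h2 : |χ y * b y| ≤ M := by
            rw [abs_mul, abs_of_nonneg (hχI y).1]
            exact (mul_le_of_le_one_left (abs_nonneg _) (hχI y).2).trans hb'
          change _ ≤ Ω.indicator (fun x => b x ^ 2) y + (V \ Ω).indicator (fun _ => M ^ 2) y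
          rw [indicator_of_notMem hy, indicator_of_mem (show y ∈ V \ Ω from ⟨hyV.1, hy⟩), zero_add]
          exact sq_le_sq.2 (h2.trans (le_abs_self M))
        · rw [hz y hyV, zero_mul, zero_pow two_ne_zero]
          exact add_nonneg (indicator_nonneg (fun _ _ => sq_nonneg _) _)
            (indicator_nonneg (fun _ _ => sq_nonneg _) _)
    _ = (∫ x in Ω, b x ^ 2) + M ^ 2 * volume.real (V \ Ω) := by
        rw [integral_add hi1 hi2, integral_indicator ho.measurableSet, integral_indicator hVm,
          setIntegral_const, smul_eq_mul, mul_comm]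
    _ ≤ _ := by
        have h3 : volume.real (V \ Ω) ≤ ε / (M ^ 2 + 1) :=
          ENNReal.toReal_le_of_le_ofReal hε'.le hVfin
        have h4 : M ^ 2 * volume.real (V \ Ω) ≤ (M ^ 2 + 1) * (ε / (M ^ 2 + 1)) := by
          gcongr; linarith
        rw [mul_div_cancel₀ _ (by positivity)] at h4
        linarith

end SC

namespace SC

/-- The gradient as a vector. -/
def grad (φ : Plane → ℝ) (x : Plane) : Plane := (fderiv ℝ φ x (1, 0), fderiv ℝ φ x (0, 1))

theorem fderiv_eq_dot2_grad (φ : Plane → ℝ) (x v : Plane) : fderiv ℝ φ x v = dot2 (grad φ x) v := by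
  have hv : v = v.1 • ((1 : ℝ), (0 : ℝ)) + v.2 • ((0 : ℝ), (1 : ℝ)) := by ext <;> simp
  conv_lhs => rw [hv]
  simp only [map_add, map_smul, smul_eq_mul, dot2, grad]
  ring

theorem norm_dotL_le (w : Plane) : ‖dotL w‖ ≤ 2 * ‖w‖ := by
  refine ContinuousLinearMap.opNorm_le_bound _ (by positivity) fun v => ?_
  have h1 := norm_fst_le w
  have h2 := norm_snd_le w
  have h3 := norm_fst_le v
  have h4 := norm_snd_le v
  rw [dotL_apply, dot2]
  calc ‖w.1 * v.1 + w.2 * v.2‖ ≤ ‖w.1‖ * ‖v.1‖ + ‖w.2‖ * ‖v.2‖ := by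
        rw [← norm_mul, ← norm_mul]; exact norm_add_le _ _
    _ ≤ ‖w‖ * ‖v‖ + ‖w‖ * ‖v‖ := by gcongr
    _ = _ := by ring

theorem dotL_sub (a b : Plane) : dotL a - dotL b = dotL (a - b) := by
  ext <;> simp [dotL]

theorem esq_le_norm_sq (v : Plane) : esq v ≤ 2 * ‖v‖ ^ 2 := by
  have h1 := norm_fst_le v
  have h2 := norm_snd_le v
  rw [Real.norm_eq_abs] at h1 h2
  have h3 : v.1 ^ 2 ≤ ‖v‖ ^ 2 := sq_le_sq.2 (by rwa [abs_of_nonneg (norm_nonneg v)])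
  have h4 : v.2 ^ 2 ≤ ‖v‖ ^ 2 := sq_le_sq.2 (by rwa [abs_of_nonneg (norm_nonneg v)])
  rw [esq]; linarith

theorem esq_grad_sub_le {φ : Plane → ℝ} {x w : Plane} {η : ℝ}
    (h : ‖fderiv ℝ φ x - dotL w‖ ≤ η) : esq (grad φ x - w) ≤ 2 * η ^ 2 := by
  have h0 : 0 ≤ η := (norm_nonneg _).trans h
  have hv : ∀ v : Plane, ‖v‖ = 1 → |fderiv ℝ φ x v - dot2 w v| ≤ η := fun v hv => by
    have := (fderiv ℝ φ x - dotL w).le_opNorm v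
    rw [hv, mul_one, sub_apply, dotL_apply, Real.norm_eq_abs] at this
    exact this.trans h
  have h1 := hv (1, 0) (by simp [Prod.norm_def])
  have h2 := hv (0, 1) (by simp [Prod.norm_def])
  simp only [dot2, mul_one, mul_zero, add_zero, zero_add] at h1 h2
  have h3 := sq_le_sq.2 (h1.trans (le_abs_self η))
  have h4 := sq_le_sq.2 (h2.trans (le_abs_self η))
  simp only [esq, grad, Prod.fst_sub, Prod.snd_sub]
  linarith

variable {Ω : Set Plane} {P : BoundaryParam Ω} {t₀ : ℝ}

namespace BoundaryParam.Collar

theorem exists_inward_field (hc : P.Collar t₀) (ho : IsOpen Ω) :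
    ∃ F : Plane → Plane, CNearCl 1 Ω F ∧ ∃ ε₀ > (0 : ℝ), ∀ ε : ℝ, 0 < ε → ε < ε₀ →
      ∀ x ∈ closure Ω, x + ε • F x ∈ Ω := by
  have ht := hc.pos
  have hF : P.PerS fun p : ℝ × ℝ => xi (t₀ / 2) p.2 ^ 2 • P.nu p.1 := fun s t => by
    simp [P.nu_per s]
  have hs : ContDiff ℝ 1 fun p : ℝ × ℝ => xi (t₀ / 2) p.2 ^ 2 • P.nu p.1 :=
    (((contDiff_xi (t₀ / 2) (n := 1)).comp contDiff_snd).pow 2).smul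
      ((P.contDiff_nu.of_le (by norm_num)).comp contDiff_fst)
  have hz : ∀ s t, t₀ / 2 ≤ t → xi (t₀ / 2) (s, t).2 ^ 2 • P.nu (s, t).1 = 0 := fun s t h => by
    simp [xi_zero (show 0 < t₀ / 2 by positivity) h]
  refine ⟨_, hc.cNearCl_ext ho (n := 1) hF (by exact_mod_cast hs) (show t₀ / 2 < t₀ by linarith) hz, t₀ / 2, by positivity,
    fun ε hε hε' x hx => ?_⟩
  by_cases hxs : x ∈ P.Psi '' strip t₀
  swap
  · rw [BoundaryParam.ext_of_not hxs, smul_zero, add_zero]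
    rcases (mem_closure_iff P ho).1 hx with h | ⟨s, rfl⟩
    · exact h
    · exact absurd ⟨(s, 0), by simpa [strip] using ht, P.Psi_zero s⟩ hxs
  obtain ⟨p, hp, rfl⟩ := hxs
  rw [hc.ext_Psi hF hp]
  have hp0 : 0 ≤ p.2 := by
    rcases (mem_closure_iff P ho).1 hx with h | ⟨s, h⟩
    · exact ((hc.Psi_mem_iff hp).1 h).le
    · by_contra hneg
      rw [not_le] at hneg
      have h2 := hc.inj s 0 p.1 p.2 (by simpa using ht) hp (by rw [P.Psi_zero, h])
      linarith [h2.1]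
  have hp' : |p.2| < t₀ := hp
  have e : P.Psi p + ε • xi (t₀ / 2) p.2 ^ 2 • P.nu p.1 =
      P.Psi (p.1, p.2 + ε * xi (t₀ / 2) p.2 ^ 2) := by
    simp only [BoundaryParam.Psi, add_smul, mul_smul, add_assoc]
  rw [e]
  have hx1 := xi_sq_le (t₀ / 2) p.2
  have hx0 := sq_nonneg (xi (t₀ / 2) p.2)
  have hpos : 0 < p.2 + ε * xi (t₀ / 2) p.2 ^ 2 := by
    rcases hp0.eq_or_lt with h | h
    · rw [← h, xi_one (by positivity) (by positivity)]; linarith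
    · positivity
  refine (hc.Psi_mem_iff ?_).2 hpos
  change |p.2 + ε * xi (t₀ / 2) p.2 ^ 2| < t₀
  rw [abs_of_pos hpos]
  rw [abs_of_nonneg hp0] at hp'
  rcases le_or_gt (t₀ / 2) p.2 with h | h
  · rw [xi_zero (by positivity) h]; linarith
  · nlinarith

end BoundaryParam.Collar

theorem exists_approx_primitive [SimplyConnectedSpace Ω] (ho : IsOpen Ω)
    (hb : Bornology.IsBounded Ω) {F : Plane → Plane} (hF : CNearCl 1 Ω F) {ε₀ : ℝ} (hε₀ : 0 < ε₀)
    (hin : ∀ ε : ℝ, 0 < ε → ε < ε₀ → ∀ x ∈ closure Ω, x + ε • F x ∈ Ω)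
    {w : Plane → Plane} (hw : CNearCl 1 Ω w) (hcl : ∀ x ∈ Ω, curl2 w x = 0) {η : ℝ} (hη : 0 < η) :
    ∃ φ : Plane → ℝ, CNearCl 1 Ω φ ∧ ∀ x ∈ closure Ω, esq (grad φ x - w x) ≤ η := by
  have hK := isCompact_closure_of_bdd hb
  obtain ⟨φ₀, hφ₀⟩ := exists_primitive ho
    (fun x hx => (hw.differentiableAt (subset_closure hx)).differentiableWithinAt) hcl
  have hφC : ContDiffOn ℝ 1 φ₀ Ω := by
    rw [show (1 : WithTop ℕ∞) = 0 + 1 by simp, contDiffOn_succ_iff_fderiv_of_isOpen ho]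
    refine ⟨fun x hx => (hφ₀ x hx).differentiableAt.differentiableWithinAt, by simp,
      contDiffOn_zero.2 ?_⟩
    have : ContinuousOn (fun x => dotL (w x)) Ω := by
      have hwc := hw.continuousOn.mono (subset_closure (s := Ω))
      unfold dotL
      exact ((continuous_fst.comp_continuousOn hwc).smul continuousOn_const).add
        ((continuous_snd.comp_continuousOn hwc).smul continuousOn_const)
    exact this.congr fun x hx => (hφ₀ x hx).fderiv
  obtain ⟨η', hη', hηη⟩ : ∃ η' > 0, 2 * η' ^ 2 ≤ η :=
    ⟨√(η / 2), by positivity, by rw [Real.sq_sqrt (by positivity)]; linarith⟩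
  obtain ⟨Mw, hMw, hMw'⟩ := exists_bound_of_continuousOn_closure hb hw.continuousOn
  obtain ⟨M₁, hM₁, hM₁'⟩ := exists_bound_of_continuousOn_closure hb hF.continuousOn
  obtain ⟨M₂, hM₂, hM₂'⟩ := exists_bound_of_continuousOn_closure hb hF.continuousOn_fderiv
  obtain ⟨δ, hδ, hu⟩ := Metric.uniformContinuousOn_iff.1
    (hK.uniformContinuousOn_of_continuous hw.continuousOn) (η' / 4) (by positivity)
  obtain ⟨ε, hε, he1, he2, he3⟩ : ∃ ε > 0, ε < ε₀ ∧ ε * M₁ < δ ∧ ε * (2 * Mw * M₂) ≤ η' / 2 := by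
    have t1 : ∀ᶠ ε in 𝓝[>] (0 : ℝ), ε < ε₀ :=
      mem_nhdsWithin_of_mem_nhds (Iio_mem_nhds hε₀)
    have t2 : Tendsto (fun ε : ℝ => ε * M₁) (𝓝[>] 0) (𝓝 0) := by
      have : Tendsto (fun ε : ℝ => ε * M₁) (𝓝 0) (𝓝 (0 * M₁)) := tendsto_id.mul_const _
      rw [zero_mul] at this; exact this.mono_left nhdsWithin_le_nhds
    have t3 : Tendsto (fun ε : ℝ => ε * (2 * Mw * M₂)) (𝓝[>] 0) (𝓝 0) := by
      have : Tendsto (fun ε : ℝ => ε * (2 * Mw * M₂)) (𝓝 0) (𝓝 (0 * (2 * Mw * M₂))) :=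
        tendsto_id.mul_const _
      rw [zero_mul] at this; exact this.mono_left nhdsWithin_le_nhds
    obtain ⟨ε, ⟨⟨h1, h2⟩, h3⟩, h4⟩ := (((t1.and (t2.eventually_lt_const hδ)).and
      (t3.eventually_le_const (show 0 < η' / 2 by positivity))).and self_mem_nhdsWithin).exists
    exact ⟨ε, h4, h1, h2, h3⟩
  have hΦ : CNearCl 1 Ω fun x => x + ε • F x :=
    (CNearCl.of_contDiff contDiff_id).add (hF.const_smul ε)
  have hin' := hin ε hε he1
  refine ⟨fun x => φ₀ (x + ε • F x), ?_, fun x hx => ?_⟩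
  · obtain ⟨U, hU, hcU, hUc⟩ := hΦ
    refine ⟨U ∩ (fun x => x + ε • F x) ⁻¹' Ω, hUc.continuousOn.isOpen_inter_preimage hU ho,
      fun x hx => ⟨hcU hx, hin' x hx⟩, ?_⟩
    exact hφC.comp (hUc.mono inter_subset_left) fun x hx => hx.2
  · refine (esq_grad_sub_le ?_).trans hηη
    have hd := (hφ₀ _ (hin' x hx)).comp x
      ((hasFDerivAt_id x).add ((hF.differentiableAt hx).hasFDerivAt.const_smul ε))
    have hd' : fderiv ℝ (fun x => φ₀ (x + ε • F x)) x =
      (dotL (w (x + ε • F x))).comp (ContinuousLinearMap.id ℝ Plane + ε • fderiv ℝ F x) := hd.fderiv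
    have hy := subset_closure (hin' x hx)
    rw [hd', ContinuousLinearMap.comp_add, ContinuousLinearMap.comp_id, add_sub_right_comm, dotL_sub]
    have n1 : ‖w (x + ε • F x) - w x‖ ≤ η' / 4 := by
      rw [← dist_eq_norm]
      refine (hu _ hy _ hx ?_).le
      rw [dist_eq_norm, add_sub_cancel_left, norm_smul, Real.norm_eq_abs, abs_of_pos hε]
      exact (mul_le_mul_of_nonneg_left (hM₁' x hx) hε.le).trans_lt he2
    have n2 : ‖(dotL (w (x + ε • F x))).comp (ε • fderiv ℝ F x)‖ ≤ ε * (2 * Mw * M₂) := by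
      refine (ContinuousLinearMap.opNorm_comp_le _ _).trans ?_
      rw [norm_smul, Real.norm_eq_abs, abs_of_pos hε]
      have := norm_dotL_le (w (x + ε • F x))
      have a1 : ‖dotL (w (x + ε • F x))‖ ≤ 2 * Mw := by linarith [hMw' _ hy]
      calc _ ≤ (2 * Mw) * (ε * M₂) := by
            gcongr
            exact hM₂' x hx
        _ = _ := by ring
    have n3 := norm_dotL_le (w (x + ε • F x) - w x)
    refine (norm_add_le _ _).trans ?_
    linarith

end SC

namespace SC

theorem curl2_eq {A : Plane → Plane} {x : Plane} (hA : DifferentiableAt ℝ A x) :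
    curl2 A x = (fderiv ℝ A x (1, 0)).2 - (fderiv ℝ A x (0, 1)).1 := by
  have h1 : fderiv ℝ (fun y => (A y).1) x = (ContinuousLinearMap.fst ℝ ℝ ℝ).comp (fderiv ℝ A x) :=
    (hasFDerivAt_fst.comp x hA.hasFDerivAt).fderiv
  have h2 : fderiv ℝ (fun y => (A y).2) x = (ContinuousLinearMap.snd ℝ ℝ ℝ).comp (fderiv ℝ A x) :=
    (hasFDerivAt_snd.comp x hA.hasFDerivAt).fderiv
  rw [curl2, h1, h2]; rfl

theorem curl2_sub {A A' : Plane → Plane} {x : Plane} (hA : DifferentiableAt ℝ A x)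
    (hA' : DifferentiableAt ℝ A' x) :
    curl2 (fun y => A y - A' y) x = curl2 A x - curl2 A' x := by
  have h : fderiv ℝ (fun y => A y - A' y) x = fderiv ℝ A x - fderiv ℝ A' x := fderiv_sub hA hA'
  rw [curl2_eq (A := fun y => A y - A' y) (hA.sub hA'), curl2_eq hA, curl2_eq hA', h]
  simp only [sub_apply, Prod.fst_sub, Prod.snd_sub]; ring

theorem curl2_const_smul {A : Plane → Plane} {x : Plane} (hA : DifferentiableAt ℝ A x) (c : ℝ) :
    curl2 (fun y => c • A y) x = c * curl2 A x := by
  have h : fderiv ℝ (fun y => c • A y) x = c • fderiv ℝ A x := fderiv_const_smul hA c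
  rw [curl2_eq (A := fun y => c • A y) (hA.const_smul c), curl2_eq hA, h]
  simp only [smul_apply, Prod.smul_fst, Prod.smul_snd, smul_eq_mul]; ring

theorem abs_curl2_sub_le {A A' : Plane → Plane} {x : Plane} (hA : DifferentiableAt ℝ A x)
    (hA' : DifferentiableAt ℝ A' x) :
    |curl2 A' x - curl2 A x| ≤ 2 * ‖fderiv ℝ A' x - fderiv ℝ A x‖ := by
  have h : ∀ v : Plane, ‖v‖ = 1 →
      ‖fderiv ℝ A' x v - fderiv ℝ A x v‖ ≤ ‖fderiv ℝ A' x - fderiv ℝ A x‖ := fun v hv => by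
    simpa [hv] using (fderiv ℝ A' x - fderiv ℝ A x).le_opNorm v
  have h1 := (norm_snd_le _).trans (h (1, 0) (by simp [Prod.norm_def]))
  have h2 := (norm_fst_le _).trans (h (0, 1) (by simp [Prod.norm_def]))
  rw [curl2_eq hA, curl2_eq hA']
  simp only [Prod.fst_sub, Prod.snd_sub, Real.norm_eq_abs] at h1 h2
  rw [abs_le] at *
  constructor <;> linarith [h1.1, h1.2, h2.1, h2.2]

theorem contDiff_curl2 {A : Plane → Plane} (hA : ContDiff ℝ 2 A) : ContDiff ℝ 1 (curl2 A) := by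
  have e : curl2 A = fun x => (fderiv ℝ A x (1, 0)).2 - (fderiv ℝ A x (0, 1)).1 :=
    funext fun x => curl2_eq (hA.differentiable two_ne_zero x)
  have h : ContDiff ℝ 1 (fderiv ℝ A) := hA.fderiv_right (by norm_num)
  rw [e]
  exact (contDiff_snd.comp (h.clm_apply contDiff_const)).sub
    (contDiff_fst.comp (h.clm_apply contDiff_const))

theorem esq_add_three_le (a b c : Plane) : esq (a + b + c) ≤ 3 * esq a + 3 * esq b + 3 * esq c := by
  simp only [esq, Prod.fst_add, Prod.snd_add]
  nlinarith [sq_nonneg (a.1 - b.1), sq_nonneg (a.2 - b.2), sq_nonneg (a.1 - c.1),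
    sq_nonneg (a.2 - c.2), sq_nonneg (b.1 - c.1), sq_nonneg (b.2 - c.2)]

theorem continuousOn_grad {Ω : Set Plane} {φ : Plane → ℝ} (hφ : CNearCl 1 Ω φ) :
    ContinuousOn (grad φ) (closure Ω) :=
  (hφ.continuousOn_fderiv_apply (1, 0)).prodMk (hφ.continuousOn_fderiv_apply (0, 1))

theorem sq_add_le_of_abs {b c η M : ℝ} (h : |c - b| ≤ 2 * η) (hb : |b| ≤ M) (hη : 0 ≤ η)
    (hη1 : η ≤ 1) : c ^ 2 ≤ b ^ 2 + η * (4 * M + 4) := by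
  have h1 : |c| ≤ |b| + 2 * η := by
    have := abs_add_le b (c - b); rw [add_sub_cancel] at this; linarith
  have h2 : c ^ 2 ≤ (|b| + 2 * η) ^ 2 := by
    rw [← sq_abs c]; exact pow_le_pow_left₀ (abs_nonneg _) h1 2
  nlinarith [sq_abs b, mul_le_mul_of_nonneg_left hb hη, mul_le_mul_of_nonneg_left hη1 hη]

theorem gauge_bound {Ω : Set Plane} [SimplyConnectedSpace Ω] {P : BoundaryParam Ω} {t₀ : ℝ}
    (hc : P.Collar t₀) (ho : IsOpen Ω) (hb : Bornology.IsBounded Ω) :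
    ∃ C > 0, ∀ (A : Plane → Plane) (u : Plane → ℂ), CNearCl 1 Ω A → CNearCl 1 Ω u → ∀ ϑ > 0,
      ∃ φ : Plane → ℝ, CNearCl 1 Ω φ ∧
        ∫ x in Ω, esq (A x - F0 x - grad φ x) * ‖u x‖ ^ 2 ≤
          C * (((∫ x in Ω, (curl2 A x - 1) ^ 2) + ϑ) * √(∫ x in Ω, ‖u x‖ ^ 4)) +
            ϑ * ∫ x in Ω, ‖u x‖ ^ 2 := by
  have hK := isCompact_closure_of_bdd hb
  obtain ⟨F, hF, ε₀, hε₀, hin⟩ := hc.exists_inward_field ho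
  obtain ⟨R, hR⟩ : ∃ R, ∀ x ∈ closure Ω, ‖x‖ < R := by
    obtain ⟨R, -, hR⟩ := exists_bound_of_continuousOn_closure hb (f := fun x : Plane => x)
      continuousOn_id
    exact ⟨R + 1, fun x hx => by linarith [hR x hx]⟩
  obtain ⟨C, hC, hbs⟩ := bs_bound ho hb fun x hx => hR x (subset_closure hx)
  refine ⟨3 * C, by positivity, fun A u hA hu ϑ hϑ => ?_⟩
  obtain ⟨M, hM, hMb⟩ := exists_bound_of_continuousOn_closure hb
    (hA.continuousOn_curl2.sub continuousOn_const : ContinuousOn (fun x => curl2 A x - 1) _)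
  set V := volume.real Ω with hV
  have hV0 : 0 ≤ V := measureReal_nonneg
  obtain ⟨η, hη, hη1, hη2, hη3⟩ : ∃ η > 0, η ≤ 1 ∧ η * ((4 * M + 4) * V + 1) ≤ ϑ ∧ 9 * η ≤ ϑ := by
    refine ⟨min 1 (min (ϑ / ((4 * M + 4) * V + 1)) (ϑ / 9)), by positivity, min_le_left _ _, ?_, ?_⟩
    · rw [← le_div_iff₀ (by positivity)]
      exact (min_le_right _ _).trans (min_le_left _ _)
    · have := (min_le_right 1 (min (ϑ / ((4 * M + 4) * V + 1)) (ϑ / 9))).trans (min_le_right _ _)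
      linarith
  obtain ⟨A', hA', hAA⟩ := exists_smooth_approx hb hA hη
  have hA'd : Differentiable ℝ A' := hA'.differentiable two_ne_zero
  have hcurl := contDiff_curl2 hA'
  obtain ⟨β, hβ, hβc, hβR, hβΩ, hβi⟩ := exists_cutoff_extension ho hb P.volume_frontier hR
    (hcurl.sub (contDiff_const (c := (1 : ℝ)))) hη
  have hbsC := contDiff_bs hβ hβc
  have hF0 : ContDiff ℝ 1 F0 := contDiff_F0
  have hw : CNearCl 1 Ω fun x => A' x - F0 x - bs β x :=
    .of_contDiff (((hA'.of_le (by norm_num)).sub hF0).sub hbsC)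
  obtain ⟨φ, hφ, hφw⟩ := exists_approx_primitive ho hb hF hε₀ hin hw (fun x hx => by
    have d1 := hF0.differentiable one_ne_zero x
    rw [curl2_sub (A := fun x => A' x - F0 x) ((hA'd x).sub d1) (hbsC.differentiable one_ne_zero x), curl2_sub (hA'd x) d1,
      curl2_F0, curl2_bs hβ hβc, hβΩ x hx, sub_self]) hη
  refine ⟨φ, hφ, ?_⟩
  have hiu := integrableOn_nsq hb hu
  have hi1 : IntegrableOn (fun x => esq (bs β x) * ‖u x‖ ^ 2) Ω :=
    integrableOn_esq_nsq hb hbsC.continuous.continuousOn hu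
  have hi2 : IntegrableOn (fun x => 3 * (esq (bs β x) * ‖u x‖ ^ 2) + ϑ * ‖u x‖ ^ 2) Ω :=
    (hi1.const_mul 3).add (hiu.const_mul ϑ)
  have hi3 : IntegrableOn (fun x => esq (A x - F0 x - grad φ x) * ‖u x‖ ^ 2) Ω :=
    integrableOn_esq_nsq hb
      ((hA.continuousOn.sub hF0.continuous.continuousOn).sub (continuousOn_grad hφ)) hu
  have hpt : ∀ x ∈ Ω, esq (A x - F0 x - grad φ x) * ‖u x‖ ^ 2 ≤
      3 * (esq (bs β x) * ‖u x‖ ^ 2) + ϑ * ‖u x‖ ^ 2 := fun x hx => by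
    have hx' := subset_closure hx
    have e : A x - F0 x - grad φ x = bs β x + (-1 : ℝ) • (A' x - A x) +
        (-1 : ℝ) • (grad φ x - (A' x - F0 x - bs β x)) := by
      simp only [neg_smul, one_smul]; abel
    have h1 := esq_add_three_le (bs β x) ((-1 : ℝ) • (A' x - A x))
      ((-1 : ℝ) • (grad φ x - (A' x - F0 x - bs β x)))
    rw [← e, esq_smul, esq_smul] at h1
    have h2 := esq_le_norm_sq (A' x - A x)
    have h3 : ‖A' x - A x‖ ^ 2 ≤ η ^ 2 := pow_le_pow_left₀ (norm_nonneg _) (hAA x hx').1 2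
    have h4 := hφw x hx'
    have h5 : esq (A x - F0 x - grad φ x) ≤ 3 * esq (bs β x) + ϑ := by nlinarith
    nlinarith [sq_nonneg ‖u x‖]
  have h1 : ∫ x in Ω, esq (A x - F0 x - grad φ x) * ‖u x‖ ^ 2 ≤
      3 * (∫ x in Ω, esq (bs β x) * ‖u x‖ ^ 2) + ϑ * ∫ x in Ω, ‖u x‖ ^ 2 := by
    rw [← integral_const_mul, ← integral_const_mul, ← integral_add (hi1.const_mul 3)
      (hiu.const_mul ϑ)]
    exact setIntegral_mono_on hi3 hi2 ho.measurableSet hpt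
  have h2 := hbs β u hβ hβc hβR hu
  have hib : IntegrableOn (fun x => (curl2 A x - 1) ^ 2) Ω :=
    integrableOn_of_continuousOn_closure hb
      ((hA.continuousOn_curl2.sub continuousOn_const).pow 2)
  have hconst : IntegrableOn (fun _ : Plane => η * (4 * M + 4)) Ω :=
    integrableOn_const (volume_lt_top_of_bdd hb).ne
  have h3 : ∫ x in Ω, (curl2 A' x - 1) ^ 2 ≤
      (∫ x in Ω, (curl2 A x - 1) ^ 2) + V * (η * (4 * M + 4)) := by
    rw [hV, ← smul_eq_mul, ← setIntegral_const, ← integral_add hib hconst]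
    refine setIntegral_mono_on (integrableOn_of_continuousOn_closure hb
      ((hcurl.continuous.sub continuous_const).pow 2).continuousOn) (hib.add hconst)
      ho.measurableSet fun x hx => ?_
    have hx' := subset_closure hx
    have := abs_curl2_sub_le (hA.differentiableAt hx') (hA'd x)
    refine sq_add_le_of_abs ?_ (hMb x hx') hη.le hη1
    rw [sub_sub_sub_cancel_right]
    linarith [(hAA x hx').2]
  have h4 : ∫ y, β y ^ 2 ≤ (∫ x in Ω, (curl2 A x - 1) ^ 2) + ϑ := by
    have e : V * (η * (4 * M + 4)) + η = η * ((4 * M + 4) * V + 1) := by ring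
    linarith
  have h5 := mul_le_mul_of_nonneg_left
    (mul_le_mul_of_nonneg_right h4 (Real.sqrt_nonneg (∫ x in Ω, ‖u x‖ ^ 4))) hC.le
  linarith

end SC

namespace SC

variable {Ω : Set Plane}

theorem GLenergy_eq (hb : Bornology.IsBounded Ω) (κ H : ℝ) {ψ : Plane → ℂ} {A : Plane → Plane}
    (hψ : CNearCl 1 Ω ψ) (hA : CNearCl 1 Ω A) :
    GLenergy Ω κ H ψ A = (∫ x in Ω, en (fun y => (κ * H) • A y) ψ x)
      - κ ^ 2 * (∫ x in Ω, ‖ψ x‖ ^ 2) + κ ^ 2 / 2 * (∫ x in Ω, ‖ψ x‖ ^ 4)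
      + (κ * H) ^ 2 * ∫ x in Ω, (curl2 A x - 1) ^ 2 := by
  have i1 : IntegrableOn (en (fun y => (κ * H) • A y) ψ) Ω :=
    integrableOn_en hb (hA.continuousOn.const_smul (κ * H)) hψ
  have i2 : IntegrableOn (fun x => κ ^ 2 * ‖ψ x‖ ^ 2) Ω := (integrableOn_nsq hb hψ).const_mul _
  have i3 : IntegrableOn (fun x => κ ^ 2 / 2 * ‖ψ x‖ ^ 4) Ω :=
    (hψ.integrableOn_pow_four hb).const_mul _
  have i4 : IntegrableOn (fun x => κ ^ 2 * H ^ 2 * (curl2 A x - 1) ^ 2) Ω :=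
    (integrableOn_of_continuousOn_closure hb
      ((hA.continuousOn_curl2.sub continuousOn_const).pow 2)).const_mul _
  have i12 : IntegrableOn (fun x => en (fun y => (κ * H) • A y) ψ x - κ ^ 2 * ‖ψ x‖ ^ 2) Ω :=
    i1.sub i2
  have i123 : IntegrableOn (fun x => en (fun y => (κ * H) • A y) ψ x - κ ^ 2 * ‖ψ x‖ ^ 2
    + κ ^ 2 / 2 * ‖ψ x‖ ^ 4) Ω := i12.add i3
  simp only [GLenergy, magSq_eq]
  rw [integral_add i123 i4, integral_add i12 i3, integral_sub i1 i2, integral_const_mul,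
    integral_const_mul, integral_const_mul, mul_pow]

theorem en_gauge_shift_le (B : ℝ) {A : Plane → Plane} {φ : Plane → ℝ} {u : Plane → ℂ} {x : Plane}
    (hφ : DifferentiableAt ℝ φ x) (hu : DifferentiableAt ℝ u x) {δ : ℝ} (hδ : 0 < δ) :
    en (fun y => B • F0 y) (fun y => Complex.exp (Complex.I * ((-B * φ y : ℝ) : ℂ)) * u y) x ≤
      (1 + δ) * en (fun y => B • A y) u x +
        (1 + δ⁻¹) * (B ^ 2 * (esq (A x - F0 x - grad φ x) * ‖u x‖ ^ 2)) := by
  have hd : DifferentiableAt ℝ (fun y => -B * φ y) x := hφ.const_mul _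
  rw [en_gauge (fun y => B • F0 y) (φ := fun y => -B * φ y) hd hu (-B • grad φ x) fun v => by
    have : fderiv ℝ (fun y => -B * φ y) x = -B • fderiv ℝ φ x := fderiv_const_mul hφ _
    rw [this, smul_apply, fderiv_eq_dot2_grad, dot2_smul_left, smul_eq_mul]]
  have e : en (fun y => B • F0 y - -B • grad φ x) u x =
      en (fun y => B • A y + (-B) • (A y - F0 y - grad φ y)) u x := by
    have : B • F0 x - -B • grad φ x = B • A x + (-B) • (A x - F0 x - grad φ x) := by
      rw [smul_sub, smul_sub]; simp only [neg_smul]; abel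
    simp only [en, Dx, Dy, this]
  rw [e, en_shift (fun y => B • A y) (fun y => (-B) • (A y - F0 y - grad φ y))]
  have h := cur_bound (fun y => B • A y) (fun y => (-B) • (A y - F0 y - grad φ y)) u x δ⁻¹
    (inv_pos.2 hδ)
  rw [inv_inv] at h
  simp only [esq_smul, neg_sq] at h ⊢
  have := neg_abs_le (dot2 (-B • (A x - F0 x - grad φ x)) (cur (fun y => B • A y) u x))
  linarith

theorem lam1_mul_le_gauge (ho : IsOpen Ω) (hb : Bornology.IsBounded Ω) (B : ℝ)
    {A : Plane → Plane} {φ : Plane → ℝ} {u : Plane → ℂ} (hA : CNearCl 1 Ω A) (hφ : CNearCl 1 Ω φ)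
    (hu : CNearCl 1 Ω u) {δ : ℝ} (hδ : 0 < δ) :
    lam1 Ω B * ∫ x in Ω, ‖u x‖ ^ 2 ≤ (1 + δ) * (∫ x in Ω, en (fun y => B • A y) u x) +
      (1 + δ⁻¹) * (B ^ 2 * ∫ x in Ω, esq (A x - F0 x - grad φ x) * ‖u x‖ ^ 2) := by
  have hBφ : CNearCl 1 Ω fun y => -B * φ y := hφ.const_smul (-B)
  have hexp : CNearCl 1 Ω fun y => Complex.exp (Complex.I * ((-B * φ y : ℝ) : ℂ)) :=
    hBφ.ofReal.map (g := fun z : ℂ => Complex.exp (Complex.I * z))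
      (contDiff_const.mul contDiff_id).cexp
  have hv := hexp.mul hu
  have h := lam1_mul_le B hv
  have hn : ∀ x, ‖Complex.exp (Complex.I * ((-B * φ x : ℝ) : ℂ)) * u x‖ = ‖u x‖ := fun x => by
    rw [norm_mul, mul_comm Complex.I, Complex.norm_exp_ofReal_mul_I, one_mul]
  simp only [hn] at h
  refine h.trans ?_
  have hF0 : ContDiff ℝ 1 F0 := contDiff_F0
  have i1 : IntegrableOn (fun x => (1 + δ) * en (fun y => B • A y) u x) Ω :=
    (integrableOn_en hb (hA.continuousOn.const_smul B) hu).const_mul _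
  have i2 : IntegrableOn (fun x => (1 + δ⁻¹) *
      (B ^ 2 * (esq (A x - F0 x - grad φ x) * ‖u x‖ ^ 2))) Ω :=
    ((integrableOn_esq_nsq hb
      ((hA.continuousOn.sub hF0.continuous.continuousOn).sub (continuousOn_grad hφ)) hu).const_mul
        _).const_mul _
  rw [← integral_const_mul, ← integral_const_mul, ← integral_const_mul, ← integral_add i1 i2]
  exact setIntegral_mono_on (integrableOn_en hb (continuous_smul_F0 B).continuousOn hv)
    (i1.add i2) ho.measurableSet fun x hx =>
      en_gauge_shift_le B (hφ.differentiableAt (subset_closure hx))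
        (hu.differentiableAt (subset_closure hx)) hδ

theorem setIntegral_nsq_le (hb : Bornology.IsBounded Ω) {u : Plane → ℂ} (hu : CNearCl 1 Ω u)
    {S : Set Plane} (hS : MeasurableSet S) (hSΩ : S ⊆ Ω) {m : ℝ} (hm : 0 < m)
    (hSm : volume.real S ≤ m ^ 2) :
    ∫ x in S, ‖u x‖ ^ 2 ≤ m * √(∫ x in Ω, ‖u x‖ ^ 4) := by
  have hfin : volume S < ⊤ := (measure_mono hSΩ).trans_lt (volume_lt_top_of_bdd hb)
  have i4 := hu.integrableOn_pow_four hb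
  have key : ∀ a > 0, ∫ x in S, ‖u x‖ ^ 2 ≤
      a / 2 * m ^ 2 + a⁻¹ / 2 * ∫ x in Ω, ‖u x‖ ^ 4 := by
    intro a ha
    have i5 : IntegrableOn (fun _ : Plane => a / 2) S := integrableOn_const hfin.ne
    have i6 : IntegrableOn (fun x => a⁻¹ / 2 * ‖u x‖ ^ 4) S := (i4.mono_set hSΩ).const_mul _
    have h1 : ∫ x in S, ‖u x‖ ^ 2 ≤ ∫ x in S, (a / 2 + a⁻¹ / 2 * ‖u x‖ ^ 4) := by
      refine setIntegral_mono_on ((integrableOn_nsq hb hu).mono_set hSΩ) (i5.add i6) hS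
        fun x _ => ?_
      have : a / 2 + a⁻¹ / 2 * ‖u x‖ ^ 4 - ‖u x‖ ^ 2 = a⁻¹ / 2 * (‖u x‖ ^ 2 - a) ^ 2 := by
        field_simp; ring
      have : 0 ≤ a⁻¹ / 2 * (‖u x‖ ^ 2 - a) ^ 2 := by positivity
      linarith
    rw [integral_add i5 i6, setIntegral_const, integral_const_mul, smul_eq_mul] at h1
    have h2 : ∫ x in S, ‖u x‖ ^ 4 ≤ ∫ x in Ω, ‖u x‖ ^ 4 :=
      setIntegral_mono_set i4 (ae_of_all _ fun x => by positivity) hSΩ.eventuallyLE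
    have h3 : a⁻¹ / 2 * ∫ x in S, ‖u x‖ ^ 4 ≤ a⁻¹ / 2 * ∫ x in Ω, ‖u x‖ ^ 4 := by gcongr
    have h4 : volume.real S * (a / 2) ≤ m ^ 2 * (a / 2) := by gcongr
    linarith
  have hX : 0 ≤ ∫ x in Ω, ‖u x‖ ^ 4 := integral_nonneg fun x => by positivity
  generalize (∫ x in Ω, ‖u x‖ ^ 4) = X at *
  rcases hX.eq_or_lt with h | h
  · rw [← h, Real.sqrt_zero, mul_zero]
    rw [← h] at key
    refine le_of_forall_pos_le_add fun ε hε => ?_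
    have := key (2 * ε / m ^ 2) (by positivity)
    have e : 2 * ε / m ^ 2 / 2 * m ^ 2 = ε := by field_simp
    rw [e] at this; linarith
  · have hs : 0 < √X := Real.sqrt_pos.2 h
    have := key (√X / m) (by positivity)
    have e : √X / m / 2 * m ^ 2 + (√X / m)⁻¹ / 2 * X = m * √X := by
      nth_rw 3 [← Real.sq_sqrt hX]
      field_simp; ring
    rwa [e] at this

namespace BoundaryParam.Collar
variable {P : BoundaryParam Ω} {t₀ : ℝ} (hc : P.Collar t₀)
include hc

theorem isOpen_layer (ho : IsOpen Ω) (ℓ : ℝ) : IsOpen (Ω ∩ P.dst t₀ ⁻¹' Iio ℓ) :=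
  ((hc.cNearCl_dst ho 1).continuousOn.mono subset_closure).isOpen_inter_preimage ho isOpen_Iio

theorem exists_thin_layer (ho : IsOpen Ω) (hb : Bornology.IsBounded Ω) {m : ℝ} (hm : 0 < m) :
    ∃ ℓ > 0, volume.real (Ω ∩ P.dst t₀ ⁻¹' Iio ℓ) ≤ m := by
  set S : ℕ → Set Plane := fun n => Ω ∩ P.dst t₀ ⁻¹' Iio (1 / ((n : ℝ) + 1)) with hS
  have hanti : Antitone S := fun a b hab x hx =>
    ⟨hx.1, lt_of_lt_of_le (show P.dst t₀ x < _ from hx.2) (Nat.one_div_le_one_div hab)⟩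
  have hinter : ⋂ n, S n = ∅ := by
    refine eq_empty_of_forall_notMem fun x hx => ?_
    rw [mem_iInter] at hx
    obtain ⟨n, hn⟩ := exists_nat_one_div_lt (hc.dst_pos (hx 0).1)
    exact absurd (hx n).2 (not_lt.2 hn.le)
  have ht := tendsto_measure_iInter_atTop (μ := volume) (s := S)
    (fun n => (hc.isOpen_layer ho _).measurableSet.nullMeasurableSet) hanti
    ⟨0, ((measure_mono inter_subset_left).trans_lt (volume_lt_top_of_bdd hb)).ne⟩
  rw [hinter, measure_empty] at ht
  obtain ⟨n, hn⟩ := (ht.eventually_le_const (ENNReal.ofReal_pos.2 hm)).exists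
  exact ⟨1 / ((n : ℝ) + 1), by positivity, ENNReal.toReal_le_of_le_ofReal hm.le hn⟩

theorem bulk_bound (ho : IsOpen Ω) (hb : Bornology.IsBounded Ω) :
    ∃ C > 0, ∀ ℓ > 0, ∀ (B : ℝ) (A : Plane → Plane) (u : Plane → ℂ), CNearCl 1 Ω A →
      CNearCl 1 Ω u →
      B * (∫ x in Ω, ‖((eta ℓ (P.dst t₀ x) : ℝ) : ℂ) * u x‖ ^ 2) ≤
        (∫ x in Ω, en (fun y => B • A y) u x) + B ^ 2 / 2 * (∫ x in Ω, (curl2 A x - 1) ^ 2)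
          + 1 / 2 * (∫ x in Ω, ‖u x‖ ^ 4) + C / ℓ ^ 2 * ∫ x in Ω, ‖u x‖ ^ 2 := by
  obtain ⟨C, hC, hCb⟩ := hc.exists_cut_gsq_bound ho hb
  refine ⟨C, hC, fun ℓ hℓ B A u hA hu => ?_⟩
  have hξ : CNearCl 1 Ω fun x => xi ℓ (P.dst t₀ x) := hc.cNearCl_comp_dst ho (contDiff_xi ℓ)
  have hη : CNearCl 1 Ω fun x => eta ℓ (P.dst t₀ x) := hc.cNearCl_comp_dst ho (contDiff_eta ℓ)
  have hBA : CNearCl 1 Ω fun y => B • A y := hA.const_smul B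
  have hsum : ∀ x ∈ Ω, xi ℓ (P.dst t₀ x) ^ 2 + eta ℓ (P.dst t₀ x) ^ 2 = 1 := fun x _ => xi_sq_add _ _
  have h1 := integral_ims ho hb hBA.continuousOn hξ hη hu hsum
  have h2 : 0 ≤ ∫ x in Ω, en (fun y => B • A y) (fun y => ((xi ℓ (P.dst t₀ y) : ℝ) : ℂ) * u y) x :=
    integral_nonneg fun x => en_nonneg _ _ _
  have hv := hη.ofReal_mul hu
  have h3 := interior_lower ho hb hBA hv fun x hx => by
    filter_upwards [hc.eventually_dst_lt ho (half_pos hℓ) hx] with y hy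
    rw [eta_zero hℓ hy.le]; simp
  have ig : IntegrableOn (fun x => gsq (fun y => xi ℓ (P.dst t₀ y)) x * ‖u x‖ ^ 2 +
      gsq (fun y => eta ℓ (P.dst t₀ y)) x * ‖u x‖ ^ 2) Ω :=
    (integrableOn_gsq_nsq hb hξ hu).add (integrableOn_gsq_nsq hb hη hu)
  have h4 : ∫ x in Ω, (gsq (fun y => xi ℓ (P.dst t₀ y)) x * ‖u x‖ ^ 2 +
      gsq (fun y => eta ℓ (P.dst t₀ y)) x * ‖u x‖ ^ 2) ≤ C / ℓ ^ 2 * ∫ x in Ω, ‖u x‖ ^ 2 := by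
    rw [← integral_const_mul]
    refine setIntegral_mono_on ig ((integrableOn_nsq hb hu).const_mul _) ho.measurableSet
      fun x hx => ?_
    rw [← add_mul]
    exact mul_le_mul_of_nonneg_right (hCb ℓ hℓ x (subset_closure hx)) (sq_nonneg _)
  have j1 : IntegrableOn (fun x => B * ‖((eta ℓ (P.dst t₀ x) : ℝ) : ℂ) * u x‖ ^ 2) Ω :=
    (integrableOn_nsq hb hv).const_mul _
  have j2 : IntegrableOn (fun x => B ^ 2 / 2 * (curl2 A x - 1) ^ 2) Ω :=
    (integrableOn_of_continuousOn_closure hb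
      ((hA.continuousOn_curl2.sub continuousOn_const).pow 2)).const_mul _
  have j3 : IntegrableOn (fun x => 1 / 2 * ‖u x‖ ^ 4) Ω := (hu.integrableOn_pow_four hb).const_mul _
  have j12 : IntegrableOn (fun x => B * ‖((eta ℓ (P.dst t₀ x) : ℝ) : ℂ) * u x‖ ^ 2 -
    B ^ 2 / 2 * (curl2 A x - 1) ^ 2) Ω := j1.sub j2
  have h5 : B * (∫ x in Ω, ‖((eta ℓ (P.dst t₀ x) : ℝ) : ℂ) * u x‖ ^ 2)
      - B ^ 2 / 2 * (∫ x in Ω, (curl2 A x - 1) ^ 2) - 1 / 2 * (∫ x in Ω, ‖u x‖ ^ 4) ≤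
      ∫ x in Ω, curl2 (fun y => B • A y) x * ‖((eta ℓ (P.dst t₀ x) : ℝ) : ℂ) * u x‖ ^ 2 := by
    rw [← integral_const_mul, ← integral_const_mul, ← integral_const_mul, ← integral_sub j1 j2,
      ← integral_sub j12 j3]
    refine setIntegral_mono_on (j12.sub j3) (integrableOn_of_continuousOn_closure hb
      (hBA.continuousOn_curl2.mul (hv.continuousOn.norm.pow 2))) ho.measurableSet fun x hx => ?_
    rw [curl2_const_smul (hA.differentiableAt (subset_closure hx)), norm_ofReal_mul_sq]
    have e1 := eta_sq_le ℓ (P.dst t₀ x)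
    have e2 : (eta ℓ (P.dst t₀ x) ^ 2 * ‖u x‖ ^ 2) ^ 2 ≤ ‖u x‖ ^ 4 := by
      rw [show ‖u x‖ ^ 4 = (‖u x‖ ^ 2) ^ 2 by ring]
      exact pow_le_pow_left₀ (by positivity)
        (mul_le_of_le_one_left (sq_nonneg _) e1) 2
    nlinarith [sq_nonneg (B * (curl2 A x - 1) + eta ℓ (P.dst t₀ x) ^ 2 * ‖u x‖ ^ 2)]
  linarith

theorem layer_bound (ho : IsOpen Ω) (hb : Bornology.IsBounded Ω) {m ℓ : ℝ} (hm : 0 < m)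
    (hℓ : 0 < ℓ) (hv : volume.real (Ω ∩ P.dst t₀ ⁻¹' Iio ℓ) ≤ m ^ 2) {u : Plane → ℂ}
    (hu : CNearCl 1 Ω u) :
    ∫ x in Ω, ‖u x‖ ^ 2 ≤ (∫ x in Ω, ‖((eta ℓ (P.dst t₀ x) : ℝ) : ℂ) * u x‖ ^ 2) +
      m * √(∫ x in Ω, ‖u x‖ ^ 4) := by
  have hξ : CNearCl 1 Ω fun x => xi ℓ (P.dst t₀ x) := hc.cNearCl_comp_dst ho (contDiff_xi ℓ)
  have hη : CNearCl 1 Ω fun x => eta ℓ (P.dst t₀ x) := hc.cNearCl_comp_dst ho (contDiff_eta ℓ)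
  have hS := (hc.isOpen_layer ho ℓ).measurableSet
  have h1 := integral_nsq_add ho hb hξ hη hu (M := 1) fun x _ => xi_sq_add _ _
  have h2 := setIntegral_nsq_le hb hu hS inter_subset_left hm hv
  have h3 : ∫ x in Ω, ‖((xi ℓ (P.dst t₀ x) : ℝ) : ℂ) * u x‖ ^ 2 ≤
      ∫ x in Ω ∩ P.dst t₀ ⁻¹' Iio ℓ, ‖u x‖ ^ 2 := by
    have i := integrableOn_nsq hb (hξ.ofReal_mul hu)
    have e := setIntegral_eq_of_subset_of_forall_sdiff_eq_zero (μ := volume)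
      (f := fun x => ‖((xi ℓ (P.dst t₀ x) : ℝ) : ℂ) * u x‖ ^ 2) ho.measurableSet
      (inter_subset_left (s := Ω) (t := P.dst t₀ ⁻¹' Iio ℓ)) fun x hx => by
        have : ℓ ≤ P.dst t₀ x := not_lt.1 fun h => hx.2 ⟨hx.1, h⟩
        simp [xi_zero hℓ this]
    rw [e]
    refine setIntegral_mono_on (i.mono_set inter_subset_left)
      ((integrableOn_nsq hb hu).mono_set inter_subset_left) hS fun x _ => ?_
    rw [norm_ofReal_mul_sq]
    exact mul_le_of_le_one_left (sq_nonneg _) (xi_sq_le _ _)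
  linarith

end BoundaryParam.Collar
end SC

namespace SC
variable {Ω : Set Plane}

/-- A nontrivial configuration of nonpositive energy is incompatible with the boundary
localization estimate once the gauge error is small. -/
theorem energy_contradiction {K B2 Q X Y b T C ε ϑ : ℝ} (hK : 0 < K) (hB : 0 < B2)
    (hY : 0 < Y) (hε : 0 < ε) (hεC : 4 * ε * C ≤ 1 / 2) (hQ : 0 ≤ Q)
    (hX : X ≤ ε * Y) (hϑ : ϑ * (B2 * (1 / 2 + 4 * ε ^ 2)) = K * Y ^ 2 / 8) (hb : 0 ≤ b)
    (hE : Q + K / 2 * Y ^ 2 + B2 * b ≤ K * X)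
    (hT : T ≤ C * ((b + ϑ) * Y) + ϑ * X)
    (hlam : K * X ≤ (1 + Y / (4 * ε)) * Q + (1 + (Y / (4 * ε))⁻¹) * (B2 * T)) :
    False := by
  have hϑ0 : 0 < ϑ := by
    refine pos_of_mul_pos_left (b := B2 * (1 / 2 + 4 * ε ^ 2)) ?_ (by positivity)
    rw [hϑ]; positivity
  obtain ⟨δ, hδ⟩ : ∃ δ, δ = Y / (4 * ε) := ⟨_, rfl⟩
  have hδ0 : 0 < δ := by rw [hδ]; positivity
  rw [← hδ] at hlam
  have hYδ : Y = 4 * ε * δ := by rw [hδ]; field_simp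
  have hδX : δ * X ≤ Y ^ 2 / 4 := by
    calc δ * X ≤ δ * (ε * Y) := by gcongr
      _ = Y ^ 2 / 4 := by rw [hYδ]; ring
  have hT' : δ⁻¹ * T ≤ (b + ϑ) / 2 + 4 * ε ^ 2 * ϑ := by
    rw [inv_mul_le_iff₀ hδ0]
    have h1 : ϑ * X ≤ ϑ * (ε * Y) := by gcongr
    have h2 : 4 * ε * C * ((b + ϑ) * δ) ≤ 1 / 2 * ((b + ϑ) * δ) := by gcongr
    have h3 : C * ((b + ϑ) * Y) = 4 * ε * C * ((b + ϑ) * δ) := by rw [hYδ]; ring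
    have h4 : ϑ * (ε * Y) = δ * (4 * ε ^ 2 * ϑ) := by rw [hYδ]; ring
    linarith
  have hX0 : 0 ≤ K * X := le_trans (by positivity) hE
  have h1 : (1 + δ) * (K / 2 * Y ^ 2 + B2 * b) ≤ (1 + δ) * (K * (δ * X) + B2 * (δ⁻¹ * T)) := by
    have e1 : (1 + δ) * (B2 * (δ⁻¹ * T)) = (1 + δ⁻¹) * (B2 * T) := by field_simp; ring
    have e2 : (1 + δ) * Q ≤ (1 + δ) * (K * X - K / 2 * Y ^ 2 - B2 * b) :=
      mul_le_mul_of_nonneg_left (by linarith) (by positivity)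
    have e3 : 0 ≤ δ ^ 2 * (K * X) := by positivity
    rw [mul_add (1 + δ) (K * (δ * X)), e1]
    linarith
  have h2 := le_of_mul_le_mul_left h1 (by positivity)
  have h3 : K * (δ * X) ≤ K * (Y ^ 2 / 4) := by gcongr
  have h4 : B2 * (δ⁻¹ * T) ≤ B2 * ((b + ϑ) / 2 + 4 * ε ^ 2 * ϑ) := by gcongr
  have h5 : 0 ≤ B2 * b := by positivity
  have h6 : 0 < K * Y ^ 2 := by positivity
  linarith

namespace BoundaryParam.Collar
variable {P : BoundaryParam Ω} {t₀ : ℝ} (hc : P.Collar t₀)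
include hc

theorem exists_localization (ho : IsOpen Ω) (hb : Bornology.IsBounded Ω) {θ ε : ℝ} (hθ : θ < 1)
    (hε : 0 < ε) : ∃ B₀ > 0, ∀ B ≥ B₀, ∀ K ≥ 1, K ≤ θ * B → ∀ (A : Plane → Plane) (u : Plane → ℂ),
      CNearCl 1 Ω A → CNearCl 1 Ω u →
      (∫ x in Ω, en (fun y => B • A y) u x) + K / 2 * (∫ x in Ω, ‖u x‖ ^ 4) +
        B ^ 2 * (∫ x in Ω, (curl2 A x - 1) ^ 2) ≤ K * (∫ x in Ω, ‖u x‖ ^ 2) →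
      ∫ x in Ω, ‖u x‖ ^ 2 ≤ ε * √(∫ x in Ω, ‖u x‖ ^ 4) := by
  obtain ⟨C, hC, hbulk⟩ := hc.bulk_bound ho hb
  have hm : 0 < (1 - θ) / 2 * ε := mul_pos (half_pos (sub_pos.2 hθ)) hε
  obtain ⟨ℓ, hℓ, hv⟩ := hc.exists_thin_layer ho hb (pow_pos hm 2)
  have hg : 0 < (1 - θ) / 2 := half_pos (sub_pos.2 hθ)
  refine ⟨C / ℓ ^ 2 / ((1 - θ) / 2), by positivity, fun B hB K hK hKB A u hA hu hE => ?_⟩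
  have hB0 : 0 < B := lt_of_lt_of_le (by positivity) hB
  have h1 := hbulk ℓ hℓ B A u hA hu
  have h2 := hc.layer_bound ho hb hm hℓ hv hu
  have hX : 0 ≤ ∫ x in Ω, ‖u x‖ ^ 2 := integral_nonneg fun x => by positivity
  have hX4 : 0 ≤ ∫ x in Ω, ‖u x‖ ^ 4 := integral_nonneg fun x => by positivity
  have hb2 : 0 ≤ ∫ x in Ω, (curl2 A x - 1) ^ 2 := integral_nonneg fun x => by positivity
  generalize (∫ x in Ω, ‖u x‖ ^ 2) = X at *
  generalize (∫ x in Ω, ‖((eta ℓ (P.dst t₀ x) : ℝ) : ℂ) * u x‖ ^ 2) = Y at *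
  generalize (∫ x in Ω, ‖u x‖ ^ 4) = Z at *
  generalize (∫ x in Ω, (curl2 A x - 1) ^ 2) = b at *
  generalize (∫ x in Ω, en (fun y => B • A y) u x) = Q at *
  rw [ge_iff_le, div_le_iff₀ hg] at hB
  have h3 : C / ℓ ^ 2 * X ≤ B * ((1 - θ) / 2) * X := mul_le_mul_of_nonneg_right hB hX
  have h4 : K * X ≤ θ * B * X := mul_le_mul_of_nonneg_right hKB hX
  have h5 : 1 / 2 * Z ≤ K / 2 * Z := by gcongr
  have h6 : 0 ≤ B ^ 2 * b := by positivity
  have h7 : B * Y ≤ B * ((1 + θ) / 2 * X) := by linarith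
  have h8 := le_of_mul_le_mul_left h7 hB0
  have h9 : (1 - θ) / 2 * X ≤ (1 - θ) / 2 * (ε * √Z) := by linarith
  exact le_of_mul_le_mul_left h9 hg

theorem exists_normalUnique [SimplyConnectedSpace Ω] (ho : IsOpen Ω) (hne : Ω.Nonempty)
    (hb : Bornology.IsBounded Ω) :
    ∃ κ₀ > 0, ∀ κ > κ₀, ∀ H > 0, κ ^ 2 ≤ lam1 Ω (κ * H) → NormalUnique Ω κ H := by
  obtain ⟨C, hC, hgauge⟩ := gauge_bound hc ho hb
  obtain ⟨D, hD, hsq⟩ := lam1_le_sq ho hne hb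
  set θ := (Th + 1) / 2 with hθ
  have hθ1 : θ < 1 := by have := Th_lt_one; linarith
  set ε := 1 / (8 * C) with hε
  have hε0 : 0 < ε := by positivity
  have hεC : 4 * ε * C ≤ 1 / 2 := by rw [hε]; field_simp; norm_num
  obtain ⟨B₁, hB₁, hloc⟩ := hc.exists_localization ho hb hθ1 hε0
  obtain ⟨B₂, hup⟩ := eventually_atTop.1
    (hc.lam_upper ho hb (δ := (1 - Th) / 2) (by have := Th_lt_one; linarith))
  set B₀ := max B₁ B₂ with hB₀
  have hB₀0 : 0 < B₀ := lt_of_lt_of_le hB₁ (le_max_left _ _)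
  refine ⟨max 1 (√D * B₀), by positivity, fun κ hκ H hH hlam => ?_⟩
  have hκ1 : 1 < κ := lt_of_le_of_lt (le_max_left _ _) hκ
  have hκ0 : 0 < κ := one_pos.trans hκ1
  set B := κ * H with hB
  have hBpos : 0 < B := mul_pos hκ0 hH
  have hBB : B₀ ≤ B := by
    have h1 : κ ^ 2 ≤ (√D * B) ^ 2 := by
      rw [mul_pow, Real.sq_sqrt hD.le]; exact hlam.trans (hsq B)
    have h2 : κ ≤ √D * B := le_of_sq_le_sq h1 (by positivity)
    have h3 : √D * B₀ ≤ √D * B := ((le_max_right _ _).trans hκ.le).trans h2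
    exact le_of_mul_le_mul_left h3 (Real.sqrt_pos.2 hD)
  have hκθ : κ ^ 2 ≤ θ * B := by
    have := hup B ((le_max_right _ _).trans hBB)
    rw [show Th + (1 - Th) / 2 = θ by rw [hθ]; ring] at this
    exact hlam.trans this
  have hpos : ∀ ψ A, GLadm Ω ψ A → (∫ x in Ω, ‖ψ x‖ ^ 2) ≠ 0 → 0 < GLenergy Ω κ H ψ A := by
    rintro ψ A ⟨hψ, hA⟩ hX
    by_contra! hE
    rw [GLenergy_eq hb κ H hψ hA, ← hB] at hE
    have hX0 : 0 < ∫ x in Ω, ‖ψ x‖ ^ 2 :=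
      lt_of_le_of_ne (integral_nonneg fun x => by positivity) hX.symm
    have hX4 : 0 ≤ ∫ x in Ω, ‖ψ x‖ ^ 4 := integral_nonneg fun x => by positivity
    have hb2 : 0 ≤ ∫ x in Ω, (curl2 A x - 1) ^ 2 := integral_nonneg fun x => by positivity
    have hQ : 0 ≤ ∫ x in Ω, en (fun y => B • A y) ψ x := integral_nonneg fun x => en_nonneg _ _ _
    have hE' : (∫ x in Ω, en (fun y => B • A y) ψ x) + κ ^ 2 / 2 * (∫ x in Ω, ‖ψ x‖ ^ 4) +
        B ^ 2 * (∫ x in Ω, (curl2 A x - 1) ^ 2) ≤ κ ^ 2 * (∫ x in Ω, ‖ψ x‖ ^ 2) := by linarith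
    have hXε := hloc B ((le_max_left _ _).trans hBB) (κ ^ 2) (one_le_pow₀ hκ1.le) hκθ A ψ hA hψ hE'
    have hY : 0 < √(∫ x in Ω, ‖ψ x‖ ^ 4) := pos_of_mul_pos_right (hX0.trans_le hXε) hε0.le
    have hYsq := Real.sq_sqrt hX4
    set Y := √(∫ x in Ω, ‖ψ x‖ ^ 4) with hYdef
    set ϑ := κ ^ 2 * Y ^ 2 / (8 * (B ^ 2 * (1 / 2 + 4 * ε ^ 2))) with hϑ
    have hϑ0 : 0 < ϑ := by positivity
    obtain ⟨φ, hφ, hT⟩ := hgauge A ψ hA hψ ϑ hϑ0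
    have hl := (mul_le_mul_of_nonneg_right hlam hX0.le).trans
      (lam1_mul_le_gauge ho hb B hA hφ hψ (δ := Y / (4 * ε)) (by positivity))
    rw [← hYsq] at hE'
    exact energy_contradiction (by positivity) (by positivity) hY hε0 hεC hQ hXε
      (by rw [hϑ]; field_simp) hb2 hE' hT hl
  refine ⟨fun ψ A h => ?_, hpos⟩
  by_cases hX : (∫ x in Ω, ‖ψ x‖ ^ 2) = 0
  · rw [GLenergy_eq hb κ H h.1 h.2, hX, mul_zero, sub_zero]
    have hX4 : 0 ≤ ∫ x in Ω, ‖ψ x‖ ^ 4 := integral_nonneg fun x => by positivity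
    have hb2 : 0 ≤ ∫ x in Ω, (curl2 A x - 1) ^ 2 := integral_nonneg fun x => by positivity
    have hQ : 0 ≤ ∫ x in Ω, en (fun y => (κ * H) • A y) ψ x :=
      integral_nonneg fun x => en_nonneg _ _ _
    positivity
  · exact (hpos ψ A h hX).le

end BoundaryParam.Collar
end SC

/-- Under the non-degeneracy assumption, for large `κ` all four
critical fields coincide: `H^{loc} = H̄^{loc} = H_{C3} = H̄_{C3}`. -/
theorem all_critical_fields_coincide
    (Ω : Set SC.Plane) (hΩ_open : IsOpen Ω) (hΩ_bdd : Bornology.IsBounded Ω)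
    (hΩ_sc : SimplyConnectedSpace ↥Ω) (P : SC.BoundaryParam Ω) (hnd : SC.NonDegen P) :
    ∃ κ₀ > 0, ∀ κ > κ₀,
      SC.HlocLow Ω κ = SC.HlocUp Ω κ ∧
      SC.HlocUp Ω κ = SC.HC3low Ω κ ∧
      SC.HC3low Ω κ = SC.HC3up Ω κ := by
  have := hΩ_sc
  have hne : Ω.Nonempty := nonempty_coe_sort.1 (PathConnectedSpace.nonempty (X := ↥Ω))
  obtain ⟨t₀, hc⟩ := P.exists_collar hΩ_open hΩ_bdd
  exact SC.critical_fields_coincide hΩ_open hne hΩ_bdd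
    (hc.lam_monotone hΩ_open hne hΩ_bdd)
    (hc.exists_normalUnique hΩ_open hne hΩ_bdd)
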